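/- Let G be a triangle-free 4-critical graph drawn in the torus. Then every face of G is bounded by a cycle, i.e., for each face f of G the frontier of f equals the drawing of some cycle of G. -/

import Mathlib

open Set Topology

noncomputable section

/-- The circle `ℝ/ℤ`. -/
abbrev Circle1 : Type := AddCircle (1 : ℝ)

/-- The torus `(ℝ/ℤ) × (ℝ/ℤ)`. -/
abbrev Torus : Type := Circle1 × Circle1

/-- A set is an arc if it is homeomorphic to the open unit interval. -/
def IsArc {S : Type} [TopologicalSpace S] (A : Set S) : Prop :=
  Nonempty ((Set.Ioo (0 : ℝ) 1) ≃ₜ A)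

/-- A drawing, in the space `S`, of a multigraph whose edges `E` have endpoints
given by `ends`.  Vertices are drawn as distinct points, edges as arcs whose closure
adds exactly the endpoint vertices; arcs are pairwise disjoint and avoid all
vertex points. -/
structure MDrawing {V E : Type} (ends : E → Sym2 V) (S : Type) [TopologicalSpace S] where
  vmap : V → S
  vinj : Function.Injective vmap
  emap : E → Set S
  arc : ∀ e, IsArc (emap e)
  closure_emap : ∀ (e : E) (u w : V), ends e = s(u, w) →
    closure (emap e) = emap e ∪ {vmap u, vmap w}
  vertex_notin : ∀ (e : E) (x : V), vmap x ∉ emap e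
  edges_disj : ∀ e f : E, e ≠ f → emap e ∩ emap f = ∅

namespace MDrawing

variable {V E S : Type} [TopologicalSpace S] {ends : E → Sym2 V}

/-- The point set `|G|` of the drawing. -/
def image (d : MDrawing ends S) : Set S :=
  Set.range d.vmap ∪ ⋃ e, d.emap e

/-- A face: a connected component of the complement of the drawing. -/
def IsFace (d : MDrawing ends S) (f : Set S) : Prop :=
  ∃ x ∈ (d.image)ᶜ, f = connectedComponentIn (d.image)ᶜ x

/-- The length of a face: each edge drawn in the frontier of `g` contributes `2`
if `g` is the unique face whose frontier contains the arc, and `1` otherwise. -/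
def faceLen (d : MDrawing ends S) (g : Set S) : ℕ :=
  2 * {e : E | d.emap e ⊆ frontier g ∧
        (∀ g', d.IsFace g' → d.emap e ⊆ frontier g' → g' = g)}.ncard +
    {e : E | d.emap e ⊆ frontier g ∧
        ¬ (∀ g', d.IsFace g' → d.emap e ⊆ frontier g' → g' = g)}.ncard

end MDrawing

/-- A drawing of a simple graph `G`: a drawing of the multigraph whose edge set is
the edge set of `G`. -/
abbrev Drawing {V : Type} (G : SimpleGraph V) (S : Type) [TopologicalSpace S] :=
  MDrawing (fun e : G.edgeSet => (e : Sym2 V)) S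

/-- The point set of (the drawing of) a walk: the vertex points of its support
together with the arcs of its edges. -/
def walkImage {V S : Type} [TopologicalSpace S] {G : SimpleGraph V} (d : Drawing G S)
    {a b : V} (w : G.Walk a b) : Set S :=
  (⋃ v ∈ w.support, {d.vmap v}) ∪
    ⋃ (e : G.edgeSet) (_ : (e : Sym2 V) ∈ w.edges), d.emap e

/-- A closed curve is null-homotopic if it is homotopic to a constant map. -/
def NullHomotopic {S : Type} [TopologicalSpace S] (γ : C(Circle1, S)) : Prop :=
  ∃ c : S, ContinuousMap.Homotopic γ (ContinuousMap.const Circle1 c)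

/-- A set is a contractible simple closed curve if it is the range of an injective
closed curve which is null-homotopic. -/
def ContractibleSet {S : Type} [TopologicalSpace S] (A : Set S) : Prop :=
  ∃ γ : C(Circle1, S), Function.Injective γ ∧ Set.range γ = A ∧ NullHomotopic γ

/-- A cycle (given as a closed walk) is contractible if the closed curve tracing
its drawing is null-homotopic. -/
def ContractibleWalk {V S : Type} [TopologicalSpace S] {G : SimpleGraph V}
    (d : Drawing G S) {a : V} (w : G.Walk a a) : Prop :=
  ContractibleSet (walkImage d w)

/-- A graph is 4-critical if its chromatic number is `4` and every proper subgraph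
has chromatic number at most `3`. -/
def FourCritical {V : Type} (G : SimpleGraph V) : Prop :=
  G.chromaticNumber = 4 ∧
    ∀ H : G.Subgraph, H ≠ ⊤ → H.coe.chromaticNumber ≤ 3

/-- A graph is triangle-free if it contains no 3-cycle. -/
def TriangleFree {V : Type} (G : SimpleGraph V) : Prop :=
  ∀ (a : V) (w : G.Walk a a), w.IsCycle → w.length ≠ 3

/-- `f` is a `k`-face: a face bounded by a cycle of length `k`. -/
def IsKFace {V S : Type} [TopologicalSpace S] {G : SimpleGraph V} (d : Drawing G S)
    (f : Set S) (k : ℕ) : Prop :=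
  d.IsFace f ∧ ∃ (a : V) (w : G.Walk a a), w.IsCycle ∧ w.length = k ∧
    frontier f = walkImage d w

/-- `f` is a face bounded by the 4-cycle `v1 v2 v3 v4`. -/
def IsQuadFace {V S : Type} [TopologicalSpace S] {G : SimpleGraph V} (d : Drawing G S)
    (f : Set S) (v1 v2 v3 v4 : V) : Prop :=
  d.IsFace f ∧ ∃ w : G.Walk v1 v1, w.IsCycle ∧
    w.support = [v1, v2, v3, v4, v1] ∧ frontier f = walkImage d w

/-- A set is an open disk if it is homeomorphic to an open disk in the plane. -/
def IsOpenDisk {S : Type} [TopologicalSpace S] (A : Set S) : Prop :=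
  Nonempty (A ≃ₜ (Metric.ball (0 : ℝ × ℝ) 1))

set_option linter.all false

namespace KY

open Classical in
/-- number of ordered adjacent pairs -/
def ee {V : Type} (G : SimpleGraph V) (A B : Finset V) : ℤ :=
  ∑ u ∈ A, ∑ v ∈ B, if G.Adj u v then 1 else 0

def Col3 {V : Type} (G : SimpleGraph V) (R : Finset V) : Prop :=
  ∃ κ : V → Fin 3, ∀ u ∈ R, ∀ v ∈ R, G.Adj u v → κ u ≠ κ v

def pot {V : Type} (G : SimpleGraph V) (R : Finset V) : ℤ :=
  10 * (R.card : ℤ) - 3 * ee G R R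

section basic
variable {V : Type} (G : SimpleGraph V)

theorem ee_nonneg (A B : Finset V) : 0 ≤ ee G A B := by
  unfold ee
  exact Finset.sum_nonneg fun u _ => Finset.sum_nonneg fun v _ => by split_ifs <;> simp

theorem ee_symm (A B : Finset V) : ee G A B = ee G B A := by
  unfold ee
  rw [Finset.sum_comm]
  exact Finset.sum_congr rfl fun u _ => Finset.sum_congr rfl fun v _ => by
    congr 1; exact propext (G.adj_comm _ _)

variable [DecidableEq V]

theorem ee_union_left {A A' B : Finset V} (h : Disjoint A A') :
    ee G (A ∪ A') B = ee G A B + ee G A' B := by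
  unfold ee; rw [Finset.sum_union h]

theorem ee_union_right {A B B' : Finset V} (h : Disjoint B B') :
    ee G A (B ∪ B') = ee G A B + ee G A B' := by
  rw [ee_symm, ee_union_left G h, ee_symm, ee_symm G B']

theorem pot_union {A B : Finset V} (h : Disjoint A B) :
    pot G (A ∪ B) = pot G A + pot G B - 6 * ee G A B := by
  unfold pot
  rw [ee_union_left G h, ee_union_right G h, ee_union_right G h, Finset.card_union_of_disjoint h,
    ee_symm G B A]
  push_cast; ring

theorem ee_singleton (a b : V) [Decidable (G.Adj a b)] : ee G {a} {b} = if G.Adj a b then 1 else 0 := by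
  unfold ee; rw [Finset.sum_singleton, Finset.sum_singleton]; congr

theorem pot_singleton (a : V) : pot G {a} = 10 := by
  unfold pot; unfold ee; simp

theorem pot_insert {a : V} {R : Finset V} (h : a ∉ R) :
    pot G (insert a R) = 10 + pot G R - 6 * ee G {a} R := by
  rw [Finset.insert_eq, pot_union G (by simpa using h), pot_singleton]

theorem pot_even (R : Finset V) : ∃ k, pot G R = 2 * k := by
  induction R using Finset.induction_on with
  | empty => exact ⟨0, by simp [pot, ee]⟩
  | insert a R h ih =>
    obtain ⟨k, hk⟩ := ih
    rw [pot_insert G h, hk]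
    exact ⟨5 + k - 3 * ee G {a} R, by ring⟩

theorem ee_mono {A A' B B' : Finset V} (h : A ⊆ A') (h' : B ⊆ B') : ee G A B ≤ ee G A' B' := by
  unfold ee
  refine (Finset.sum_le_sum fun u _ => Finset.sum_le_sum_of_subset_of_nonneg h' ?_).trans
    (Finset.sum_le_sum_of_subset_of_nonneg h ?_)
  · intros; split_ifs <;> simp
  · intro i _ _; exact Finset.sum_nonneg fun v _ => by split_ifs <;> simp

theorem ee_pos {A B : Finset V} {a b : V} (ha : a ∈ A) (hb : b ∈ B) (h : G.Adj a b) :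
    1 ≤ ee G A B := by
  classical
  have := ee_mono G (Finset.singleton_subset_iff.2 ha) (Finset.singleton_subset_iff.2 hb)
  rw [ee_singleton, if_pos h] at this
  exact this

theorem ee_le_card (a : V) (R : Finset V) : ee G {a} R ≤ R.card := by
  unfold ee
  simp only [Finset.sum_singleton]
  calc _ ≤ ∑ v ∈ R, (1:ℤ) := Finset.sum_le_sum fun v _ => by split_ifs <;> simp
    _ = _ := by simp

theorem ee_card (R : Finset V) : ee G R R ≤ R.card * (R.card - 1) := by
  induction R using Finset.induction_on with
  | empty => simp [ee]
  | insert a R h ih =>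
    have h1 := pot_insert G h
    have h2 := ee_le_card G a R
    unfold pot at h1
    rw [Finset.card_insert_of_notMem h] at h1 ⊢
    push_cast at h1 ⊢
    nlinarith

theorem Col3.mono {A B : Finset V} (h : A ⊆ B) (hB : Col3 G B) : Col3 G A := by
  obtain ⟨κ, hκ⟩ := hB
  exact ⟨κ, fun u hu v hv => hκ u (h hu) v (h hv)⟩

theorem four_le_card {R : Finset V} (h : ¬ Col3 G R) : 4 ≤ R.card := by
  by_contra hc
  apply h
  have hc : R.card ≤ 3 := by omega
  let e := R.equivFin
  refine ⟨fun v => if hv : v ∈ R then Fin.castLE hc (e ⟨v, hv⟩) else 0, fun u hu v hv huv => ?_⟩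
  simp only [hu, hv, dif_pos]
  intro he
  have := e.injective (Fin.castLE_injective hc he)
  simp only [Subtype.mk.injEq] at this
  exact G.ne_of_adj huv this

end basic

/-- induction hypothesis -/
def IH (n : ℕ) : Prop := ∀ (V : Type) (G : SimpleGraph V) (S : Finset V), S.card < n →
  ¬ Col3 G S → ∃ R ⊆ S, ¬ Col3 G R ∧ pot G R ≤ 4

def yGraph {V : Type} (G : SimpleGraph V) (R : Finset V) (κ : V → Fin 3) :
    SimpleGraph (V ⊕ Fin 3) where
  Adj a b := match a, b with
    | .inl u, .inl v => G.Adj u v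
    | .inl u, .inr i => ∃ w ∈ R, κ w = i ∧ G.Adj u w
    | .inr i, .inl u => ∃ w ∈ R, κ w = i ∧ G.Adj u w
    | .inr i, .inr j => i ≠ j
  symm := ⟨by
    rintro (u | i) (v | j) h
    · exact G.adj_symm h
    · exact h
    · exact h
    · exact Ne.symm h⟩
  loopless := ⟨by
    rintro (u | i) h
    · exact G.loopless.irrefl u h
    · exact h rfl⟩

theorem yGraph_ee_le {V : Type} [DecidableEq V] (G : SimpleGraph V) (R : Finset V) (κ : V → Fin 3)
    (u : V) (I : Finset (Fin 3)) :
    (∑ i ∈ I, (open Classical in if ∃ w ∈ R, κ w = i ∧ G.Adj u w then (1:ℤ) else 0)) ≤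
      ee G {u} (R.filter (fun w => κ w ∈ I)) := by
  classical
  unfold ee
  rw [Finset.sum_singleton]
  rw [← Finset.sum_fiberwise_of_maps_to (t := I) (g := κ) (by simp)]
  refine Finset.sum_le_sum fun i hi => ?_
  split_ifs with h
  · obtain ⟨w, hw, hwi, hadj⟩ := h
    have : (fun v => if G.Adj u v then (1:ℤ) else 0) w ≤ ∑ v ∈ (R.filter (fun w => κ w ∈ I)).filter (fun v => κ v = i), if G.Adj u v then (1:ℤ) else 0 := by
      apply Finset.single_le_sum (f := fun v => if G.Adj u v then (1:ℤ) else 0)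
      · intro j _; split_ifs <;> simp
      · simp [hw, hwi, hi]
    simpa [hadj] using this
  · exact Finset.sum_nonneg fun v _ => by split_ifs <;> simp

theorem ite_inst (p q : Prop) (d1 : Decidable p) (d2 : Decidable q) (h : p ↔ q) :
    (if p then (1:ℤ) else 0) = (if q then (1:ℤ) else 0) := by
  by_cases hp : p
  · rw [if_pos hp, if_pos (h.1 hp)]
  · rw [if_neg hp, if_neg (fun hq => hp (h.2 hq))]

theorem yGraph_pot {V : Type} [DecidableEq V] (G : SimpleGraph V) (R : Finset V) (κ : V → Fin 3)
    (W : Finset V) (I : Finset (Fin 3)) :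
    pot G W + 10 * I.card - 3 * (I.card * (I.card - 1)) - 6 * ee G W (R.filter (fun w => κ w ∈ I))
      ≤ pot (yGraph G R κ) (W.disjSum I) := by
  classical
  unfold pot
  have h1 : ee (yGraph G R κ) (W.disjSum I) (W.disjSum I) = ee G W W +
     2 * ∑ u ∈ W, ∑ i ∈ I, (if ∃ w ∈ R, κ w = i ∧ G.Adj u w then (1:ℤ) else 0) + I.card * (I.card - 1) := by
    have h2 : ∑ i ∈ I, ∑ j ∈ I, (if i ≠ j then (1:ℤ) else 0) = I.card * (I.card - 1) := by
      have : ∀ i ∈ I, ∑ j ∈ I, (if i ≠ j then (1:ℤ) else 0) = I.card - 1 := by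
        intro i hi
        have : ∀ j ∈ I, (if i ≠ j then (1:ℤ) else 0) = 1 - (if i = j then 1 else 0) := by
          intro j _; split_ifs <;> simp_all
        rw [Finset.sum_congr rfl this, Finset.sum_sub_distrib]
        simp [hi]
      rw [Finset.sum_congr rfl this, Finset.sum_const, nsmul_eq_mul]
    unfold ee
    simp only [Finset.sum_disjSum, Finset.sum_add_distrib]
    rw [← h2, Finset.sum_comm (s := I) (t := W)]
    simp only [yGraph]
    have key : ∀ a b a' b' b'' c c' : ℤ, a = a' → b = b'' → b' = b'' → c = c' →
        a + b + (b' + c) = a' + 2 * b'' + c' := by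
      intros; subst_vars; ring
    apply key <;> exact Finset.sum_congr rfl fun _ _ => Finset.sum_congr rfl fun _ _ =>
      @ite_inst _ _ _ _ Iff.rfl
  have h3 : ∑ u ∈ W, ∑ i ∈ I, (if ∃ w ∈ R, κ w = i ∧ G.Adj u w then (1:ℤ) else 0) ≤
      ee G W (R.filter (fun w => κ w ∈ I)) := by
    calc _ ≤ ∑ u ∈ W, ee G {u} (R.filter (fun w => κ w ∈ I)) := Finset.sum_le_sum fun u _ => by
            convert yGraph_ee_le G R κ u I
      _ = _ := by unfold ee; simp
  rw [h1, Finset.card_disjSum]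
  push_cast
  linarith

theorem y_lemma {V : Type} [DecidableEq V] {G : SimpleGraph V} {S R : Finset V} (ih : IH S.card)
    (hS : ¬ Col3 G S) (hR : R ⊆ S) (hRc : 4 ≤ R.card) (κ : V → Fin 3)
    (hcol : ∀ R', R' ⊂ S → Col3 G R')
    (hκ : ∀ u ∈ R, ∀ v ∈ R, G.Adj u v → κ u ≠ κ v) :
    ∃ W ⊆ S \ R, ∃ I : Finset (Fin 3), W.Nonempty ∧ 1 ≤ I.card ∧ I.card ≤ 3 ∧
      pot G (W ∪ R) + 6 * ee G W (R.filter (fun w => κ w ∉ I)) ≤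
       pot G R + 4 - (10 * I.card - 3 * (I.card * (I.card - 1))) := by
  have hcard : ((S \ R).disjSum (Finset.univ : Finset (Fin 3))).card < S.card := by
    rw [Finset.card_disjSum, Finset.card_sdiff_of_subset hR]
    have := Finset.card_le_card hR
    simp
    omega
  have hnot : ¬ Col3 (yGraph G R κ) ((S \ R).disjSum (Finset.univ : Finset (Fin 3))) := by
    rintro ⟨c, hc⟩
    apply hS
    have hinj : ∀ i j : Fin 3, i ≠ j → c (.inr i) ≠ c (.inr j) := by
      intro i j hij
      exact hc _ (by simp) _ (by simp) hij
    refine ⟨fun v => if v ∈ R then c (.inr (κ v)) else c (.inl v), ?_⟩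
    intro u hu v hv huv
    by_cases h1 : u ∈ R <;> by_cases h2 : v ∈ R <;> simp only [h1, h2, if_true, if_false]
    · exact hinj _ _ (hκ u h1 v h2 huv)
    · exact hc _ (by simp) _ (by simp [hv, h2]) (show ∃ w ∈ R, κ w = κ u ∧ G.Adj v w from ⟨u, h1, rfl, huv.symm⟩)
    · exact hc _ (by simp [hu, h1]) _ (by simp) (show ∃ w ∈ R, κ w = κ v ∧ G.Adj u w from ⟨v, h2, rfl, huv⟩)
    · exact hc _ (by simp [hu, h1]) _ (by simp [hv, h2]) huv
  obtain ⟨W0, hW0, hW0c, hW0p⟩ := ih _ _ _ hcard hnot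
  have hWe : W0.toLeft.disjSum W0.toRight = W0 := Finset.toLeft_disjSum_toRight
  have hWs : W0.toLeft ⊆ S \ R := by
    intro x hx
    have := hW0 (Finset.mem_toLeft.1 hx)
    simpa using this
  have hI3 : W0.toRight.card ≤ 3 := by simpa using Finset.card_le_univ W0.toRight
  refine ⟨W0.toLeft, hWs, W0.toRight, ?_, ?_, hI3, ?_⟩
  · rw [Finset.nonempty_iff_ne_empty]
    intro h0
    have := four_le_card _ hW0c
    rw [← hWe, h0, Finset.card_disjSum] at this
    simp at this
    omega
  · by_contra h0
    have h0 : W0.toRight = ∅ := by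
      rw [← Finset.card_eq_zero]; omega
    apply hW0c
    have hss : W0.toLeft ⊂ S := by
      refine ⟨fun x hx => (Finset.mem_sdiff.1 (hWs hx)).1, fun h => ?_⟩
      obtain ⟨x, hx⟩ := Finset.card_pos.1 (show 0 < R.card by omega)
      exact (Finset.mem_sdiff.1 (hWs (h (hR hx)))).2 hx
    obtain ⟨c, hc⟩ := hcol _ hss
    refine ⟨Sum.elim c (fun _ => 0), ?_⟩
    rw [← hWe, h0]
    rintro (u | i) hu (v | j) hv huv <;> simp at hu hv
    exact hc u (by simpa using hu) v (by simpa using hv) huv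
  · have h1 := yGraph_pot G R κ W0.toLeft W0.toRight
    rw [hWe] at h1
    have hd : Disjoint W0.toLeft R := by
      rw [Finset.disjoint_left]; intro x hx; exact (Finset.mem_sdiff.1 (hWs hx)).2
    rw [pot_union G hd]
    have h2 : ee G W0.toLeft R = ee G W0.toLeft (R.filter (fun w => κ w ∈ W0.toRight)) +
        ee G W0.toLeft (R.filter (fun w => κ w ∉ W0.toRight)) := by
      rw [← ee_union_right G (Finset.disjoint_filter_filter_not _ _ _), Finset.filter_union_filter_not_eq]
    linarith

/-- identification of two vertices -/
def idGraph {V : Type} (G : SimpleGraph V) (x y : V) : SimpleGraph V where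
  Adj a b := a ≠ b ∧ (G.Adj a b ∨ (a = x ∧ G.Adj y b) ∨ (b = x ∧ G.Adj y a))
  symm := ⟨by
    rintro a b ⟨h, h1⟩
    refine ⟨h.symm, ?_⟩
    rcases h1 with h1 | h1 | h1
    · exact Or.inl h1.symm
    · exact Or.inr (Or.inr h1)
    · exact Or.inr (Or.inl h1)⟩
  loopless := ⟨fun a h => h.1 rfl⟩

theorem id_lemma {V : Type} [DecidableEq V] {G : SimpleGraph V} {S T : Finset V} (ih : IH S.card)
    (hcol : ∀ R', R' ⊂ S → Col3 G R') (hT : T ⊂ S) {x y : V} (hx : x ∈ T) (hy : y ∈ T)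
    (hxy : x ≠ y) (hadj : ¬ G.Adj x y) :
    (∃ κ : V → Fin 3, (∀ u ∈ T, ∀ v ∈ T, G.Adj u v → κ u ≠ κ v) ∧ κ x = κ y) ∨
    (∃ R ⊆ T, x ∈ R ∧ y ∈ R ∧ 5 ≤ R.card ∧ pot G R ≤ 14) := by
  by_cases hc : Col3 (idGraph G x y) (T.erase y)
  · left
    obtain ⟨c, hc⟩ := hc
    refine ⟨fun v => if v = y then c x else c v, ?_, by simp⟩
    intro u hu v hv huv
    have hne := G.ne_of_adj huv
    by_cases h1 : u = y <;> by_cases h2 : v = y <;> simp only [h1, h2, if_true, if_false]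
    · exact absurd (h1.trans h2.symm) hne
    · subst h1
      have : x ≠ v := by rintro rfl; exact hadj huv.symm
      exact hc x (by simp [hxy, hx]) v (by simp [h2, hv]) ⟨this, Or.inr (Or.inl ⟨rfl, huv⟩)⟩
    · subst h2
      have : u ≠ x := by rintro rfl; exact hadj huv
      exact hc u (by simp [h1, hu]) x (by simp [hxy, hx]) ⟨this, Or.inr (Or.inr ⟨rfl, huv.symm⟩)⟩
    · exact hc u (by simp [h1, hu]) v (by simp [h2, hv]) ⟨hne, Or.inl huv⟩
  · right
    obtain ⟨R, hR, hRc, hRp⟩ := ih V _ _ ((Finset.card_lt_card (Finset.erase_ssubset hy)).trans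
      (Finset.card_lt_card hT)) hc
    have hRT : R ⊆ T := hR.trans (Finset.erase_subset _ _)
    have hyR : y ∉ R := fun h => by simpa using hR h
    have hxR : x ∈ R := by
      by_contra hxR
      apply hRc
      obtain ⟨c, hc⟩ := hcol R (Finset.ssubset_of_subset_of_ssubset hRT hT)
      refine ⟨c, fun u hu v hv huv => ?_⟩
      rcases huv.2 with h | ⟨rfl, _⟩ | ⟨rfl, _⟩
      · exact hc u hu v hv h
      · exact absurd hu hxR
      · exact absurd hv hxR
    have h4 := four_le_card _ hRc
    refine ⟨insert y R, Finset.insert_subset hy hRT, Finset.mem_insert_of_mem hxR,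
      Finset.mem_insert_self _ _, by rw [Finset.card_insert_of_notMem hyR]; omega, ?_⟩
    rw [pot_insert G hyR]
    set R1 := R.erase x with hR1
    have hRe : R = insert x R1 := (Finset.insert_erase hxR).symm
    have hxR1 : x ∉ R1 := by simp [hR1]
    rw [hRe, pot_insert _ hxR1] at hRp
    rw [hRe, pot_insert _ hxR1]
    have e1 : ee (idGraph G x y) R1 R1 = ee G R1 R1 := by
      unfold ee
      refine Finset.sum_congr rfl fun u hu => Finset.sum_congr rfl fun v hv => ?_
      congr 1
      apply propext
      have hux : u ≠ x := by rintro rfl; exact hxR1 hu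
      have hvx : v ≠ x := by rintro rfl; exact hxR1 hv
      simp only [idGraph, hux, hvx, false_and, or_false]
      exact ⟨fun h => h.2, fun h => ⟨G.ne_of_adj h, h⟩⟩
    have e2 : ee (idGraph G x y) {x} R1 ≤ ee G {x} R1 + ee G {y} R1 := by
      classical
      unfold ee
      simp only [Finset.sum_singleton]
      rw [← Finset.sum_add_distrib]
      refine Finset.sum_le_sum fun v hv => ?_
      have hvx : v ≠ x := by rintro rfl; exact hxR1 hv
      by_cases h1 : G.Adj x v <;> by_cases h2 : G.Adj y v <;> simp [idGraph, h1, h2, hvx]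
      all_goals split_ifs <;> simp
    have e3 : ee G {y} R1 ≤ ee G {y} (insert x R1) := ee_mono G (subset_refl _) (Finset.subset_insert _ _)
    have e4 : pot (idGraph G x y) R1 = pot G R1 := by unfold pot; rw [e1]
    linarith

theorem edge_lemma {V : Type} [DecidableEq V] {G : SimpleGraph V} {S T : Finset V} (ih : IH S.card)
    (hcol : ∀ R', R' ⊂ S → Col3 G R') (hT : T ⊂ S) {x y : V} (hx : x ∈ T) (hy : y ∈ T)
    (hxy : x ≠ y) (hc1 : ∀ R, R ⊂ S → 2 ≤ R.card → 12 ≤ pot G R) :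
    (∃ κ : V → Fin 3, (∀ u ∈ T, ∀ v ∈ T, G.Adj u v → κ u ≠ κ v) ∧ κ x ≠ κ y) := by
  by_cases hc : Col3 (G ⊔ SimpleGraph.edge x y) T
  · obtain ⟨c, hc⟩ := hc
    exact ⟨c, fun u hu v hv huv => hc u hu v hv (Or.inl huv), hc x hx y hy
      (Or.inr (by simp [SimpleGraph.edge_adj, hxy]))⟩
  · exfalso
    obtain ⟨R, hR, hRc, hRp⟩ := ih V _ _ (Finset.card_lt_card hT) hc
    have h4 := four_le_card _ hRc
    have := hc1 R (Finset.ssubset_of_subset_of_ssubset hR hT) (by omega)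
    have e1 : ee (G ⊔ SimpleGraph.edge x y) R R ≤ ee G R R + 2 := by
      classical
      have : ∑ u ∈ R, ∑ v ∈ R, ((if u = x then (if v = y then (1:ℤ) else 0) else 0) +
          (if u = y then (if v = x then (1:ℤ) else 0) else 0)) ≤ 2 := by
        simp only [Finset.sum_add_distrib]
        have : ∀ x y : V, ∑ u ∈ R, ∑ v ∈ R, (if u = x then (if v = y then (1:ℤ) else 0) else 0) ≤ 1 := by
          intro x y
          rw [Finset.sum_congr rfl (g := fun u => if u = x then (if y ∈ R then (1:ℤ) else 0) else 0)]
          · rw [Finset.sum_ite_eq']; split_ifs <;> simp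
          · intro u _; split_ifs <;> simp_all
        linarith [this x y, this y x]
      refine le_trans ?_ (add_le_add_right this _)
      unfold ee
      rw [← Finset.sum_add_distrib]
      refine Finset.sum_le_sum fun u _ => ?_
      rw [← Finset.sum_add_distrib]
      refine Finset.sum_le_sum fun v _ => ?_
      by_cases h1 : G.Adj u v
      · simp [h1]; split_ifs <;> simp
      · simp only [SimpleGraph.sup_adj, h1, SimpleGraph.edge_adj, false_or]
        by_cases a1 : u = x <;> by_cases a2 : v = y <;> by_cases a3 : u = y <;> by_cases a4 : v = x <;> simp_all
    unfold pot at *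
    linarith


structure Ctx {V : Type} (G : SimpleGraph V) (S : Finset V) : Prop where
  ih : IH S.card
  hS : ¬ Col3 G S
  hcol : ∀ R', R' ⊂ S → Col3 G R'
  hpot : 6 ≤ pot G S

section ctx
variable {V : Type} [DecidableEq V] {G : SimpleGraph V} {S : Finset V}

theorem fac {k : ℕ} (h1 : 1 ≤ k) (h3 : k ≤ 3) : 10 ≤ 10 * (k:ℤ) - 3 * (k * (k - 1)) := by
  interval_cases k <;> simp

theorem claim1 (C : Ctx G S) (R : Finset V) (hR : R ⊂ S) (hc : 2 ≤ R.card) : 12 ≤ pot G R := by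
  classical
  by_contra hlt
  obtain ⟨R0, hR0, hmin⟩ := Finset.exists_min_image (S.ssubsets.filter (fun R => 2 ≤ R.card)) (pot G)
    ⟨R, by simp [hR, hc]⟩
  have h1 := hmin R (by simp [hR, hc])
  simp only [Finset.mem_filter, Finset.mem_ssubsets] at hR0 hmin
  obtain ⟨hR0, hR0c⟩ := hR0
  have hp : pot G R0 ≤ 10 := by
    obtain ⟨k, hk⟩ := pot_even G R0
    omega
  have h4 : 4 ≤ R0.card := by
    by_contra h4
    have hec := ee_card G R0
    unfold pot at hp
    have : R0.card = 2 ∨ R0.card = 3 := by omega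
    rcases this with h | h <;> rw [h] at hec hp <;> norm_num at hec hp <;> omega
  obtain ⟨κ, hκ⟩ := C.hcol R0 hR0
  obtain ⟨W, hW, I, hWn, hI1, hI3, hle⟩ := y_lemma C.ih C.hS hR0.1 h4 κ C.hcol hκ
  have hf := fac hI1 hI3
  have hnn := ee_nonneg G W (R0.filter (fun w => κ w ∉ I))
  have hsub : W ∪ R0 ⊆ S := Finset.union_subset (fun x hx => (Finset.mem_sdiff.1 (hW hx)).1) hR0.1
  by_cases hss : W ∪ R0 = S
  · rw [hss] at hle
    have := C.hpot
    linarith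
  · have := hmin (W ∪ R0) ⟨⟨hsub, fun h => hss (Finset.Subset.antisymm hsub h)⟩,
      hR0c.trans (Finset.card_le_card Finset.subset_union_right)⟩
    linarith

theorem perm3 (a b : Fin 3) : ∃ π : Equiv.Perm (Fin 3), π a = b := ⟨Equiv.swap a b, by simp⟩

/-- two boundary vertices -/
theorem two_boundary (C : Ctx G S) {R : Finset V} (hR : R ⊂ S) (hc : 4 ≤ R.card) :
    ∃ u ∈ R, ∃ v ∈ R, u ≠ v ∧ (∃ x ∈ S \ R, G.Adj x u) ∧ (∃ x ∈ S \ R, G.Adj x v) := by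
  by_contra hno
  push Not at hno
  have : ∃ u ∈ R, ∀ v ∈ R, v ≠ u → ∀ x ∈ S \ R, ¬ G.Adj x v := by
    by_cases h : ∃ u ∈ R, ∃ x ∈ S \ R, G.Adj x u
    · obtain ⟨u, hu, x, hx, hxu⟩ := h
      exact ⟨u, hu, fun v hv hvu => hno u hu v hv hvu.symm ⟨x, hx, hxu⟩⟩
    · push Not at h
      obtain ⟨u, hu⟩ := Finset.card_pos.1 (show 0 < R.card by omega)
      exact ⟨u, hu, fun v hv _ => h v hv⟩
  obtain ⟨u, hu, hall⟩ := this
  obtain ⟨κ1, h1⟩ := C.hcol R hR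
  have hT : insert u (S \ R) ⊂ S := by
    refine ⟨Finset.insert_subset (hR.1 hu) Finset.sdiff_subset, fun h => ?_⟩
    have : R ⊆ {u} := by
      intro x hx
      have := h (hR.1 hx)
      simp [hx] at this
      simp [this]
    have := Finset.card_le_card this
    simp at this
    omega
  obtain ⟨κ2, h2⟩ := C.hcol _ hT
  obtain ⟨π, hπ⟩ := perm3 (κ2 u) (κ1 u)
  apply C.hS
  have key : ∀ a ∈ S, ∀ b ∈ S, a ∈ R → b ∉ R → G.Adj b a → κ1 a ≠ π (κ2 b) := by
    intro a ha b hb haR hbR hba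
    by_cases hau : a = u
    · subst hau
      rw [← hπ]
      intro h
      exact h2 a (by simp) b (by simp [hb, hbR]) hba.symm (π.injective h)
    · exact absurd hba (hall a haR hau b (by simp [hb, hbR]))
  refine ⟨fun v => if v ∈ R then κ1 v else π (κ2 v), fun a ha b hb hab => ?_⟩
  by_cases haR : a ∈ R <;> by_cases hbR : b ∈ R <;> simp only [haR, hbR, if_true, if_false]
  · exact h1 a haR b hbR hab
  · exact key a ha b hb haR hbR hab.symm
  · exact (key b hb a ha hbR haR hab).symm
  · intro h
    exact h2 a (by simp [ha, haR]) b (by simp [hb, hbR]) hab (π.injective h)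

theorem claim2 (C : Ctx G S) (R : Finset V) (hR : R ⊂ S) (hc : 4 ≤ R.card) : 14 ≤ pot G R := by
  by_contra hlt
  have hp : pot G R ≤ 12 := by
    obtain ⟨k, hk⟩ := pot_even G R
    omega
  obtain ⟨u, hu, v, hv, huv, ⟨x, hx, hxu⟩, ⟨y, hy, hyv⟩⟩ := two_boundary C hR hc
  obtain ⟨κ, hκ, hκuv⟩ := edge_lemma C.ih C.hcol hR hu hv huv (claim1 C)
  obtain ⟨W, hW, I, hWn, hI1, hI3, hle⟩ := y_lemma C.ih C.hS hR.1 hc κ C.hcol hκ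
  have hf := fac hI1 hI3
  have hnn := ee_nonneg G W (R.filter (fun w => κ w ∉ I))
  have hsub : W ∪ R ⊆ S := Finset.union_subset (fun x hx => (Finset.mem_sdiff.1 (hW hx)).1) hR.1
  by_cases hss : W ∪ R = S
  · have hWS : ∀ z ∈ S \ R, z ∈ W := by
      intro z hz
      rw [← hss] at hz
      simp at hz
      tauto
    rw [hss] at hle
    have hS6 := C.hpot
    obtain h | h | h : I.card = 1 ∨ I.card = 2 ∨ I.card = 3 := by omega
    · rw [Finset.card_eq_one] at h
      obtain ⟨i, rfl⟩ := h
      have : 1 ≤ ee G W (R.filter (fun w => κ w ∉ ({i} : Finset (Fin 3)))) := by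
        by_cases hui : κ u = i
        · exact ee_pos G (hWS y hy) (b := v) (by simp [hv]; rintro rfl; exact hκuv hui) hyv
        · exact ee_pos G (hWS x hx) (b := u) (by simp [hu, hui]) hxu
      simp at hle this
      linarith
    · rw [h] at hle; norm_num at hle; linarith
    · rw [h] at hle; norm_num at hle; linarith
  · have := claim1 C (W ∪ R) ⟨hsub, fun h => hss (Finset.Subset.antisymm hsub h)⟩
      (le_trans (by omega) (Finset.card_le_card (Finset.subset_union_right (s₁ := W))))
    linarith

open Classical in
def nb (G : SimpleGraph V) (S : Finset V) (v : V) : Finset V := S.filter (fun w => G.Adj v w)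

theorem mem_nb {v w : V} : w ∈ nb G S v ↔ w ∈ S ∧ G.Adj v w := by simp [nb]

theorem avoid {L : Finset (Fin 3)} (h : L.card ≤ 2) : ∃ c, c ∉ L := by
  by_contra hc
  push Not at hc
  have : L = Finset.univ := Finset.eq_univ_iff_forall.2 hc
  rw [this] at h
  simp at h

theorem mindeg (C : Ctx G S) (v : V) (hv : v ∈ S) : 3 ≤ (nb G S v).card := by
  by_contra h
  obtain ⟨κ, hκ⟩ := C.hcol (S.erase v) (Finset.erase_ssubset hv)
  obtain ⟨c, hc⟩ := avoid (L := (nb G S v).image κ) (Finset.card_image_le.trans (by omega))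
  apply C.hS
  refine ⟨Function.update κ v c, fun a ha b hb hab => ?_⟩
  have hne := G.ne_of_adj hab
  by_cases h1 : a = v
  · subst h1
    rw [Function.update_self, Function.update_of_ne hne.symm]
    rintro rfl
    exact hc (Finset.mem_image_of_mem _ (mem_nb.2 ⟨hb, hab⟩))
  · by_cases h2 : b = v
    · subst h2
      rw [Function.update_self, Function.update_of_ne hne]
      rintro rfl
      exact hc (Finset.mem_image_of_mem _ (mem_nb.2 ⟨ha, hab.symm⟩))
    · rw [Function.update_of_ne h1, Function.update_of_ne h2]
      exact hκ a (by simp [h1, ha]) b (by simp [h2, hb]) hab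

/-- extension of a colouring to two adjacent vertices of degree three -/
theorem ext2 {v w a b c e : V} (hvw : v ≠ w) 
    (hv : ∀ x ∈ S, G.Adj v x → x = w ∨ x = a ∨ x = b)
    (hw : ∀ x ∈ S, G.Adj w x → x = v ∨ x = c ∨ x = e) 
    (ha : a ≠ v ∧ a ≠ w) (hb : b ≠ v ∧ b ≠ w) (hc : c ≠ v ∧ c ≠ w) (he : e ≠ v ∧ e ≠ w)
    (κ : V → Fin 3)
    (hκ : ∀ x ∈ (S.erase v).erase w, ∀ y ∈ (S.erase v).erase w, G.Adj x y → κ x ≠ κ y)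
    (hx : ∃ i j : Fin 3, i ≠ j ∧ i ≠ κ a ∧ i ≠ κ b ∧ j ≠ κ c ∧ j ≠ κ e) : Col3 G S := by
  obtain ⟨i, j, hij, h1, h2, h3, h4⟩ := hx
  have gv : ∀ x ∈ S, G.Adj v x → i ≠ Function.update (Function.update κ v i) w j x := by
    intro x hx hvx
    rcases hv x hx hvx with rfl | rfl | rfl
    · simpa using hij
    · simpa [Function.update_of_ne ha.1, Function.update_of_ne ha.2] using h1
    · simpa [Function.update_of_ne hb.1, Function.update_of_ne hb.2] using h2
  have gw : ∀ x ∈ S, G.Adj w x → j ≠ Function.update (Function.update κ v i) w j x := by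
    intro x hx hvx
    rcases hw x hx hvx with rfl | rfl | rfl
    · simpa [Function.update_of_ne hvw] using hij.symm
    · simpa [Function.update_of_ne hc.1, Function.update_of_ne hc.2] using h3
    · simpa [Function.update_of_ne he.1, Function.update_of_ne he.2] using h4
  have eqv : Function.update (Function.update κ v i) w j v = i := by
    simp [Function.update_of_ne hvw]
  have eqw : Function.update (Function.update κ v i) w j w = j := by simp
  refine ⟨Function.update (Function.update κ v i) w j, fun x hx y hy hxy => ?_⟩
  by_cases x1 : x = v
  · subst x1; rw [eqv]; exact gv y hy hxy
  by_cases y1 : y = v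
  · subst y1; rw [eqv]; exact (gv x hx hxy.symm).symm
  by_cases x2 : x = w
  · subst x2; rw [eqw]; exact gw y hy hxy
  by_cases y2 : y = w
  · subst y2; rw [eqw]; exact (gw x hx hxy.symm).symm
  rw [Function.update_of_ne x2, Function.update_of_ne y2, Function.update_of_ne x1,
    Function.update_of_ne y1]
  exact hκ x (by simp [x1, x2, hx]) y (by simp [y1, y2, hy]) hxy

theorem nb3 {v a b : V} (h : (nb G S v).card = 3) (ha : a ∈ nb G S v) (hb : b ∈ nb G S v) (hab : a ≠ b) :
    ∃ c, c ∈ nb G S v ∧ c ≠ a ∧ c ≠ b ∧ ∀ x ∈ S, G.Adj v x → x = a ∨ x = b ∨ x = c := by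
  have h1 : (((nb G S v).erase a).erase b).card = 1 := by
    rw [Finset.card_erase_of_mem (by simp [hab.symm, hb]), Finset.card_erase_of_mem ha, h]
  obtain ⟨c, hc⟩ := Finset.card_eq_one.1 h1
  have hc' : c ∈ ((nb G S v).erase a).erase b := by rw [hc]; simp
  simp only [Finset.mem_erase] at hc'
  refine ⟨c, hc'.2.2, hc'.2.1, hc'.1, fun x hx hvx => ?_⟩
  by_contra hn
  push Not at hn
  have : x ∈ ((nb G S v).erase a).erase b := by
    simp only [Finset.mem_erase]
    exact ⟨hn.2.1, hn.1, mem_nb.2 ⟨hx, hvx⟩⟩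
  rw [hc] at this
  exact hn.2.2 (by simpa using this)

theorem two_pot {a b x : V} {R : Finset V} (hx : x ∉ R) (ha : a ∈ R) (hb : b ∈ R) (hab : a ≠ b)
    (h1 : G.Adj x a) (h2 : G.Adj x b) : pot G (insert x R) ≤ pot G R - 2 := by
  classical
  rw [pot_insert G hx]
  have : ee G {x} ({a} ∪ {b}) ≤ ee G {x} R := ee_mono G (subset_refl _) (by
    intro z hz; simp at hz; rcases hz with rfl | rfl <;> assumption)
  rw [ee_union_right G (by simpa using hab), ee_singleton, ee_singleton, if_pos h1, if_pos h2] at this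
  linarith

theorem three_pot {a b c x : V} {R : Finset V} (hx : x ∉ R) (ha : a ∈ R) (hb : b ∈ R) (hc : c ∈ R)
    (hab : a ≠ b) (hac : a ≠ c) (hbc : b ≠ c)
    (h1 : G.Adj x a) (h2 : G.Adj x b) (h3 : G.Adj x c) : pot G (insert x R) ≤ pot G R - 8 := by
  classical
  rw [pot_insert G hx]
  have : ee G {x} (({a} ∪ {b}) ∪ {c}) ≤ ee G {x} R := ee_mono G (subset_refl _) (by
    intro z hz; simp at hz; rcases hz with rfl | rfl | rfl <;> assumption)
  rw [ee_union_right G (by simp [hac.symm, hbc.symm]), ee_union_right G (by simpa using hab), ee_singleton, ee_singleton, ee_singleton, if_pos h1, if_pos h2, if_pos h3] at this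
  linarith

theorem claim3 (C : Ctx G S) {v w s : V} (hv : v ∈ S) (hw : w ∈ S) (hs : s ∈ S)
    (hvw : G.Adj v w) (hvs : G.Adj v s) (hws : G.Adj w s)
    (dv : (nb G S v).card = 3) (dw : (nb G S w).card = 3) : False := by
  have nvw := G.ne_of_adj hvw
  have nvs := G.ne_of_adj hvs
  have nws := G.ne_of_adj hws
  obtain ⟨u, hu, huw, hus, hvall⟩ := nb3 dv (mem_nb.2 ⟨hw, hvw⟩) (mem_nb.2 ⟨hs, hvs⟩) nws
  obtain ⟨r, hr, hrv, hrs, hwall⟩ := nb3 dw (mem_nb.2 ⟨hv, hvw.symm⟩) (mem_nb.2 ⟨hs, hws⟩) nvs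
  obtain ⟨hu, hvu⟩ := mem_nb.1 hu
  obtain ⟨hr, hwr⟩ := mem_nb.1 hr
  have nvu := G.ne_of_adj hvu
  have nwr := G.ne_of_adj hwr
  have hT : (S.erase v).erase w ⊂ S := 
    Finset.ssubset_of_subset_of_ssubset (Finset.erase_subset _ _) (Finset.erase_ssubset hv)
  have huT : u ∈ (S.erase v).erase w := by simp [hu, huw, nvu.symm]
  have hrT : r ∈ (S.erase v).erase w := by simp [hr, hrv, nwr.symm]
  have hsT : s ∈ (S.erase v).erase w := by simp [hs, nws.symm, nvs.symm]
  by_cases hur : u = r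
  · subst hur
    by_cases hus' : G.Adj u s
    · have hK : ¬ Col3 G {v, w, s, u} := by
        rintro ⟨κ, hκ⟩
        have a1 := hκ v (by simp) w (by simp) hvw
        have a2 := hκ v (by simp) s (by simp) hvs
        have a3 := hκ v (by simp) u (by simp) hvu
        have a4 := hκ w (by simp) s (by simp) hws
        have a5 := hκ w (by simp) u (by simp) hwr
        have a6 := hκ u (by simp) s (by simp) hus'
        omega
      have hsub : ({v, w, s, u} : Finset V) ⊆ S := by
        intro z hz; simp at hz; rcases hz with rfl | rfl | rfl | rfl <;> assumption
      have hSe : ({v, w, s, u} : Finset V) = S := by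
        by_contra hne
        exact hK (C.hcol _ ⟨hsub, fun h => hne (Finset.Subset.antisymm hsub h)⟩)
      have h1 := three_pot (G := G) (R := {w, s, u}) (x := v) (a := w) (b := s) (c := u) (by simp [nvw, nvs, nvu])
        (by simp) (by simp) (by simp) nws huw.symm hus.symm hvw hvs hvu
      have h2 := two_pot (G := G) (R := {s, u}) (x := w) (a := s) (b := u) (by simp [nws, huw.symm])
        (by simp) (by simp) hus.symm hws hwr
      have h3 := pot_insert G (R := {u}) (a := s) (by simp [hus.symm])
      have h4 := ee_pos G (A := {s}) (B := {u}) (by simp) (by simp) hus'.symm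
      rw [pot_singleton] at h3
      rw [hSe] at h1
      have := C.hpot
      linarith
    · rcases id_lemma C.ih C.hcol hT huT hsT hus hus' with ⟨κ, hκ, heq⟩ | ⟨R, hRT, huR, hsR, hR5, hRp⟩
      · apply C.hS
        refine ext2 nvw hvall hwall ⟨nvs.symm, nws.symm⟩ ⟨nvu.symm, huw⟩ ⟨nvs.symm, nws.symm⟩ ⟨nvu.symm, huw⟩ κ hκ ?_
        rw [heq]
        generalize κ s = z
        revert z; decide
      · have hvR : v ∉ R := fun h => by simpa using hRT h
        have hwR : w ∉ R := fun h => by simpa using hRT h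
        have h1 := two_pot (x := w) (R := R) hwR hsR huR hus.symm hws hwr
        have h2 := three_pot (x := v) (R := insert w R) (by simp [nvw, hvR]) (a := w) (b := s) (c := u)
          (by simp) (by simp [hsR]) (by simp [huR]) nws huw.symm hus.symm hvw hvs hvu
        have hsub : insert v (insert w R) ⊆ S := by
          intro z hz
          simp at hz
          rcases hz with rfl | rfl | hz
          · exact hv
          · exact hw
          · exact hT.1 (hRT hz)
        by_cases hSe : insert v (insert w R) = S
        · rw [hSe] at h2
          have := C.hpot
          linarith
        · have := claim1 C _ ⟨hsub, fun h => hSe (Finset.Subset.antisymm hsub h)⟩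
            (le_trans (by omega) (Finset.card_le_card ((Finset.subset_insert w R).trans (Finset.subset_insert v _))))
          linarith
  · obtain ⟨κ, hκ, hne⟩ := edge_lemma C.ih C.hcol hT huT hrT hur (claim1 C)
    apply C.hS
    refine ext2 nvw hvall hwall ⟨nvs.symm, nws.symm⟩ ⟨nvu.symm, huw⟩ ⟨nvs.symm, nws.symm⟩ ⟨hrv, nwr.symm⟩ κ hκ ?_
    revert hne
    generalize κ s = z; generalize κ u = y; generalize κ r = x
    revert x y z; decide

theorem claim4 (C : Ctx G S) {u v x y : V} (hu : u ∈ S) (hv : v ∈ S) (hx : x ∈ S) (hy : y ∈ S)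
    (huv : G.Adj u v) (hux : G.Adj u x) (huy : G.Adj u y) (hvx : v ≠ x) (hvy : v ≠ y) (hxy : x ≠ y)
    (du : (nb G S u).card = 3) (dv : (nb G S v).card = 3) : G.Adj x y := by
  by_contra hadj
  have nuv := G.ne_of_adj huv
  have nux := G.ne_of_adj hux
  have nuy := G.ne_of_adj huy
  have huall : ∀ z ∈ S, G.Adj u z → z = v ∨ z = x ∨ z = y := by
    obtain ⟨c, hc, hcv, hcx, hall⟩ := nb3 du (mem_nb.2 ⟨hv, huv⟩) (mem_nb.2 ⟨hx, hux⟩) hvx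
    have : y = c := by
      rcases hall y hy huy with h | h | h
      · exact absurd h.symm hvy
      · exact absurd h.symm hxy
      · exact h
    rw [this]; exact hall
  obtain ⟨p, hp, hpu⟩ : ∃ p ∈ nb G S v, p ≠ u := by
    by_contra hno
    push Not at hno
    have : nb G S v ⊆ {u} := fun z hz => by simp [hno z hz]
    have := Finset.card_le_card this
    simp at this; omega
  obtain ⟨q, hq, hqu, hqp, hvall⟩ := nb3 dv (mem_nb.2 ⟨hu, huv.symm⟩) hp hpu.symm
  obtain ⟨hp, hvp⟩ := mem_nb.1 hp
  obtain ⟨hq, hvq⟩ := mem_nb.1 hq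
  have hT : (S.erase u).erase v ⊂ S := 
    Finset.ssubset_of_subset_of_ssubset (Finset.erase_subset _ _) (Finset.erase_ssubset hu)
  have hxT : x ∈ (S.erase u).erase v := by simp [hx, hvx.symm, nux.symm]
  have hyT : y ∈ (S.erase u).erase v := by simp [hy, hvy.symm, nuy.symm]
  rcases id_lemma C.ih C.hcol hT hxT hyT hxy hadj with ⟨κ, hκ, heq⟩ | ⟨R, hRT, hxR, hyR, hR5, hRp⟩
  · apply C.hS
    refine ext2 nuv huall hvall ⟨nux.symm, hvx.symm⟩ ⟨nuy.symm, hvy.symm⟩ ⟨hpu, (G.ne_of_adj hvp).symm⟩ ⟨hqu, (G.ne_of_adj hvq).symm⟩ κ hκ ?_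
    rw [heq]
    generalize κ y = z; generalize κ p = y; generalize κ q = x
    revert x y z; decide
  · have huR : u ∉ R := fun h => by simpa using hRT h
    have hvR : v ∉ R := fun h => by simpa using hRT h
    have h1 := two_pot (x := u) (R := R) huR hxR hyR hxy hux huy
    have := claim2 C (insert u R) ⟨by
      intro z hz
      simp at hz
      rcases hz with rfl | hz
      · exact hu
      · exact hT.1 (hRT hz), fun h => by
      have := h hv
      simp [nuv.symm, hvR] at this⟩ (le_trans (by omega) (Finset.card_le_card (Finset.subset_insert u R)))
    linarith

theorem claim5 (C : Ctx G S) {u : V} (hu : u ∈ S) (du : (nb G S u).card = 3) :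
    2 ≤ ((nb G S u).filter (fun w => 4 ≤ (nb G S w).card)).card := by
  by_contra hlt
  have hsplit := Finset.card_filter_add_card_filter_not (s := nb G S u) (fun w => 4 ≤ (nb G S w).card)
  have h2 : 1 < ((nb G S u).filter (fun w => ¬ 4 ≤ (nb G S w).card)).card := by omega
  obtain ⟨v, hv, w, hw, hvw⟩ := Finset.one_lt_card.1 h2
  rw [Finset.mem_filter] at hv hw
  obtain ⟨y, hy, hyv, hyw, -⟩ := nb3 du hv.1 hw.1 hvw
  obtain ⟨hvS, huv⟩ := mem_nb.1 hv.1
  obtain ⟨hwS, huw⟩ := mem_nb.1 hw.1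
  obtain ⟨hyS, huy⟩ := mem_nb.1 hy
  have dv : (nb G S v).card = 3 := by have := mindeg C v hvS; omega
  have dw : (nb G S w).card = 3 := by have := mindeg C w hwS; omega
  have := claim4 C hu hvS hwS hyS huv huw huy hvw hyv.symm hyw.symm du dv
  exact claim3 C hu hwS hyS huw huy this du dw

theorem ctx_false (C : Ctx G S) : False := by
  classical
  have hee : ee G S S = ∑ v ∈ S, ((nb G S v).card : ℤ) := by
    unfold ee nb
    refine Finset.sum_congr rfl fun v _ => ?_
    simp
  let d := fun v => (nb G S v).card
  let c : V → V → ℤ := fun v w => if G.Adj v w ∧ 4 ≤ d v ∧ d w = 3 then 1 else 0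
  have hcomm : ∑ v ∈ S, ∑ w ∈ S, c v w = ∑ w ∈ S, ∑ v ∈ S, c v w := Finset.sum_comm
  have hmain : 0 ≤ ∑ v ∈ S, ((6 * (d v : ℤ) - 20) - ∑ w ∈ S, c v w + ∑ w ∈ S, c w v) := by
    refine Finset.sum_nonneg fun v hv => ?_
    have h3 := mindeg C v hv
    have hin : 0 ≤ ∑ w ∈ S, c w v := Finset.sum_nonneg fun w _ => by
      dsimp only [c]; split_ifs <;> simp
    by_cases hd : d v = 3
    · have hout : ∑ w ∈ S, c v w = 0 := Finset.sum_eq_zero fun w _ => by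
        dsimp only [c]; rw [if_neg]; rintro ⟨_, h, _⟩; omega
      have hin2 : 2 ≤ ∑ w ∈ S, c w v := by
        have h5 := claim5 C hv hd
        have : ∑ w ∈ S, c w v = ((nb G S v).filter (fun w => 4 ≤ (nb G S w).card)).card := by
          dsimp only [c]
          rw [Finset.sum_boole]
          congr 2
          ext w
          simp only [Finset.mem_filter, mem_nb, hd, and_true, G.adj_comm w v, d, and_assoc]
        rw [this]; exact_mod_cast h5
      have hd' : (d v : ℤ) = 3 := by exact_mod_cast hd
      rw [hout, hd']; linarith
    · have hout : ∑ w ∈ S, c v w ≤ d v := by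
        have : (d v : ℤ) = ∑ w ∈ S, if G.Adj v w then 1 else 0 := by
          dsimp only [d]; unfold nb; simp
        rw [this]
        refine Finset.sum_le_sum fun w _ => ?_
        dsimp only [c]
        split_ifs <;> simp_all
      have : (4:ℤ) ≤ d v := by
        have : 4 ≤ d v := by simp only [d] at hd ⊢; omega
        exact_mod_cast this
      linarith
  rw [Finset.sum_add_distrib, Finset.sum_sub_distrib, Finset.sum_sub_distrib, ← hcomm,
    ← Finset.mul_sum, ← hee] at hmain
  have := C.hpot
  unfold pot at this
  simp at hmain
  linarith

end ctx

theorem main (n : ℕ) : IH n := by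
  induction n with
  | zero => intro V G S h; exact absurd h (Nat.not_lt_zero _)
  | succ n ih =>
    intro V G S hn hS
    classical
    have ih' : IH S.card := fun V G S' h => ih V G S' (by omega)
    by_cases hcol : ∀ R', R' ⊂ S → Col3 G R'
    · by_cases hp : pot G S ≤ 4
      · exact ⟨S, subset_refl _, hS, hp⟩
      · exfalso
        refine ctx_false (G := G) (S := S) ⟨ih', hS, hcol, ?_⟩
        obtain ⟨k, hk⟩ := pot_even G S
        omega
    · push Not at hcol
      obtain ⟨R, hR, hRc⟩ := hcol
      obtain ⟨R', h1, h2⟩ := ih' V G R (Finset.card_lt_card hR) hRc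
      exact ⟨R', h1.trans hR.1, h2⟩

end KY

namespace DS

variable {D V Φ : Type} [DecidableEq D] [DecidableEq V] [DecidableEq Φ]

/-- degree of a chain at a vertex -/
def sm (A : Finset D) (src : D → V) (c : D → ZMod 2) (v : V) : ZMod 2 :=
  ∑ d ∈ A, if src d = v then c d else 0

/-- boundary of a set of faces -/
def bd (α : D → D) (face : D → Φ) (X : Φ → ZMod 2) (d : D) : ZMod 2 := X (face d) + X (face (α d))

structure PD (α : D → D) (A : Finset D) (src : D → V) (face : D → Φ) : Prop where
  inv : ∀ d, α (α d) = d
  ne : ∀ d, α d ≠ d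
  cl : ∀ d ∈ A, α d ∈ A
  even : ∀ X v, sm A src (bd α face X) v = 0
  full : ∀ c : D → ZMod 2, (∀ d, c (α d) = c d) → (∀ d, d ∉ A → c d = 0) → (∀ v, sm A src c v = 0) →
    ∃ X : Φ → ZMod 2, ∀ d ∈ A, c d = bd α face X d

structure Good (α : D → D) (A : Finset D) (src : D → V) (p q : V) : Prop where
  noloop : ∀ d ∈ A, src d ≠ src (α d)
  notri : ∀ d ∈ A, ∀ e ∈ A, ∀ f ∈ A, src (α d) = src e → src (α e) = src f → src (α f) ≠ src d
  npq : ∀ d ∈ A, src d = p → src (α d) ≠ q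

def Col (α : D → D) (A : Finset D) (src : D → V) (p q : V) : Prop :=
  ∃ κ : V → Fin 3, (∀ d ∈ A, κ (src d) ≠ κ (src (α d))) ∧ κ p = κ q

def ad (α : D → D) (A : Finset D) (src : D → V) (a b : V) : Prop := ∃ d ∈ A, src d = a ∧ src (α d) = b

/-- delete an edge -/
def del (α : D → D) (A : Finset D) (d : D) : Finset D := (A.erase d).erase (α d)

theorem z2 (a : ZMod 2) : a = 0 ∨ a = 1 := by revert a; decide
theorem z2add (a : ZMod 2) : a + a = 0 := by revert a; decide

theorem sm_add (A : Finset D) (src : D → V) (c c' : D → ZMod 2) (v : V) :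
    sm A src (fun d => c d + c' d) v = sm A src c v + sm A src c' v := by
  unfold sm
  rw [← Finset.sum_add_distrib]
  refine Finset.sum_congr rfl fun d _ => ?_
  split_ifs <;> simp

section
variable {α : D → D} {A : Finset D} {src : D → V} {face : D → Φ}

theorem mem_del {d e : D} : e ∈ del α A d ↔ e ≠ α d ∧ e ≠ d ∧ e ∈ A := by
  simp [del]

theorem sum_del (hne : ∀ d, α d ≠ d) {d : D} (hd : d ∈ A) (hd' : α d ∈ A) (f : D → ZMod 2) :
    ∑ e ∈ A, f e = (∑ e ∈ del α A d, f e) + (f d + f (α d)) := by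
  unfold del
  rw [← Finset.sum_erase_add _ _ hd, ← Finset.sum_erase_add (A.erase d) _ (Finset.mem_erase.2 ⟨hne d, hd'⟩)]
  ring

theorem sm_del (hne : ∀ d, α d ≠ d) {d : D} (hd : d ∈ A) (hd' : α d ∈ A) (c : D → ZMod 2) (v : V) :
    sm A src c v = sm (del α A d) src c v +
      ((if src d = v then c d else 0) + (if src (α d) = v then c (α d) else 0)) := by
  unfold sm
  rw [sum_del hne hd hd']

theorem card_del (hne : ∀ d, α d ≠ d) {d : D} (hd : d ∈ A) (hd' : α d ∈ A) :
    (del α A d).card + 2 = A.card := by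
  unfold del
  have h1 := Finset.card_erase_add_one hd
  have h2 := Finset.card_erase_add_one (Finset.mem_erase.2 ⟨hne d, hd'⟩ : α d ∈ A.erase d)
  omega

theorem bd_symm (hinv : ∀ d, α (α d) = d) (X : Φ → ZMod 2) (d : D) : bd α face X (α d) = bd α face X d := by
  unfold bd; rw [hinv, add_comm]

theorem PD.adsymm (h : PD α A src face) {a b : V} (hab : ad α A src a b) : ad α A src b a := by
  obtain ⟨d, hd, h1, h2⟩ := hab
  exact ⟨α d, h.cl d hd, h2, by rw [h.inv]; exact h1⟩

theorem PD.delete (h : PD α A src face) {d0 : D} (hd0 : d0 ∈ A) :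
    PD α (del α A d0) src (fun d => if face d = face (α d0) then face d0 else face d) := by
  refine ⟨h.inv, h.ne, ?_, ?_, ?_⟩
  · intro d hd
    rw [mem_del] at hd ⊢
    refine ⟨fun h1 => hd.2.1 ?_, fun h1 => hd.1 ?_, h.cl d hd.2.2⟩
    · rw [← h.inv d, h1, h.inv]
    · rw [← h.inv d, h1]
  · intro X v
    have h1 := h.even (fun f => X (if f = face (α d0) then face d0 else f)) v
    rw [sm_del h.ne hd0 (h.cl _ hd0)] at h1
    have h2 : bd α face (fun f => X (if f = face (α d0) then face d0 else f)) d0 = 0 := by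
      unfold bd
      simp only [if_true]
      split_ifs <;> exact z2add _
    rw [bd_symm h.inv, h2] at h1
    simp only [ite_self, add_zero] at h1
    exact h1
  · intro c hc hs hz
    obtain ⟨X, hX⟩ := h.full c hc (fun d hd => hs d (fun h' => hd (mem_del.1 h').2.2)) (by
      intro v
      rw [sm_del h.ne hd0 (h.cl _ hd0), hz v, hc, hs d0 (by simp [mem_del])]
      simp)
    refine ⟨X, fun d hd => ?_⟩
    rw [hX d (mem_del.1 hd).2.2]
    have h0 : X (face d0) = X (face (α d0)) := by
      have := hX d0 hd0
      rw [hs d0 (by simp [mem_del])] at this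
      unfold bd at this
      exact (CharTwo.add_eq_zero.1 this.symm)
    have h1 : ∀ f, X (if f = face (α d0) then face d0 else f) = X f := by
      intro f; split_ifs with hf
      · rw [hf, h0]
      · rfl
    unfold bd
    rw [h1, h1]

theorem Good.mono {p q : V} {A' : Finset D} (h : Good α A src p q) (hs : A' ⊆ A) : Good α A' src p q :=
  ⟨fun d hd => h.noloop d (hs hd), fun d hd e he f hf => h.notri d (hs hd) e (hs he) f (hs hf),
    fun d hd => h.npq d (hs hd)⟩

theorem del_sub {d : D} : del α A d ⊆ A := fun e he => (mem_del.1 he).2.2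

/-- A facial 4-cycle. -/
structure Q4 (α : D → D) (A : Finset D) (src : D → V) (face : D → Φ) (g : Φ) (d1 d2 d3 d4 : D) : Prop where
  m1 : d1 ∈ A
  m2 : d2 ∈ A
  m3 : d3 ∈ A
  m4 : d4 ∈ A
  t1 : src (α d1) = src d2
  t2 : src (α d2) = src d3
  t3 : src (α d3) = src d4
  t4 : src (α d4) = src d1
  n13 : src d1 ≠ src d3
  n24 : src d2 ≠ src d4
  b : ∀ d ∈ A, ((face d = g ∧ face (α d) ≠ g) ∨ (face d ≠ g ∧ face (α d) = g)) ↔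
    (d = d1 ∨ d = α d1 ∨ d = d2 ∨ d = α d2 ∨ d = d3 ∨ d = α d3 ∨ d = d4 ∨ d = α d4)

theorem Q4.rot {g : Φ} {d1 d2 d3 d4 : D} (h : Q4 α A src face g d1 d2 d3 d4) :
    Q4 α A src face g d2 d3 d4 d1 :=
  ⟨h.m2, h.m3, h.m4, h.m1, h.t2, h.t3, h.t4, h.t1, h.n24, h.n13.symm, fun d hd => by
    rw [h.b d hd]; tauto⟩

theorem Q4.rev (hP : PD α A src face) {g : Φ} {d1 d2 d3 d4 : D} (h : Q4 α A src face g d1 d2 d3 d4) :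
    Q4 α A src face g (α d4) (α d3) (α d2) (α d1) :=
  ⟨hP.cl _ h.m4, hP.cl _ h.m3, hP.cl _ h.m2, hP.cl _ h.m1, by rw [hP.inv, h.t3], by rw [hP.inv, h.t2],
   by rw [hP.inv, h.t1], by rw [hP.inv, h.t4], by rw [h.t4, h.t2]; exact h.n13,
   by rw [h.t1, h.t3]; exact h.n24.symm, fun d hd => by
    rw [h.b d hd]; simp only [hP.inv]; tauto⟩

/-- T-join between two vertices avoiding a set of vertices -/
def TJ (α : D → D) (A : Finset D) (src : D → V) (F : Set V) (a b : V) : Prop :=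
  ∃ c : D → ZMod 2, (∀ d, c (α d) = c d) ∧ (∀ d, d ∉ A → c d = 0) ∧
    (∀ v, sm A src c v = (if v = a then 1 else 0) + (if v = b then 1 else 0)) ∧
    ∀ d, src d ∈ F → c d = 0

theorem TJ.trans {F : Set V} {a b e : V} (h1 : TJ α A src F a b) (h2 : TJ α A src F b e) :
    TJ α A src F a e := by
  obtain ⟨c, c1, c2, c3, c4⟩ := h1
  obtain ⟨c', c1', c2', c3', c4'⟩ := h2
  refine ⟨fun d => c d + c' d, fun d => by simp only [c1, c1'], fun d hd => by simp only [c2 d hd, c2' d hd, add_zero],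
    fun v => ?_, fun d hd => by simp only [c4 d hd, c4' d hd, add_zero]⟩
  rw [sm_add, c3, c3']
  generalize (if v = a then (1 : ZMod 2) else 0) = x
  generalize (if v = b then (1 : ZMod 2) else 0) = y
  generalize (if v = e then (1 : ZMod 2) else 0) = z
  revert x y z; decide

/-- indicator chain of an edge -/
def ic (α : D → D) (d : D) (e : D) : ZMod 2 := if e = d ∨ e = α d then 1 else 0

theorem PD.ic_symm (h : PD α A src face) (d e : D) : ic α d (α e) = ic α d e := by
  unfold ic
  have : (α e = d ∨ α e = α d) ↔ (e = d ∨ e = α d) := by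
    constructor
    · rintro (h1 | h1)
      · right; rw [← h1, h.inv]
      · left; rw [← h.inv e, h1, h.inv]
    · rintro (h1 | h1)
      · right; rw [h1]
      · left; rw [h1, h.inv]
  simp only [this]

theorem PD.ic_sm (h : PD α A src face) {d : D} (hd : d ∈ A) (v : V) :
    sm A src (ic α d) v = (if v = src d then 1 else 0) + (if v = src (α d) then 1 else 0) := by
  rw [sm_del h.ne hd (h.cl d hd)]
  have : sm (del α A d) src (ic α d) v = 0 := by
    unfold sm
    refine Finset.sum_eq_zero fun e he => ?_
    rw [mem_del] at he
    simp [ic, he.1, he.2.1]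
  rw [this]
  simp [ic, eq_comm]

theorem TJ.edge (h : PD α A src face) {F : Set V} {a b : V} (hab : ad α A src a b) (ha : a ∉ F) (hb : b ∉ F) :
    TJ α A src F a b := by
  obtain ⟨d, hd, rfl, rfl⟩ := hab
  refine ⟨ic α d, h.ic_symm d, fun e he => ?_, h.ic_sm hd, fun e he => ?_⟩
  · unfold ic; rw [if_neg]; rintro (rfl | rfl)
    · exact he hd
    · exact he (h.cl d hd)
  · unfold ic; rw [if_neg]; rintro (rfl | rfl)
    · exact ha he
    · exact hb he

end

end DS

namespace DS

variable {D V Φ : Type} [DecidableEq D] [DecidableEq V] [DecidableEq Φ]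
variable {α : D → D} {A : Finset D} {src : D → V} {face : D → Φ}

theorem sm_merge {v1 v3 : V} (h13 : v1 ≠ v3) (A : Finset D) (src : D → V) (c : D → ZMod 2) (v : V) :
    sm A (fun d => if src d = v3 then v1 else src d) c v =
      if v = v1 then sm A src c v1 + sm A src c v3 else if v = v3 then 0 else sm A src c v := by
  unfold sm
  split_ifs with h1 h2
  · subst h1
    rw [← Finset.sum_add_distrib]
    refine Finset.sum_congr rfl fun d _ => ?_
    by_cases a : src d = v3
    · simp [a, h13.symm]
    · simp [a]
  · subst h2
    refine Finset.sum_eq_zero fun d _ => ?_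
    by_cases a : src d = v
    · simp [a, h13]
    · simp [a]
  · refine Finset.sum_congr rfl fun d _ => ?_
    by_cases a : src d = v3
    · simp [a, Ne.symm h1, Ne.symm h2]
    · simp [a]

theorem sm_congr {A : Finset D} {src : D → V} {c c' : D → ZMod 2} (h : ∀ d ∈ A, c d = c' d) (v : V) :
    sm A src c v = sm A src c' v := by
  unfold sm
  exact Finset.sum_congr rfl fun d hd => by rw [h d hd]

/-- other side of an edge of a face -/
def oside (α : D → D) (face : D → Φ) (g : Φ) (d : D) : Φ := if face d = g then face (α d) else face d

theorem Q4.bd_eq (hP : PD α A src face) {g : Φ} {d1 d2 d3 d4 : D} (h : Q4 α A src face g d1 d2 d3 d4) (X : Φ → ZMod 2) :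
    bd α face X d1 = X g + X (oside α face g d1) := by
  have := (h.b d1 h.m1).2 (by simp)
  unfold bd oside
  rcases this with ⟨a, b⟩ | ⟨a, b⟩
  · simp [a]
  · simp [a, b, add_comm]

def idface (α : D → D) (face : D → Φ) (g : Φ) (d1 d2 d3 d4 : D) (d : D) : Φ :=
  if d = d1 then oside α face g d1 else if d = α d1 then oside α face g d2 else
  if d = d4 then oside α face g d4 else if d = α d4 then oside α face g d3 else face d

theorem PD.ident (hP : PD α A src face) {p q : V} (hG : Good α A src p q) {g : Φ} {d1 d2 d3 d4 : D}
    (h : Q4 α A src face g d1 d2 d3 d4) :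
    PD α (del α (del α A d2) d3) (fun d => if src d = src d3 then src d1 else src d)
      (idface α face g d1 d2 d3 d4) := by
  have n12 : src d1 ≠ src d2 := by rw [← h.t1]; exact hG.noloop _ h.m1
  have n23 : src d2 ≠ src d3 := by rw [← h.t2]; exact hG.noloop _ h.m2
  have n34 : src d3 ≠ src d4 := by rw [← h.t3]; exact hG.noloop _ h.m3
  have n41 : src d4 ≠ src d1 := by rw [← h.t4]; exact hG.noloop _ h.m4
  have n13 := h.n13
  have n24 := h.n24
  have s1 := h.t1
  have s2 := h.t2
  have s3 := h.t3
  have s4 := h.t4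
  have inv := hP.inv
  have hne := hP.ne
  have e12 : d2 ≠ d1 := fun e => n12 (by rw [e])
  have e12' : d2 ≠ α d1 := fun e => n13 (by rw [← s2, e, inv])
  have e13 : d3 ≠ d1 := fun e => n13 (by rw [e])
  have e13' : d3 ≠ α d1 := fun e => n23 (by rw [e, s1])
  have e14 : d4 ≠ d1 := fun e => n41 (by rw [e])
  have e14' : d4 ≠ α d1 := fun e => n24 (by rw [← s1, e])
  have e23 : d3 ≠ d2 := fun e => n23 (by rw [e])
  have e23' : d3 ≠ α d2 := fun e => n24 (by rw [← s3, e, inv])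
  have e24 : d4 ≠ d2 := fun e => n24 (by rw [e])
  have e24' : d4 ≠ α d2 := fun e => n34 (by rw [e, s2])
  have e34 : d4 ≠ d3 := fun e => n34 (by rw [e])
  have e34' : d4 ≠ α d3 := fun e => n13 (by rw [← s4, e, inv])
  have sw : ∀ {a b : D}, a ≠ α b → b ≠ α a := fun {a b} hab e => hab (by rw [e, inv])
  have aa : ∀ {a b : D}, a ≠ b → α a ≠ α b := fun {a b} hab e => hab (by rw [← inv a, e, inv])
  have sw2 : ∀ {a b : D}, a ≠ α b → α a ≠ b := fun {a b} hab e => hab (by rw [← e, inv])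
  have cl := hP.cl
  have cldel : ∀ (B : Finset D) (d : D), (∀ x ∈ B, α x ∈ B) → ∀ x ∈ del α B d, α x ∈ del α B d := by
    intro B d hB x hx
    rw [mem_del] at hx ⊢
    exact ⟨aa hx.2.1, sw2 hx.1, hB x hx.2.2⟩
  set A1 := del α A d2 with hA1
  have cl1 : ∀ x ∈ A1, α x ∈ A1 := cldel _ _ cl
  have m31 : d3 ∈ A1 := mem_del.2 ⟨e23', e23, h.m3⟩
  set A' := del α A1 d3 with hA'
  have cl' : ∀ x ∈ A', α x ∈ A' := cldel _ _ cl1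
  have m1' : d1 ∈ A' := mem_del.2 ⟨sw e13', e13.symm, mem_del.2 ⟨sw e12', e12.symm, h.m1⟩⟩
  have m4' : d4 ∈ A' := mem_del.2 ⟨e34', e34, mem_del.2 ⟨e24', e24, h.m4⟩⟩
  set B1 := del α A' d1 with hB1
  have clB1 : ∀ x ∈ B1, α x ∈ B1 := cldel _ _ cl'
  have m4B : d4 ∈ B1 := mem_del.2 ⟨e14', e14, m4'⟩
  set B := del α B1 d4 with hB
  have hBmem : ∀ x ∈ B, x ∈ A ∧ x ≠ d1 ∧ x ≠ α d1 ∧ x ≠ d2 ∧ x ≠ α d2 ∧ x ≠ d3 ∧ x ≠ α d3 ∧ x ≠ d4 ∧ x ≠ α d4 := by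
    intro x hx
    simp only [hB, hB1, hA', hA1, mem_del] at hx
    tauto
  have clB : ∀ x ∈ B, α x ∈ B := cldel _ _ clB1
  have dec' : ∀ (sr : D → V) (c : D → ZMod 2) v, sm A' sr c v = sm B sr c v +
      ((if sr d4 = v then c d4 else 0) + (if sr (α d4) = v then c (α d4) else 0)) +
      ((if sr d1 = v then c d1 else 0) + (if sr (α d1) = v then c (α d1) else 0)) := by
    intro sr c v
    rw [sm_del hne m1' (cl' _ m1'), sm_del hne m4B (clB1 _ m4B)]
  have dec : ∀ (c : D → ZMod 2) v, sm A src c v = sm A' src c v +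
      ((if src d3 = v then c d3 else 0) + (if src d4 = v then c (α d3) else 0)) +
      ((if src d2 = v then c d2 else 0) + (if src d3 = v then c (α d2) else 0)) := by
    intro c v
    rw [sm_del hne h.m2 (cl _ h.m2), sm_del hne m31 (cl1 _ m31), s2, s3]
  have g1 := fun X => h.bd_eq hP X
  have g2 := fun X => h.rot.bd_eq hP X
  have g3 := fun X => h.rot.rot.bd_eq hP X
  have g4 := fun X => h.rot.rot.rot.bd_eq hP X
  have f1 : ∀ X, bd α (idface α face g d1 d2 d3 d4) X d1 = bd α face X d1 + bd α face X d2 := by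
    intro X
    rw [g1, g2]
    have : bd α (idface α face g d1 d2 d3 d4) X d1 = X (oside α face g d1) + X (oside α face g d2) := by
      simp [bd, idface, hne]
    rw [this]
    generalize X g = a; generalize X (oside α face g d1) = b; generalize X (oside α face g d2) = c
    revert a b c; decide
  have f4 : ∀ X, bd α (idface α face g d1 d2 d3 d4) X d4 = bd α face X d4 + bd α face X d3 := by
    intro X
    rw [g3, g4]
    have : bd α (idface α face g d1 d2 d3 d4) X d4 = X (oside α face g d4) + X (oside α face g d3) := by
      simp [bd, idface, hne, e14, e14', sw2 e14', aa e14]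
    rw [this]
    generalize X g = a; generalize X (oside α face g d4) = b; generalize X (oside α face g d3) = c
    revert a b c; decide
  have fB : ∀ X, ∀ x ∈ B, bd α (idface α face g d1 d2 d3 d4) X x = bd α face X x := by
    intro X x hx
    obtain ⟨-, a1, a2, -, -, -, -, a3, a4⟩ := hBmem x hx
    obtain ⟨-, b1, b2, -, -, -, -, b3, b4⟩ := hBmem _ (clB x hx)
    simp [bd, idface, a1, a2, a3, a4, b1, b2, b3, b4]
  refine ⟨inv, hne, cl', ?_, ?_⟩
  · intro X v
    rw [dec', sm_merge n13, bd_symm inv, bd_symm inv, f1, f4]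
    rw [sm_congr (fB X), sm_congr (fB X), sm_congr (fB X)]
    have hev := hP.even X
    simp only [dec, dec', s1, s4, bd_symm inv] at hev
    simp only [s1, s4]
    by_cases hv1 : v = src d1
    · subst hv1
      have E1 := hev (src d1)
      have E3 := hev (src d3)
      simp [n12.symm, n13.symm, n41, n34.symm, n23, n13] at E1 E3 ⊢
      linear_combination E1 + E3
    by_cases hv2 : v = src d2
    · subst hv2
      have E1 := hev (src d2)
      simp [n12, n12.symm, n24.symm, n23, n23.symm, n34.symm, n24] at E1 ⊢
      linear_combination E1
    by_cases hv3 : v = src d3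
    · subst hv3
      simp [n13, n13.symm, n23, n34.symm]
    by_cases hv4 : v = src d4
    · subst hv4
      have E1 := hev (src d4)
      simp [n41, n41.symm, n34, n34.symm, n24, n23] at E1 ⊢
      linear_combination E1
    have E1 := hev v
    simp [Ne.symm hv1, Ne.symm hv2, Ne.symm hv3, Ne.symm hv4, hv1, hv3, n23, n34.symm] at E1 ⊢
    exact E1
  · intro c' hc hs hz
    have z2' : c' d2 = 0 := hs d2 (by simp [hA', hA1, mem_del])
    have z3' : c' d3 = 0 := hs d3 (by simp [hA', mem_del])
    set s := sm B src c' (src d1) + c' d4 with hsdef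
    set c : D → ZMod 2 := fun d => if d = d1 ∨ d = α d1 then s else
      if d = d2 ∨ d = α d2 then c' d1 + s else c' d with hcdef
    have cs : ∀ d, c (α d) = c d := by
      intro d
      have k : ∀ b, (α d = b ∨ α d = α b) ↔ (d = b ∨ d = α b) := by
        intro b
        constructor
        · rintro (h1 | h1)
          · right; rw [← h1, inv]
          · left; rw [← inv d, h1, inv]
        · rintro (h1 | h1)
          · right; rw [h1]
          · left; rw [h1, inv]
      simp only [hcdef, k, hc]
    have c1 : c d1 = s := by simp [hcdef]
    have c2 : c d2 = c' d1 + s := by simp [hcdef, e12, e12']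
    have c3 : c d3 = 0 := by simp [hcdef, e13, e13', e23, e23', z3']
    have c4 : c d4 = c' d4 := by simp [hcdef, e14, e14', e24, e24']
    have cB : ∀ x ∈ B, c x = c' x := by
      intro x hx
      obtain ⟨-, a1, a2, a3, a4, -, -, -, -⟩ := hBmem x hx
      simp [hcdef, a1, a2, a3, a4]
    simp only [dec', sm_merge n13, hc, s1, s4] at hz
    obtain ⟨X, hX⟩ := hP.full c cs (by
      intro d hd
      have k1 : ¬ (d = d1 ∨ d = α d1) := by
        rintro (rfl | rfl)
        · exact hd h.m1
        · exact hd (cl _ h.m1)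
      have k2 : ¬ (d = d2 ∨ d = α d2) := by
        rintro (rfl | rfl)
        · exact hd h.m2
        · exact hd (cl _ h.m2)
      simp only [hcdef, k1, k2, if_false]
      exact hs d (fun h' => hd (del_sub (del_sub h')))) (by
      intro v
      rw [dec, dec', sm_congr cB, cs, cs, cs, cs, c1, c2, c3, c4, s1, s4]
      by_cases hv1 : v = src d1
      · subst hv1
        simp [n12.symm, n13.symm, n41]
        rw [hsdef]
        generalize sm B src c' (src d1) = a; generalize c' d4 = b
        revert a b; decide
      by_cases hv2 : v = src d2
      · subst hv2
        have E := hz (src d2)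
        simp [n12, n12.symm, n24.symm, n23, n23.symm, n34.symm, n24] at E ⊢
        rw [← E]
        generalize sm B src c' (src d2) = a; generalize c' d1 = b; generalize s = e
        revert a b e; decide
      by_cases hv3 : v = src d3
      · subst hv3
        have E := hz (src d1)
        simp [n12.symm, n13.symm, n41, n34.symm, n23, n13] at E ⊢
        rw [hsdef, ← E]
        ring
      by_cases hv4 : v = src d4
      · subst hv4
        have E := hz (src d4)
        simp [n41, n41.symm, n34, n34.symm, n24, n23] at E ⊢
        exact E
      have E := hz v
      simp [Ne.symm hv1, Ne.symm hv2, Ne.symm hv3, Ne.symm hv4, hv1, hv3, n23, n34.symm] at E ⊢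
      exact E)
    refine ⟨X, fun d hd => ?_⟩
    have r1 : c' d1 = bd α (idface α face g d1 d2 d3 d4) X d1 := by
      rw [f1, ← hX d1 h.m1, ← hX d2 h.m2, c1, c2]
      generalize c' d1 = a; generalize s = b
      revert a b; decide
    have r4 : c' d4 = bd α (idface α face g d1 d2 d3 d4) X d4 := by
      rw [f4, ← hX d3 h.m3, ← hX d4 h.m4, c3, c4, add_zero]
    by_cases k1 : d = d1
    · rw [k1, r1]
    by_cases k2 : d = α d1
    · rw [k2, hc, bd_symm inv, r1]
    by_cases k3 : d = d4
    · rw [k3, r4]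
    by_cases k4 : d = α d4
    · rw [k4, hc, bd_symm inv, r4]
    have hdB : d ∈ B := mem_del.2 ⟨k4, k3, mem_del.2 ⟨k2, k1, hd⟩⟩
    rw [fB X d hdB, ← cB d hdB, hX d (hBmem d hdB).1]

end DS

namespace DS

variable {D V Φ : Type} [DecidableEq D] [DecidableEq V] [DecidableEq Φ]
variable {α : D → D} {A : Finset D} {src : D → V} {face : D → Φ}

theorem sm_congr2 {A : Finset D} {src : D → V} {c c' : D → ZMod 2} {v : V}
    (h : ∀ d ∈ A, src d = v → c d = c' d) :
    sm A src c v = sm A src c' v := by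
  unfold sm
  exact Finset.sum_congr rfl fun d hd => by
    split_ifs with hv
    · exact h d hd hv
    · rfl

theorem PD.ic_sm_mul (h : PD α A src face) {e : D} (he : e ∈ A) (f : D → ZMod 2) (v : V) :
    sm A src (fun d => ic α e d * f d) v =
      (if src e = v then f e else 0) + (if src (α e) = v then f (α e) else 0) := by
  rw [sm_del h.ne he (h.cl e he)]
  have : sm (del α A e) src (fun d => ic α e d * f d) v = 0 := by
    unfold sm
    refine Finset.sum_eq_zero fun x hx => ?_
    rw [mem_del] at hx
    simp [ic, hx.1, hx.2.1]
  rw [this]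
  simp [ic]

theorem ic_off (h : PD α A src face) {e d : D} (he : e ∈ A) (hd : d ∉ A) : ic α e d = 0 := by
  unfold ic; rw [if_neg]; rintro (rfl | rfl)
  · exact hd he
  · exact hd (h.cl _ he)

theorem ic_src {e d : D} {v : V} (hd : src d = v) (h1 : src e ≠ v) (h2 : src (α e) ≠ v) : ic α e d = 0 := by
  unfold ic; rw [if_neg]; rintro (rfl | rfl)
  · exact h1 hd
  · exact h2 hd

theorem crossing (hP : PD α A src face) {g : Φ} {d1 d2 d3 d4 q1 q2 q3 : D}
    (h : Q4 α A src face g d1 d2 d3 d4) (nl : ∀ d ∈ A, src d ≠ src (α d))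
    (a1 : q1 ∈ A) (a2 : q2 ∈ A) (a3 : q3 ∈ A) {z w : V}
    (b1 : src q1 = src d2) (b2 : src (α q1) = z) (b3 : src q2 = z) (b4 : src (α q2) = w)
    (b5 : src q3 = w) (b6 : src (α q3) = src d4)
    (z1 : z ≠ src d1) (z3 : z ≠ src d3) (z4 : z ≠ src d4)
    (w1 : w ≠ src d1) (w2 : w ≠ src d2) (w3 : w ≠ src d3)
    (hTJ : TJ α A src {src d2, z, w, src d4} (src d1) (src d3)) : False := by
  have n12 : src d1 ≠ src d2 := by rw [← h.t1]; exact nl _ h.m1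
  have n23 : src d2 ≠ src d3 := by rw [← h.t2]; exact nl _ h.m2
  have n34 : src d3 ≠ src d4 := by rw [← h.t3]; exact nl _ h.m3
  have n41 : src d4 ≠ src d1 := by rw [← h.t4]; exact nl _ h.m4
  have zw : z ≠ w := by rw [← b3, ← b4]; exact nl _ a2
  have z2 : z ≠ src d2 := by rw [← b1, ← b2]; exact (nl _ a1).symm
  have w4 : w ≠ src d4 := by rw [← b5, ← b6]; exact nl _ a3
  have n13 := h.n13
  have n24 := h.n24
  have s1 := h.t1
  have s2 := h.t2
  have s3 := h.t3
  have s4 := h.t4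
  obtain ⟨cP, p1, p2, p3, p4⟩ := hTJ
  obtain ⟨X0, hX0⟩ := hP.full (fun d => cP d + (ic α d1 d + ic α d2 d))
    (fun d => by simp only [p1, hP.ic_symm]) (fun d hd => by
      simp only [p2 d hd, ic_off hP h.m1 hd, ic_off hP h.m2 hd, add_zero]) (fun v => by
      rw [sm_add, sm_add, p3, hP.ic_sm h.m1, hP.ic_sm h.m2, s1, s2]
      generalize (if v = src d1 then (1 : ZMod 2) else 0) = x
      generalize (if v = src d2 then (1 : ZMod 2) else 0) = y
      generalize (if v = src d3 then (1 : ZMod 2) else 0) = z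
      revert x y z; decide)
  obtain ⟨Y, hY⟩ := hP.full (fun d => (ic α q1 d + ic α q2 d) + (ic α q3 d + (ic α d3 d + ic α d2 d)))
    (fun d => by simp only [hP.ic_symm]) (fun d hd => by
      simp only [ic_off hP a1 hd, ic_off hP a2 hd, ic_off hP a3 hd, ic_off hP h.m2 hd, ic_off hP h.m3 hd, add_zero])
    (fun v => by
      rw [sm_add, sm_add, sm_add, sm_add, hP.ic_sm a1, hP.ic_sm a2, hP.ic_sm a3, hP.ic_sm h.m3, hP.ic_sm h.m2,
        b1, b2, b3, b4, b5, b6, s2, s3]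
      generalize (if v = z then (1 : ZMod 2) else 0) = x
      generalize (if v = w then (1 : ZMod 2) else 0) = y
      generalize (if v = src d3 then (1 : ZMod 2) else 0) = z
      generalize (if v = src d2 then (1 : ZMod 2) else 0) = t
      generalize (if v = src d4 then (1 : ZMod 2) else 0) = u
      revert x y z t u; decide)
  -- normalise
  obtain ⟨X, hXg, hX⟩ : ∃ X : Φ → ZMod 2, X g = 1 ∧ ∀ d ∈ A, cP d + (ic α d1 d + ic α d2 d) = bd α face X d := by
    refine ⟨fun f => X0 f + (X0 g + 1), ?_, fun d hd => ?_⟩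
    · show X0 g + (X0 g + 1) = 1
      generalize X0 g = a; revert a; decide
    · rw [hX0 d hd]; unfold bd; beta_reduce
      generalize X0 g = a; generalize X0 (face d) = b; generalize X0 (face (α d)) = c
      revert a b c; decide
  -- vanishing
  have eqX : ∀ d ∈ A, cP d + (ic α d1 d + ic α d2 d) = 0 → X (face d) = X (face (α d)) := by
    intro d hd h0
    rw [hX d hd] at h0
    exact CharTwo.add_eq_zero.1 h0
  have van : ∀ d ∈ A, (src d = z ∨ src d = w ∨ src d = src d4) → X (face d) = X (face (α d)) := by
    intro d hd hs
    apply eqX d hd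
    have hF : cP d = 0 := p4 d (by simp; tauto)
    rcases hs with hs | hs | hs
    · rw [hF, ic_src hs z1.symm (by rw [s1]; exact z2.symm), ic_src hs z2.symm (by rw [s2]; exact z3.symm)]; simp
    · rw [hF, ic_src hs w1.symm (by rw [s1]; exact w2.symm), ic_src hs w2.symm (by rw [s2]; exact w3.symm)]; simp
    · rw [hF, ic_src hs n41.symm (by rw [s1]; exact n24), ic_src hs n24 (by rw [s2]; exact n34)]; simp
  have key : ∀ u, (u = z ∨ u = w ∨ u = src d4) →
      sm A src (fun d => ic α q1 d * X (face d)) u + sm A src (fun d => ic α q2 d * X (face d)) u +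
      (sm A src (fun d => ic α q3 d * X (face d)) u + (sm A src (fun d => ic α d3 d * X (face d)) u
       + sm A src (fun d => ic α d2 d * X (face d)) u)) = 0 := by
    intro u hu
    rw [← sm_add, ← sm_add, ← sm_add, ← sm_add, ← hP.even (fun f => X f * Y f) u]
    refine sm_congr2 fun d hd hs => ?_
    have e1 := van d hd (by rw [hs]; exact hu)
    have e2 := hY d hd
    unfold bd at e2 ⊢
    beta_reduce
    rw [← e1, ← mul_add, ← e2]
    ring
  simp only [hP.ic_sm_mul a1, hP.ic_sm_mul a2, hP.ic_sm_mul a3, hP.ic_sm_mul h.m3, hP.ic_sm_mul h.m2,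
        b1, b2, b3, b4, b5, b6, s2, s3] at key
  have k4 := key (src d4) (by simp)
  have kw := key w (by simp)
  have kz := key z (by simp)
  simp [n24, z4, w4, n34, n34.symm] at k4
  simp [zw, zw.symm, w2.symm, w4.symm, w3.symm] at kw
  simp [zw, zw.symm, z2.symm, z4.symm, z3.symm] at kz
  have i3 := van (α d3) (hP.cl _ h.m3) (by rw [s3]; simp)
  rw [hP.inv] at i3
  have j3 : X (face (α d3)) = 1 := by
    rcases (h.b d3 h.m3).2 (by simp) with ⟨e, -⟩ | ⟨-, e⟩
    · rw [i3, e, hXg]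
    · rw [e, hXg]
  have l1 := van (α q1) (hP.cl _ a1) (by rw [b2]; simp)
  have l2 := van q2 a2 (by rw [b3]; simp)
  have l3 := van q3 a3 (by rw [b5]; simp)
  rw [hP.inv] at l1
  -- X is one along the path
  have r1 : X (face q1) = 1 ∧ X (face (α q1)) = 1 := by
    rw [j3] at k4
    have : X (face (α q1)) = 1 := by
      rw [← l3] at k4
      rw [← l2] at kw
      have aux : ∀ a b c : ZMod 2, a + 1 = 0 → b + a = 0 → c + b = 0 → c = 1 := by decide
      exact aux _ _ _ k4 kw kz
    exact ⟨by rw [← l1, this], this⟩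
  -- the vertex v2
  have hv2 : sm A src (fun d => (ic α q1 d + (ic α q2 d + (ic α q3 d + (ic α d3 d)))) * (X (face d) * X (face (α d))) +
      (ic α d1 d * Y g + ic α d2 d * Y g)) (src d2) = 0 := by
    rw [← hP.even (fun f => X f * Y f) (src d2)]
    refine sm_congr2 fun d hd hs => ?_
    have hF : cP d = 0 := p4 d (by simp [hs])
    have e2 := hY d hd
    have e1 := hX d hd
    by_cases i1 : d = d1 ∨ d = α d1
    · have j1 : ic α d1 d = 1 := by simp [ic, i1]
      have j2 : ic α d2 d = 0 := by
        unfold ic; rw [if_neg]; rintro (rfl | rfl)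
        · rcases i1 with i1 | i1
          · exact n12 (by rw [i1])
          · exact n13 (by rw [← s2, i1, hP.inv])
        · exact n23 (by rw [← hs, s2])
      rw [hF, j1, j2] at e1
      rw [j1, j2]
      have hb := (h.b d hd).2 (by tauto)
      unfold bd at e1 ⊢
      beta_reduce
      have hm : X (face d) * X (face (α d)) = 0 := by
        revert e1
        generalize X (face d) = a; generalize X (face (α d)) = b
        revert a b; decide
      rw [hm]
      rcases hb with ⟨hb, -⟩ | ⟨-, hb⟩
      · rw [hb, hXg] at hm e1 ⊢
        simp at hm
        rw [hm]; simp
      · rw [hb, hXg] at hm e1 ⊢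
        simp at hm
        rw [hm]; simp
    · have j1 : ic α d1 d = 0 := by simp only [ic, i1, if_false]
      by_cases i2 : d = d2 ∨ d = α d2
      · have j2 : ic α d2 d = 1 := by simp [ic, i2]
        rw [hF, j1, j2] at e1
        rw [j1, j2]
        have hb := (h.b d hd).2 (by tauto)
        unfold bd at e1 ⊢
        beta_reduce
        have hm : X (face d) * X (face (α d)) = 0 := by
          revert e1
          generalize X (face d) = a; generalize X (face (α d)) = b
          revert a b; decide
        rw [hm]
        rcases hb with ⟨hb, -⟩ | ⟨-, hb⟩
        · rw [hb, hXg] at hm e1 ⊢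
          simp at hm
          rw [hm]; simp
        · rw [hb, hXg] at hm e1 ⊢
          simp at hm
          rw [hm]; simp
      · have j2 : ic α d2 d = 0 := by simp only [ic, i2, if_false]
        have e3 := eqX d hd (by rw [hF, j1, j2]; simp)
        rw [j1, j2]
        unfold bd at e2 ⊢
        beta_reduce
        rw [← e3, ← mul_add (X (face d)), ← e2, j2]
        generalize X (face d) = a; 
        rcases DS.z2 a with rfl | rfl
        · simp
        · simp; ring
  simp only [add_mul, sm_add] at hv2
  rw [hP.ic_sm_mul a1 (fun d => X (face d) * X (face (α d))), hP.ic_sm_mul a2 (fun d => X (face d) * X (face (α d))),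
    hP.ic_sm_mul a3 (fun d => X (face d) * X (face (α d))), hP.ic_sm_mul h.m3 (fun d => X (face d) * X (face (α d))),
    hP.ic_sm_mul h.m1 (fun _ => Y g), hP.ic_sm_mul h.m2 (fun _ => Y g), b1, b2, b3, b4, b5, b6, s1, s2, s3,
    r1.1, r1.2] at hv2
  simp [z2, w2, n24.symm, n23.symm, n12] at hv2
  revert hv2
  generalize Y g = a
  revert a; decide

end DS

namespace DS

variable {D V Φ : Type} [DecidableEq D] [DecidableEq V] [DecidableEq Φ]
variable {α : D → D} {A : Finset D} {src : D → V} {face : D → Φ} {p q : V}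

/-- minimal counterexample context -/
structure Cx (α : D → D) (A : Finset D) (src : D → V) (face : D → Φ) (p q : V) : Prop where
  P : PD α A src face
  G : Good α A src p q
  IH : ∀ (A' : Finset D) (src' : D → V) (face' : D → Φ) (p' q' : V), A'.card < A.card →
    PD α A' src' face' → Good α A' src' p' q' → Col α A' src' p' q'
  N : ¬ Col α A src p q

theorem Cx.swap (C : Cx α A src face p q) : Cx α A src face q p :=
  ⟨C.P, ⟨C.G.noloop, C.G.notri, fun d hd h1 h2 => C.G.npq (α d) (C.P.cl d hd) h2 (by rw [C.P.inv]; exact h1)⟩,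
    C.IH, fun ⟨κ, h1, h2⟩ => C.N ⟨κ, h1, h2.symm⟩⟩

theorem Cx.tri (C : Cx α A src face p q) {a b c : V} (h1 : ad α A src a b) (h2 : ad α A src b c)
    (h3 : ad α A src a c) : False := by
  obtain ⟨d, hd, rfl, rfl⟩ := h1
  obtain ⟨e, he, h4, rfl⟩ := h2
  obtain ⟨f, hf, h5, h6⟩ := C.P.adsymm h3
  exact C.G.notri d hd e he f hf h4.symm h5.symm h6

theorem Cx.irr (C : Cx α A src face p q) {a : V} (h1 : ad α A src a a) : False := by
  obtain ⟨d, hd, h2, h3⟩ := h1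
  exact C.G.noloop d hd (h2.trans h3.symm)

theorem Cx.npq (C : Cx α A src face p q) (h : ad α A src p q) : False := by
  obtain ⟨d, hd, h2, h3⟩ := h
  exact C.G.npq d hd h2 h3

theorem Cx.delCol (C : Cx α A src face p q) {d0 : D} (h : d0 ∈ A) : Col α (del α A d0) src p q := by
  have := card_del C.P.ne h (C.P.cl _ h)
  exact C.IH _ _ _ _ _ (by omega) (C.P.delete h) (C.G.mono del_sub)

theorem Cx.delMono (C : Cx α A src face p q) {d0 : D} (h : d0 ∈ A) {κ : V → Fin 3}
    (h1 : ∀ d ∈ del α A d0, κ (src d) ≠ κ (src (α d))) (h2 : κ p = κ q) : κ (src d0) = κ (src (α d0)) := by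
  by_contra h3
  refine C.N ⟨κ, fun d hd => ?_, h2⟩
  by_cases h4 : d = d0
  · rw [h4]; exact h3
  · by_cases h5 : d = α d0
    · rw [h5, C.P.inv]; exact fun h => h3 h.symm
    · exact h1 d (mem_del.2 ⟨h5, h4, hd⟩)

theorem Cx.nopar (C : Cx α A src face p q) {d e : D} (hd : d ∈ A) (he : e ∈ A) (h1 : src d = src e)
    (h2 : src (α d) = src (α e)) : d = e := by
  by_contra hne
  obtain ⟨κ, h3, h4⟩ := C.delCol hd
  have h5 := C.delMono hd h3 h4
  have hea : e ≠ α d := by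
    rintro rfl
    exact C.G.noloop d hd h1
  have := h3 e (mem_del.2 ⟨hea, fun h => hne h.symm, he⟩)
  rw [← h1, ← h2] at this
  exact this h5

theorem Cx.nocn (C : Cx α A src face p q) (hpq : p ≠ q) {x : V} (h1 : ad α A src p x)
    (h2 : ad α A src x q) : False := by
  obtain ⟨d, hd, rfl, rfl⟩ := h1
  obtain ⟨e, he, h4, rfl⟩ := h2
  obtain ⟨κ, h5, h6⟩ := C.delCol hd
  have h7 := C.delMono hd h5 h6
  have := h5 e (mem_del.2 ⟨?_, ?_, he⟩)
  · rw [h4, ← h7] at this; exact this h6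
  · rintro rfl; exact hpq (by rw [C.P.inv])
  · rintro rfl; exact C.G.noloop _ he h4

theorem Cx.nocn' (C : Cx α A src face p q) {x y : V} (h0 : ad α A src p y) (h0' : ad α A src y x)
  (h1 : ad α A src x q) : p ≠ q := by
  rintro rfl
  exact C.tri h0 h0' (C.P.adsymm h1)

def bet (α : D → D) (A : Finset D) (src : D → V) (a b : V) : Prop :=
  ∃ x y, ad α A src a x ∧ ad α A src x y ∧ ad α A src y b

theorem Cx.betsymm (C : Cx α A src face p q) {a b : V} (h : bet α A src a b) : bet α A src b a := by
  obtain ⟨x, y, h1, h2, h3⟩ := h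
  exact ⟨y, x, C.P.adsymm h3, C.P.adsymm h2, C.P.adsymm h1⟩

def alp (α : D → D) (A : Finset D) (src : D → V) (p q a b : V) : Prop :=
  (p = a ∧ ad α A src b q) ∨ (p = b ∧ ad α A src a q) ∨ (q = a ∧ ad α A src b p) ∨ (q = b ∧ ad α A src a p)

theorem Q4.r1 {g : Φ} {d1 d2 d3 d4 : D} (h : Q4 α A src face g d1 d2 d3 d4) : ad α A src (src d1) (src d2) :=
  ⟨d1, h.m1, rfl, h.t1⟩

theorem Cx.ident (C : Cx α A src face p q) {g : Φ} {d1 d2 d3 d4 : D} (h : Q4 α A src face g d1 d2 d3 d4) :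
    bet α A src (src d1) (src d3) ∨ alp α A src p q (src d1) (src d3) := by
  by_contra hcon
  push Not at hcon
  obtain ⟨hb, ha⟩ := hcon
  have hP := C.P.ident C.G h
  have hsub : ∀ d ∈ del α (del α A d2) d3, d ∈ A := fun d hd => del_sub (del_sub hd)
  set m : V → V := fun v => if v = src d3 then src d1 else v with hm
  have hmm : ∀ a b, m a = m b → a = b ∨ (a = src d1 ∧ b = src d3) ∨ (a = src d3 ∧ b = src d1) := by
    intro a b hab
    simp only [hm] at hab
    split_ifs at hab with h1 h2 h2
    · left; rw [h1, h2]
    · right; right; exact ⟨h1, hab.symm⟩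
    · right; left; exact ⟨hab, h2⟩
    · left; exact hab
  have n13 : ∀ d ∈ A, src d = src d1 → src (α d) = src d3 → False := fun d hd h1 h2 =>
    C.tri h.r1 h.rot.r1 ⟨d, hd, h1, h2⟩
  have n31 : ∀ d ∈ A, src d = src d3 → src (α d) = src d1 → False := fun d hd h1 h2 =>
    n13 (α d) (C.P.cl d hd) h2 (by rw [C.P.inv]; exact h1)
  have nl := C.G.noloop
  have hbs : ¬ bet α A src (src d3) (src d1) := fun h => hb (C.betsymm h)
  have hG : Good α (del α (del α A d2) d3) (fun d => m (src d)) (m p) (m q) := by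
    refine ⟨fun d hd he => ?_, fun d hd e he f hf h1 h2 h3 => ?_, fun d hd h1 h2 => ?_⟩
    · have hd := hsub d hd
      rcases hmm _ _ he with h1 | h1 | h1
      · exact nl d hd h1
      · exact n13 d hd h1.1 h1.2
      · exact n31 d hd h1.1 h1.2
    · have hd := hsub d hd
      have he := hsub e he
      have hf := hsub f hf
      have ld := nl d hd
      have le := nl e he
      have lf := nl f hf
      have xd := n13 d hd
      have yd := n31 d hd
      have xe := n13 e he
      have ye := n31 e he
      have xf := n13 f hf
      have yf := n31 f hf
      have t := C.G.notri d hd e he f hf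
      have hmk : ∀ d ∈ A, ad α A src (src d) (src (α d)) := fun d hd => ⟨d, hd, rfl, rfl⟩
      have kd := hmk d hd
      have ke := hmk e he
      have kf := hmk f hf
      have hb' : ∀ x y, ad α A src (src d1) x → ad α A src x y → ad α A src y (src d3) → False :=
        fun x y h1 h2 h3 => hb ⟨x, y, h1, h2, h3⟩
      have hb'' : ∀ x y, ad α A src (src d3) x → ad α A src x y → ad α A src y (src d1) → False :=
        fun x y h1 h2 h3 => hbs ⟨x, y, h1, h2, h3⟩
      have n := h.n13
      generalize src d1 = v1 at *
      generalize src d3 = v3 at *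
      generalize src d = a at *
      generalize src (α d) = a' at *
      generalize src e = b at *
      generalize src (α e) = b' at *
      generalize src f = c at *
      generalize src (α f) = c' at *
      rcases hmm _ _ h1 with h1 | h1 | h1 <;> rcases hmm _ _ h2 with h2 | h2 | h2 <;>
        rcases hmm _ _ h3 with h3 | h3 | h3 <;> clear hmm hm <;> grind
    · have hd := hsub d hd
      have ld := nl d hd
      have xd := n13 d hd
      have yd := n31 d hd
      have t := C.G.npq d hd
      have kd : ad α A src (src d) (src (α d)) := ⟨d, hd, rfl, rfl⟩
      have kd' := C.P.adsymm kd
      unfold alp at ha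
      rcases hmm _ _ h1 with h1 | h1 | h1 <;> rcases hmm _ _ h2 with h2 | h2 | h2 <;> clear hmm hm <;> grind
  have c1 := card_del C.P.ne h.m2 (C.P.cl _ h.m2)
  have c2 : (del α (del α A d2) d3).card ≤ (del α A d2).card := Finset.card_le_card del_sub
  obtain ⟨κ, k1, k2⟩ := C.IH _ _ _ _ _ (by omega) hP hG
  have n12 : src d1 ≠ src d2 := by rw [← h.t1]; exact nl _ h.m1
  have n23 : src d2 ≠ src d3 := by rw [← h.t2]; exact nl _ h.m2
  have n34 : src d3 ≠ src d4 := by rw [← h.t3]; exact nl _ h.m3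
  have n41 : src d4 ≠ src d1 := by rw [← h.t4]; exact nl _ h.m4
  have hin : ∀ d ∈ A, d ≠ d2 → d ≠ α d2 → d ≠ d3 → d ≠ α d3 → d ∈ del α (del α A d2) d3 := by
    intro d hd x1 x2 x3 x4
    exact mem_del.2 ⟨x4, x3, mem_del.2 ⟨x2, x1, hd⟩⟩
  have m1 : m (src d1) = src d1 := by simp [hm, h.n13]
  have m2 : m (src d2) = src d2 := by simp [hm, n23]
  have m3 : m (src d3) = src d1 := by simp [hm]
  have m4 : m (src d4) = src d4 := by simp [hm, n34.symm]
  have e1 := k1 d1 (hin d1 h.m1 (fun e => n12 (by rw [e])) (fun e => h.n13 (by rw [e, h.t2]))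
    (fun e => h.n13 (by rw [e])) (fun e => n41 (by rw [e, h.t3])))
  have e4 := k1 d4 (hin d4 h.m4 (fun e => h.n24 (by rw [e])) (fun e => n34 (by rw [e, h.t2]))
    (fun e => n34 (by rw [e])) (fun e => h.n13 (by rw [← h.t4, e, C.P.inv])))
  have e1 : κ (m (src d1)) ≠ κ (m (src (α d1))) := e1
  have e4 : κ (m (src d4)) ≠ κ (m (src (α d4))) := e4
  rw [h.t1, m1, m2] at e1
  rw [h.t4, m1, m4] at e4
  refine C.N ⟨fun v => κ (m v), fun d hd => ?_, k2⟩
  show κ (m (src d)) ≠ κ (m (src (α d)))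
  by_cases x1 : d = d2
  · rw [x1, h.t2, m2, m3]; exact e1.symm
  by_cases x2 : d = α d2
  · rw [x2, C.P.inv, h.t2, m2, m3]; exact e1
  by_cases x3 : d = d3
  · rw [x3, h.t3, m3, m4]; exact e4.symm
  by_cases x4 : d = α d3
  · rw [x4, C.P.inv, h.t3, m3, m4]; exact e4
  exact k1 d (hin d hd x1 x2 x3 x4)

theorem Cx.cross (C : Cx α A src face p q) {g : Φ} {d1 d2 d3 d4 : D} (h : Q4 α A src face g d1 d2 d3 d4)
    {z w : V} (h1 : ad α A src (src d2) z) (h2 : ad α A src z w) (h3 : ad α A src w (src d4))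
    (hTJ : TJ α A src {src d2, z, w, src d4} (src d1) (src d3)) : False := by
  obtain ⟨q1, a1, b1, b2⟩ := id h1
  obtain ⟨q2, a2, b3, b4⟩ := id h2
  obtain ⟨q3, a3, b5, b6⟩ := id h3
  have T := @Cx.tri _ _ _ _ _ _ α A src face p q C
  have S := @PD.adsymm _ _ _ _ _ _ α A src face C.P
  have r1 := h.r1
  have r2 := h.rot.r1
  have r3 := h.rot.rot.r1
  have r4 := h.rot.rot.rot.r1
  refine crossing C.P h C.G.noloop a1 a2 a3 b1 b2 b3 b4 b5 b6 ?_ ?_ ?_ ?_ ?_ ?_ hTJ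
  · rintro rfl; exact T h2 h3 (S r4)
  · rintro rfl; exact T h2 h3 r3
  · rintro rfl; exact T r1 h1 (S r4)
  · rintro rfl; exact T h1 h2 (S r1)
  · rintro rfl; exact T r1 h3 (S r4)
  · rintro rfl; exact T h1 h2 r2

theorem Cx.nbb (C : Cx α A src face p q) {g : Φ} {d1 d2 d3 d4 : D} (h : Q4 α A src face g d1 d2 d3 d4)
    (h1 : bet α A src (src d1) (src d3)) (h2 : bet α A src (src d2) (src d4)) : False := by
  obtain ⟨x, y, x1, x2, x3⟩ := h1
  obtain ⟨z, w, z1, z2, z3⟩ := h2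
  have T := @Cx.tri _ _ _ _ _ _ α A src face p q C
  have S := @PD.adsymm _ _ _ _ _ _ α A src face C.P
  have I := @Cx.irr _ _ _ _ _ _ α A src face p q C
  have r1 := h.r1
  have r2 := h.rot.r1
  have r3 := h.rot.rot.r1
  have r4 := h.rot.rot.rot.r1
  refine C.cross h z1 z2 z3 ((TJ.edge C.P x1 ?_ ?_).trans ((TJ.edge C.P x2 ?_ ?_).trans (TJ.edge C.P x3 ?_ ?_)))
  all_goals
    generalize src d1 = v1 at *
    generalize src d2 = v2 at *
    generalize src d3 = v3 at *
    generalize src d4 = v4 at *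
    simp only [Set.mem_insert_iff, Set.mem_singleton_iff, not_or]
    refine ⟨?_, ?_, ?_, ?_⟩ <;> rintro rfl <;> grind

end DS

namespace DS

variable {D V Φ : Type} [DecidableEq D] [DecidableEq V] [DecidableEq Φ]
variable {α : D → D} {A : Finset D} {src : D → V} {face : D → Φ} {p q : V}

/-- a 4-face at `p` -/
structure FP (α : D → D) (A : Finset D) (src : D → V) (face : D → Φ) (p q : V) (g : Φ) (d1 d2 d3 d4 : D)
    (z w : V) : Prop where
  Q : Q4 α A src face g d1 d2 d3 d4
  e1 : src d1 = p
  e3 : ad α A src (src d3) q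
  z1 : ad α A src (src d2) z
  z2 : ad α A src z w
  z3 : ad α A src w (src d4)

theorem FP.rev (hP : PD α A src face) {g : Φ} {d1 d2 d3 d4 : D} {z w : V}
    (h : FP α A src face p q g d1 d2 d3 d4 z w) :
    FP α A src face p q g (α d4) (α d3) (α d2) (α d1) w z := by
  refine ⟨h.Q.rev hP, ?_, ?_, ?_, hP.adsymm h.z2, ?_⟩
  · rw [h.Q.t4, h.e1]
  · rw [h.Q.t2]; exact h.e3
  · rw [h.Q.t3]; exact hP.adsymm h.z3
  · rw [h.Q.t1]; exact hP.adsymm h.z1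

theorem Cx.exFP (C : Cx α A src face p q) {g : Φ} {d1 d2 d3 d4 : D} (h : Q4 α A src face g d1 d2 d3 d4) :
    ∃ e1 e2 e3 e4 z w, FP α A src face p q g e1 e2 e3 e4 z w ∨ FP α A src face q p g e1 e2 e3 e4 z w := by
  have aux : ∀ {d1 d2 d3 d4 : D} (h : Q4 α A src face g d1 d2 d3 d4),
      alp α A src p q (src d1) (src d3) → bet α A src (src d2) (src d4) →
      ∃ e1 e2 e3 e4 z w, FP α A src face p q g e1 e2 e3 e4 z w ∨ FP α A src face q p g e1 e2 e3 e4 z w := by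
    intro d1 d2 d3 d4 h ha hb
    obtain ⟨z, w, z1, z2, z3⟩ := hb
    rcases ha with ⟨a, b⟩ | ⟨a, b⟩ | ⟨a, b⟩ | ⟨a, b⟩
    · exact ⟨d1, d2, d3, d4, z, w, Or.inl ⟨h, a.symm, b, z1, z2, z3⟩⟩
    · exact ⟨d3, d4, d1, d2, w, z, Or.inl ⟨h.rot.rot, a.symm, b, C.P.adsymm z3, C.P.adsymm z2, C.P.adsymm z1⟩⟩
    · exact ⟨d1, d2, d3, d4, z, w, Or.inr ⟨h, a.symm, b, z1, z2, z3⟩⟩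
    · exact ⟨d3, d4, d1, d2, w, z, Or.inr ⟨h.rot.rot, a.symm, b, C.P.adsymm z3, C.P.adsymm z2, C.P.adsymm z1⟩⟩
  have i1 := C.ident h
  have i2 := C.ident h.rot
  rcases i1 with i1 | i1
  · rcases i2 with i2 | i2
    · exact (C.nbb h i1 i2).elim
    · exact aux h.rot i2 (C.betsymm i1)
  · rcases i2 with i2 | i2
    · exact aux h i1 i2
    · exfalso
      have N := C.npq
      have S := @PD.adsymm _ _ _ _ _ _ α A src face C.P
      have I := @Cx.irr _ _ _ _ _ _ α A src face p q C
      have r1 := h.r1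
      have r2 := h.rot.r1
      have r3 := h.rot.rot.r1
      have r4 := h.rot.rot.rot.r1
      unfold alp at i1 i2
      generalize src d1 = v1 at *
      generalize src d2 = v2 at *
      generalize src d3 = v3 at *
      generalize src d4 = v4 at *
      rcases i1 with ⟨a, b⟩ | ⟨a, b⟩ | ⟨a, b⟩ | ⟨a, b⟩ <;> rcases i2 with ⟨a', b'⟩ | ⟨a', b'⟩ | ⟨a', b'⟩ | ⟨a', b'⟩ <;>
        grind

theorem q4prop {a b c c' d d' e e' f f' g g' : Prop} (ha : ¬ a) (hb : ¬ b)
    (h1 : ¬ ((c ∨ c') ∧ (f ∨ f'))) (h2 : ¬ ((c ∨ c') ∧ (g ∨ g'))) (h3 : ¬ ((c ∨ c') ∧ (e ∨ e')))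
    (h4 : ¬ ((d ∨ d') ∧ (f ∨ f'))) (h5 : ¬ ((d ∨ d') ∧ (g ∨ g'))) (h6 : ¬ ((d ∨ d') ∧ (e ∨ e')))
    (h7 : ¬ ((f ∨ f') ∧ (e ∨ e'))) (h8 : ¬ ((g ∨ g') ∧ (e ∨ e'))) :
    ((a ∨ b ∨ c ∨ c' ∨ d ∨ d' ∨ e ∨ e') ∧ ¬ (a ∨ b ∨ f ∨ f' ∨ g ∨ g' ∨ e ∨ e') ∨
     ¬ (a ∨ b ∨ c ∨ c' ∨ d ∨ d' ∨ e ∨ e') ∧ (a ∨ b ∨ f ∨ f' ∨ g ∨ g' ∨ e ∨ e')) ↔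
     (c' ∨ c ∨ f ∨ f' ∨ g ∨ g' ∨ d' ∨ d) := by
  grind

set_option maxHeartbeats 1000000 in
theorem Cx.caseB (C : Cx α A src face p q) {g g' : Φ} (hg : g ≠ g') {d1 d2 d3 d4 e1 e2 e3 e4 : D} {z w z' w' : V}
    (h : FP α A src face p q g d1 d2 d3 d4 z w) (h' : FP α A src face p q g' e1 e2 e3 e4 z' w')
    (h2 : src d2 = src e2) (h4 : src d4 = src e4) : False := by
  have inv := C.P.inv
  have q1 : d1 = e1 := C.nopar h.Q.m1 h'.Q.m1 (by rw [h.e1, h'.e1]) (by rw [h.Q.t1, h'.Q.t1, h2])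
  have q4 : d4 = e4 := C.nopar h.Q.m4 h'.Q.m4 h4 (by rw [h.Q.t4, h'.Q.t4, h.e1, h'.e1])
  subst q1 q4
  have T := @Cx.tri _ _ _ _ _ _ α A src face p q C
  have S := @PD.adsymm _ _ _ _ _ _ α A src face C.P
  have I := @Cx.irr _ _ _ _ _ _ α A src face p q C
  have r1 := h.Q.r1
  have r2 := h.Q.rot.r1
  have r3 := h.Q.rot.rot.r1
  have r4 := h.Q.rot.rot.rot.r1
  have hpq : p ≠ q := by
    have := h.e1
    exact C.nocn' (this ▸ r1) r2 h.e3
  have CN := @Cx.nocn _ _ _ _ _ _ α A src face p q C hpq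
  have s1 := h'.Q.r1
  have s2 := h'.Q.rot.r1
  have s3 := h'.Q.rot.rot.r1
  have s4 := h'.Q.rot.rot.rot.r1
  have t1 := h.Q.t1
  have t2 := h.Q.t2
  have t3 := h.Q.t3
  have t4 := h.Q.t4
  have t1' := h'.Q.t1
  have t2' := h'.Q.t2
  have t3' := h'.Q.t3
  have t4' := h'.Q.t4
  have n13 := h.Q.n13
  have n24 := h.Q.n24
  have n13' := h'.Q.n13
  obtain ⟨x1, a1, b1, b2⟩ := id h.z1
  obtain ⟨x2, a2, b3, b4⟩ := id h.z2
  obtain ⟨x3, a3, b5, b6⟩ := id h.z3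
  have zz1 := h.z1
  have zz2 := h.z2
  have zz3 := h.z3
  have he1 := h.e1
  have z1 : z ≠ src d1 := by rintro rfl; exact T zz2 zz3 (S r4)
  have z3 : z ≠ src d3 := by rintro rfl; exact T zz2 zz3 r3
  have z4 : z ≠ src d4 := by rintro rfl; exact T r1 zz1 (S r4)
  have w1 : w ≠ src d1 := by rintro rfl; exact T zz1 zz2 (S r1)
  have w2 : w ≠ src d2 := by rintro rfl; exact T r1 zz3 (S r4)
  have w3 : w ≠ src d3 := by rintro rfl; exact T zz1 zz2 r2
  have z2 : z ≠ src d2 := by rintro rfl; exact I zz1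
  have w4 : w ≠ src d4 := by rintro rfl; exact I zz3
  have n12 : src d1 ≠ src d2 := by intro e; rw [e] at r1; exact I r1
  have n23 : src d2 ≠ src d3 := by intro e; rw [e] at r2; exact I r2
  have n34 : src d3 ≠ src d4 := by intro e; rw [e] at r3; exact I r3
  have n41 : src d4 ≠ src d1 := by intro e; rw [e] at r4; exact I r4
  have fd1 := (h.Q.b d1 h.Q.m1).2 (by simp)
  have fd1' := (h'.Q.b d1 h.Q.m1).2 (by simp)
  have fd : (face d1 = g ∧ face (α d1) = g') ∨ (face d1 = g' ∧ face (α d1) = g) := by grind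
  by_cases h3 : src d3 = src e3
  · have q2 : d2 = e2 := C.nopar h.Q.m2 h'.Q.m2 h2 (by rw [h.Q.t2, h'.Q.t2, h3])
    subst q2
    have fd2 := (h.Q.b d2 h.Q.m2).2 (by simp)
    have fd2' := (h'.Q.b d2 h.Q.m2).2 (by simp)
    have fe : (face d2 = g ∧ face (α d2) = g') ∨ (face d2 = g' ∧ face (α d2) = g) := by grind
    obtain ⟨Y, hY⟩ := C.P.full (fun d => (ic α x1 d + ic α x2 d) + (ic α x3 d + (ic α d3 d + ic α d2 d)))
      (fun d => by simp only [C.P.ic_symm]) (fun d hd => by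
        simp only [ic_off C.P a1 hd, ic_off C.P a2 hd, ic_off C.P a3 hd, ic_off C.P h.Q.m2 hd, ic_off C.P h.Q.m3 hd, add_zero])
      (fun v => by
        rw [sm_add, sm_add, sm_add, sm_add, C.P.ic_sm a1, C.P.ic_sm a2, C.P.ic_sm a3, C.P.ic_sm h.Q.m3, C.P.ic_sm h.Q.m2,
          b1, b2, b3, b4, b5, b6, t2, t3]
        generalize (if v = z then (1 : ZMod 2) else 0) = x
        generalize (if v = w then (1 : ZMod 2) else 0) = y
        generalize (if v = src d3 then (1 : ZMod 2) else 0) = z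
        generalize (if v = src d2 then (1 : ZMod 2) else 0) = t
        generalize (if v = src d4 then (1 : ZMod 2) else 0) = u
        revert x y z t u; decide)
    have y1 := hY d1 h.Q.m1
    have y2 := hY d2 h.Q.m2
    have k1 : bd α face Y d1 = bd α face Y d2 := by
      unfold bd
      rcases fd with ⟨f1, f2⟩ | ⟨f1, f2⟩ <;> rcases fe with ⟨f3, f4⟩ | ⟨f3, f4⟩ <;> rw [f1, f2, f3, f4] <;> ring
    rw [← k1, ← y1] at y2
    have ics : ∀ e d : D, ¬ (src e = src d ∧ src (α e) = src (α d)) → ¬ (src (α e) = src d ∧ src e = src (α d)) →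
        ic α e d = 0 := by
      intro e d i1 i2
      unfold ic; rw [if_neg]; rintro (rfl | rfl)
      · exact i1 ⟨rfl, rfl⟩
      · exact i2 ⟨rfl, by rw [inv]⟩
    have ic1 : ic α d2 d2 = 1 := by simp [ic]
    rw [ics x1 d1, ics x2 d1, ics x3 d1, ics d3 d1, ics d2 d1, ics x1 d2, ics x2 d2, ics x3 d2, ics d3 d2, ic1] at y2
    · exact absurd y2 (by decide)
    all_goals
      simp only [b1, b2, b3, b4, b5, b6, t1, t2, t3]
      grind
  · -- delete the edge p v2
    have hP := C.P.delete h.Q.m1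
    have mA : ∀ d ∈ A, src d ≠ src d1 → src (α d) ≠ src d1 → d ∈ del α A d1 := by
      intro d hd i1 i2
      refine mem_del.2 ⟨?_, ?_, hd⟩
      · rintro rfl; exact i2 (by rw [inv])
      · rintro rfl; exact i1 rfl
    have hQ : Q4 α (del α A d1) src (fun d => if face d = face (α d1) then face d1 else face d) (face d1)
        (α d2) e2 e3 (α d3) := by
      refine ⟨?_, ?_, ?_, ?_, ?_, ?_, ?_, ?_, ?_, ?_, ?_⟩
      · apply mA _ (C.P.cl _ h.Q.m2)
        · rw [t2]; exact n13.symm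
        · rw [inv]; exact n12.symm
      · apply mA _ h'.Q.m2
        · rw [← h2]; exact n12.symm
        · rw [t2']; exact n13'.symm
      · apply mA _ h'.Q.m3
        · exact n13'.symm
        · rw [t3']; exact n41
      · apply mA _ (C.P.cl _ h.Q.m3)
        · rw [t3]; exact n41
        · rw [inv]; exact n13.symm
      · rw [inv, h2]
      · rw [t2']
      · rw [t3', t3]
      · rw [inv, t2]
      · rw [t2]; exact h3
      · rw [t3, ← h2]; exact n24
      · intro d hd
        have hdA := del_sub hd
        obtain ⟨k1, k2, -⟩ := mem_del.1 hd
        have c1 := h.Q.b d hdA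
        have c2 := h'.Q.b d hdA
        have fx : ∀ d, (if face d = face (α d1) then face d1 else face d) = face d1 ↔ (face d = g ∨ face d = g') := by
          intro d
          rcases fd with ⟨f1, f2⟩ | ⟨f1, f2⟩ <;> rw [f1, f2] <;> split_ifs with hh <;> grind
        simp only [Ne, fx, inv]
        have key : ((face d = g ∨ face d = g') ∧ ¬(face (α d) = g ∨ face (α d) = g') ∨
          ¬(face d = g ∨ face d = g') ∧ (face (α d) = g ∨ face (α d) = g')) ↔
          (((face d = g ∧ face (α d) ≠ g) ∨ (face d ≠ g ∧ face (α d) = g)) ∧ ¬ ((face d = g' ∧ face (α d) ≠ g') ∨ (face d ≠ g' ∧ face (α d) = g'))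
          ∨ ¬ ((face d = g ∧ face (α d) ≠ g) ∨ (face d ≠ g ∧ face (α d) = g)) ∧ ((face d = g' ∧ face (α d) ≠ g') ∨ (face d ≠ g' ∧ face (α d) = g'))) := by
          clear c1 c2 fx fd fd1 fd1'
          generalize face d = a at *
          generalize face (α d) = b at *
          grind
        rw [key, c1, c2]
        have aa : ∀ {a b : D}, a = α b → b = α a := fun {a b} e => by rw [e, inv]
        have y22 : d2 ≠ e2 := fun e => h3 (by rw [← t2, e, t2'])
        have y22' : d2 ≠ α e2 := fun e => n23 (h2.trans (by rw [← t2, e, inv]))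
        have y23 : d2 ≠ e3 := fun e => n34 (by rw [← t2, e, t3'])
        have y23' : d2 ≠ α e3 := fun e => h3 (by rw [← t2, e, inv])
        have y32 : d3 ≠ e2 := fun e => n23 (by rw [e, h2])
        have y32' : d3 ≠ α e2 := fun e => h3 (by rw [e, t2'])
        have y33 : d3 ≠ e3 := fun e => h3 (by rw [e])
        have y33' : d3 ≠ α e3 := fun e => n34 (by rw [e, t3'])
        have y24 : d2 ≠ d4 := fun e => n24 (by rw [e])
        have y24' : d2 ≠ α d4 := fun e => n12 (by rw [e, t4])
        have y34 : d3 ≠ d4 := fun e => n34 (by rw [e])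
        have y34' : d3 ≠ α d4 := fun e => n13 (by rw [e, t4])
        have u24 : e2 ≠ d4 := fun e => n24 (by rw [h2, e])
        have u24' : e2 ≠ α d4 := fun e => n12 (by rw [h2, e, t4])
        have u34 : e3 ≠ d4 := fun e => n41 (by rw [← t3', e, t4])
        have u34' : e3 ≠ α d4 := fun e => n13' (by rw [e, t4])
        have ai : ∀ {a b : D}, α a = α b → a = b := fun {a b} e => by rw [← inv a, e, inv]
        have pn : ∀ a b : D, a ≠ b → a ≠ α b → ¬ ((d = a ∨ d = α a) ∧ (d = b ∨ d = α b)) := by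
          rintro a b n1 n2 ⟨i1 | i1, i2 | i2⟩
          · exact n1 (i1.symm.trans i2)
          · exact n2 (i1.symm.trans i2)
          · exact n2 (aa (i2.symm.trans i1))
          · exact n1 (ai (i1.symm.trans i2))
        exact q4prop k2 k1 (pn _ _ y22 y22') (pn _ _ y23 y23') (pn _ _ y24 y24') (pn _ _ y32 y32') (pn _ _ y33 y33')
          (pn _ _ y34 y34') (pn _ _ u24 u24') (pn _ _ u34 u34')
    have hF : ∀ x, x ≠ src d2 → x ≠ z → x ≠ w → x ≠ src d4 → x ∉ ({src e2, z, w, src (α d3)} : Set V) := by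
      intro x i1 i2 i3 i4
      rw [t3, ← h2]
      simp [i1, i2, i3, i4]
    have he3 := h.e3
    have he3' := h'.e3
    have qz : q ≠ z := by rintro rfl; exact CN (he1 ▸ r1) zz1
    have qw : q ≠ w := by rintro rfl; exact CN (he1 ▸ S r4) (S zz3)
    have q2 : q ≠ src d2 := by rintro rfl; exact C.npq (he1 ▸ r1)
    have q4 : q ≠ src d4 := by rintro rfl; exact C.npq (he1 ▸ S r4)
    have hqd : q ≠ src d1 := by rw [he1]; exact hpq.symm
    have adel : ∀ {a b : V}, a ≠ src d1 → b ≠ src d1 → ad α A src a b → ad α (del α A d1) src a b := by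
      rintro a b i1 i2 ⟨d, hd, rfl, rfl⟩
      exact ⟨d, mA d hd i1 i2, rfl, rfl⟩
    rw [← h2] at s2
    have w2e : src e3 ≠ src d2 := by intro e; rw [e] at s2; exact I s2
    have w4e : src e3 ≠ src d4 := by intro e; rw [e] at s3; exact I s3
    have wz : src e3 ≠ z := by intro e; rw [e] at s3; exact T zz2 zz3 s3
    have ww : src e3 ≠ w := by intro e; rw [e] at s2; exact T zz1 zz2 s2
    have hTJ : TJ α (del α A d1) src {src e2, z, w, src (α d3)} (src (α d2)) (src e3) := by
      rw [t2]
      refine (TJ.edge (b := q) hP (adel n13.symm hqd he3) ?_ ?_).trans (TJ.edge hP (adel hqd n13'.symm (S he3')) ?_ ?_)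
      · exact hF _ n23.symm z3.symm w3.symm n34
      · exact hF _ q2 qz qw q4
      · exact hF _ q2 qz qw q4
      · exact hF _ w2e wz ww w4e
    refine crossing hP hQ (fun d hd => C.G.noloop d (del_sub hd)) (mA _ a1 ?_ ?_) (mA _ a2 ?_ ?_) (mA _ a3 ?_ ?_)
      (by rw [b1, h2]) b2 b3 b4 b5 (by rw [b6, t3]) ?_ ?_ ?_ ?_ ?_ ?_ hTJ
    · rw [b1]; exact n12.symm
    · rw [b2]; exact z1
    · rw [b3]; exact z1
    · rw [b4]; exact w1
    · rw [b5]; exact w1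
    · rw [b6]; exact n41
    · rw [t2]; exact z3
    · exact wz.symm
    · rw [t3]; exact z4
    · rw [t2]; exact w3
    · rw [← h2]; exact w2
    · exact ww.symm

end DS

namespace DS

variable {D V Φ : Type} [DecidableEq D] [DecidableEq V] [DecidableEq Φ]
variable {α : D → D} {A : Finset D} {src : D → V} {face : D → Φ} {p q : V}

theorem FP.facts (C : Cx α A src face p q) {g : Φ} {d1 d2 d3 d4 : D} {z w : V}
    (h : FP α A src face p q g d1 d2 d3 d4 z w) : ad α A src p (src d2) ∧ ad α A src (src d2) (src d3) ∧
    ad α A src (src d3) (src d4) ∧ ad α A src (src d4) p ∧ p ≠ q ∧ src d2 ≠ src d4 := by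
  have r1 := h.Q.r1
  have r2 := h.Q.rot.r1
  have r3 := h.Q.rot.rot.r1
  have r4 := h.Q.rot.rot.rot.r1
  rw [h.e1] at r1 r4
  exact ⟨r1, r2, r3, r4, C.nocn' r1 r2 h.e3, h.Q.n24⟩

theorem Cx.half (C : Cx α A src face p q) {g g' : Φ} {d1 d2 d3 d4 e1 e2 e3 e4 : D} {z w z' w' : V}
    (h : FP α A src face p q g d1 d2 d3 d4 z w) (h' : FP α A src face p q g' e1 e2 e3 e4 z' w') :
    (src e2 = src d2 ∨ src e2 = src d4) ∨ (src e3 = z ∨ src e3 = w) := by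
  by_contra hcon
  push Not at hcon
  obtain ⟨r1, r2, r3, r4, hpq, n24⟩ := h.facts C
  obtain ⟨s1, s2, s3, s4, -, n24'⟩ := h'.facts C
  have T := @Cx.tri _ _ _ _ _ _ α A src face p q C
  have S := @PD.adsymm _ _ _ _ _ _ α A src face C.P
  have I := @Cx.irr _ _ _ _ _ _ α A src face p q C
  have CN := @Cx.nocn _ _ _ _ _ _ α A src face p q C hpq
  have N := C.npq
  have z1 := h.z1
  have z2 := h.z2
  have z3 := h.z3
  have k3 := h.e3
  have e3' := h'.e3
  refine C.cross h.Q h.z1 h.z2 h.z3 ?_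
  rw [h.e1]
  refine (TJ.edge C.P s1 ?_ ?_).trans ((TJ.edge C.P s2 ?_ ?_).trans ((TJ.edge C.P e3' ?_ ?_).trans (TJ.edge C.P (S k3) ?_ ?_)))
  all_goals
    clear h h'
    generalize src d2 = v2 at *
    generalize src d3 = v3 at *
    generalize src d4 = v4 at *
    simp only [Set.mem_insert_iff, Set.mem_singleton_iff, not_or]
    refine ⟨?_, ?_, ?_, ?_⟩ <;> intro hh <;> subst hh <;> grind

theorem Cx.caseA (C : Cx α A src face p q) {g g' : Φ} {d1 d2 d3 d4 e1 e2 e3 e4 : D} {z w z' w' : V}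
    (h : FP α A src face p q g d1 d2 d3 d4 z w) (h' : FP α A src face p q g' e1 e2 e3 e4 z' w')
    (h1 : src e3 = z) (h2 : src d3 = z') : False := by
  obtain ⟨r1, r2, r3, r4, hpq, n24⟩ := h.facts C
  obtain ⟨s1, s2, s3, s4, -, n24'⟩ := h'.facts C
  have T := @Cx.tri _ _ _ _ _ _ α A src face p q C
  have S := @PD.adsymm _ _ _ _ _ _ α A src face C.P
  have I := @Cx.irr _ _ _ _ _ _ α A src face p q C
  have CN := @Cx.nocn _ _ _ _ _ _ α A src face p q C hpq
  have N := C.npq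
  have z1 := h.z1
  have z2 := h.z2
  have z3 := h.z3
  have k3 := h.e3
  have z1' := h'.z1
  have z2' := h'.z2
  have z3' := h'.z3
  have e3' := h'.e3
  have cr := C.cross h.Q h.z1 h.z2 h.z3
  rw [h.e1] at cr
  rw [← h2] at z1' z2'
  rw [← h1] at z1 z2 cr
  by_cases hu : src e2 = src d2 ∨ src e2 = src d4
  · rcases hu with hu | hu
    · refine cr ((TJ.edge C.P (S s4) ?_ ?_).trans ((TJ.edge C.P (S z3') ?_ ?_).trans (TJ.edge C.P (S z2') ?_ ?_)))
      all_goals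
        clear h h' cr
        generalize src d2 = v2 at *
        generalize src d3 = v3 at *
        generalize src d4 = v4 at *
        generalize src e4 = u4 at *
        generalize src e3 = u3 at *
        simp only [Set.mem_insert_iff, Set.mem_singleton_iff, not_or]
        refine ⟨?_, ?_, ?_, ?_⟩ <;> intro hh <;> subst hh <;> grind
    · rw [hu] at s2
      exact T z2 z3 (S s2)
  · push Not at hu
    refine cr ((TJ.edge C.P s1 ?_ ?_).trans ((TJ.edge C.P z1' ?_ ?_)))
    all_goals
      clear h h' cr
      generalize src d2 = v2 at *
      generalize src d3 = v3 at *
      generalize src d4 = v4 at *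
      generalize src e2 = u2 at *
      generalize src e3 = u3 at *
      simp only [Set.mem_insert_iff, Set.mem_singleton_iff, not_or]
      refine ⟨?_, ?_, ?_, ?_⟩ <;> intro hh <;> subst hh <;> grind

theorem Cx.uniq (C : Cx α A src face p q) {g g' : Φ} (hg : g ≠ g') {d1 d2 d3 d4 e1 e2 e3 e4 : D} {z w z' w' : V}
    (h : FP α A src face p q g d1 d2 d3 d4 z w) (h' : FP α A src face p q g' e1 e2 e3 e4 z' w') : False := by
  have t2 := h.Q.t2
  have t3 := h.Q.t3
  have t1 := h.Q.t1
  have t2' := h'.Q.t2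
  have t3' := h'.Q.t3
  have t1' := h'.Q.t1
  have n := h.Q.n24
  have n' := h'.Q.n24
  have B1 : ¬ (src e2 = src d2 ∧ src e4 = src d4) := fun e => C.caseB hg h h' e.1.symm e.2.symm
  have B2 : ¬ (src e2 = src d4 ∧ src e4 = src d2) := fun e =>
    C.caseB hg h (h'.rev C.P) (by rw [t3']; exact e.2.symm) (by rw [t1']; exact e.1.symm)
  have H1 := C.half h h'
  have H2 := C.half h (h'.rev C.P)
  have H3 := C.half h' h
  have H4 := C.half h' (h.rev C.P)
  rw [t3', t2'] at H2
  rw [t3, t2] at H4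
  have a1 : src e3 = z ∨ src e3 = w := by grind
  have a2 : src d3 = z' ∨ src d3 = w' := by grind
  rcases a1 with a1 | a1 <;> rcases a2 with a2 | a2
  · exact C.caseA h h' a1 a2
  · exact C.caseA h (h'.rev C.P) (by rw [t2', a1]) a2
  · exact C.caseA (h.rev C.P) h' a1 (by rw [t2, a2])
  · exact C.caseA (h.rev C.P) (h'.rev C.P) (by rw [t2', a1]) (by rw [t2, a2])

end DS

namespace DS

variable {D V Φ : Type} [DecidableEq D] [DecidableEq V] [DecidableEq Φ]
variable {α : D → D} {A : Finset D} {src : D → V} {face : D → Φ} {p q : V}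

def Bg (α : D → D) (A : Finset D) (face : D → Φ) (g : Φ) : Finset D :=
  A.filter (fun d => (face d = g ∧ face (α d) ≠ g) ∨ (face d ≠ g ∧ face (α d) = g))

theorem mem_Bg {g : Φ} {d : D} : d ∈ Bg α A face g ↔
    d ∈ A ∧ ((face d = g ∧ face (α d) ≠ g) ∨ (face d ≠ g ∧ face (α d) = g)) := by simp [Bg]

theorem Bg_cl (hP : PD α A src face) {g : Φ} {d : D} (h : d ∈ Bg α A face g) : α d ∈ Bg α A face g := by
  rw [mem_Bg] at h ⊢
  refine ⟨hP.cl _ h.1, ?_⟩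
  rw [hP.inv]; tauto

theorem Bg_step (hP : PD α A src face) {g : Φ} {d : D} (h : d ∈ Bg α A face g) :
    ∃ e ∈ Bg α A face g, src e = src (α d) ∧ e ≠ α d := by
  by_contra hcon
  push Not at hcon
  have h1 := hP.even (fun f => if f = g then 1 else 0) (src (α d))
  have h2 : sm A src (bd α face (fun f => if f = g then 1 else 0)) (src (α d)) = 1 := by
    unfold sm
    rw [Finset.sum_eq_single (α d)]
    · have := (mem_Bg.1 (Bg_cl hP h)).2
      rw [hP.inv] at this
      simp only [if_true, bd, hP.inv]
      rcases this with ⟨a, b⟩ | ⟨a, b⟩ <;> simp [a, b]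
    · intro e he hne
      split_ifs with hs
      · have : e ∉ Bg α A face g := fun hh => hne (hcon e hh hs)
        have : ¬ ((face e = g ∧ face (α e) ≠ g) ∨ (face e ≠ g ∧ face (α e) = g)) := fun hh => this (mem_Bg.2 ⟨he, hh⟩)
        unfold bd
        by_cases a : face e = g <;> by_cases b : face (α e) = g <;> simp [a, b] at this ⊢
        decide
      · rfl
    · intro hh; exact absurd (mem_Bg.1 (Bg_cl hP h)).1 hh
  rw [h1] at h2
  exact absurd h2 (by decide)

theorem card_pairs (C : Cx α A src face p q) {g : Φ} (S : Finset (V × V))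
    (hS : ∀ s ∈ S, ∃ d ∈ Bg α A face g, src d = s.1 ∧ src (α d) = s.2) : S.card ≤ (Bg α A face g).card := by
  calc S.card ≤ ((Bg α A face g).image (fun d => (src d, src (α d)))).card := by
        refine Finset.card_le_card fun s hs => ?_
        obtain ⟨d, hd, h1, h2⟩ := hS s hs
        exact Finset.mem_image.2 ⟨d, hd, by rw [h1, h2]⟩
    _ ≤ _ := Finset.card_image_le

theorem card8 {v1 v2 v3 v4 : V} (n12 : v1 ≠ v2) (n23 : v2 ≠ v3) (n34 : v3 ≠ v4) (n14 : v4 ≠ v1) (p2 : v3 ≠ v1)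
    (p3 : v4 ≠ v2) : ({(v1, v2), (v2, v1), (v2, v3), (v3, v2), (v3, v4), (v4, v3), (v4, v1), (v1, v4)} : Finset (V × V)).card = 8 := by
  have := n12.symm; have := n23.symm; have := n34.symm; have := n14.symm; have := p2.symm; have := p3.symm
  rw [Finset.card_insert_of_notMem, Finset.card_insert_of_notMem, Finset.card_insert_of_notMem, Finset.card_insert_of_notMem,
    Finset.card_insert_of_notMem, Finset.card_insert_of_notMem, Finset.card_insert_of_notMem, Finset.card_singleton] <;>
    simp [*]

theorem card10 {v1 v2 v3 v4 v5 v6 : V} (n12 : v1 ≠ v2) (n23 : v2 ≠ v3) (n34 : v3 ≠ v4) (n14 : v4 ≠ v1) (p2 : v3 ≠ v1)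
    (p3 : v4 ≠ v2) (n45 : v4 ≠ v5) (n25 : v5 ≠ v2) (p5 : v6 ≠ v4) (p4 : v5 ≠ v3) (n56 : v6 ≠ v5) (h51 : v5 ≠ v1) :
    ({(v1, v2), (v2, v1), (v2, v3), (v3, v2), (v3, v4), (v4, v3), (v4, v5), (v5, v4), (v5, v6), (v6, v5)} : Finset (V × V)).card = 10 := by
  have := n12.symm; have := n23.symm; have := n34.symm; have := n14.symm; have := p2.symm; have := p3.symm
  have := n45.symm; have := n25.symm; have := p5.symm; have := p4.symm; have := n56.symm; have := h51.symm
  rw [Finset.card_insert_of_notMem, Finset.card_insert_of_notMem, Finset.card_insert_of_notMem, Finset.card_insert_of_notMem,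
    Finset.card_insert_of_notMem, Finset.card_insert_of_notMem, Finset.card_insert_of_notMem, Finset.card_insert_of_notMem,
    Finset.card_insert_of_notMem, Finset.card_singleton] <;>
    simp [*]

theorem Cx.bface (C : Cx α A src face p q) {g : Φ} (h : (Bg α A face g).Nonempty) :
    8 ≤ (Bg α A face g).card ∧ ((Bg α A face g).card ≤ 9 → ∃ d1 d2 d3 d4, Q4 α A src face g d1 d2 d3 d4) := by
  obtain ⟨d1, b1⟩ := h
  obtain ⟨d2, b2, s2, n2⟩ := Bg_step C.P b1
  obtain ⟨d3, b3, s3, n3⟩ := Bg_step C.P b2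
  obtain ⟨d4, b4, s4, n4⟩ := Bg_step C.P b3
  obtain ⟨d5, b5, s5, n5⟩ := Bg_step C.P b4
  have inv := C.P.inv
  have m : ∀ {d}, d ∈ Bg α A face g → d ∈ A := fun h => (mem_Bg.1 h).1
  have cl : ∀ {d}, d ∈ Bg α A face g → α d ∈ Bg α A face g := fun h => Bg_cl C.P h
  have rr : ∀ {d}, d ∈ Bg α A face g → ad α A src (src d) (src (α d)) := fun {d} h => ⟨d, m h, rfl, rfl⟩
  have T := @Cx.tri _ _ _ _ _ _ α A src face p q C
  have S := @PD.adsymm _ _ _ _ _ _ α A src face C.P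
  have I := @Cx.irr _ _ _ _ _ _ α A src face p q C
  have np : ∀ {d e}, d ∈ Bg α A face g → e ∈ Bg α A face g → src e = src (α d) → e ≠ α d → src (α e) ≠ src d := by
    intro d e hd he h1 h2 h3
    exact h2 (C.nopar (m he) (m (cl hd)) h1 (by rw [inv]; exact h3))
  have r1 := rr b1
  have r2 := rr b2
  have r3 := rr b3
  have r4 := rr b4
  have r5 := rr b5
  have p2 := np b1 b2 s2 n2
  have p3 := np b2 b3 s3 n3
  have p4 := np b3 b4 s4 n4
  have p5 := np b4 b5 s5 n5
  have key : ∀ (d : D), d ∈ Bg α A face g → ∀ s : V × V, (s = (src d, src (α d)) ∨ s = (src (α d), src d)) →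
      ∃ d ∈ Bg α A face g, src d = s.1 ∧ src (α d) = s.2 := by
    rintro d hd s (rfl | rfl)
    · exact ⟨d, hd, rfl, rfl⟩
    · exact ⟨α d, cl hd, rfl, by rw [inv]⟩
  have k1 := key d1 b1
  have k2 := key d2 b2
  have k3 := key d3 b3
  have k4 := key d4 b4
  have k5 := key d5 b5
  have n12 : src d1 ≠ src d2 := by intro e; rw [← s2, ← e] at r1; exact I r1
  have n23 : src d2 ≠ src d3 := by intro e; rw [← s3, ← e] at r2; exact I r2
  have n34 : src d3 ≠ src d4 := by intro e; rw [← s4, ← e] at r3; exact I r3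
  have n45 : src d4 ≠ src d5 := by intro e; rw [← s5, ← e] at r4; exact I r4
  rw [← s2] at r1 k1
  rw [← s3] at r2 p2 k2
  rw [← s4] at r3 p3 k3
  rw [← s5] at r4 p4 k4
  have n14 : src d4 ≠ src d1 := by intro e; rw [e] at r3; exact T r1 r2 (S r3)
  have n25 : src d5 ≠ src d2 := by intro e; rw [e] at r4; exact T r2 r3 (S r4)
  by_cases h51 : src d5 = src d1
  · rw [h51] at k4
    have hk : ∀ s ∈ ({(src d1, src d2), (src d2, src d1), (src d2, src d3), (src d3, src d2), (src d3, src d4), (src d4, src d3), (src d4, src d1), (src d1, src d4)} : Finset (V × V)), ∃ d ∈ Bg α A face g, src d = s.1 ∧ src (α d) = s.2 := by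
      intro s hs
      simp only [Finset.mem_insert, Finset.mem_singleton] at hs
      rcases hs with hs | hs | hs | hs | hs | hs | hs | hs
      · exact k1 s (Or.inl hs)
      · exact k1 s (Or.inr hs)
      · exact k2 s (Or.inl hs)
      · exact k2 s (Or.inr hs)
      · exact k3 s (Or.inl hs)
      · exact k3 s (Or.inr hs)
      · exact k4 s (Or.inl hs)
      · exact k4 s (Or.inr hs)
    have hc : ({(src d1, src d2), (src d2, src d1), (src d2, src d3), (src d3, src d2), (src d3, src d4), (src d4, src d3), (src d4, src d1), (src d1, src d4)} : Finset (V × V)).card = 8 := by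
      exact card8 n12 n23 n34 n14 p2 p3
    refine ⟨hc ▸ card_pairs C _ hk, fun h9 => ⟨d1, d2, d3, d4, m b1, m b2, m b3, m b4, s2.symm, s3.symm, s4.symm,
      by rw [← h51, s5], p2.symm, p3.symm, fun d hd => ?_⟩⟩
    constructor
    · intro hb
      have hdB : d ∈ Bg α A face g := mem_Bg.2 ⟨hd, hb⟩
      by_contra hnot
      push Not at hnot
      obtain ⟨x1, x2, x3, x4, x5, x6, x7, x8⟩ := hnot
      set S8 : Finset D := {d1, α d1, d2, α d2, d3, α d3, d4, α d4} with hS8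
      have hsub : insert d (insert (α d) S8) ⊆ Bg α A face g := by
        intro e he
        simp only [hS8, Finset.mem_insert, Finset.mem_singleton] at he
        rcases he with rfl | rfl | rfl | rfl | rfl | rfl | rfl | rfl | rfl | rfl
        · exact hdB
        · exact cl hdB
        · exact b1
        · exact cl b1
        · exact b2
        · exact cl b2
        · exact b3
        · exact cl b3
        · exact b4
        · exact cl b4
      have hdn : d ∉ insert (α d) S8 := by
        simp only [hS8, Finset.mem_insert, Finset.mem_singleton, not_or]
        exact ⟨(C.P.ne d).symm, x1, x2, x3, x4, x5, x6, x7, x8⟩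
      have ai : ∀ {a b : D}, a ≠ b → α a ≠ α b := fun {a b} h e => h (by rw [← inv a, e, inv])
      have aj : ∀ {a b : D}, a ≠ α b → α a ≠ b := fun {a b} h e => h (by rw [← e, inv])
      have hdn' : α d ∉ S8 := by
        simp only [hS8, Finset.mem_insert, Finset.mem_singleton, not_or]
        exact ⟨aj x2, ai x1, aj x4, ai x3, aj x6, ai x5, aj x8, ai x7⟩
      have h8 : 8 ≤ S8.card := by
        rw [← hc]
        calc _ ≤ (S8.image (fun d => (src d, src (α d)))).card := by
              refine Finset.card_le_card fun s hs => ?_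
              simp only [hS8, Finset.image_insert, Finset.image_singleton, inv, ← s2, ← s3, ← s4, ← s5, h51]
              exact hs
          _ ≤ _ := Finset.card_image_le
      have := Finset.card_le_card hsub
      rw [Finset.card_insert_of_notMem hdn, Finset.card_insert_of_notMem hdn'] at this
      omega
    · rintro (rfl | rfl | rfl | rfl | rfl | rfl | rfl | rfl)
      · exact (mem_Bg.1 b1).2
      · exact (mem_Bg.1 (cl b1)).2
      · exact (mem_Bg.1 b2).2
      · exact (mem_Bg.1 (cl b2)).2
      · exact (mem_Bg.1 b3).2
      · exact (mem_Bg.1 (cl b3)).2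
      · exact (mem_Bg.1 b4).2
      · exact (mem_Bg.1 (cl b4)).2
  · have hk : ∀ s ∈ ({(src d1, src d2), (src d2, src d1), (src d2, src d3), (src d3, src d2), (src d3, src d4), (src d4, src d3), (src d4, src d5), (src d5, src d4), (src d5, src (α d5)), (src (α d5), src d5)} : Finset (V × V)), ∃ d ∈ Bg α A face g, src d = s.1 ∧ src (α d) = s.2 := by
      intro s hs
      simp only [Finset.mem_insert, Finset.mem_singleton] at hs
      rcases hs with hs | hs | hs | hs | hs | hs | hs | hs | hs | hs
      · exact k1 s (Or.inl hs)
      · exact k1 s (Or.inr hs)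
      · exact k2 s (Or.inl hs)
      · exact k2 s (Or.inr hs)
      · exact k3 s (Or.inl hs)
      · exact k3 s (Or.inr hs)
      · exact k4 s (Or.inl hs)
      · exact k4 s (Or.inr hs)
      · exact k5 s (Or.inl hs)
      · exact k5 s (Or.inr hs)
    have n56 : src (α d5) ≠ src d5 := by intro e; rw [e] at r5; exact I r5
    have hc : ({(src d1, src d2), (src d2, src d1), (src d2, src d3), (src d3, src d2), (src d3, src d4), (src d4, src d3), (src d4, src d5), (src d5, src d4), (src d5, src (α d5)), (src (α d5), src d5)} : Finset (V × V)).card = 10 := by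
      exact card10 n12 n23 n34 n14 p2 p3 n45 n25 p5 p4 n56 h51
    have h10 := card_pairs C _ hk
    rw [hc] at h10
    exact ⟨by omega, fun h => by omega⟩

end DS

namespace DS

variable {D V Φ : Type} [DecidableEq D] [DecidableEq V] [DecidableEq Φ]
variable {α : D → D} {A : Finset D} {src : D → V} {face : D → Φ} {p q : V}

theorem PD.half (hP : PD α A src face) : ∃ H : Finset D, H ⊆ A ∧ (∀ d ∈ A, (d ∈ H ∧ α d ∉ H) ∨ (d ∉ H ∧ α d ∈ H)) ∧
    Disjoint H (H.image α) ∧ A = H ∪ H.image α := by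
  classical
  have tri : ∀ d, WellOrderingRel d (α d) ∨ WellOrderingRel (α d) d := by
    intro d
    rcases trichotomous_of (WellOrderingRel) d (α d) with h | h | h
    · exact Or.inl h
    · exact absurd h.symm (hP.ne d)
    · exact Or.inr h
  have asy : ∀ a b : D, WellOrderingRel a b → ¬ WellOrderingRel b a := fun a b h => asymm h
  have main : ∀ d ∈ A, (d ∈ A.filter (fun d => WellOrderingRel d (α d)) ∧ α d ∉ A.filter (fun d => WellOrderingRel d (α d))) ∨ (d ∉ A.filter (fun d => WellOrderingRel d (α d)) ∧ α d ∈ A.filter (fun d => WellOrderingRel d (α d))) := by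
    intro d hd
    simp only [Finset.mem_filter, hd, hP.cl d hd, hP.inv, true_and]
    rcases tri d with h | h
    · exact Or.inl ⟨h, asy _ _ h⟩
    · exact Or.inr ⟨asy _ _ h, h⟩
  refine ⟨A.filter (fun d => WellOrderingRel d (α d)), Finset.filter_subset _ _, main, ?_, ?_⟩
  · rw [Finset.disjoint_left]
    intro d hd hd'
    obtain ⟨e, he, rfl⟩ := Finset.mem_image.1 hd'
    have := main e (Finset.filter_subset _ _ he)
    tauto
  · ext d
    rw [Finset.mem_union, Finset.mem_image]
    constructor
    · intro hd
      rcases main d hd with h | h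
      · exact Or.inl h.1
      · exact Or.inr ⟨α d, h.2, hP.inv d⟩
    · rintro (h | ⟨e, he, rfl⟩)
      · exact Finset.filter_subset _ _ h
      · exact hP.cl _ (Finset.filter_subset _ _ he)

def Ph (α : D → D) (A : Finset D) (face : D → Φ) : Finset Φ := (A.filter (fun d => face d ≠ face (α d))).image face

theorem PD.euler (hP : PD α A src face) (hA : A.Nonempty) :
    (A.card + 4 ≤ 2 * (A.image src).card + 2 * (Ph α A face).card) ∨
    (Ph α A face = ∅ ∧ A.card + 2 ≤ 2 * (A.image src).card) := by
  classical
  obtain ⟨H, hHA, hH, hdisj, hun⟩ := hP.half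
  have inj : Function.Injective α := fun a b h => by rw [← hP.inv a, h, hP.inv]
  have hcard : A.card = 2 * H.card := by
    conv_lhs => rw [hun]
    rw [Finset.card_union_of_disjoint hdisj, Finset.card_image_of_injective _ inj]; ring
  set W := A.image src with hW
  set F1 := Ph α A face with hF1
  let T : (H → ZMod 2) →ₗ[ZMod 2] (W → ZMod 2) :=
    { toFun := fun c v => ∑ d : H, c d * ((if src d.1 = v.1 then 1 else 0) + (if src (α d.1) = v.1 then 1 else 0))
      map_add' := fun c c' => by
        ext v; simp only [Pi.add_apply, add_mul, Finset.sum_add_distrib]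
      map_smul' := fun r c => by
        ext v; simp only [Pi.smul_apply, smul_eq_mul, RingHom.id_apply, Finset.mul_sum, mul_assoc] }
  let X' : (F1 → ZMod 2) → Φ → ZMod 2 := fun X f => if h : f ∈ F1 then X ⟨f, h⟩ else 0
  let U : (F1 → ZMod 2) →ₗ[ZMod 2] (H → ZMod 2) :=
    { toFun := fun X d => X' X (face d.1) + X' X (face (α d.1))
      map_add' := fun c c' => by
        ext v; simp only [X', Pi.add_apply]
        split_ifs <;> ring
      map_smul' := fun r c => by
        ext v; simp only [X', Pi.smul_apply, smul_eq_mul, RingHom.id_apply]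
        split_ifs <;> ring }
  let s : (W → ZMod 2) →ₗ[ZMod 2] ZMod 2 :=
    { toFun := fun x => ∑ v, x v
      map_add' := fun c c' => by simp only [Pi.add_apply, Finset.sum_add_distrib]
      map_smul' := fun r c => by simp only [Pi.smul_apply, smul_eq_mul, RingHom.id_apply, Finset.mul_sum] }
  have hTs : LinearMap.range T ≤ LinearMap.ker s := by
    rintro _ ⟨c, rfl⟩
    rw [LinearMap.mem_ker]
    show ∑ v : W, ∑ d : H, c d * ((if src d.1 = v.1 then 1 else 0) + (if src (α d.1) = v.1 then 1 else 0)) = 0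
    rw [Finset.sum_comm]
    refine Finset.sum_eq_zero fun d _ => ?_
    rw [← Finset.mul_sum, Finset.sum_add_distrib]
    have e1 : ∀ e ∈ A, ∑ v : W, (if src e = v.1 then (1 : ZMod 2) else 0) = 1 := by
      intro e he
      rw [Finset.sum_eq_single (⟨src e, Finset.mem_image_of_mem _ he⟩ : W)]
      · simp
      · intro v _ hv
        rw [if_neg]; intro h; exact hv (Subtype.ext h.symm)
      · intro h; exact absurd (Finset.mem_univ _) h
    rw [e1 _ (hHA d.2), e1 _ (hP.cl _ (hHA d.2))]
    have : (1 : ZMod 2) + 1 = 0 := by decide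
    rw [this, mul_zero]
  have hs : Function.Surjective s := by
    obtain ⟨d, hd⟩ := hA
    intro r
    refine ⟨Pi.single (⟨src d, Finset.mem_image_of_mem _ hd⟩ : W) r, ?_⟩
    show ∑ v, Pi.single (⟨src d, Finset.mem_image_of_mem _ hd⟩ : W) r v = r
    simp
  have hker : LinearMap.ker T ≤ LinearMap.range U := by
    intro c hc
    rw [LinearMap.mem_ker] at hc
    let c' : D → ZMod 2 := fun d => if h : d ∈ H then c ⟨d, h⟩ else if h : α d ∈ H then c ⟨α d, h⟩ else 0
    have cs : ∀ d ∈ A, c' (α d) = c' d := by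
      intro d hd
      rcases hH d hd with ⟨h1, h2⟩ | ⟨h1, h2⟩
      · have : α (α d) ∈ H := by rw [hP.inv]; exact h1
        simp only [c', h1, h2, this, dif_pos, dif_neg, not_false_eq_true]
        congr 2; exact hP.inv d
      · simp only [c', h1, h2, dif_pos, dif_neg, not_false_eq_true]
    have hcl : ∀ d, α d ∈ A → d ∈ A := fun d h => by have := hP.cl _ h; rwa [hP.inv] at this
    have c0 : ∀ d, d ∉ A → c' d = 0 := by
      intro d hd
      have h1 : d ∉ H := fun h => hd (hHA h)
      have h2 : α d ∉ H := fun h => hd (hcl _ (hHA h))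
      simp only [c', h1, h2, dif_neg, not_false_eq_true]
    have cs' : ∀ d, c' (α d) = c' d := by
      intro d
      by_cases hd : d ∈ A
      · exact cs d hd
      · rw [c0 d hd, c0 _ (fun h => hd (hcl d h))]
    have cH : ∀ d : H, c' d.1 = c d := by
      intro d; simp only [c', d.2, dif_pos]
    have csm : ∀ v, sm A src c' v = 0 := by
      intro v
      have e1 : sm A src c' v = ∑ d : H, c d * ((if src d.1 = v then 1 else 0) + (if src (α d.1) = v then 1 else 0)) := by
        unfold sm
        conv_lhs => rw [hun]
        rw [Finset.sum_union hdisj, Finset.sum_image (fun a _ b _ h => inj h), ← Finset.sum_add_distrib,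
          ← Finset.sum_coe_sort]
        refine Finset.sum_congr rfl fun d _ => ?_
        rw [cs', cH]
        split_ifs <;> ring
      by_cases hv : v ∈ W
      · rw [e1]; exact congrFun hc ⟨v, hv⟩
      · unfold sm
        refine Finset.sum_eq_zero fun d hd => ?_
        rw [if_neg]; rintro rfl; exact hv (Finset.mem_image_of_mem _ hd)
    obtain ⟨X, hX⟩ := hP.full c' cs' c0 csm
    refine ⟨fun f => X f.1, ?_⟩
    ext d
    show X' (fun f => X f.1) (face d.1) + X' (fun f => X f.1) (face (α d.1)) = c d
    rw [← cH, hX d.1 (hHA d.2)]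
    unfold bd
    by_cases hf : face d.1 = face (α d.1)
    · rw [hf, z2add, z2add]
    · have m1 : face d.1 ∈ F1 := Finset.mem_image_of_mem _ (Finset.mem_filter.2 ⟨hHA d.2, hf⟩)
      have m2 : face (α d.1) ∈ F1 := Finset.mem_image_of_mem _ (Finset.mem_filter.2 ⟨hP.cl _ (hHA d.2), by
        rw [hP.inv]; exact fun h => hf h.symm⟩)
      simp only [X', m1, m2, dif_pos]
  have d1 := LinearMap.finrank_range_add_finrank_ker T
  have d2 := LinearMap.finrank_range_add_finrank_ker s
  have d3 := LinearMap.finrank_range_add_finrank_ker U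
  have d4 := Submodule.finrank_mono hTs
  have d5 := Submodule.finrank_mono hker
  rw [LinearMap.range_eq_top.2 hs, finrank_top, Module.finrank_self] at d2
  rw [Module.finrank_pi, Fintype.card_coe] at d1 d2 d3
  by_cases hF : F1 = ∅
  · right
    refine ⟨hF, ?_⟩
    have hF0 : F1.card = 0 := by rw [hF, Finset.card_empty]
    omega
  · left
    have : 0 < Module.finrank (ZMod 2) (LinearMap.ker U) := by
      rw [Module.finrank_pos_iff]
      obtain ⟨f, hf⟩ := Finset.nonempty_of_ne_empty hF
      refine ⟨⟨⟨fun _ => 1, ?_⟩, 0, ?_⟩⟩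
      · rw [LinearMap.mem_ker]
        ext d
        show X' (fun f => 1) (face d.1) + X' (fun f => 1) (face (α d.1)) = 0
        by_cases hf : face d.1 = face (α d.1)
        · rw [hf, z2add]
        · have m1 : face d.1 ∈ F1 := Finset.mem_image_of_mem _ (Finset.mem_filter.2 ⟨hHA d.2, hf⟩)
          have m2 : face (α d.1) ∈ F1 := Finset.mem_image_of_mem _ (Finset.mem_filter.2 ⟨hP.cl _ (hHA d.2), by
            rw [hP.inv]; exact fun h => hf h.symm⟩)
          simp only [X', m1, m2, dif_pos]
          decide
      · intro h
        have := congrFun (congrArg Subtype.val h) ⟨f, hf⟩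
        simp at this
    omega

end DS

namespace DS

variable {D V Φ : Type} [DecidableEq D] [DecidableEq V] [DecidableEq Φ]
variable {α : D → D} {A : Finset D} {src : D → V} {face : D → Φ} {p q : V}

/-- at most two short faces, hence the count of faces -/
theorem Cx.count (C : Cx α A src face p q) : 10 * (Ph α A face).card ≤ 2 * A.card + 4 := by
  classical
  set F1 := Ph α A face with hF1
  have hne : ∀ g ∈ F1, (Bg α A face g).Nonempty := by
    intro g hg
    obtain ⟨d, hd, rfl⟩ := Finset.mem_image.1 hg
    obtain ⟨hd, hf⟩ := Finset.mem_filter.1 hd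
    exact ⟨d, mem_Bg.2 ⟨hd, Or.inl ⟨rfl, fun h => hf h.symm⟩⟩⟩
  have hsum : ∑ g ∈ F1, (Bg α A face g).card ≤ 2 * A.card := by
    have e1 : ∑ g ∈ F1, (Bg α A face g).card = ∑ d ∈ A, (F1.filter (fun g => d ∈ Bg α A face g)).card := by
      have : ∀ g, (Bg α A face g).card = ∑ d ∈ A, if d ∈ Bg α A face g then 1 else 0 := by
        intro g
        rw [← Finset.sum_filter, ← Finset.card_eq_sum_ones]
        congr 1
        ext d
        simp only [Finset.mem_filter, mem_Bg]; tauto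
      simp only [this]
      rw [Finset.sum_comm]
      refine Finset.sum_congr rfl fun d _ => ?_
      rw [← Finset.sum_filter, ← Finset.card_eq_sum_ones]
    rw [e1]
    calc _ ≤ ∑ d ∈ A, 2 := by
          refine Finset.sum_le_sum fun d _ => ?_
          calc _ ≤ ({face d, face (α d)} : Finset Φ).card := by
                refine Finset.card_le_card fun g hg => ?_
                have := (mem_Bg.1 (Finset.mem_filter.1 hg).2).2
                simp only [Finset.mem_insert, Finset.mem_singleton]
                rcases this with ⟨a, -⟩ | ⟨-, a⟩
                · exact Or.inl a.symm
                · exact Or.inr a.symm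
            _ ≤ 2 := Finset.card_le_two
      _ = 2 * A.card := by simp [mul_comm]
  set P1 := F1.filter (fun g => ∃ d1 d2 d3 d4 z w, FP α A src face p q g d1 d2 d3 d4 z w) with hP1
  set P2 := F1.filter (fun g => ∃ d1 d2 d3 d4 z w, FP α A src face q p g d1 d2 d3 d4 z w) with hP2
  have c1 : P1.card ≤ 1 := by
    rw [Finset.card_le_one]
    intro g hg g' hg'
    obtain ⟨-, d1, d2, d3, d4, z, w, h⟩ := Finset.mem_filter.1 hg
    obtain ⟨-, e1, e2, e3, e4, z', w', h'⟩ := Finset.mem_filter.1 hg'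
    by_contra hgg
    exact C.uniq hgg h h'
  have c2 : P2.card ≤ 1 := by
    rw [Finset.card_le_one]
    intro g hg g' hg'
    obtain ⟨-, d1, d2, d3, d4, z, w, h⟩ := Finset.mem_filter.1 hg
    obtain ⟨-, e1, e2, e3, e4, z', w', h'⟩ := Finset.mem_filter.1 hg'
    by_contra hgg
    exact C.swap.uniq hgg h h'
  have c3 : (P1 ∪ P2).card ≤ 2 := (Finset.card_union_le _ _).trans (by omega)
  have hlow : ∀ g ∈ F1, 10 ≤ (Bg α A face g).card + (if g ∈ P1 ∪ P2 then 2 else 0) := by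
    intro g hg
    obtain ⟨h8, h9⟩ := C.bface (hne g hg)
    split_ifs with hh
    · omega
    · by_contra hlt
      obtain ⟨d1, d2, d3, d4, hQ⟩ := h9 (by omega)
      obtain ⟨e1, e2, e3, e4, z, w, h | h⟩ := C.exFP hQ
      · exact hh (Finset.mem_union_left _ (Finset.mem_filter.2 ⟨hg, e1, e2, e3, e4, z, w, h⟩))
      · exact hh (Finset.mem_union_right _ (Finset.mem_filter.2 ⟨hg, e1, e2, e3, e4, z, w, h⟩))
  have h1 := Finset.sum_le_sum hlow
  rw [Finset.sum_add_distrib, Finset.sum_const, smul_eq_mul, ← Finset.sum_filter, Finset.sum_const, smul_eq_mul] at h1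
  have h2 : (F1.filter (fun g => g ∈ P1 ∪ P2)).card ≤ (P1 ∪ P2).card := by
    refine Finset.card_le_card fun g hg => (Finset.mem_filter.1 hg).2
  omega

theorem Cx.false (C : Cx α A src face p q) : False := by
  classical
  let m : V → V := fun v => if v = q then p else v
  have mm : ∀ (κ : V → Fin 3), κ p = κ q → ∀ v, κ (m v) = κ v := by
    intro κ h v
    simp only [m]
    split_ifs with hv
    · rw [hv, h]
    · rfl
  let H : SimpleGraph V := 
    { Adj := fun a b => a ≠ b ∧ ∃ d ∈ A, m (src d) = a ∧ m (src (α d)) = b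
      symm := ⟨fun a b ⟨h1, d, hd, h2, h3⟩ => ⟨h1.symm, α d, C.P.cl d hd, h3, by rw [C.P.inv]; exact h2⟩⟩
      loopless := ⟨fun a h => h.1 rfl⟩ }
  let S : Finset V := A.image (fun d => m (src d))
  have mne : ∀ d ∈ A, m (src d) ≠ m (src (α d)) := by
    intro d hd h
    have h1 := C.G.noloop d hd
    have h2 : ad α A src (src d) (src (α d)) := ⟨d, hd, rfl, rfl⟩
    have h3 := C.P.adsymm h2
    have N := C.npq
    simp only [m] at h
    split_ifs at h with a b b
    · exact h1 (a.trans b.symm)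
    · rw [a, ← h] at h3; exact N h3
    · rw [b, h] at h2; exact N h2
    · exact h1 h
  have hS : ¬ KY.Col3 H S := by
    rintro ⟨κ, hκ⟩
    refine C.N ⟨fun v => κ (m v), fun d hd => ?_, ?_⟩
    · exact hκ _ (Finset.mem_image_of_mem _ hd) _ (Finset.mem_image.2 ⟨α d, C.P.cl d hd, rfl⟩)
        ⟨mne d hd, d, hd, rfl, rfl⟩
    · show κ (m p) = κ (m q)
      simp [m]
  obtain ⟨R, hRS, hR, hpot⟩ := KY.main (S.card + 1) V H S (by omega) hS
  have hRS' : R = S := by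
    refine Finset.Subset.antisymm hRS fun v hv => ?_
    obtain ⟨d, hd, rfl⟩ := Finset.mem_image.1 hv
    by_contra hn
    obtain ⟨κ, k1, k2⟩ := C.delCol hd
    refine hR ⟨κ, ?_⟩
    rintro a ha b hb ⟨-, e, he, rfl, rfl⟩
    rw [mm κ k2, mm κ k2]
    refine k1 e (mem_del.2 ⟨?_, ?_, he⟩)
    · rintro rfl
      rw [C.P.inv] at hb; exact hn hb
    · rintro rfl; exact hn ha
  rw [hRS'] at hpot hR
  have hee : KY.ee H S S ≤ A.card := by
    unfold KY.ee
    rw [← Finset.sum_product']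
    have : ((S ×ˢ S).filter (fun x => H.Adj x.1 x.2)).card ≤ A.card := by
      calc _ ≤ (A.image (fun d => (m (src d), m (src (α d))))).card := by
            refine Finset.card_le_card fun x hx => ?_
            obtain ⟨-, -, d, hd, h1, h2⟩ := Finset.mem_filter.1 hx
            exact Finset.mem_image.2 ⟨d, hd, by rw [h1, h2]⟩
        _ ≤ _ := Finset.card_image_le
    refine le_trans (le_of_eq ?_) ((Nat.cast_le (α := ℤ)).2 this)
    rw [Finset.card_eq_sum_ones, Finset.sum_filter]
    push_cast
    exact Finset.sum_congr rfl fun x _ => by split_ifs <;> rfl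
  have h4 := KY.four_le_card H hR
  have hSA : S.card ≤ A.card := Finset.card_image_le
  have hW : (A.image src).card ≤ S.card + 1 := by
    have : A.image src ⊆ insert q S := by
      intro v hv
      obtain ⟨d, hd, rfl⟩ := Finset.mem_image.1 hv
      by_cases h : src d = q
      · rw [h]; exact Finset.mem_insert_self _ _
      · refine Finset.mem_insert_of_mem (Finset.mem_image.2 ⟨d, hd, ?_⟩)
        simp [m, h]
    exact (Finset.card_le_card this).trans (Finset.card_insert_le _ _)
  have hA : A.Nonempty := Finset.card_pos.1 (by omega)
  unfold KY.pot at hpot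
  have hc := C.count
  rcases C.P.euler hA with he | ⟨he0, he⟩
  · omega
  · omega

theorem thmA_aux (α : D → D) (n : ℕ) : ∀ (A : Finset D) (src : D → V) (face : D → Φ) (p q : V), A.card < n →
    PD α A src face → Good α A src p q → Col α A src p q := by
  induction n with
  | zero => intro A src face p q h; omega
  | succ n ih =>
    intro A src face p q h hP hG
    by_contra hN
    exact Cx.false ⟨hP, hG, fun A' src' face' p' q' hA' h1 h2 => ih A' src' face' p' q' (by omega) h1 h2, hN⟩

/-- Grötzsch-type theorem with a prescribed pair of equally coloured vertices. -/
theorem thmA (hP : PD α A src face) (hG : Good α A src p q) : Col α A src p q :=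
  thmA_aux α (A.card + 1) A src face p q (by omega) hP hG

end DS

namespace CM
open DS Equiv

variable {D V ι : Type} [DecidableEq D] [DecidableEq V]

def skip (σ : Perm D) (d : D) : Perm D := swap d (σ d) * σ

theorem skip_apply (σ : Perm D) (d e : D) :
    skip σ d e = if e = d then d else if σ e = d then σ d else σ e := by
  unfold skip
  rw [Perm.mul_apply]
  split_ifs with h1 h2
  · subst h1; simp
  · rw [h2]; simp
  · exact swap_apply_of_ne_of_ne h2 (fun h => h1 (σ.injective h))

theorem skip_X (σ : Perm D) (d : D) {X : D → ZMod 2} (h : X (σ d) = X d) (e : D) : X (skip σ d e) = X (σ e) := by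
  rw [skip_apply]
  split_ifs with h1 h2
  · rw [h1, h]
  · rw [h2, h]
  · rfl

/-- skip both darts of an edge -/
def skip2 (α : D → D) (σ : Perm D) (d : D) : Perm D := skip (skip σ d) (α d)

structure Mp (α : D → D) (A : Finset D) (σ : Perm D) (src : D → V) (L : ι → (D → ZMod 2) → ZMod 2) : Prop where
  inv : ∀ d, α (α d) = d
  ne : ∀ d, α d ≠ d
  cl : ∀ d ∈ A, α d ∈ A
  sA : ∀ d ∈ A, σ d ∈ A
  ss : ∀ d ∈ A, src (σ d) = src d
  link : ∀ Y : D → ZMod 2, (∀ z ∈ A, Y (σ z) = Y z) → ∀ d ∈ A, ∀ d' ∈ A, src d = src d' → Y d = Y d'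
  lin : ∀ i c c', L i (fun d => c d + c' d) = L i c + L i c'
  full : ∀ c : D → ZMod 2, (∀ d, c (α d) = c d) → (∀ d, d ∉ A → c d = 0) → (∀ v, sm A src c v = 0) →
    (∀ i, L i c = 0) → ∃ X : D → ZMod 2, (∀ d ∈ A, X (σ (α d)) = X d) ∧ ∀ d ∈ A, c d = X d + X (α d)

/-- face-invariant functions -/
def IX (α : D → D) (A : Finset D) (σ : Perm D) (X : D → ZMod 2) : Prop := ∀ d ∈ A, X (σ (α d)) = X d

variable {α : D → D} {A : Finset D} {σ : Perm D} {src : D → V} {L : ι → (D → ZMod 2) → ZMod 2}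

theorem link_skip {A : Finset D} {σ : Perm D} {src : D → V} {d : D}
    (h : ∀ Y : D → ZMod 2, (∀ z ∈ A, Y (σ z) = Y z) → ∀ d ∈ A, ∀ d' ∈ A, src d = src d' → Y d = Y d') :
    ∀ Y : D → ZMod 2, (∀ z ∈ A.erase d, Y (skip σ d z) = Y z) →
      ∀ e ∈ A.erase d, ∀ e' ∈ A.erase d, src e = src e' → Y e = Y e' := by
  intro Y hY e he e' he' hs
  rw [Finset.mem_erase] at he he'
  have := h (fun z => if z = d then Y (σ d) else Y z) ?_ e he.2 e' he'.2 hs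
  · simpa [he.1, he'.1] using this
  · intro z hz
    beta_reduce
    by_cases h1 : z = d
    · subst h1; simp
    · have := hY z (Finset.mem_erase.2 ⟨h1, hz⟩)
      rw [skip_apply] at this
      simp only [h1, if_false] at this ⊢
      split_ifs with h2
      · rw [if_pos h2] at this; exact this
      · rw [if_neg h2] at this; exact this

theorem skip_mem {A : Finset D} {σ : Perm D} {d : D} (h : ∀ d ∈ A, σ d ∈ A) (hd : d ∈ A) :
    ∀ e ∈ A.erase d, skip σ d e ∈ A.erase d := by
  intro e he
  rw [Finset.mem_erase] at he ⊢
  rw [skip_apply, if_neg he.1]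
  split_ifs with h1
  · exact ⟨fun h2 => he.1 (σ.injective (h1.trans h2.symm)), h _ hd⟩
  · exact ⟨h1, h _ he.2⟩

theorem skip_src {A : Finset D} {σ : Perm D} {src : D → V} {d : D} (h : ∀ d ∈ A, src (σ d) = src d) (hd : d ∈ A) :
    ∀ e ∈ A.erase d, src (skip σ d e) = src e := by
  intro e he
  rw [Finset.mem_erase] at he
  rw [skip_apply, if_neg he.1]
  split_ifs with h1
  · rw [h d hd, ← h e he.2, h1]
  · exact h e he.2

theorem del_cl (hinv : ∀ d, α (α d) = d) (hcl : ∀ d ∈ A, α d ∈ A) (d0 : D) : ∀ d ∈ del α A d0, α d ∈ del α A d0 := by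
  intro d hd
  rw [mem_del] at hd ⊢
  refine ⟨fun h1 => hd.2.1 ?_, fun h1 => hd.1 ?_, hcl d hd.2.2⟩
  · rw [← hinv d, h1, hinv]
  · rw [← hinv d, h1]

theorem sm_eq_of_del (hne : ∀ d, α d ≠ d) (hcl : ∀ d ∈ A, α d ∈ A) {d : D} (hd : d ∈ A) {c : D → ZMod 2}
    (hc : ∀ e, e ∉ del α A d → c e = 0) (v : V) : sm A src c v = sm (del α A d) src c v := by
  rw [sm_del hne hd (hcl d hd), hc d (by simp [del]), hc (α d) (by simp [del])]
  simp

theorem Mp.delete (h : Mp α A σ src L) {d : D} (hd : d ∈ A) : Mp α (del α A d) (skip2 α σ d) src L := by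
  have hd' : α d ∈ A.erase d := Finset.mem_erase.2 ⟨h.ne d, h.cl d hd⟩
  refine ⟨h.inv, h.ne, del_cl h.inv h.cl d, skip_mem (skip_mem h.sA hd) hd', skip_src (skip_src h.ss hd) hd',
    link_skip (link_skip h.link), h.lin, ?_⟩
  intro c c1 c2 c3 c4
  obtain ⟨X, hX, hX'⟩ := h.full c c1 (fun e he => c2 e (fun h => he (mem_del.1 h).2.2))
    (fun v => by rw [sm_eq_of_del h.ne h.cl hd c2, c3]) c4
  refine ⟨X, fun e he => ?_, fun e he => hX' e (mem_del.1 he).2.2⟩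
  have h0 := hX' d hd
  rw [c2 d (by simp [del])] at h0
  have h1 : X (α d) = X d := by
    have : ∀ a b : ZMod 2, 0 = a + b → b = a := by decide
    exact this _ _ h0
  have h2 : X (σ d) = X d := by
    have := hX (α d) (h.cl d hd)
    rw [h.inv] at this; rw [this, h1]
  have h3 : X (skip σ d (α d)) = X (α d) := by
    rw [skip_X σ d h2, hX d hd, h1]
  rw [skip2, skip_X _ _ h3, skip_X _ _ h2]
  exact hX e (mem_del.1 he).2.2

/-- merging two orbits -/
theorem merge [Finite D] {A : Finset D} {π : Perm D} (hA : ∀ z ∈ A, π z ∈ A) {a b : D} (ha : a ∈ A)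
    {Z X : D → ZMod 2} (hZ : ∀ z ∈ A, Z (π z) = Z z) (hab : Z a ≠ Z b)
    (hX : ∀ z ∈ A, X (swap a b (π z)) = X z) : X a = X b := by
  have hex : ∃ m, 0 < m ∧ (π ^ m) a = a := by
    refine ⟨orderOf π, orderOf_pos π, ?_⟩
    rw [pow_orderOf_eq_one]; rfl
  have hm := Nat.find_spec hex
  have hmin := fun k => @Nat.find_min _ _ hex k
  set m := Nat.find hex with hmdef
  have hAk : ∀ k, (π ^ k) a ∈ A := by
    intro k
    induction k with
    | zero => simpa
    | succ k ih => rw [pow_succ', Perm.mul_apply]; exact hA _ ih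
  have hZk : ∀ k, Z ((π ^ k) a) = Z a := by
    intro k
    induction k with
    | zero => simp
    | succ k ih => rw [pow_succ', Perm.mul_apply, hZ _ (hAk k), ih]
  have hXk : ∀ k, k < m → X ((π ^ k) a) = X a := by
    intro k
    induction k with
    | zero => simp
    | succ k ih =>
      intro hk
      rw [← ih (by omega), ← hX _ (hAk k), ← Perm.mul_apply π, ← pow_succ', swap_apply_of_ne_of_ne]
      · intro h; exact hmin _ hk ⟨by omega, h⟩
      · intro h; exact hab (by rw [← h, hZk])
  have h1 := hXk (m - 1) (by omega)
  have h2 := hX _ (hAk (m - 1))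
  rw [← Perm.mul_apply π, ← pow_succ', show m - 1 + 1 = m by omega, hm.2, swap_apply_left] at h2
  rw [← h1, h2]

/-- splitting an orbit -/
theorem splitOrb [Finite D] {π : Perm D} {a b : D} (hab : a ≠ b)
    (h : π.SameCycle a b) : ¬ (swap a b * π).SameCycle a b := by
  have hex : ∃ m, (π ^ m) a = b := by
    obtain ⟨m, -, hm⟩ := h.exists_pow_eq'
    exact ⟨m, hm⟩
  have hm := Nat.find_spec hex
  have hmin := fun k => @Nat.find_min _ _ hex k
  set m := Nat.find hex with hmdef
  have hm0 : 0 < m := by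
    rcases Nat.eq_zero_or_pos m with h0 | h0
    · rw [h0] at hm; exact absurd hm hab
    · exact h0
  let W : Set D := {z | ∃ k, k < m ∧ (π ^ k) a = z}
  have hW : Set.MapsTo (swap a b * π) W W := by
    rintro z ⟨k, hk, rfl⟩
    rw [Perm.mul_apply, ← Perm.mul_apply π, ← pow_succ']
    by_cases h1 : k + 1 = m
    · rw [h1, hm, swap_apply_right]; exact ⟨0, hm0, rfl⟩
    · rw [swap_apply_of_ne_of_ne]
      · exact ⟨k + 1, by omega, rfl⟩
      · intro h2
        refine hmin (m - (k + 1)) (by omega) ?_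
        have : (π ^ (m - (k + 1))) ((π ^ (k + 1)) a) = b := by
          rw [← Perm.mul_apply, ← pow_add, show m - (k + 1) + (k + 1) = m by omega, hm]
        rwa [h2] at this
      · exact hmin _ (by omega)
  rintro hs
  obtain ⟨n, -, hn⟩ := hs.exists_pow_eq'
  have hk : ∀ k, ((swap a b * π) ^ k) a ∈ W := by
    intro k
    induction k with
    | zero => exact ⟨0, hm0, rfl⟩
    | succ k ih => rw [pow_succ', Perm.mul_apply]; exact hW ih
  obtain ⟨k, hk, hk'⟩ := hk n
  rw [hn] at hk'
  exact hmin k hk hk'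

end CM

namespace CM
open DS Equiv

variable {D V ι : Type} [DecidableEq D] [DecidableEq V]
variable {α : D → D} {A : Finset D} {σ : Perm D} {src : D → V} {L : ι → (D → ZMod 2) → ZMod 2}

def csrc (α : D → D) (src : D → V) (d : D) (z : D) : V := if src z = src (α d) then src d else src z
def ctr (α : D → D) (σ : Perm D) (d : D) : Perm D := skip2 α (σ * swap d (α d)) d
def ext (α : D → D) (A : Finset D) (src : D → V) (d : D) (c : D → ZMod 2) (e : D) : ZMod 2 :=
  if e = d ∨ e = α d then sm (del α A d) src c (src d) else c e

theorem ext_add (d : D) (c c' : D → ZMod 2) :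
    ext α A src d (fun e => c e + c' e) = fun e => ext α A src d c e + ext α A src d c' e := by
  funext e
  unfold ext
  rw [sm_add]
  split_ifs <;> rfl

theorem sm_ext (hne : ∀ d, α d ≠ d) (hcl : ∀ d ∈ A, α d ∈ A) {d : D} (hd : d ∈ A) (hnl : src d ≠ src (α d))
    {c : D → ZMod 2} (hc : ∀ v, sm (del α A d) (csrc α src d) c v = 0) (v : V) :
    sm A src (ext α A src d c) v = 0 := by
  rw [sm_del hne hd (hcl d hd)]
  have h1 : ∀ v, sm (del α A d) src (ext α A src d c) v = sm (del α A d) src c v := by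
    intro v
    unfold sm
    refine Finset.sum_congr rfl fun e he => ?_
    rw [mem_del] at he
    simp [ext, he.1, he.2.1]
  have h2 : ext α A src d c d = sm (del α A d) src c (src d) := by simp [ext]
  have h3 : ext α A src d c (α d) = sm (del α A d) src c (src d) := by simp [ext]
  rw [h1, h2, h3]
  by_cases hv : src d = v
  · subst hv
    rw [if_pos rfl, if_neg (Ne.symm hnl), add_zero, z2add]
  by_cases hv' : src (α d) = v
  · subst hv'
    rw [if_neg hv, if_pos rfl, zero_add, ← hc (src d)]
    unfold sm
    rw [← Finset.sum_add_distrib]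
    refine Finset.sum_congr rfl fun e he => ?_
    unfold csrc
    by_cases h4 : src e = src (α d)
    · simp [h4, Ne.symm hnl]
    · simp [h4]
  · rw [if_neg hv, if_neg hv', add_zero, add_zero, ← hc v]
    unfold sm
    refine Finset.sum_congr rfl fun e he => ?_
    unfold csrc
    by_cases h4 : src e = src (α d)
    · simp [h4, hv, hv']
    · simp [h4]

theorem Mp.contract [Finite D] (h : Mp α A σ src L) {d : D} (hd : d ∈ A) (hnl : src d ≠ src (α d)) :
    Mp α (del α A d) (ctr α σ d) (csrc α src d) (fun i c => L i (ext α A src d c)) := by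
  have hd1 : α d ∈ A := h.cl d hd
  have hd' : α d ∈ A.erase d := Finset.mem_erase.2 ⟨h.ne d, hd1⟩
  have e1 : (σ * swap d (α d)) d = σ (α d) := by simp
  have e2 : (σ * swap d (α d)) (α d) = σ d := by simp
  have e3 : ∀ z, z ≠ d → z ≠ α d → (σ * swap d (α d)) z = σ z := by
    intro z h1 h2
    rw [Perm.mul_apply, swap_apply_of_ne_of_ne h1 h2]
  have sA1 : ∀ z ∈ A, (σ * swap d (α d)) z ∈ A := by
    intro z hz
    by_cases h1 : z = d
    · rw [h1, e1]; exact h.sA _ hd1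
    by_cases h2 : z = α d
    · rw [h2, e2]; exact h.sA _ hd
    · rw [e3 z h1 h2]; exact h.sA _ hz
  have ss1 : ∀ z ∈ A, csrc α src d ((σ * swap d (α d)) z) = csrc α src d z := by
    intro z hz
    by_cases h1 : z = d
    · rw [h1, e1]; unfold csrc; rw [h.ss _ hd1]; simp
    by_cases h2 : z = α d
    · rw [h2, e2]; unfold csrc; rw [h.ss _ hd]; simp
    · rw [e3 z h1 h2]; unfold csrc; rw [h.ss _ hz]
  refine ⟨h.inv, h.ne, del_cl h.inv h.cl d, skip_mem (skip_mem sA1 hd) hd', skip_src (skip_src ss1 hd) hd',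
    link_skip (link_skip ?_), ?_, ?_⟩
  · intro Y hY
    have hm : Y (σ d) = Y (σ (α d)) := by
      refine merge (A := A) (π := σ) h.sA (h.sA _ hd) (Z := fun z => if src z = src d then 1 else 0)
        (fun z hz => by simp [h.ss z hz]) ?_ ?_
      · simp [h.ss d hd, h.ss _ hd1, Ne.symm hnl]
      · intro z hz
        rw [← Perm.mul_apply, ← Equiv.mul_swap_eq_swap_mul]
        exact hY z hz
    have k1 : Y d = Y (σ (α d)) := by rw [← hY d hd, e1]
    have k2 : Y (α d) = Y (σ d) := by rw [← hY _ hd1, e2]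
    have hs : ∀ z ∈ A, Y (σ z) = Y z := by
      intro z hz
      by_cases h1 : z = d
      · rw [h1, hm, k1]
      by_cases h2 : z = α d
      · rw [h2, ← hm, k2]
      · rw [← hY z hz, e3 z h1 h2]
    have hl := h.link Y hs
    intro z hz z' hz' hzz
    have key : ∀ z ∈ A, Y z = (if src z = src (α d) then Y d else Y z) := by
      intro z hz
      split_ifs with h1
      · rw [hl z hz _ hd1 h1, k2, hm, k1]
      · rfl
    unfold csrc at hzz
    split_ifs at hzz with h1 h2 h2
    · exact hl z hz z' hz' (h1.trans h2.symm)
    · rw [key z hz, if_pos h1]; exact hl _ hd _ hz' hzz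
    · rw [key z' hz', if_pos h2]; exact hl _ hz _ hd hzz
    · exact hl z hz z' hz' hzz
  · intro i c c'
    rw [ext_add, h.lin]
  · intro c c1 c2 c3 c4
    have g1 : ∀ e, ext α A src d c (α e) = ext α A src d c e := by
      intro e
      unfold ext
      have : (α e = d ∨ α e = α d) ↔ (e = d ∨ e = α d) := by
        constructor
        · rintro (h1 | h1)
          · right; rw [← h1, h.inv]
          · left; rw [← h.inv e, h1, h.inv]
        · rintro (h1 | h1)
          · right; rw [h1]
          · left; rw [h1, h.inv]
      rw [c1 e]
      simp only [this]
    have g2 : ∀ e, e ∉ A → ext α A src d c e = 0 := by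
      intro e he
      have h1 : e ≠ d := fun h => he (h ▸ hd)
      have h2 : e ≠ α d := fun h => he (h ▸ hd1)
      simp only [ext, h1, h2, or_self, if_false]
      exact c2 e (fun h => he (mem_del.1 h).2.2)
    obtain ⟨X, hX, hX'⟩ := h.full (ext α A src d c) g1 g2 (sm_ext h.ne h.cl hd hnl c3) c4
    · refine ⟨X, fun e he => ?_, fun e he => ?_⟩
      · have h2 : X ((σ * swap d (α d)) d) = X d := by rw [e1, hX d hd]
        have h4 : X ((σ * swap d (α d)) (α d)) = X (α d) := by
          have := hX _ hd1
          rw [h.inv] at this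
          rw [e2, this]
        have h3 : X (skip (σ * swap d (α d)) d (α d)) = X (α d) := by
          rw [skip_X _ d h2, h4]
        rw [ctr, skip2, skip_X _ _ h3, skip_X _ _ h2]
        have := del_cl h.inv h.cl d e he
        rw [mem_del] at this he
        rw [e3 _ this.2.1 this.1]
        exact hX e he.2.2
      · rw [← hX' e (mem_del.1 he).2.2]
        rw [mem_del] at he
        simp [ext, he.1, he.2.1]

theorem Mp.congrSrc {V' : Type} [DecidableEq V'] (h : Mp α A σ src L) (src' : D → V')
    (hs : ∀ d ∈ A, ∀ d' ∈ A, src d = src d' ↔ src' d = src' d') : Mp α A σ src' L := by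
  refine ⟨h.inv, h.ne, h.cl, h.sA, fun d hd => (hs _ (h.sA d hd) _ hd).1 (h.ss d hd), fun Y hY d hd d' hd' he =>
    h.link Y hY d hd d' hd' ((hs d hd d' hd').2 he), h.lin, fun c c1 c2 c3 c4 => h.full c c1 c2 (fun v => ?_) c4⟩
  by_cases hv : ∃ d ∈ A, src d = v
  · obtain ⟨d, hd, rfl⟩ := hv
    rw [← c3 (src' d)]
    unfold sm
    refine Finset.sum_congr rfl fun e he => ?_
    simp only [hs e he d hd]
  · push Not at hv
    unfold sm
    exact Finset.sum_eq_zero fun e he => by rw [if_neg (hv e he)]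

theorem Mp.restrict (n : ℕ) : ∀ (A : Finset D) (σ : Perm D), Mp α A σ src L → ∀ K ⊆ A, (∀ d ∈ K, α d ∈ K) → A.card < n →
    ∃ σ', Mp α K σ' src L := by
  induction n with
  | zero => intro A σ h K hK h1 h2; omega
  | succ n ih =>
    intro A σ h K hK h1 h2
    by_cases hA : A = K
    · subst hA; exact ⟨σ, h⟩
    · obtain ⟨d, hd, hdK⟩ : ∃ d ∈ A, d ∉ K := by
        by_contra hc
        push Not at hc
        exact hA (Finset.Subset.antisymm hc hK)
      refine ih _ _ (h.delete hd) K (fun e he => ?_) h1 (by have := card_del h.ne hd (h.cl d hd); omega)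
      rw [mem_del]
      refine ⟨?_, ?_, hK he⟩
      · rintro rfl; exact hdK (by rw [← h.inv d]; exact h1 _ he)
      · rintro rfl; exact hdK he

theorem Mp.contractAll [Finite D] {V' : Type} [DecidableEq V'] (β : V → V') (K : Finset D) (hKα : ∀ d ∈ K, α d ∈ K)
    (n : ℕ) : ∀ (A : Finset D) (σ : Perm D) (src : D → V) (L : ι → (D → ZMod 2) → ZMod 2), Mp α A σ src L → K ⊆ A →
    (∀ d ∈ A, d ∉ K → β (src d) = β (src (α d))) →
    (∀ d ∈ K, ∀ d' ∈ K, β (src d) = β (src d') → ∀ Y : V → ZMod 2,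
      (∀ e ∈ A, e ∉ K → Y (src e) = Y (src (α e))) → Y (src d) = Y (src d')) → A.card < n →
    ∃ (σ' : Perm D) (L' : ι → (D → ZMod 2) → ZMod 2), Mp α K σ' (fun d => β (src d)) L' := by
  induction n with
  | zero => intro A σ src L h K hK h1 h2; omega
  | succ n ih =>
    intro A σ src L h hKA h1 h2 hn
    by_cases hA : A = K
    · subst hA
      refine ⟨σ, L, h.congrSrc _ fun d hd d' hd' => ⟨fun h => by rw [h], fun he => ?_⟩⟩
      have := h2 d hd d' hd' he (fun v => if v = src d then 1 else 0) (fun e he he' => absurd he he')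
      by_contra hc
      simp [Ne.symm hc] at this
    · obtain ⟨d, hd, hdK⟩ : ∃ d ∈ A, d ∉ K := by
        by_contra hc
        push Not at hc
        exact hA (Finset.Subset.antisymm hc hKA)
      have hKd : K ⊆ del α A d := by
        intro e he
        rw [mem_del]
        refine ⟨?_, ?_, hKA he⟩
        · rintro rfl; exact hdK (by rw [← h.inv d]; exact hKα _ he)
        · rintro rfl; exact hdK he
      have hcard := card_del h.ne hd (h.cl d hd)
      by_cases hl : src d = src (α d)
      · refine ih _ _ _ _ (h.delete hd) hKd (fun e he => h1 e (mem_del.1 he).2.2) ?_ (by omega)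
        intro e he e' he' hβ Y hY
        refine h2 e he e' he' hβ Y fun z hz hzK => ?_
        by_cases z1 : z = d
        · rw [z1, ← hl]
        by_cases z2 : z = α d
        · rw [z2, h.inv, hl]
        exact hY z (mem_del.2 ⟨z2, z1, hz⟩) hzK
      · have hβd := h1 d hd hdK
        have hβ : ∀ z, β (csrc α src d z) = β (src z) := by
          intro z; unfold csrc
          split_ifs with h4
          · rw [h4, hβd]
          · rfl
        have g : ∀ e ∈ K, ∀ e' ∈ K, β (csrc α src d e) = β (csrc α src d e') → ∀ Y : V → ZMod 2,
            (∀ z ∈ del α A d, z ∉ K → Y (csrc α src d z) = Y (csrc α src d (α z))) →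
            Y (csrc α src d e) = Y (csrc α src d e') := by
          intro e he e' he' hβe Y hY
          rw [hβ, hβ] at hβe
          refine h2 e he e' he' hβe (fun v => Y (if v = src (α d) then src d else v)) fun z hz hzK => ?_
          by_cases z1 : z = d
          · rw [z1]; simp [hl]
          by_cases z2 : z = α d
          · rw [z2, h.inv]; simp [hl]
          exact hY z (mem_del.2 ⟨z2, z1, hz⟩) hzK
        obtain ⟨σ', L', h'⟩ := ih _ _ _ _ (h.contract hd hl) hKd (fun e he => by rw [hβ, hβ]; exact h1 e (mem_del.1 he).2.2) g (by omega)
        refine ⟨σ', L', ?_⟩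
        simpa only [hβ] using h'

end CM

namespace CM
open DS Equiv

variable {D V ι : Type} [DecidableEq D] [DecidableEq V]
variable {α : D → D} {A : Finset D} {σ : Perm D} {src : D → V} {L : ι → (D → ZMod 2) → ZMod 2}

theorem even {A : Finset D} {σ : Perm D} {src : D → V} (inv : ∀ d, α (α d) = d) (cl : ∀ d ∈ A, α d ∈ A)
    (sA : ∀ d ∈ A, σ d ∈ A) (ss : ∀ d ∈ A, src (σ d) = src d) {X : D → ZMod 2} (hX : IX α A σ X) (v : V) :
    sm A src (fun d => X d + X (α d)) v = 0 := by
  rw [sm_add]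
  have h1 : sm A src (fun d => X (α d)) v = sm A src X v := by
    unfold sm
    refine Finset.sum_nbij σ sA σ.injective.injOn ?_ ?_
    · exact Finset.surjOn_of_injOn_of_card_le _ sA σ.injective.injOn le_rfl
    · intro d hd
      have := hX _ (cl d hd)
      rw [inv] at this
      rw [ss d hd, this]
  rw [h1, z2add]

theorem sm_ind (a : D) (ha : a ∈ A) (w : V) : sm A src (fun d => if d = a then 1 else 0) w = if src a = w then 1 else 0 := by
  unfold sm
  rw [Finset.sum_eq_single a]
  · simp
  · intro b hb hba; simp [hba]
  · intro h; exact absurd ha h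

/-- cycles -/
def Cyc (α : D → D) (A : Finset D) (src : D → V) (c : D → ZMod 2) : Prop :=
  (∀ d, c (α d) = c d) ∧ (∀ d, d ∉ A → c d = 0) ∧ ∀ v, sm A src c v = 0

theorem Cyc.add {c c' : D → ZMod 2} (h : Cyc α A src c) (h' : Cyc α A src c') : Cyc α A src (fun d => c d + c' d) :=
  ⟨fun d => by beta_reduce; rw [h.1, h'.1], fun d hd => by beta_reduce; rw [h.2.1 d hd, h'.2.1 d hd, add_zero], fun v => by
    rw [sm_add, h.2.2, h'.2.2, add_zero]⟩

theorem join (inv : ∀ d, α (α d) = d) (ne : ∀ d, α d ≠ d) (cl : ∀ d ∈ A, α d ∈ A) {v : V}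
    (conn : ∀ Y : V → ZMod 2, (∀ d ∈ A, src d ≠ v → src (α d) ≠ v → Y (src d) = Y (src (α d))) →
      ∀ d ∈ A, ∀ d' ∈ A, src d ≠ v → src d' ≠ v → Y (src d) = Y (src d'))
    {a b : D} (ha : a ∈ A) (hb : b ∈ A) (hav : src a ≠ v) (hbv : src b ≠ v) :
    ∃ c : D → ZMod 2, (∀ d, c (α d) = c d) ∧ (∀ d, d ∉ A → c d = 0) ∧ (∀ d, src d = v → c d = 0) ∧
      ∀ w, sm A src c w = (if src a = w then 1 else 0) + (if src b = w then 1 else 0) := by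
  classical
  let P : V → Prop := fun u => ∃ c : D → ZMod 2, (∀ d, c (α d) = c d) ∧ (∀ d, d ∉ A → c d = 0) ∧ (∀ d, src d = v → c d = 0) ∧
      ∀ w, sm A src c w = (if src a = w then 1 else 0) + (if u = w then 1 else 0)
  have hP : ∀ d ∈ A, src d ≠ v → src (α d) ≠ v → P (src d) → P (src (α d)) := by
    rintro d hd h1 h2 ⟨c, c1, c2, c3, c4⟩
    refine ⟨fun z => c z + ((if z = d then 1 else 0) + (if z = α d then 1 else 0)), ?_, ?_, ?_, ?_⟩
    · intro z
      have e1 : α z = d ↔ z = α d := ⟨fun h => by rw [← h, inv], fun h => by rw [h, inv]⟩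
      have e2 : α z = α d ↔ z = d := ⟨fun h => by rw [← inv z, h, inv], fun h => by rw [h]⟩
      beta_reduce
      rw [c1]; simp only [e1, e2]; ring
    · intro z hz
      have e1 : z ≠ d := fun h => hz (h ▸ hd)
      have e2 : z ≠ α d := fun h => hz (h ▸ cl d hd)
      simp [e1, e2, c2 z hz]
    · intro z hz
      have e1 : z ≠ d := fun h => h1 (h ▸ hz)
      have e2 : z ≠ α d := fun h => h2 (h ▸ hz)
      simp [e1, e2, c3 z hz]
    · intro w
      rw [sm_add, sm_add, sm_ind d hd, sm_ind _ (cl d hd), c4 w]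
      have : ∀ x y z : ZMod 2, x + y + (y + z) = x + z := by decide
      exact this _ _ _
  have := conn (fun u => if P u then 1 else 0) ?_ a ha b hb hav hbv
  · have hPa : P (src a) := ⟨fun _ => 0, fun _ => rfl, fun _ _ => rfl, fun _ _ => rfl, fun w => by rw [z2add]; simp [sm]⟩
    simp only [hPa, if_true] at this
    by_contra hc
    have hPb : ¬ P (src b) := hc
    simp [hPb] at this
  · intro d hd h1 h2
    have : P (src d) ↔ P (src (α d)) := ⟨hP d hd h1 h2, fun h => by
      have := hP (α d) (cl d hd) h2 (by rwa [inv]) h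
      rwa [inv] at this⟩
    simp only [this]

def aP (α : D → D) (inv : ∀ d, α (α d) = d) : Perm D := ⟨α, α, inv, inv⟩

theorem orb_same {A : Finset D} {π : Perm D} {a b : D} (h : ∀ X : D → ZMod 2, (∀ z ∈ A, X (π z) = X z) → X a = X b) :
    π.SameCycle a b := by
  classical
  have := h (fun z => if π.SameCycle a z then 1 else 0) (fun z _ => by simp)
  by_contra hc
  simp [hc] at this
  exact this (Perm.SameCycle.refl _ _)

end CM

namespace CM
open DS Equiv

variable {D V ι : Type} [DecidableEq D] [DecidableEq V]
variable {α : D → D} {A : Finset D} {σ : Perm D} {src : D → V} {L : Fin 2 → (D → ZMod 2) → ZMod 2}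

def Conn (α : D → D) (A : Finset D) (src : D → V) (v : V) : Prop :=
  ∀ Y : V → ZMod 2, (∀ d ∈ A, src d ≠ v → src (α d) ≠ v → Y (src d) = Y (src (α d))) →
      ∀ d ∈ A, ∀ d' ∈ A, src d ≠ v → src d' ≠ v → Y (src d) = Y (src d')

open Classical in
def ssrc (σ' : Perm D) (src : D → V) (v : V) (d1 : D) (z : D) : Option V :=
  if src z = v then (if σ'.SameCycle d1 z then none else some v) else some (src z)

theorem sm_ssrc (σ' : Perm D) (v : V) (d1 : D) (c : D → ZMod 2) :
    sm A src c v = sm A (ssrc σ' src v d1) c none + sm A (ssrc σ' src v d1) c (some v) := by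
  unfold sm
  rw [← Finset.sum_add_distrib]
  refine Finset.sum_congr rfl fun e he => ?_
  unfold ssrc
  split_ifs <;> simp_all

theorem sm_ssrc' (σ' : Perm D) {v w : V} (hw : w ≠ v) (d1 : D) (c : D → ZMod 2) :
    sm A src c w = sm A (ssrc σ' src v d1) c (some w) := by
  unfold sm
  refine Finset.sum_congr rfl fun e he => ?_
  unfold ssrc
  split_ifs <;> simp_all

theorem link_split (link : ∀ Y : D → ZMod 2, (∀ z ∈ A, Y (σ z) = Y z) → ∀ d ∈ A, ∀ d' ∈ A, src d = src d' → Y d = Y d')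
    (ss : ∀ d ∈ A, src (σ d) = src d) {d1 d2 : D} (h1 : d1 ∈ A) (h2 : d2 ∈ A) {v : V} (s1 : src d1 = v) (s2 : src d2 = v) :
    ∀ Y : D → ZMod 2, (∀ z ∈ A, Y ((swap d1 d2 * σ) z) = Y z) →
      (∀ z, (swap d1 d2 * σ).SameCycle d1 z → Y z = Y d1) →
      ∀ d ∈ A, ∀ d' ∈ A, ssrc (swap d1 d2 * σ) src v d1 d = ssrc (swap d1 d2 * σ) src v d1 d' → Y d = Y d' := by
  classical
  intro Y hY hY1 d hd d' hd' he
  by_cases hv : src d = v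
  · by_cases hv' : src d' = v
    · by_cases hs : (swap d1 d2 * σ).SameCycle d1 d
      · by_cases hs' : (swap d1 d2 * σ).SameCycle d1 d'
        · rw [hY1 d hs, hY1 d' hs']
        · simp [ssrc, hv, hv', hs, hs'] at he
      · by_cases hs' : (swap d1 d2 * σ).SameCycle d1 d'
        · simp [ssrc, hv, hv', hs, hs'] at he
        · have key : ∀ z ∈ A, src z = v → ¬ (swap d1 d2 * σ).SameCycle d1 z → Y z = Y d2 := by
            intro z hz hzv hzs
            have := link (fun z => if src z = v then (if (swap d1 d2 * σ).SameCycle d1 z then Y d2 else Y z) else 0) ?_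
              z hz d2 h2 (hzv.trans s2.symm)
            · simpa [hzv, s2, hzs] using this
            · intro z hz
              beta_reduce
              rw [ss z hz]
              by_cases hzv : src z = v
              swap
              · rw [if_neg hzv, if_neg hzv]
              rw [if_pos hzv, if_pos hzv]
              have hYz := hY z hz
              have hc : (swap d1 d2 * σ).SameCycle d1 ((swap d1 d2 * σ) z) ↔ (swap d1 d2 * σ).SameCycle d1 z :=
                Perm.sameCycle_apply_right
              by_cases e1 : σ z = d1
              · have e2 : (swap d1 d2 * σ) z = d2 := by rw [Perm.mul_apply, e1, swap_apply_left]
                rw [e1, if_pos (Perm.SameCycle.refl _ _)]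
                rw [e2] at hYz
                rw [← hYz]; simp
              · by_cases e2 : σ z = d2
                · have e3 : (swap d1 d2 * σ) z = d1 := by rw [Perm.mul_apply, e2, swap_apply_right]
                  rw [e3] at hc
                  rw [if_pos (hc.1 (Perm.SameCycle.refl _ _)), e2]; simp
                · have e3 : (swap d1 d2 * σ) z = σ z := by rw [Perm.mul_apply, swap_apply_of_ne_of_ne e1 e2]
                  rw [e3] at hYz hc
                  rw [hYz]; simp only [hc]
          rw [key d hd hv hs, key d' hd' hv' hs']
    · exfalso
      simp only [ssrc, hv, hv', if_true, if_false] at he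
      split_ifs at he
      exact hv' (Option.some.inj he).symm
  · by_cases hv' : src d' = v
    · exfalso
      simp only [ssrc, hv, hv', if_true, if_false] at he
      split_ifs at he
      exact hv (Option.some.inj he)
    · simp only [ssrc, hv, hv', if_false] at he
      have := link (fun z => if src z = v then 0 else Y z) ?_ d hd d' hd' (Option.some.inj he)
      · simpa [hv, hv'] using this
      · intro z hz
        beta_reduce
        rw [ss z hz]
        by_cases hzv : src z = v
        · rw [if_pos hzv, if_pos hzv]
        · rw [if_neg hzv, if_neg hzv, ← hY z hz, Perm.mul_apply, swap_apply_of_ne_of_ne]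
          · intro h; exact hzv (by rw [← ss z hz, h, s1])
          · intro h; exact hzv (by rw [← ss z hz, h, s2])

end CM

namespace CM
open DS Equiv

variable {D V ι : Type} [DecidableEq D] [DecidableEq V]
variable {α : D → D} {A : Finset D} {σ : Perm D} {src : D → V} {L : Fin 2 → (D → ZMod 2) → ZMod 2}

theorem const_cycle [Finite D] {π : Perm D} (sA : ∀ z ∈ A, π z ∈ A) {Y : D → ZMod 2} (hY : ∀ z ∈ A, Y (π z) = Y z)
    {a : D} (ha : a ∈ A) (z : D) (hz : π.SameCycle a z) : Y z = Y a ∧ z ∈ A := by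
  obtain ⟨n, -, rfl⟩ := hz.exists_pow_eq'
  induction n with
  | zero => exact ⟨rfl, ha⟩
  | succ n ih =>
    have ih := ih (Perm.SameCycle.pow_right (Perm.SameCycle.refl _ _))
    rw [pow_succ', Perm.mul_apply]
    exact ⟨by rw [hY _ ih.2, ih.1], sA _ ih.2⟩

theorem vec2 : ∀ a0 a1 w0 w1 e0 e1 : ZMod 2, ¬ (w0 = 0 ∧ w1 = 0) → (a0 = 0 ∧ a1 = 0) ∨ (a0 + w0 = 0 ∧ a1 + w1 = 0) ∨
    (e0 = 0 ∧ e1 = 0) ∨ (e0 + a0 = 0 ∧ e1 + a1 = 0) ∨ (e0 + w0 = 0 ∧ e1 + w1 = 0) ∨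
    (e0 + (a0 + w0) = 0 ∧ e1 + (a1 + w1) = 0) := by decide

theorem Mp.split [Finite D] (h : Mp α A σ src L) {v : V} {d1 d2 : D} (h1 : d1 ∈ A) (h2 : d2 ∈ A) (hne : d1 ≠ d2)
    (s1 : src d1 = v) (s2 : src d2 = v) (orb : ∀ X, IX α A σ X → X d1 = X d2)
    (nol : ∀ d ∈ A, src d = v → src (α d) ≠ v) (conn : Conn α A src v) :
    ∃ (σ' : Perm D) (src' : D → Option V) (L' : Empty → (D → ZMod 2) → ZMod 2), Mp α A σ' src' L' ∧
      src' d1 = none ∧ src' d2 = some v ∧ (∀ d, src d ≠ v → src' d = some (src d)) ∧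
      (∀ d, src d = v → src' d = none ∨ src' d = some v) := by
  classical
  let φ : Perm D := σ * aP α h.inv
  have hφ : φ.SameCycle d1 d2 := orb_same (A := A) fun X hX => orb X hX
  have hσ : σ.SameCycle d1 d2 := orb_same (A := A) fun X hX => h.link X hX d1 h1 d2 h2 (s1.trans s2.symm)
  set σ' : Perm D := swap d1 d2 * σ with hσ'
  have n1 : ¬ σ'.SameCycle d1 d2 := splitOrb hne hσ
  have n2 : ¬ (swap d1 d2 * φ).SameCycle d1 d2 := splitOrb hne hφ
  set φ' : Perm D := swap d1 d2 * φ with hφ'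
  have hφe : ∀ z, φ' z = σ' (α z) := fun z => rfl
  have sA' : ∀ z ∈ A, σ' z ∈ A := by
    intro z hz
    rw [hσ', Perm.mul_apply]
    by_cases e1 : σ z = d1
    · rw [e1, swap_apply_left]; exact h2
    by_cases e2 : σ z = d2
    · rw [e2, swap_apply_right]; exact h1
    rw [swap_apply_of_ne_of_ne e1 e2]; exact h.sA z hz
  have ss0 : ∀ z ∈ A, src (σ' z) = src z := by
    intro z hz
    rw [hσ', Perm.mul_apply]
    by_cases e1 : σ z = d1
    · rw [e1, swap_apply_left, ← h.ss z hz, e1, s1, s2]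
    by_cases e2 : σ z = d2
    · rw [e2, swap_apply_right, ← h.ss z hz, e2, s1, s2]
    rw [swap_apply_of_ne_of_ne e1 e2]; exact h.ss z hz
  have ss' : ∀ z ∈ A, ssrc σ' src v d1 (σ' z) = ssrc σ' src v d1 z := by
    intro z hz
    unfold ssrc
    rw [ss0 z hz]
    simp only [Perm.sameCycle_apply_right]
  have link' : ∀ Y : D → ZMod 2, (∀ z ∈ A, Y (σ' z) = Y z) → ∀ d ∈ A, ∀ d' ∈ A,
      ssrc σ' src v d1 d = ssrc σ' src v d1 d' → Y d = Y d' := fun Y hY =>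
    link_split h.link h.ss h1 h2 s1 s2 Y hY (fun z hz => (const_cycle sA' hY h1 z hz).1)
  have hIX : ∀ X, IX α A σ X → IX α A σ' X := by
    intro X hX z hz
    rw [← hX z hz, hσ', Perm.mul_apply]
    by_cases e1 : σ (α z) = d1
    · rw [e1, swap_apply_left, orb X hX]
    by_cases e2 : σ (α z) = d2
    · rw [e2, swap_apply_right, orb X hX]
    rw [swap_apply_of_ne_of_ne e1 e2]
  have ev' : ∀ X, IX α A σ' X → ∀ o, sm A (ssrc σ' src v d1) (fun d => X d + X (α d)) o = 0 :=
    fun X hX o => even h.inv h.cl sA' ss' hX o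
  have toZ : ∀ c, (∀ o, sm A (ssrc σ' src v d1) c o = 0) → ∀ u, sm A src c u = 0 := by
    intro c hc u
    by_cases hu : u = v
    · rw [hu, sm_ssrc σ' v d1, hc, hc, add_zero]
    · rw [sm_ssrc' σ' hu d1, hc]
  -- the new face
  let W : D → ZMod 2 := fun z => if φ'.SameCycle d1 z then 1 else 0
  have W1 : W d1 = 1 := if_pos (Perm.SameCycle.refl _ _)
  have W2 : W d2 = 0 := if_neg n2
  have hW : IX α A σ' W := by
    intro z hz
    show (if φ'.SameCycle d1 (σ' (α z)) then (1 : ZMod 2) else 0) = if φ'.SameCycle d1 z then 1 else 0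
    rw [← hφe]
    simp only [Perm.sameCycle_apply_right]
  let w : D → ZMod 2 := fun d => if d ∈ A then W d + W (α d) else 0
  have smw : ∀ o, sm A (ssrc σ' src v d1) w o = 0 := by
    intro o
    rw [← ev' W hW o]
    unfold sm
    refine Finset.sum_congr rfl fun e he => ?_
    simp [w, he]
  have clA : ∀ d, α d ∈ A ↔ d ∈ A := fun d => ⟨fun hd => by rw [← h.inv d]; exact h.cl _ hd, h.cl d⟩
  have cw : Cyc α A src w := by
    refine ⟨fun d => ?_, fun d hd => if_neg hd, toZ w smw⟩
    simp only [w, clA, h.inv]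
    rw [add_comm]
  have hLw : ¬ (L 0 w = 0 ∧ L 1 w = 0) := by
    rintro ⟨l0, l1⟩
    obtain ⟨X, hX, hX'⟩ := h.full w cw.1 cw.2.1 cw.2.2 (by intro i; fin_cases i; exacts [l0, l1])
    have hXi := hIX X hX
    let U : D → ZMod 2 := fun z => W z + X z
    have U1 : ∀ z ∈ A, U (α z) = U z := by
      intro z hz
      have := hX' z hz
      simp only [w, hz, if_true] at this
      have aux : ∀ a b c d : ZMod 2, a + b = c + d → b + d = a + c := by decide
      exact aux _ _ _ _ this
    have U2 : ∀ z ∈ A, U (σ' z) = U z := by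
      intro z hz
      have e1 := hW _ (h.cl z hz)
      have e2 := hXi _ (h.cl z hz)
      rw [h.inv] at e1 e2
      rw [← U1 z hz]
      show W _ + X _ = W _ + X _
      rw [e1, e2]
    have hl := link' U U2
    let Y : V → ZMod 2 := fun u => if ∃ d ∈ A, src d = u ∧ U d = 1 then 1 else 0
    have hY : ∀ d ∈ A, src d ≠ v → Y (src d) = U d := by
      intro d hd hdv
      show (if ∃ d' ∈ A, src d' = src d ∧ U d' = 1 then (1 : ZMod 2) else 0) = U d
      split_ifs with hx
      · obtain ⟨d', hd', e1, e2⟩ := hx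
        rw [← e2]
        refine hl d' hd' d hd ?_
        simp [ssrc, e1, hdv]
      · rcases z2 (U d) with e | e
        · exact e.symm
        · exact absurd ⟨d, hd, rfl, e⟩ hx
    have nv1 := nol d1 h1 s1
    have nv2 := nol d2 h2 s2
    have := conn Y (fun d hd e1 e2 => by rw [hY d hd e1, hY _ (h.cl d hd) e2, U1 d hd]) _ (h.cl _ h1) _ (h.cl _ h2) nv1 nv2
    rw [hY _ (h.cl _ h1) nv1, hY _ (h.cl _ h2) nv2, U1 _ h1, U1 _ h2] at this
    change W d1 + X d1 = W d2 + X d2 at this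
    rw [W1, W2, orb X hX] at this
    have aux : ∀ a : ZMod 2, 1 + a ≠ 0 + a := by decide
    exact aux _ this
  -- a cycle crossing
  obtain ⟨c0, k0, kq⟩ : ∃ c0, Cyc α A src c0 ∧ sm A (ssrc σ' src v d1) c0 none = 1 := by
    have nv1 := nol d1 h1 s1
    have nv2 := nol d2 h2 s2
    obtain ⟨c, c1, c2, c3, c4⟩ := join h.inv h.ne h.cl conn (h.cl _ h1) (h.cl _ h2) nv1 nv2
    refine ⟨fun z => c z + (((if z = d1 then 1 else 0) + (if z = α d1 then 1 else 0)) +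
      ((if z = d2 then 1 else 0) + (if z = α d2 then 1 else 0))), ⟨?_, ?_, ?_⟩, ?_⟩
    · intro z
      have e1 : ∀ d, α z = d ↔ z = α d := fun d => ⟨fun h' => by rw [← h', h.inv], fun h' => by rw [h', h.inv]⟩
      beta_reduce
      rw [c1]; simp only [e1, h.inv]; ring
    · intro z hz
      have e1 : z ≠ d1 := fun h' => hz (h' ▸ h1)
      have e2 : z ≠ α d1 := fun h' => hz (h' ▸ h.cl d1 h1)
      have e3 : z ≠ d2 := fun h' => hz (h' ▸ h2)
      have e4 : z ≠ α d2 := fun h' => hz (h' ▸ h.cl d2 h2)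
      simp [e1, e2, e3, e4, c2 z hz]
    · intro u
      rw [sm_add, sm_add, sm_add, sm_add, sm_ind d1 h1, sm_ind _ (h.cl d1 h1), sm_ind d2 h2, sm_ind _ (h.cl d2 h2), c4, s1, s2]
      have : ∀ x y z : ZMod 2, x + y + (z + x + (z + y)) = 0 := by decide
      exact this _ _ _
    · have z1 : sm A (ssrc σ' src v d1) c none = 0 := by
        unfold sm
        refine Finset.sum_eq_zero fun e he => ?_
        by_cases hev : src e = v
        · simp [c3 e hev]
        · simp [ssrc, hev]
      rw [sm_add, sm_add, sm_add, sm_add, sm_ind d1 h1, sm_ind _ (h.cl d1 h1), sm_ind d2 h2, sm_ind _ (h.cl d2 h2), z1]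
      simp [ssrc, s1, s2, nv1, nv2, n1, Perm.SameCycle.refl]
  have crit : ∀ z, Cyc α A src z → L 0 z = 0 ∧ L 1 z = 0 → sm A (ssrc σ' src v d1) z none = 0 := by
    rintro z hz ⟨l0, l1⟩
    obtain ⟨X, hX, hX'⟩ := h.full z hz.1 hz.2.1 hz.2.2 (by intro i; fin_cases i; exacts [l0, l1])
    rw [← ev' X (hIX X hX) none]
    unfold sm
    exact Finset.sum_congr rfl fun e he => by rw [hX' e he]
  refine ⟨σ', ssrc σ' src v d1, fun i => i.elim, ⟨h.inv, h.ne, h.cl, sA', ss', link', fun i => i.elim, ?_⟩, ?_, ?_, ?_, ?_⟩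
  · intro c c1 c2 c3 _
    have hc : Cyc α A src c := ⟨c1, c2, toZ c c3⟩
    have e3 := c3 none
    have e4 := smw none
    rcases vec2 (L 0 c) (L 1 c) (L 0 w) (L 1 w) (L 0 c0) (L 1 c0) hLw with l | l | l | l | l | l
    · obtain ⟨X, hX, hX'⟩ := h.full c hc.1 hc.2.1 hc.2.2 (by intro i; fin_cases i; exacts [l.1, l.2])
      exact ⟨X, hIX X hX, hX'⟩
    · have hcw := hc.add cw
      obtain ⟨X, hX, hX'⟩ := h.full _ hcw.1 hcw.2.1 hcw.2.2 (by
        intro i; rw [h.lin]; fin_cases i; exacts [l.1, l.2])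
      refine ⟨fun z => X z + W z, fun d hd => ?_, fun d hd => ?_⟩
      · beta_reduce
        rw [hIX X hX d hd, hW d hd]
      · have := hX' d hd
        simp only [w, hd, if_true] at this
        have aux : ∀ c a b x y : ZMod 2, c + (a + b) = x + y → c = x + a + (y + b) := by decide
        exact aux _ _ _ _ _ this
    · have := crit c0 k0 l
      rw [kq] at this; exact absurd this (by decide)
    · have := crit _ (k0.add hc) (by rw [h.lin, h.lin]; exact l)
      rw [sm_add, kq, e3] at this; exact absurd this (by decide)
    · have := crit _ (k0.add cw) (by rw [h.lin, h.lin]; exact l)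
      rw [sm_add, kq, e4] at this; exact absurd this (by decide)
    · have := crit _ (k0.add (hc.add cw)) (by rw [h.lin, h.lin, h.lin, h.lin]; exact l)
      rw [sm_add, sm_add, kq, e3, e4] at this; exact absurd this (by decide)
  · simp [ssrc, s1, Perm.SameCycle.refl]
  · simp [ssrc, s2, n1]
  · intro d hd; simp [ssrc, hd]
  · intro d hd
    simp only [ssrc, hd, if_true]
    split_ifs <;> simp

end CM

namespace CM
open DS Equiv

variable {D V ι : Type} [DecidableEq D] [DecidableEq V]
variable {α : D → D} {A : Finset D} {σ : Perm D} {src : D → V}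

theorem Mp.iA {L : ι → (D → ZMod 2) → ZMod 2} (h : Mp α A σ src L) (d : D) : α d ∈ A ↔ d ∈ A :=
  ⟨fun hd => by rw [← h.inv d]; exact h.cl _ hd, h.cl d⟩

theorem del_extend [Finite D] {L : ι → (D → ZMod 2) → ZMod 2} (h : Mp α A σ src L) {d : D} (hd : d ∈ A) (hnl : src d ≠ src (α d))
    (ha : σ (α d) ≠ α d) (hcase : σ d = d ∨ ∃ Z, IX α A σ Z ∧ Z d ≠ Z (α d)) {X' : D → ZMod 2}
    (hX' : IX α (del α A d) (skip2 α σ d) X') :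
    ∃ X, IX α A σ X ∧ (∀ e ∈ del α A d, X e = X' e) ∧ X d = X (α d) := by
  have hd1 := h.cl d hd
  have a1 : σ (α d) ≠ d := fun e => hnl (by rw [← h.ss _ hd1, e])
  have a2 : σ d ≠ α d := fun e => hnl (by rw [← h.ss _ hd, e])
  let X : D → ZMod 2 := fun e => if e = d ∨ e = α d then X' (σ (α d)) else X' e
  have Xd : X d = X' (σ (α d)) := by simp [X]
  have Xad : X (α d) = X' (σ (α d)) := by simp [X]
  have Xo : ∀ e, e ≠ d → e ≠ α d → X e = X' e := fun e h1 h2 => by simp [X, h1, h2]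
  have sk1 : ∀ e, e ≠ d → e ≠ α d → σ e = d → skip2 α σ d e = σ d := by
    intro e e1 e2 e3
    rw [skip2, skip_apply, if_neg e2, skip_apply, if_neg e1, if_pos e3, if_neg a2]
  have sk2 : ∀ e, e ≠ d → e ≠ α d → σ e = α d → skip2 α σ d e = σ (α d) := by
    intro e e1 e2 e3
    have e4 : σ e ≠ d := by rw [e3]; exact h.ne d
    rw [skip2, skip_apply, if_neg e2, skip_apply, if_neg e1, if_neg e4, if_pos e3, skip_apply, if_neg (h.ne d), if_neg a1]
  have sk3 : ∀ e, e ≠ d → e ≠ α d → σ e ≠ d → σ e ≠ α d → skip2 α σ d e = σ e := by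
    intro e e1 e2 e3 e4
    rw [skip2, skip_apply, if_neg e2, skip_apply, if_neg e1, if_neg e3, if_neg e4]
  have oth : ∀ z ∈ A, z ≠ d → z ≠ α d → α z ≠ d ∧ α z ≠ α d ∧ X' (skip2 α σ d (α z)) = X' z := by
    intro z hz z1 z2
    refine ⟨fun e => z2 (by rw [← e, h.inv]), fun e => z1 (by rw [← h.inv z, e, h.inv]), hX' z (mem_del.2 ⟨z2, z1, hz⟩)⟩
  have key : σ d ≠ d → X d = X (σ d) := by
    intro hs
    obtain ⟨Z, hZ, hZd⟩ := hcase.resolve_left hs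
    refine merge (A := A) (π := σ * aP α h.inv) (fun z hz => h.sA _ (h.cl z hz)) hd (Z := Z) hZ ?_ ?_
    · have := hZ _ hd1
      rw [h.inv] at this
      rw [this]; exact hZd
    · intro z hz
      show X (swap d (σ d) (σ (α z))) = X z
      by_cases z1 : z = d
      · rw [z1, swap_apply_of_ne_of_ne a1 (fun e => h.ne d (σ.injective e)), Xd, Xo _ a1 ha]
      by_cases z2 : z = α d
      · rw [z2, h.inv, swap_apply_right, Xd, Xad]
      obtain ⟨o1, o2, o3⟩ := oth z hz z1 z2
      rw [Xo z z1 z2, ← o3]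
      by_cases e1 : σ (α z) = d
      · rw [sk1 _ o1 o2 e1, e1, swap_apply_left, Xo _ hs a2]
      by_cases e2 : σ (α z) = α d
      · rw [sk2 _ o1 o2 e2, e2, swap_apply_of_ne_of_ne (h.ne d) (Ne.symm a2), Xad]
      rw [sk3 _ o1 o2 e1 e2, swap_apply_of_ne_of_ne e1 (fun e => o1 (σ.injective e)), Xo _ e1 e2]
  refine ⟨X, fun z hz => ?_, fun e he => Xo e (mem_del.1 he).2.1 (mem_del.1 he).1, by rw [Xd, Xad]⟩
  by_cases z1 : z = d
  · rw [z1, Xd, Xo _ a1 ha]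
  by_cases z2 : z = α d
  · rw [z2, h.inv]
    by_cases hs : σ d = d
    · rw [hs, Xd, Xad]
    · rw [← key hs, Xd, Xad]
  obtain ⟨o1, o2, o3⟩ := oth z hz z1 z2
  rw [Xo z z1 z2, ← o3]
  by_cases e1 : σ (α z) = d
  · have hs : σ d ≠ d := fun e => o1 (σ.injective (e1.trans e.symm))
    rw [sk1 _ o1 o2 e1, e1, key hs, Xo _ hs a2]
  by_cases e2 : σ (α z) = α d
  · rw [sk2 _ o1 o2 e2, e2, Xad]
  rw [sk3 _ o1 o2 e1 e2, Xo _ e1 e2]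

theorem ctr_extend {L : ι → (D → ZMod 2) → ZMod 2} (h : Mp α A σ src L) {d : D} (hd : d ∈ A) (hnl : src d ≠ src (α d))
    (ha : σ (α d) ≠ α d) (hb : σ d ≠ d) {X' : D → ZMod 2}
    (hX' : IX α (del α A d) (ctr α σ d) X') :
    ∃ X, IX α A σ X ∧ (∀ e ∈ del α A d, X e = X' e) := by
  have hd1 := h.cl d hd
  have a1 : σ (α d) ≠ d := fun e => hnl (by rw [← h.ss _ hd1, e])
  have a2 : σ d ≠ α d := fun e => hnl (by rw [← h.ss _ hd, e])
  have t1 : (σ * swap d (α d)) d = σ (α d) := by simp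
  have t2 : (σ * swap d (α d)) (α d) = σ d := by simp
  have t3 : ∀ z, z ≠ d → z ≠ α d → (σ * swap d (α d)) z = σ z := by
    intro z h1 h2
    rw [Perm.mul_apply, swap_apply_of_ne_of_ne h1 h2]
  let X : D → ZMod 2 := fun e => if e = d then X' (σ (α d)) else if e = α d then X' (σ d) else X' e
  have Xd : X d = X' (σ (α d)) := by simp [X]
  have Xad : X (α d) = X' (σ d) := by simp [X, h.ne d]
  have Xo : ∀ e, e ≠ d → e ≠ α d → X e = X' e := fun e h1 h2 => by simp [X, h1, h2]
  have sk1 : ∀ e, e ≠ d → e ≠ α d → σ e = d → ctr α σ d e = σ (α d) := by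
    intro e e1 e2 e3
    rw [ctr, skip2, skip_apply, if_neg e2, skip_apply, if_neg e1, t3 e e1 e2, if_pos e3, t1, if_neg ha]
  have sk2 : ∀ e, e ≠ d → e ≠ α d → σ e = α d → ctr α σ d e = σ d := by
    intro e e1 e2 e3
    have e4 : σ e ≠ d := by rw [e3]; exact h.ne d
    rw [ctr, skip2, skip_apply, if_neg e2, skip_apply, if_neg e1, t3 e e1 e2, if_neg e4, if_pos e3, skip_apply, if_neg (h.ne d), t2,
      if_neg hb]
  have sk3 : ∀ e, e ≠ d → e ≠ α d → σ e ≠ d → σ e ≠ α d → ctr α σ d e = σ e := by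
    intro e e1 e2 e3 e4
    rw [ctr, skip2, skip_apply, if_neg e2, skip_apply, if_neg e1, t3 e e1 e2, if_neg e3, if_neg e4]
  refine ⟨X, fun z hz => ?_, fun e he => Xo e (mem_del.1 he).2.1 (mem_del.1 he).1⟩
  by_cases z1 : z = d
  · rw [z1, Xd, Xo _ a1 ha]
  by_cases z2 : z = α d
  · rw [z2, h.inv, Xad, Xo _ hb a2]
  have o1 : α z ≠ d := fun e => z2 (by rw [← e, h.inv])
  have o2 : α z ≠ α d := fun e => z1 (by rw [← h.inv z, e, h.inv])
  have o3 := hX' z (mem_del.2 ⟨z2, z1, hz⟩)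
  rw [Xo z z1 z2, ← o3]
  by_cases e1 : σ (α z) = d
  · rw [sk1 _ o1 o2 e1, e1, Xd]
  by_cases e2 : σ (α z) = α d
  · rw [sk2 _ o1 o2 e2, e2, Xad]
  rw [sk3 _ o1 o2 e1 e2, Xo _ e1 e2]

theorem Mp.fix {L : ι → (D → ZMod 2) → ZMod 2} (h : Mp α A σ src L) {d e : D} (hd : d ∈ A) (he : e ∈ A) (hs : src e = src d)
    (hf : σ d = d) : e = d := by
  have := h.link (fun z => if z = d then 1 else 0) (fun z _ => by
    have : σ z = d ↔ z = d := ⟨fun h => σ.injective (h.trans hf.symm), fun h => by rw [h, hf]⟩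
    simp [this]) d hd e he hs.symm
  by_contra hc
  simp [hc] at this

theorem Mp.spokes [Finite D] {L : Fin 2 → (D → ZMod 2) → ZMod 2} (x : V) (n : ℕ) : ∀ (A : Finset D) (σ : Perm D), Mp α A σ src L →
    (∀ d ∈ A, src d = x → src (α d) ≠ x) → Conn α A src x →
    (∀ d ∈ A, src d = x → ∃ e ∈ A, src e = src (α d) ∧ src (α e) ≠ x) → A.card < n →
    (∃ (σ' : Perm D) (L' : Empty → (D → ZMod 2) → ZMod 2), Mp α (A.filter fun d => src d ≠ x ∧ src (α d) ≠ x) σ' src L') ∨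
    ∃ σ', Mp α (A.filter fun d => src d ≠ x ∧ src (α d) ≠ x) σ' src L ∧
      ∀ X', IX α (A.filter fun d => src d ≠ x ∧ src (α d) ≠ x) σ' X' → ∃ X s, IX α A σ X ∧
        (∀ e ∈ A.filter (fun d => src d ≠ x ∧ src (α d) ≠ x), X e = X' e) ∧ ∀ d ∈ A, src d = x → X d = s ∧ X (α d) = s := by
  induction n with
  | zero => intro A σ _ _ _ _ h; omega
  | succ n ih =>
    intro A σ h nol conn deg hn
    by_cases hx : ∃ d ∈ A, src d = x
    swap
    · push Not at hx
      have hR : A.filter (fun d => src d ≠ x ∧ src (α d) ≠ x) = A := by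
        rw [Finset.filter_eq_self]
        exact fun d hd => ⟨hx d hd, hx _ (h.cl d hd)⟩
      right
      rw [hR]
      exact ⟨σ, h, fun X hX => ⟨X, 0, hX, fun _ _ => rfl, fun d hd hdx => absurd hdx (hx d hd)⟩⟩
    obtain ⟨d, hd, hdx⟩ := hx
    have hd1 := h.cl d hd
    have hnx := nol d hd hdx
    have hnl : src d ≠ src (α d) := by rw [hdx]; exact Ne.symm hnx
    have ha : σ (α d) ≠ α d := by
      intro hf
      obtain ⟨e, he, e1, e2⟩ := deg d hd hdx
      have := h.fix hd1 he e1 hf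
      rw [this, h.inv] at e2
      exact e2 hdx
    by_cases hcase : σ d = d ∨ ∃ Z, IX α A σ Z ∧ Z d ≠ Z (α d)
    · have hRe : (del α A d).filter (fun d => src d ≠ x ∧ src (α d) ≠ x) = A.filter (fun d => src d ≠ x ∧ src (α d) ≠ x) := by
        ext e
        rw [Finset.mem_filter, Finset.mem_filter, mem_del]
        refine ⟨fun he => ⟨he.1.2.2, he.2⟩, fun he => ⟨⟨?_, ?_, he.1⟩, he.2⟩⟩
        · rintro rfl; rw [h.inv] at he; exact he.2.2 hdx
        · rintro rfl; exact he.2.1 hdx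
      have nodel : ∀ e ∈ A, src e ≠ x → src (α e) ≠ x → e ∈ del α A d := by
        intro e he h1 h2
        have : e ∈ (del α A d).filter (fun d => src d ≠ x ∧ src (α d) ≠ x) := by
          rw [hRe, Finset.mem_filter]; exact ⟨he, h1, h2⟩
        exact (Finset.mem_filter.1 this).1
      have ih' := ih (del α A d) (skip2 α σ d) (h.delete hd) (fun e he => nol e (mem_del.1 he).2.2)
        (fun Y hY e he e' he' => conn Y (fun z hz h1 h2 => hY z (nodel z hz h1 h2) h1 h2) e (mem_del.1 he).2.2 e' (mem_del.1 he').2.2)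
        (fun e he hex => by
          obtain ⟨z, hz, z1, z2⟩ := deg e (mem_del.1 he).2.2 hex
          exact ⟨z, nodel z hz (by rw [z1]; exact nol e (mem_del.1 he).2.2 hex) z2, z1, z2⟩)
        (by have := card_del h.ne hd hd1; omega)
      rw [hRe] at ih'
      rcases ih' with ih' | ⟨σ', hm, hext⟩
      · exact Or.inl ih'
      · right
        refine ⟨σ', hm, fun X' hX' => ?_⟩
        obtain ⟨X1, s, i1, i2, i3⟩ := hext X' hX'
        obtain ⟨X, j1, j2, j3⟩ := del_extend h hd hnl ha hcase i1
        by_cases hs : σ d = d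
        · refine ⟨X, X d, j1, fun e he => ?_, fun e he hex => ?_⟩
          · rw [← i2 e he]; rw [← hRe] at he; exact j2 e (Finset.mem_filter.1 he).1
          · have := h.fix hd he (hex.trans hdx.symm) hs
            rw [this]; exact ⟨rfl, j3.symm⟩
        · refine ⟨X, s, j1, fun e he => ?_, fun e he hex => ?_⟩
          · rw [← i2 e he]; rw [← hRe] at he; exact j2 e (Finset.mem_filter.1 he).1
          · have hal : ∀ e ∈ A, src e = x → e ≠ d → e ∈ del α A d := by
              intro e he hex hed
              rw [mem_del]
              exact ⟨fun h' => hnx (h' ▸ hex), hed, he⟩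
            by_cases hed : e = d
            · have k1 := j1 _ hd1
              rw [h.inv] at k1
              have hsx : src (σ d) = x := by rw [h.ss d hd, hdx]
              have hsd := hal _ (h.sA d hd) hsx hs
              have k2 := (i3 _ hsd hsx).1
              rw [← j2 _ hsd, k1] at k2
              rw [hed, j3]
              exact ⟨k2, k2⟩
            · have hed' := hal e he hex hed
              rw [j2 e hed', j2 _ (del_cl h.inv h.cl d e hed')]
              exact i3 e hed' hex
    · left
      push Not at hcase
      obtain ⟨hs, hZ⟩ := hcase
      obtain ⟨σ', src', L', hm, q1, q2, q3, q4⟩ := h.split hd (h.sA d hd) (Ne.symm hs) hdx (by rw [h.ss d hd, hdx]) (fun X hX => by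
        have := hX _ hd1
        rw [h.inv] at this
        rw [this]; exact hZ X hX) nol conn
      obtain ⟨σ2, hm2⟩ := Mp.restrict (A.card + 1) A σ' hm (A.filter fun d => src d ≠ x ∧ src (α d) ≠ x) (Finset.filter_subset _ _)
        (fun e he => by
          rw [Finset.mem_filter] at he ⊢
          rw [h.inv]; exact ⟨h.cl e he.1, he.2.2, he.2.1⟩) (by omega)
      refine ⟨σ2, L', hm2.congrSrc src fun e he e' he' => ?_⟩
      rw [q3 e (Finset.mem_filter.1 he).2.1, q3 e' (Finset.mem_filter.1 he').2.1]
      exact ⟨fun h => Option.some.inj h, fun h => by rw [h]⟩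

end CM

namespace CM
open DS Equiv

variable {D V ι : Type} [DecidableEq D] [DecidableEq V]
variable {α : D → D} {A : Finset D} {σ : Perm D} {src : D → V}

theorem Mp.contractExt [Finite D] {V' : Type} [DecidableEq V'] (γ : V → V') (Yv : V → Prop) (K : Finset D) (hKα : ∀ d ∈ K, α d ∈ K)
    (n : ℕ) : ∀ (A : Finset D) (σ : Perm D) (src : D → V) (L : ι → (D → ZMod 2) → ZMod 2), Mp α A σ src L → K ⊆ A →
    (∀ z ∈ A, z ∉ K → γ (src z) = γ (src (α z)) ∧ (Yv (src z) ∨ Yv (src (α z))) ∧ ¬ (Yv (src z) ∧ Yv (src (α z)))) →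
    (∀ z ∈ A, z ∉ K → ∀ z' ∈ A, z' ∉ K → Yv (src z) → src z = src z' → z = z') →
    (∀ z ∈ A, Yv (src z) → ∃ g ∈ A, g ∉ K ∧ src g = src z) →
    (∀ z ∈ A, ∀ z' ∈ A, ¬ Yv (src z) → ¬ Yv (src z') → γ (src z) = γ (src z') → src z = src z') →
    (∀ z ∈ A, ∃ z' ∈ A, z' ≠ z ∧ src z' = src z) → A.card < n →
    ∃ (σ' : Perm D) (L' : ι → (D → ZMod 2) → ZMod 2), Mp α K σ' (fun d => γ (src d)) L' ∧
      ∀ X', IX α K σ' X' → ∃ X, IX α A σ X ∧ ∀ e ∈ K, X e = X' e := by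
  induction n with
  | zero => intro A σ src L _ _ _ _ _ _ _ h; omega
  | succ n ih =>
    intro A σ src L h hKA h1 h2 h3 h4 deg hn
    by_cases hA : A = K
    · subst hA
      have hnY : ∀ z ∈ A, ¬ Yv (src z) := fun z hz hy => by
        obtain ⟨g, g1, g2, -⟩ := h3 z hz hy
        exact g2 g1
      exact ⟨σ, L, h.congrSrc _ fun d hd d' hd' => ⟨fun h => by rw [h], h4 d hd d' hd' (hnY d hd) (hnY d' hd')⟩,
        fun X hX => ⟨X, hX, fun _ _ => rfl⟩⟩
    obtain ⟨g, hg, hgK, hgY⟩ : ∃ g ∈ A, g ∉ K ∧ Yv (src g) := by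
      obtain ⟨d, hd, hdK⟩ : ∃ d ∈ A, d ∉ K := by
        by_contra hc
        push Not at hc
        exact hA (Finset.Subset.antisymm hc hKA)
      rcases (h1 d hd hdK).2.1 with hy | hy
      · exact ⟨d, hd, hdK, hy⟩
      · exact ⟨α d, h.cl d hd, fun hk => hdK (by rw [← h.inv d]; exact hKα _ hk), hy⟩
    obtain ⟨γg, -, hnY⟩ := h1 g hg hgK
    have hgu : ¬ Yv (src (α g)) := fun hy => hnY ⟨hgY, hy⟩
    have hne : src g ≠ src (α g) := fun e => hgu (e ▸ hgY)
    have hg1 := h.cl g hg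
    have hg1K : α g ∉ K := fun hk => hgK (by rw [← h.inv g]; exact hKα _ hk)
    have hmd : ∀ z, z ∈ del α A (α g) ↔ z ≠ g ∧ z ≠ α g ∧ z ∈ A := by
      intro z; rw [mem_del, h.inv]
    have hcs : ∀ z, csrc α src (α g) z = if src z = src g then src (α g) else src z := by
      intro z; unfold csrc; rw [h.inv]
    have hcsY : ∀ z, Yv (csrc α src (α g) z) → csrc α src (α g) z = src z ∧ src z ≠ src g := by
      intro z hz
      rw [hcs] at hz ⊢
      split_ifs at hz ⊢ with h5
      · exact absurd hz hgu
      · exact ⟨rfl, h5⟩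
    have hcsN : ∀ z, ¬ Yv (src z) → csrc α src (α g) z = src z := by
      intro z hz
      rw [hcs, if_neg]
      intro e; rw [e] at hz; exact hz hgY
    have hcsO : ∀ z, src z ≠ src g → csrc α src (α g) z = src z := fun z hz => by rw [hcs, if_neg hz]
    have hγ : ∀ z, γ (csrc α src (α g) z) = γ (src z) := by
      intro z
      rw [hcs]
      split_ifs with h5
      · rw [h5, γg]
      · rfl
    have hKd : K ⊆ del α A (α g) := by
      intro e he
      rw [hmd]
      exact ⟨fun h' => hgK (h' ▸ he), fun h' => hg1K (h' ▸ he), hKA he⟩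
    have rem : ∀ z ∈ del α A (α g), z ∉ K → csrc α src (α g) z = src z := by
      intro z hz hzK
      rw [hmd] at hz
      apply hcsO
      intro e
      exact hz.1 (h2 g hg hgK z hz.2.2 hzK hgY e.symm).symm
    have remα : ∀ z ∈ del α A (α g), z ∉ K → csrc α src (α g) (α z) = src (α z) := by
      intro z hz hzK
      refine rem _ (del_cl h.inv h.cl _ z hz) fun hk => hzK (by rw [← h.inv z]; exact hKα _ hk)
    have hnl' : src (α g) ≠ src (α (α g)) := by rw [h.inv]; exact Ne.symm hne
    have ih' := ih _ _ _ _ (h.contract hg1 hnl') hKd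
      (fun z hz hzK => by
        rw [rem z hz hzK, remα z hz hzK]
        exact h1 z ((hmd z).1 hz).2.2 hzK)
      (fun z hz hzK z' hz' hzK' => by
        rw [rem z hz hzK, rem z' hz' hzK']
        exact h2 z ((hmd z).1 hz).2.2 hzK z' ((hmd z').1 hz').2.2 hzK')
      (fun z hz hy => by
        obtain ⟨e1, e2⟩ := hcsY z hy
        rw [e1] at hy
        obtain ⟨g', g1, g2, g3⟩ := h3 z ((hmd z).1 hz).2.2 hy
        refine ⟨g', (hmd g').2 ⟨fun e => e2 (by rw [← g3, e]), fun e => hgu (by rw [← e, g3]; exact hy), g1⟩, g2, ?_⟩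
        rw [e1, hcsO _ (by rw [g3]; exact e2), g3])
      (fun z hz z' hz' y y' hzz => by
        rw [hγ, hγ] at hzz
        have key : ∀ z ∈ A, ¬ Yv (csrc α src (α g) z) → ∃ w ∈ A, ¬ Yv (src w) ∧ src w = csrc α src (α g) z ∧ γ (src w) = γ (src z) := by
          intro z hz hy
          by_cases e : src z = src g
          · exact ⟨α g, hg1, hgu, by rw [hcs, if_pos e], by rw [e, γg]⟩
          · exact ⟨z, hz, by rwa [hcsO z e] at hy, (hcsO z e).symm, rfl⟩
        obtain ⟨w, w1, w2, w3, w4⟩ := key z ((hmd z).1 hz).2.2 y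
        obtain ⟨w', w1', w2', w3', w4'⟩ := key z' ((hmd z').1 hz').2.2 y'
        rw [← w3, ← w3']
        exact h4 w w1 w' w1' w2 w2' (by rw [w4, w4', hzz]))
      (fun z hz => by
        rw [hmd] at hz
        by_cases e : src z = src g
        · obtain ⟨z', k1, k2, k3⟩ := deg _ hg1
          refine ⟨z', (hmd z').2 ⟨fun e' => hne (by rw [← k3, e']), k2, k1⟩, fun e' => hne (by rw [← e, ← e', k3]), ?_⟩
          rw [hcs z, if_pos e, hcsN z' (by rw [k3]; exact hgu), k3]
        by_cases e' : src z = src (α g)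
        · obtain ⟨z', k1, k2, k3⟩ := deg _ hg
          refine ⟨z', (hmd z').2 ⟨k2, fun e'' => hne (by rw [← k3, e'']), k1⟩, fun e'' => e (by rw [← e'', k3]), ?_⟩
          rw [hcsO z e, hcs z', if_pos k3, e']
        · obtain ⟨z', k1, k2, k3⟩ := deg z hz.2.2
          refine ⟨z', (hmd z').2 ⟨fun e'' => e (by rw [← k3, e'']), fun e'' => e' (by rw [← k3, e'']), k1⟩, k2, ?_⟩
          rw [hcsO z e, hcsO z' (by rw [k3]; exact e), k3])
      (by have := card_del h.ne hg1 (h.cl _ hg1); omega)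
    obtain ⟨σ', L', hm, hext⟩ := ih'
    refine ⟨σ', L', ?_, fun X' hX' => ?_⟩
    · simpa only [hγ] using hm
    · obtain ⟨X1, j1, j2⟩ := hext X' hX'
      have nofix : ∀ z ∈ A, σ z ≠ z := by
        intro z hz hf
        obtain ⟨z', k1, k2, k3⟩ := deg z hz
        exact k2 (h.fix hz k1 k3 hf)
      obtain ⟨X, i1, i2⟩ := ctr_extend h hg1 hnl' (nofix _ (h.cl _ hg1)) (nofix _ hg1) j1
      exact ⟨X, i1, fun e he => by rw [i2 e (hKd he), j2 e he]⟩

end CM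

namespace CM
open DS Equiv

variable {D V E : Type} [DecidableEq D] [DecidableEq V] [DecidableEq E]

structure GPl (α : D → D) (A : Finset D) (src : D → Option (V ⊕ E)) (a b : E → V) (S : Set E) (dart : E → Fin 3 → D) : Prop where
  mem : ∀ z, z ∈ A ↔ ∃ e k, (k = 2 → e ∈ S) ∧ (z = dart e k ∨ z = α (dart e k))
  s0 : ∀ e, src (dart e 0) = some (Sum.inl (a e))
  s1 : ∀ e, src (dart e 1) = some (Sum.inl (b e))
  s2 : ∀ e ∈ S, src (dart e 2) = none
  sy : ∀ e k, (k = 2 → e ∈ S) → src (α (dart e k)) = some (Sum.inr e)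

def gam (b : E → V) (v0 : V) : Option (V ⊕ E) → V
  | some (Sum.inl v) => v
  | some (Sum.inr e) => b e
  | none => v0

open Classical in
def kp (α : D → D) (A : Finset D) (dart : E → Fin 3 → D) : Finset D :=
  A.filter fun z => ∃ e, z = dart e 0 ∨ z = α (dart e 0)

variable {α : D → D} {A : Finset D} {σ : Perm D} {src : D → Option (V ⊕ E)} {a b : E → V} {S : Set E} {dart : E → Fin 3 → D}

theorem GPl.inR (g : GPl α A src a b S dart) (inv : ∀ d, α (α d) = d) (z : D) :
    z ∈ A.filter (fun d => src d ≠ none ∧ src (α d) ≠ none) ↔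
      ∃ e, (z = dart e 0 ∨ z = α (dart e 0)) ∨ (z = dart e 1 ∨ z = α (dart e 1)) := by
  rw [Finset.mem_filter, g.mem]
  constructor
  · rintro ⟨⟨e, k, hk, hz⟩, h1, h2⟩
    fin_cases k
    · exact ⟨e, Or.inl hz⟩
    · exact ⟨e, Or.inr hz⟩
    · exfalso
      have he : e ∈ S := hk rfl
      rcases hz with rfl | rfl
      · exact h1 (g.s2 e he)
      · rw [inv] at h2; exact h2 (g.s2 e he)
  · have y0 := fun e => g.sy e 0 (fun h => absurd h (by decide))
    have y1 := fun e => g.sy e 1 (fun h => absurd h (by decide))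
    rintro ⟨e, hz | hz⟩
    · refine ⟨⟨e, 0, fun h => absurd h (by decide), hz⟩, ?_⟩
      rcases hz with rfl | rfl
      · rw [g.s0, y0]; simp
      · rw [inv, g.s0, y0]; simp
    · refine ⟨⟨e, 1, fun h => absurd h (by decide), hz⟩, ?_⟩
      rcases hz with rfl | rfl
      · rw [g.s1, y1]; simp
      · rw [inv, g.s1, y1]; simp

theorem GPl.ctx {ι : Type} [Finite D] (g : GPl α A src a b S dart) (v0 : V) (hab : ∀ e, a e ≠ b e)
    (hdeg : ∀ e, (∃ e', e' ≠ e ∧ (a e' = a e ∨ b e' = a e)) ∧ (∃ e', e' ≠ e ∧ (a e' = b e ∨ b e' = b e)))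
    {L : ι → (D → ZMod 2) → ZMod 2} {σ : Perm D} (h : Mp α (A.filter (fun d => src d ≠ none ∧ src (α d) ≠ none)) σ src L) :
    ∃ (σ' : Perm D) (L' : ι → (D → ZMod 2) → ZMod 2), Mp α (kp α A dart) σ' (fun d => gam b v0 (src d)) L' ∧
      ∀ X', IX α (kp α A dart) σ' X' → ∃ X, IX α (A.filter (fun d => src d ≠ none ∧ src (α d) ≠ none)) σ X ∧
        ∀ e ∈ kp α A dart, X e = X' e := by
  have y0 := fun e => g.sy e 0 (fun h => absurd h (by decide))
  have y1 := fun e => g.sy e 1 (fun h => absurd h (by decide))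
  have inR := g.inR h.inv
  have inK : ∀ z, z ∈ kp α A dart ↔ ∃ e, z = dart e 0 ∨ z = α (dart e 0) := by
    intro z
    simp only [kp, Finset.mem_filter]
    refine ⟨fun h => h.2, fun h => ⟨?_, h⟩⟩
    obtain ⟨e, he⟩ := h
    exact (g.mem z).2 ⟨e, 0, fun h => absurd h (by decide), he⟩
  have d01 : ∀ e e', dart e 0 ≠ dart e' 1 := by
    intro e e' hh
    have h1 := congrArg (fun z => src (α z)) hh
    simp only [y0, y1, Option.some.injEq, Sum.inr.injEq] at h1
    subst h1
    have h2 := congrArg src hh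
    simp only [g.s0, g.s1, Option.some.injEq, Sum.inl.injEq] at h2
    exact hab _ h2
  have a01 : ∀ e e', α (dart e 0) ≠ α (dart e' 1) := by
    intro e e' hh
    exact d01 e e' (by rw [← h.inv (dart e 0), hh, h.inv])
  have x01 : ∀ e e', dart e 0 ≠ α (dart e' 1) := fun e e' hh => by
    have h1 := congrArg src hh
    simp [g.s0, y1] at h1
  have x10 : ∀ e e', dart e 1 ≠ α (dart e' 0) := fun e e' hh => by
    have h1 := congrArg src hh
    simp [g.s1, y0] at h1
  have k1 : ∀ e, dart e 1 ∉ kp α A dart := by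
    intro e
    rw [inK]
    rintro ⟨e', h1 | h1⟩
    · exact d01 _ _ h1.symm
    · exact x10 _ _ h1
  have k1' : ∀ e, α (dart e 1) ∉ kp α A dart := by
    intro e
    rw [inK]
    rintro ⟨e', h1 | h1⟩
    · exact x01 _ _ h1.symm
    · exact a01 _ _ h1.symm
  have notK : ∀ z ∈ A.filter (fun d => src d ≠ none ∧ src (α d) ≠ none), z ∉ kp α A dart → ∃ e, z = dart e 1 ∨ z = α (dart e 1) := by
    intro z hz hzK
    obtain ⟨e, he | he⟩ := (inR z).1 hz
    · exact absurd ((inK z).2 ⟨e, he⟩) hzK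
    · exact ⟨e, he⟩
  have r0 : ∀ e, dart e 0 ∈ A.filter (fun d => src d ≠ none ∧ src (α d) ≠ none) := fun e => (inR _).2 ⟨e, Or.inl (Or.inl rfl)⟩
  have r0' : ∀ e, α (dart e 0) ∈ A.filter (fun d => src d ≠ none ∧ src (α d) ≠ none) := fun e => (inR _).2 ⟨e, Or.inl (Or.inr rfl)⟩
  have r1 : ∀ e, dart e 1 ∈ A.filter (fun d => src d ≠ none ∧ src (α d) ≠ none) := fun e => (inR _).2 ⟨e, Or.inr (Or.inl rfl)⟩
  have r1' : ∀ e, α (dart e 1) ∈ A.filter (fun d => src d ≠ none ∧ src (α d) ≠ none) := fun e => (inR _).2 ⟨e, Or.inr (Or.inr rfl)⟩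
  have od : ∀ v, ∀ e z, (z = dart e 0 ∨ z = dart e 1) → (∃ e', e' ≠ e ∧ (a e' = v ∨ b e' = v)) →
      ∃ z' ∈ A.filter (fun d => src d ≠ none ∧ src (α d) ≠ none), z' ≠ z ∧ src z' = some (Sum.inl v) := by
    rintro v e z hz ⟨e', hne, h1 | h1⟩
    · refine ⟨dart e' 0, r0 e', ?_, by rw [g.s0, h1]⟩
      rintro rfl
      rcases hz with hz | hz
      · have := congrArg (fun z => src (α z)) hz
        simp only [y0, Option.some.injEq, Sum.inr.injEq] at this
        exact hne this
      · exact d01 _ _ hz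
    · refine ⟨dart e' 1, r1 e', ?_, by rw [g.s1, h1]⟩
      rintro rfl
      rcases hz with hz | hz
      · exact d01 _ _ hz.symm
      · have := congrArg (fun z => src (α z)) hz
        simp only [y1, Option.some.injEq, Sum.inr.injEq] at this
        exact hne this
  refine Mp.contractExt (gam b v0) (fun w => ∃ e, w = some (Sum.inr e)) (kp α A dart) ?_ _ _ σ src L h ?_ ?_ ?_ ?_ ?_ ?_ (Nat.lt_succ_self _)
  · intro d hd
    rw [inK] at hd ⊢
    obtain ⟨e, rfl | rfl⟩ := hd
    · exact ⟨e, Or.inr rfl⟩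
    · exact ⟨e, Or.inl (h.inv _)⟩
  · intro z hz
    obtain ⟨e, he⟩ := (inK z).1 hz
    exact (inR z).2 ⟨e, Or.inl he⟩
  · intro z hz hzK
    obtain ⟨e, rfl | rfl⟩ := notK z hz hzK
    · rw [g.s1, y1]; simp [gam]
    · rw [h.inv, g.s1, y1]; simp [gam]
  · rintro z hz hzK z' hz' hzK' ⟨e0, hy⟩ hs
    obtain ⟨e, rfl | rfl⟩ := notK z hz hzK
    · rw [g.s1] at hy; simp at hy
    obtain ⟨e', rfl | rfl⟩ := notK z' hz' hzK'
    · rw [g.s1, y1] at hs; simp at hs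
    · rw [y1, y1] at hs
      simp at hs
      rw [hs]
  · rintro z hz ⟨e, he⟩
    exact ⟨α (dart e 1), r1' e, k1' e, by rw [y1, he]⟩
  · intro z hz z' hz' n1 n2 hγ
    have key : ∀ z ∈ A.filter (fun d => src d ≠ none ∧ src (α d) ≠ none), (¬ ∃ e, src z = some (Sum.inr e)) → ∃ v, src z = some (Sum.inl v) := by
      intro z hz hn
      obtain ⟨e, (rfl | rfl) | (rfl | rfl)⟩ := (inR z).1 hz
      · exact ⟨_, g.s0 e⟩
      · exact absurd ⟨_, y0 e⟩ hn
      · exact ⟨_, g.s1 e⟩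
      · exact absurd ⟨_, y1 e⟩ hn
    obtain ⟨v, hv⟩ := key z hz n1
    obtain ⟨v', hv'⟩ := key z' hz' n2
    rw [hv, hv'] at hγ ⊢
    simp only [gam] at hγ
    rw [hγ]
  · intro z hz
    obtain ⟨e, (rfl | rfl) | (rfl | rfl)⟩ := (inR z).1 hz
    · rw [g.s0]; exact od _ e _ (Or.inl rfl) (hdeg e).1
    · exact ⟨_, r1' e, (a01 e e).symm, by rw [y0, y1]⟩
    · rw [g.s1]; exact od _ e _ (Or.inr rfl) (hdeg e).2
    · exact ⟨_, r0' e, a01 e e, by rw [y0, y1]⟩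

theorem GPl.main [Finite D] (g : GPl α A src a b S dart) (v0 : V) (hab : ∀ e, a e ≠ b e)
    (hconn : ∀ Y : V → ZMod 2, (∀ e, Y (a e) = Y (b e)) → ∀ u v, Y u = Y v)
    (hdeg : ∀ e, (∃ e', e' ≠ e ∧ (a e' = a e ∨ b e' = a e)) ∧ (∃ e', e' ≠ e ∧ (a e' = b e ∨ b e' = b e)))
    {L : Fin 2 → (D → ZMod 2) → ZMod 2} {σ : Perm D} (h : Mp α A σ src L) :
    (∃ (σ' : Perm D) (L' : Empty → (D → ZMod 2) → ZMod 2), Mp α (kp α A dart) σ' (fun d => gam b v0 (src d)) L') ∨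
    ∃ (σ' : Perm D) (L' : Fin 2 → (D → ZMod 2) → ZMod 2), Mp α (kp α A dart) σ' (fun d => gam b v0 (src d)) L' ∧
      ∃ t : E → D, (∀ e ∈ S, t e = dart e 0 ∨ t e = α (dart e 0)) ∧
        ∀ X, IX α (kp α A dart) σ' X → ∃ s, ∀ e ∈ S, X (t e) = s := by
  classical
  have y0 := fun e => g.sy e 0 (fun h => absurd h (by decide))
  have y1 := fun e => g.sy e 1 (fun h => absurd h (by decide))
  have mm : ∀ e k, (k = 2 → e ∈ S) → dart e k ∈ A := fun e k hk => (g.mem _).2 ⟨e, k, hk, Or.inl rfl⟩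
  have m0 := fun e => mm e 0 (fun h => absurd h (by decide))
  have m1 := fun e => mm e 1 (fun h => absurd h (by decide))
  have atx : ∀ z ∈ A, src z = none → ∃ e ∈ S, z = dart e 2 := by
    intro z hz hn
    obtain ⟨e, k, hk, rfl | rfl⟩ := (g.mem z).1 hz
    · fin_cases k
      · rw [show dart e ((fun i => i) ⟨0, by decide⟩) = dart e 0 from rfl, g.s0] at hn; simp at hn
      · rw [show dart e ((fun i => i) ⟨1, by decide⟩) = dart e 1 from rfl, g.s1] at hn; simp at hn
      · exact ⟨e, hk rfl, rfl⟩
    · rw [g.sy e k hk] at hn; simp at hn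
  have conn : Conn α A src none := by
    intro Y hY
    have e0 : ∀ e, Y (some (Sum.inl (a e))) = Y (some (Sum.inr e)) := by
      intro e
      have := hY (dart e 0) (m0 e) (by rw [g.s0]; simp) (by rw [y0]; simp)
      rwa [g.s0, y0] at this
    have e1 : ∀ e, Y (some (Sum.inl (b e))) = Y (some (Sum.inr e)) := by
      intro e
      have := hY (dart e 1) (m1 e) (by rw [g.s1]; simp) (by rw [y1]; simp)
      rwa [g.s1, y1] at this
    have hc := hconn (fun v => Y (some (Sum.inl v))) (fun e => by rw [e0, e1])
    have key : ∀ z ∈ A, src z ≠ none → Y (src z) = Y (some (Sum.inl v0)) := by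
      intro z hz hn
      rcases hs : src z with _ | (v | e)
      · exact absurd hs hn
      · exact hc v v0
      · rw [← e0]; exact hc _ v0
    intro d hd d' hd' n1 n2
    rw [key d hd n1, key d' hd' n2]
  have nol : ∀ d ∈ A, src d = none → src (α d) ≠ none := by
    intro d hd hn
    obtain ⟨e, he, rfl⟩ := atx d hd hn
    rw [g.sy e 2 (fun _ => he)]; simp
  have deg : ∀ d ∈ A, src d = none → ∃ e ∈ A, src e = src (α d) ∧ src (α e) ≠ none := by
    intro d hd hn
    obtain ⟨e, he, rfl⟩ := atx d hd hn
    exact ⟨α (dart e 0), h.cl _ (m0 e), by rw [y0, g.sy e 2 (fun _ => he)], by rw [h.inv, g.s0]; simp⟩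
  rcases Mp.spokes none (A.card + 1) A σ h nol conn deg (by omega) with ⟨σ', L', hm⟩ | ⟨σ', hm, hext⟩
  · left
    obtain ⟨σ2, L2, h2, -⟩ := g.ctx v0 hab hdeg hm
    exact ⟨σ2, L2, h2⟩
  · right
    obtain ⟨σ2, L2, h2, hext2⟩ := g.ctx v0 hab hdeg hm
    refine ⟨σ2, L2, h2, fun e => if σ (α (dart e 2)) = α (dart e 0) then α (dart e 0) else dart e 0, fun e he => ?_, fun X2 hX2 => ?_⟩
    · dsimp only; split_ifs <;> simp
    obtain ⟨X1, i1, i2⟩ := hext2 X2 hX2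
    obtain ⟨X, s, j1, j2, j3⟩ := hext X1 i1
    refine ⟨s, fun e he => ?_⟩
    have kk : ∀ z, (z = dart e 0 ∨ z = α (dart e 0)) → X2 z = X z := by
      intro z hz
      rw [j2 z ((g.inR h.inv z).2 ⟨e, Or.inl hz⟩)]
      refine (i2 z ?_).symm
      simp only [kp, Finset.mem_filter]
      exact ⟨(g.mem z).2 ⟨e, 0, fun h => absurd h (by decide), hz⟩, e, hz⟩
    rw [kk _ (by dsimp only; split_ifs <;> simp)]
    have y2 := g.sy e 2 (fun _ => he)
    have m2 := mm e 2 (fun _ => he)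
    obtain ⟨x1, x2⟩ := j3 _ m2 (g.s2 e he)
    have n0 := h.cl _ (m0 e)
    have n1 := h.cl _ (m1 e)
    have n2 := h.cl _ m2
    dsimp only
    split_ifs with hc
    · rw [← hc, j1 _ m2, x1]
    · -- the other rotation
      have aty : ∀ z ∈ A, src z = some (Sum.inr e) → z = α (dart e 0) ∨ z = α (dart e 1) ∨ z = α (dart e 2) := by
        intro z hz hs
        obtain ⟨e', k, hk, rfl | rfl⟩ := (g.mem z).1 hz
        · fin_cases k
          · rw [show dart e' ((fun i => i) ⟨0, by decide⟩) = dart e' 0 from rfl, g.s0] at hs; simp at hs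
          · rw [show dart e' ((fun i => i) ⟨1, by decide⟩) = dart e' 1 from rfl, g.s1] at hs; simp at hs
          · have := g.s2 e' (hk rfl)
            rw [show dart e' ((fun i => i) ⟨2, by decide⟩) = dart e' 2 from rfl, this] at hs; simp at hs
        · rw [g.sy e' k hk] at hs
          simp at hs
          subst hs
          fin_cases k <;> simp
      have p02 : α (dart e 0) ≠ α (dart e 2) := by
        intro hh
        have : dart e 0 = dart e 2 := by rw [← h.inv (dart e 0), hh, h.inv]
        have := congrArg src this
        rw [g.s0, g.s2 e he] at this; simp at this
      have p12 : α (dart e 1) ≠ α (dart e 2) := by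
        intro hh
        have : dart e 1 = dart e 2 := by rw [← h.inv (dart e 1), hh, h.inv]
        have := congrArg src this
        rw [g.s1, g.s2 e he] at this; simp at this
      have p01 : α (dart e 0) ≠ α (dart e 1) := by
        intro hh
        have : dart e 0 = dart e 1 := by rw [← h.inv (dart e 0), hh, h.inv]
        have := congrArg src this
        rw [g.s0, g.s1] at this; simp at this; exact hab e this
      have f2 : σ (α (dart e 2)) ≠ α (dart e 2) := fun hf => p02 (h.fix n2 n0 (by rw [y0, y2]) hf)
      have f1 : σ (α (dart e 1)) ≠ α (dart e 1) := fun hf => p01 (h.fix n1 n0 (by rw [y0, y1]) hf)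
      have f0 : σ (α (dart e 0)) ≠ α (dart e 0) := fun hf => p02.symm (h.fix n0 n2 (by rw [y0, y2]) hf)
      have s2 : σ (α (dart e 2)) = α (dart e 1) := by
        rcases aty _ (h.sA _ n2) (by rw [h.ss _ n2, y2]) with q | q | q
        · exact absurd q hc
        · exact q
        · exact absurd q f2
      have s0 : σ (α (dart e 0)) = α (dart e 2) := by
        rcases aty _ (h.sA _ n0) (by rw [h.ss _ n0, y0]) with q | q | q
        · exact absurd q f0
        · exact absurd (σ.injective (q.trans s2.symm)) p02
        · exact q
      have := j1 _ (m0 e)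
      rw [s0, x2] at this
      exact this.symm

end CM

namespace CM
open DS Equiv

variable {D V : Type} [DecidableEq D] [DecidableEq V]

theorem Mp.toPD [Finite D] {ι : Type} [IsEmpty ι] {α : D → D} {A : Finset D} {σ : Perm D} {src : D → V}
    {L : ι → (D → ZMod 2) → ZMod 2} (h : Mp α A σ src L) :
    PD α A src (fun d => (Quotient.mk (Perm.SameCycle.setoid (σ * aP α h.inv)) d)) := by
  classical
  have hφ : ∀ d, (σ * aP α h.inv) d = σ (α d) := fun d => rfl
  refine ⟨h.inv, h.ne, h.cl, fun X v => ?_, fun c h1 h2 h3 => ?_⟩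
  · refine even h.inv h.cl h.sA h.ss (X := fun d => X (Quotient.mk _ d)) (fun d hd => ?_) v
    dsimp only
    congr 1
    apply Quotient.sound
    show Perm.SameCycle _ _ _
    rw [← hφ]
    exact Perm.sameCycle_apply_left.2 (Perm.SameCycle.refl _ _)
  · obtain ⟨X, hX, hc⟩ := h.full c h1 h2 h3 (fun i => isEmptyElim i)
    have key := fun a ha z hz => const_cycle (A := A) (π := σ * aP α h.inv) (fun z hz => h.sA _ (h.cl z hz))
      (Y := X) (fun z hz => hX z hz) (a := a) ha z hz
    refine ⟨Quotient.lift (fun d => if d ∈ A then X d else 0) ?_, fun d hd => ?_⟩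
    · intro x y hxy
      have hxy : Perm.SameCycle (σ * aP α h.inv) x y := hxy
      by_cases hx : x ∈ A
      · have := key x hx y hxy
        rw [if_pos hx, if_pos this.2, this.1]
      · by_cases hy : y ∈ A
        · exact absurd (key y hy x hxy.symm).2 hx
        · rw [if_neg hx, if_neg hy]
    · simp only [bd, Quotient.lift_mk]
      rw [if_pos hd, if_pos (h.cl d hd), hc d hd]

theorem zprim (N : ℕ) [NeZero N] (g : ZMod N → ZMod 2) (hg : ∑ i, g i = 0) :
    ∃ y : ZMod N → ZMod 2, y 0 = 0 ∧ ∀ i, y i + y (i + 1) = g i := by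
  have hN : 0 < N := Nat.pos_of_ne_zero (NeZero.ne N)
  have tot : ∑ l ∈ Finset.range N, g (l : ZMod N) = 0 := by
    rw [← hg]
    refine Finset.sum_bij (fun l _ => (l : ZMod N)) (by simp) ?_ ?_ (by simp)
    · intro a ha b hb hab
      simp only [Finset.mem_range] at ha hb
      have := congrArg ZMod.val hab
      rwa [ZMod.val_natCast_of_lt ha, ZMod.val_natCast_of_lt hb] at this
    · intro b _
      exact ⟨b.val, by simpa using ZMod.val_lt b, by simp⟩
  refine ⟨fun i => ∑ l ∈ Finset.range i.val, g (l : ZMod N), by simp, fun i => ?_⟩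
  dsimp only
  have hlt := ZMod.val_lt i
  by_cases hi : i.val + 1 = N
  · have e0 : i + 1 = 0 := by
      have := congrArg (fun n : ℕ => (n : ZMod N)) hi
      simpa using this
    rw [e0]
    rw [show Finset.range N = Finset.range (i.val + 1) from by rw [hi], Finset.sum_range_succ] at tot
    simp only [ZMod.val_zero, Finset.range_zero, Finset.sum_empty, add_zero]
    simp only [ZMod.natCast_val, ZMod.cast_id', id] at tot
    exact CharTwo.add_eq_zero.1 tot
  · have e1 : (i + 1).val = i.val + 1 := by
      have : i + 1 = ((i.val + 1 : ℕ) : ZMod N) := by simp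
      rw [this, ZMod.val_natCast_of_lt (by omega)]
    rw [e1, Finset.sum_range_succ, ← add_assoc, CharTwo.add_self_eq_zero, zero_add]
    simp

abbrev GD (N : ℕ) := ZMod N × ZMod N × Fin 4

def gal (N : ℕ) : GD N → GD N := fun d =>
  if d.2.2 = 0 then (d.1 + 1, d.2.1, 2) else if d.2.2 = 1 then (d.1, d.2.1 + 1, 3)
  else if d.2.2 = 2 then (d.1 - 1, d.2.1, 0) else (d.1, d.2.1 - 1, 1)

def gsg (N : ℕ) : Perm (GD N) where
  toFun d := (d.1, d.2.1, d.2.2 + 1)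
  invFun d := (d.1, d.2.1, d.2.2 - 1)
  left_inv d := by simp
  right_inv d := by simp

def gsrc (N : ℕ) : GD N → ZMod N × ZMod N := fun d => (d.1, d.2.1)

theorem gridMap (N : ℕ) [NeZero N] : ∃ L : Fin 2 → (GD N → ZMod 2) → ZMod 2,
    Mp (gal N) Finset.univ (gsg N) (gsrc N) L := by
  have g0 : ∀ i j, gal N (i, j, 0) = (i + 1, j, 2) := fun i j => rfl
  have g1 : ∀ i j, gal N (i, j, 1) = (i, j + 1, 3) := fun i j => rfl
  have g2 : ∀ i j, gal N (i, j, 2) = (i - 1, j, 0) := fun i j => rfl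
  have g3 : ∀ i j, gal N (i, j, 3) = (i, j - 1, 1) := fun i j => rfl
  have f4 : ∀ P : Fin 4 → Prop, P 0 → P 1 → P 2 → P 3 → ∀ k, P k := by
    intro P h0 h1 h2 h3 k
    fin_cases k <;> assumption
  refine ⟨![fun c => ∑ j, c (0, j, 0), fun c => ∑ k, c (k, -1, 1)], ?_, ?_, by simp, by simp, fun d _ => rfl, ?_, ?_, ?_⟩
  · rintro ⟨i, j, k⟩
    revert k
    apply f4 <;> simp [g0, g1, g2, g3]
  · rintro ⟨i, j, k⟩
    revert k
    apply f4 <;> simp [g0, g1, g2, g3]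
  · rintro Y hY ⟨i, j, k⟩ - ⟨i', j', k'⟩ - hs
    simp only [gsrc, Prod.mk.injEq] at hs
    obtain ⟨rfl, rfl⟩ := hs
    have e0 : Y (i, j, 1) = Y (i, j, 0) := hY (i, j, 0) (Finset.mem_univ _)
    have e1 : Y (i, j, 2) = Y (i, j, 1) := hY (i, j, 1) (Finset.mem_univ _)
    have e2 : Y (i, j, 3) = Y (i, j, 2) := hY (i, j, 2) (Finset.mem_univ _)
    have : ∀ k, Y (i, j, k) = Y (i, j, 0) := by
      apply f4
      · rfl
      · exact e0
      · rw [e1, e0]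
      · rw [e2, e1, e0]
    rw [this k, this k']
  · intro i c c'
    fin_cases i <;> simp [Finset.sum_add_distrib]
  · intro c hs _ hc hL
    have hL0 : ∑ j, c (0, j, 0) = 0 := hL 0
    have hL1 : ∑ k, c (k, -1, 1) = 0 := hL 1
    have s2 : ∀ i j, c (i, j, 2) = c (i - 1, j, 0) := by
      intro i j; rw [← hs (i, j, 2), g2]
    have s3 : ∀ i j, c (i, j, 3) = c (i, j - 1, 1) := by
      intro i j; rw [← hs (i, j, 3), g3]
    have cyc : ∀ i j, c (i, j, 0) + c (i, j, 1) + c (i - 1, j, 0) + c (i, j - 1, 1) = 0 := by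
      intro i j
      rw [← s2, ← s3]
      have := hc (i, j)
      rw [sm, Fintype.sum_prod_type] at this
      simp only [Fintype.sum_prod_type, gsrc, Prod.mk.injEq] at this
      rw [Finset.sum_eq_single i (fun b _ hb => by simp [hb]) (by simp),
        Finset.sum_eq_single j (fun b _ hb => by simp [hb]) (by simp)] at this
      simpa [Fin.sum_univ_four] using this
    have col : ∀ n : ℕ, ∑ j, c ((n : ZMod N), j, 0) = 0 := by
      intro n
      induction n with
      | zero => simpa using hL0
      | succ n ih =>
        have e := Finset.sum_congr (rfl : (Finset.univ : Finset (ZMod N)) = Finset.univ) fun j _ => cyc ((n + 1 : ℕ) : ZMod N) j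
        simp only [Finset.sum_add_distrib, Finset.sum_const_zero] at e
        have e1 : ∑ j, c (((n + 1 : ℕ) : ZMod N), j - 1, 1) = ∑ j, c (((n + 1 : ℕ) : ZMod N), j, 1) :=
          Equiv.sum_comp (Equiv.subRight (1 : ZMod N)) (fun j => c (((n + 1 : ℕ) : ZMod N), j, 1))
        have e2 : ((n + 1 : ℕ) : ZMod N) - 1 = n := by push_cast; ring
        rw [e1, e2, ih] at e
        generalize ∑ j, c (((n + 1 : ℕ) : ZMod N), j, 0) = p at e ⊢
        generalize ∑ j, c (((n + 1 : ℕ) : ZMod N), j, 1) = q at e ⊢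
        revert p q; decide
    have col' : ∀ i, ∑ j, c (i, j, 0) = 0 := by
      intro i
      have := col i.val
      simpa using this
    choose y y0 hy using fun i => zprim N (fun j => c (i, j, 0)) (col' i)
    obtain ⟨z, -, hz⟩ := zprim N (fun i => c (i + 1, -1, 1)) (by
      rw [← hL1]
      exact Equiv.sum_comp (Equiv.addRight (1 : ZMod N)) (fun k => c (k, -1, 1)))
    set x : ZMod N → ZMod N → ZMod 2 := fun i j => z i + y i j with hx
    have hh : ∀ i j, c (i, j, 0) = x i j + x i (j + 1) := by
      intro i j
      have := hy i j
      simp only [hx]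
      rw [← this]
      generalize y i j = p; generalize y i (j + 1) = q; generalize z i = r
      revert p q r; decide
    have hv : ∀ (n : ℕ) i, c (i, (n : ZMod N) - 1, 1) = x i n + x (i - 1) n := by
      intro n
      induction n with
      | zero =>
        intro i
        have := hz (i - 1)
        simp only [sub_add_cancel] at this
        simp only [hx, Nat.cast_zero, y0, zero_sub, add_zero, ← this]
        rw [add_comm]
      | succ n ih =>
        intro i
        have e := cyc i n
        rw [ih i, hh i n, hh (i - 1) n] at e
        push_cast
        rw [add_sub_cancel_right]
        generalize c (i, (n : ZMod N), 1) = q at e ⊢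
        generalize x i n = a1 at e ⊢
        generalize x (i - 1) n = a2 at e ⊢
        generalize x i (n + 1) = a3 at e ⊢
        generalize x (i - 1) (n + 1) = a4 at e ⊢
        revert q a1 a2 a3 a4; decide
    have hv' : ∀ i j, c (i, j, 1) = x i (j + 1) + x (i - 1) (j + 1) := by
      intro i j
      have := hv (j + 1).val i
      simpa using this
    let X : GD N → ZMod 2 := fun d => ![x d.1 d.2.1, x d.1 (d.2.1 + 1), x (d.1 - 1) (d.2.1 + 1), x (d.1 - 1) d.2.1] d.2.2
    have X0 : ∀ i j, X (i, j, 0) = x i j := fun i j => rfl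
    have X1 : ∀ i j, X (i, j, 1) = x i (j + 1) := fun i j => rfl
    have X2 : ∀ i j, X (i, j, 2) = x (i - 1) (j + 1) := fun i j => rfl
    have X3 : ∀ i j, X (i, j, 3) = x (i - 1) j := fun i j => rfl
    have gs : ∀ i j k, gsg N (i, j, k) = (i, j, k + 1) := fun i j k => rfl
    refine ⟨X, ?_, ?_⟩
    · rintro ⟨i, j, k⟩ -
      revert k
      apply f4
      · rw [g0, gs, show (2 : Fin 4) + 1 = 3 from rfl, X3, X0]; simp
      · rw [g1, gs, show (3 : Fin 4) + 1 = 0 from rfl, X0, X1]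
      · rw [g2, gs, show (0 : Fin 4) + 1 = 1 from rfl, X1, X2]
      · rw [g3, gs, show (1 : Fin 4) + 1 = 2 from rfl, X2, X3]; simp
    · rintro ⟨i, j, k⟩ -
      revert k
      apply f4
      · rw [g0, X0, X2, hh]; simp
      · rw [g1, X1, X3, hv']
      · rw [s2, g2, X2, X0, hh, add_comm]
      · rw [s3, g3, X3, X1, hv', sub_add_cancel, add_comm]

end CM

namespace TG
open DS CM Equiv

abbrev C1 : Type := AddCircle (1 : ℝ)
abbrev T2 : Type := C1 × C1

def seg (N : ℕ) (i : ZMod N) : Set C1 := (fun t : ℝ => (((i.val + t) / N : ℝ) : C1)) '' Icc 0 1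

def sqr (N : ℕ) (z : ZMod N × ZMod N) : Set T2 := seg N z.1 ×ˢ seg N z.2

theorem seg_compact (N : ℕ) (i : ZMod N) : IsCompact (seg N i) := by
  apply isCompact_Icc.image
  exact (AddCircle.continuous_mk' 1).comp (by fun_prop)

theorem sqr_closed (N : ℕ) (z : ZMod N × ZMod N) : IsClosed (sqr N z) :=
  ((seg_compact N z.1).prod (seg_compact N z.2)).isClosed

theorem seg_cover (N : ℕ) [NeZero N] (x : C1) : ∃ i, x ∈ seg N i := by
  have hN : 0 < N := Nat.pos_of_ne_zero (NeZero.ne N)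
  have hN' : (0 : ℝ) < N := by exact_mod_cast hN
  obtain ⟨y, rfl⟩ := QuotientAddGroup.mk_surjective x
  set m : ℤ := ⌊y * N⌋ with hm
  have h1 : (m : ℝ) ≤ y * N := Int.floor_le _
  have h2 : y * N < m + 1 := Int.lt_floor_add_one _
  refine ⟨(m : ZMod N), y * N - m, ⟨by linarith, by linarith⟩, ?_⟩
  have hv : ((m : ZMod N).val : ℤ) = m % N := ZMod.val_intCast m
  have hd := Int.emod_add_mul_ediv m N
  rw [← hv] at hd
  have hd' : (((m : ZMod N).val : ℕ) : ℝ) + N * ((m / N : ℤ) : ℝ) = m := by exact_mod_cast hd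
  have e : (((m : ZMod N).val : ℕ) + (y * N - m)) / N = y - ((m / N : ℤ) : ℝ) := by
    rw [← hd']
    field_simp
    ring
  simp only [e]
  rw [AddCircle.coe_sub]
  have : (((m / N : ℤ) : ℝ) : C1) = 0 := by
    rw [AddCircle.coe_eq_zero_iff]
    exact ⟨m / N, by simp⟩
  rw [this, sub_zero]

theorem seg_adj (N : ℕ) [NeZero N] {i j : ZMod N} {x : C1} (hi : x ∈ seg N i) (hj : x ∈ seg N j) :
    i = j ∨ i = j + 1 ∨ j = i + 1 := by
  have hN : 0 < N := Nat.pos_of_ne_zero (NeZero.ne N)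
  have hN' : (0 : ℝ) < N := by exact_mod_cast hN
  obtain ⟨t, ht, rfl⟩ := hi
  obtain ⟨s, hs, he⟩ := hj
  simp only [] at he
  rw [← sub_eq_zero, ← AddCircle.coe_sub, AddCircle.coe_eq_zero_iff] at he
  obtain ⟨m, hm⟩ := he
  simp only [zsmul_eq_mul, mul_one] at hm
  have h1 : (m : ℝ) * N = (j.val + s) - (i.val + t) := by
    rw [hm]; field_simp
  set k : ℤ := m * N + i.val - j.val with hk
  have hk' : (k : ℝ) = s - t := by
    simp only [hk]; push_cast; linarith
  have b1 : k ≤ 1 := by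
    have : (k : ℝ) ≤ 1 := by rw [hk']; linarith [hs.2, ht.1]
    exact_mod_cast this
  have b2 : -1 ≤ k := by
    have : (-1 : ℝ) ≤ k := by rw [hk']; linarith [hs.1, ht.2]
    exact_mod_cast this
  have hc : (k : ZMod N) = i - j := by
    simp only [hk]; push_cast; simp
  have : k = 0 ∨ k = 1 ∨ k = -1 := by omega
  rcases this with h | h | h
  · left
    rw [h] at hc
    exact (sub_eq_zero.1 (by simpa using hc.symm))
  · right; left
    rw [h] at hc
    have : (1 : ZMod N) = i - j := by simpa using hc
    rw [this]; ring
  · right; right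
    rw [h] at hc
    have : (-1 : ZMod N) = i - j := by simpa using hc
    have e : (1 : ZMod N) = -(-1) := by ring
    rw [e, this]; ring

theorem cdist (a b : ℝ) : dist (a : C1) (b : C1) ≤ |a - b| := by
  rw [dist_eq_norm, ← AddCircle.coe_sub]
  exact (QuotientAddGroup.norm_mk_le_norm (S := AddSubgroup.zmultiples (1 : ℝ)) (m := a - b))

theorem seg_small (N : ℕ) [NeZero N] {i : ZMod N} {x y : C1} (hx : x ∈ seg N i) (hy : y ∈ seg N i) :
    dist x y ≤ 1 / N := by
  have hN : 0 < N := Nat.pos_of_ne_zero (NeZero.ne N)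
  have hN' : (0 : ℝ) < N := by exact_mod_cast hN
  obtain ⟨t, ht, rfl⟩ := hx
  obtain ⟨s, hs, rfl⟩ := hy
  refine (cdist _ _).trans ?_
  rw [← sub_div, abs_div, abs_of_pos hN']
  gcongr
  rw [abs_le]
  constructor <;> linarith [hs.1, hs.2, ht.1, ht.2]

theorem sqr_small (N : ℕ) [NeZero N] {z : ZMod N × ZMod N} {x y : T2} (hx : x ∈ sqr N z) (hy : y ∈ sqr N z) :
    dist x y ≤ 1 / N := by
  rw [Prod.dist_eq]
  exact max_le (seg_small N hx.1 hy.1) (seg_small N hx.2 hy.2)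

def Sq (N : ℕ) (C : Set T2) : Set (ZMod N × ZMod N) := {z | (sqr N z ∩ C).Nonempty}

theorem Sq_of_mem (N : ℕ) [NeZero N] {C : Set T2} {x : T2} (hx : x ∈ C) : ∃ z ∈ Sq N C, x ∈ sqr N z := by
  obtain ⟨i, hi⟩ := seg_cover N x.1
  obtain ⟨j, hj⟩ := seg_cover N x.2
  exact ⟨(i, j), ⟨x, ⟨hi, hj⟩, hx⟩, ⟨hi, hj⟩⟩

theorem Sq_conn (N : ℕ) [NeZero N] {C : Set T2} (hC : IsPreconnected C) (Y : ZMod N × ZMod N → ZMod 2)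
    (hY : ∀ d : GD N, gsrc N d ∈ Sq N C → gsrc N (gal N d) ∈ Sq N C → Y (gsrc N d) = Y (gsrc N (gal N d))) :
    ∀ z ∈ Sq N C, ∀ z' ∈ Sq N C, Y z = Y z' := by
  have hx : ∀ i i' j (p : T2), p ∈ C → p ∈ sqr N (i, j) → p ∈ sqr N (i', j) → Y (i, j) = Y (i', j) := by
    intro i i' j p hp h1 h2
    have m1 : (i, j) ∈ Sq N C := ⟨p, h1, hp⟩
    have m2 : (i', j) ∈ Sq N C := ⟨p, h2, hp⟩
    rcases seg_adj N h1.1 h2.1 with rfl | h | h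
    · rfl
    · simp only [] at h
      subst h
      exact (hY (i', j, 0) m2 m1).symm
    · simp only [] at h
      subst h
      exact hY (i, j, 0) m1 m2
  have hy : ∀ i j j' (p : T2), p ∈ C → p ∈ sqr N (i, j) → p ∈ sqr N (i, j') → Y (i, j) = Y (i, j') := by
    intro i j j' p hp h1 h2
    have m1 : (i, j) ∈ Sq N C := ⟨p, h1, hp⟩
    have m2 : (i, j') ∈ Sq N C := ⟨p, h2, hp⟩
    rcases seg_adj N h1.2 h2.2 with rfl | h | h
    · rfl
    · simp only [] at h
      subst h
      exact (hY (i, j', 1) m2 m1).symm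
    · simp only [] at h
      subst h
      exact hY (i, j, 1) m1 m2
  have key : ∀ (p : T2) z z', p ∈ C → p ∈ sqr N z → p ∈ sqr N z' → Y z = Y z' := by
    rintro p ⟨i, j⟩ ⟨i', j'⟩ hp h1 h2
    have h3 : p ∈ sqr N (i', j) := ⟨h2.1, h1.2⟩
    rw [hx i i' j p hp h1 h3, hy i' j j' p hp h3 h2]
  rintro z ⟨p, hp1, hp2⟩ z' ⟨p', hp1', hp2'⟩
  by_contra hne
  let F : Prop → Set T2 := fun P => ⋃ u ∈ {u : ZMod N × ZMod N | (Y u = Y z) = P}, sqr N u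
  have hF : ∀ P, IsClosed (F P) := fun P => (Set.toFinite _).isClosed_biUnion fun u _ => sqr_closed N u
  have := isPreconnected_closed_iff.1 hC (F True) (F False) (hF _) (hF _) ?_ ⟨p, hp2, ?_⟩ ⟨p', hp2', ?_⟩
  · obtain ⟨q, hq, h1, h2⟩ := this
    simp only [F, mem_iUnion, exists_prop, mem_setOf_eq, eq_iff_iff, iff_true, iff_false] at h1 h2
    obtain ⟨u, hu, hqu⟩ := h1
    obtain ⟨u', hu', hqu'⟩ := h2
    exact hu' ((key q u' u hq hqu' hqu).trans hu)
  · intro q hq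
    obtain ⟨u, hu, hqu⟩ := Sq_of_mem N hq
    by_cases h : Y u = Y z
    · left
      simp only [F, mem_iUnion, exists_prop, mem_setOf_eq, eq_iff_iff, iff_true, iff_false]
      exact ⟨u, h, hqu⟩
    · right
      simp only [F, mem_iUnion, exists_prop, mem_setOf_eq, eq_iff_iff, iff_true, iff_false]
      exact ⟨u, h, hqu⟩
  · simp only [F, mem_iUnion, exists_prop, mem_setOf_eq, eq_iff_iff, iff_true, iff_false]
    exact ⟨z, rfl, hp1⟩
  · simp only [F, mem_iUnion, exists_prop, mem_setOf_eq, eq_iff_iff, iff_true, iff_false]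
    exact ⟨z', fun h => hne h.symm, hp1'⟩

/-- disjoint compact sets are separated by fine grids -/
theorem Sq_sep {A B : Set T2} (hA : IsCompact A) (hB : IsCompact B) (h : Disjoint A B) :
    ∃ N0 : ℕ, ∀ N : ℕ, N0 ≤ N → ∀ [NeZero N], ∀ z, ¬ (z ∈ Sq N A ∧ z ∈ Sq N B) := by
  obtain ⟨r, hr, hd⟩ := Metric.exists_pos_forall_lt_edist hA hB.isClosed h
  obtain ⟨N0, hN0⟩ := exists_nat_gt (1 / (r : ℝ))
  have hr' : (0 : ℝ) < r := by exact_mod_cast hr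
  refine ⟨N0, fun N hN _ z hz => ?_⟩
  obtain ⟨⟨p, hp1, hp2⟩, ⟨q, hq1, hq2⟩⟩ := hz
  have h1 := hd p hp2 q hq2
  rw [edist_nndist] at h1
  have h2 : r < nndist p q := by exact_mod_cast h1
  have h3 : (r : ℝ) < dist p q := by exact_mod_cast h2
  have h4 := sqr_small N hp1 hq1
  have hNpos : (0 : ℝ) < N := by exact_mod_cast Nat.pos_of_ne_zero (NeZero.ne N)
  have h5 : (N0 : ℝ) ≤ N := by exact_mod_cast hN
  have h6 : 1 / (r : ℝ) < N := by linarith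
  rw [div_lt_iff₀ hr'] at h6
  rw [le_div_iff₀ hNpos] at h4
  nlinarith

end TG

namespace TG
open DS CM Equiv

/-- combinatorial minor extraction in an arbitrary map -/
theorem minorComb {D Z W J : Type} [Finite D] [DecidableEq D] [DecidableEq Z] [DecidableEq W] (w0 : W)
    {ι : Type} {α : D → D} {A : Finset D} {σ : Perm D} {src : D → Z} {L : ι → (D → ZMod 2) → ZMod 2} (h : Mp α A σ src L)
    (hA : ∀ d, d ∈ A)
    (B : W → Set Z) (S : J → Set Z) (a b : J → W) (hab : ∀ j, a j ≠ b j)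
    (Bc : ∀ w, ∀ Y : Z → ZMod 2, (∀ d, src d ∈ B w → src (α d) ∈ B w → Y (src d) = Y (src (α d))) → ∀ z ∈ B w, ∀ z' ∈ B w, Y z = Y z')
    (Sc : ∀ w, ∀ Y : Z → ZMod 2, (∀ d, src d ∈ S w → src (α d) ∈ S w → Y (src d) = Y (src (α d))) → ∀ z ∈ S w, ∀ z' ∈ S w, Y z = Y z')
    (Bd : ∀ w w' z, z ∈ B w → z ∈ B w' → w = w') (Sd : ∀ w w' z, z ∈ S w → z ∈ S w' → w = w')
    (SB : ∀ j w z, z ∈ S j → z ∈ B w → w = a j ∨ w = b j)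
    (Sa : ∀ j, ∃ z ∈ S j, z ∈ B (a j)) (Sb : ∀ j, ∃ z ∈ S j, z ∈ B (b j)) :
    ∃ (K : Finset D) (σ' : Perm D) (src' : D → W) (L' : ι → (D → ZMod 2) → ZMod 2) (dart : J → D),
      Mp α K σ' src' L' ∧ (∀ z, z ∈ K ↔ ∃ j, z = dart j ∨ z = α (dart j)) ∧
      ∀ j, src' (dart j) = a j ∧ src' (α (dart j)) = b j := by
  classical
  let R : J → Z → Z → Prop := fun j z z' => (z' ∈ S j ∧ z' ∉ B (b j)) ∧ ∃ d, src d = z ∧ src (α d) = z'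
  let P : J → Set Z := fun j => {z | ∃ s, s ∈ S j ∧ s ∈ B (a j) ∧ Relation.ReflTransGen (R j) s z}
  have PS : ∀ j z, z ∈ P j → z ∈ S j ∧ z ∉ B (b j) := by
    rintro j z ⟨s, h1, h2, h3⟩
    induction h3 with
    | refl => exact ⟨h1, fun h => hab j (Bd _ _ _ h2 h)⟩
    | tail _ hr _ => exact hr.1
  have dart : ∀ j, ∃ d, src d ∈ P j ∧ src (α d) ∈ B (b j) ∧ src (α d) ∈ S j := by
    intro j
    by_contra hc
    push Not at hc
    obtain ⟨s, hs1, hs2⟩ := Sa j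
    obtain ⟨t, ht1, ht2⟩ := Sb j
    have clo : ∀ d, src (α d) ∈ S j → src d ∈ P j → src (α d) ∈ P j := by
      intro d h1 h2
      have h3 : src (α d) ∉ B (b j) := fun h3 => hc d h2 h3 h1
      obtain ⟨s', i1, i2, i3⟩ := h2
      exact ⟨s', i1, i2, i3.tail ⟨⟨h1, h3⟩, d, rfl, rfl⟩⟩
    have := Sc j (fun z => if z ∈ P j then 1 else 0) (fun d h1 h2 => by
      have e : src d ∈ P j ↔ src (α d) ∈ P j := by
        refine ⟨clo d h2, fun h3 => ?_⟩
        have := clo (α d) (by rw [h.inv]; exact h1) h3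
        rwa [h.inv] at this
      simp only [e]) s hs1 t ht1
    have p1 : s ∈ P j := ⟨s, hs1, hs2, Relation.ReflTransGen.refl⟩
    have p2 : t ∉ P j := fun h => (PS j t h).2 ht2
    simp [p1, p2] at this
  choose dart da db ds using dart
  let β : Z → Option W := fun z => if h : ∃ w, z ∈ B w then some h.choose else if h : ∃ j, z ∈ P j then some (a h.choose) else none
  have βB : ∀ w z, z ∈ B w → β z = some w := by
    intro w z hz
    have h : ∃ w, z ∈ B w := ⟨w, hz⟩
    simp only [β, dif_pos h]
    rw [Bd _ _ _ h.choose_spec hz]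
  have βP : ∀ j z, z ∈ P j → β z = some (a j) := by
    intro j z hz
    by_cases h : ∃ w, z ∈ B w
    · obtain ⟨w, hw⟩ := h
      rw [βB w z hw]
      rcases SB j w z (PS j z hz).1 hw with rfl | rfl
      · rfl
      · exact absurd hw (PS j z hz).2
    · have h2 : ∃ j, z ∈ P j := ⟨j, hz⟩
      simp only [β, dif_neg h, dif_pos h2]
      rw [Sd _ _ _ (PS _ _ h2.choose_spec).1 (PS j z hz).1]
  have βinv : ∀ z w, β z = some w → z ∈ B w ∨ ∃ j, z ∈ P j ∧ a j = w := by
    intro z w hz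
    by_cases h : ∃ w, z ∈ B w
    · obtain ⟨w', hw⟩ := h
      rw [βB w' z hw, Option.some.injEq] at hz
      subst hz
      exact Or.inl hw
    · by_cases h2 : ∃ j, z ∈ P j
      · obtain ⟨j, hj⟩ := h2
        rw [βP j z hj, Option.some.injEq] at hz
        exact Or.inr ⟨j, hj, hz⟩
      · simp [β, dif_neg h, dif_neg h2] at hz
  have βda : ∀ j, β (src (dart j)) = some (a j) := fun j => βP j _ (da j)
  have βdb : ∀ j, β (src (α (dart j))) = some (b j) := fun j => βB _ _ (db j)
  let K : Finset D := A.filter fun z => ∃ j, z = dart j ∨ z = α (dart j)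
  have inK : ∀ z, z ∈ K ↔ ∃ j, z = dart j ∨ z = α (dart j) := by
    intro z
    simp only [K, Finset.mem_filter, hA, true_and]
  have Kα : ∀ d ∈ K, α d ∈ K := by
    intro d hd
    rw [inK] at hd ⊢
    obtain ⟨j, rfl | rfl⟩ := hd
    · exact ⟨j, Or.inr rfl⟩
    · exact ⟨j, Or.inl (h.inv _)⟩
  have Kne : ∀ d ∈ K, β (src d) ≠ β (src (α d)) := by
    intro d hd
    rw [inK] at hd
    obtain ⟨j, rfl | rfl⟩ := hd
    · rw [βda, βdb]; simpa using hab j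
    · rw [h.inv, βda, βdb]; simpa using (hab j).symm
  have Ksome : ∀ d ∈ K, ∃ w, β (src d) = some w := by
    intro d hd
    rw [inK] at hd
    obtain ⟨j, rfl | rfl⟩ := hd
    · exact ⟨_, βda j⟩
    · exact ⟨_, βdb j⟩
  let A' : Finset D := A.filter fun d => β (src d) = β (src (α d)) ∨ d ∈ K
  have inA' : ∀ d, d ∈ A' ↔ β (src d) = β (src (α d)) ∨ d ∈ K := by
    intro d
    simp only [A', Finset.mem_filter, hA, true_and]
  obtain ⟨σ1, h1⟩ := Mp.restrict (A.card + 1) A σ h A' (Finset.filter_subset _ _) (by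
    intro d hd
    rw [inA'] at hd ⊢
    rcases hd with hd | hd
    · left; rw [h.inv, hd]
    · right; exact Kα d hd) (by omega)
  have conn : ∀ w (Y : Z → ZMod 2), (∀ e ∈ A', e ∉ K → Y (src e) = Y (src (α e))) →
      ∀ z z', β z = some w → β z' = some w → Y z = Y z' := by
    intro w Y hY
    have step : ∀ d, β (src d) = β (src (α d)) → Y (src d) = Y (src (α d)) := by
      intro d hd
      exact hY d ((inA' d).2 (Or.inl hd)) fun hk => Kne d hk hd
    have cB : ∀ z ∈ B w, ∀ z' ∈ B w, Y z = Y z' := by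
      refine Bc w Y fun d h1 h2 => step d ?_
      rw [βB w _ h1, βB w _ h2]
    have cP : ∀ z, β z = some w → ∃ z' ∈ B w, Y z = Y z' := by
      intro z hz
      rcases βinv z w hz with hz | ⟨j, ⟨s, h1, h2, h3⟩, rfl⟩
      · exact ⟨z, hz, rfl⟩
      · clear hz
        refine ⟨s, h2, ?_⟩
        induction h3 with
        | refl => rfl
        | @tail y z h4 h5 ih =>
          rw [← ih]
          have p1 : y ∈ P j := ⟨s, h1, h2, h4⟩
          have p2 : z ∈ P j := ⟨s, h1, h2, h4.tail h5⟩
          obtain ⟨-, d, rfl, rfl⟩ := h5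
          exact (step d (by rw [βP _ _ p1, βP _ _ p2])).symm
    intro z z' hz hz'
    obtain ⟨y, hy, e⟩ := cP z hz
    obtain ⟨y', hy', e'⟩ := cP z' hz'
    rw [e, e', cB y hy y' hy']
  obtain ⟨σ2, L2, h2⟩ := Mp.contractAll β K Kα (A'.card + 1) A' σ1 src L h1 (fun d hd => (inA' d).2 (Or.inr hd))
    (fun d hd hdK => by
      rw [inA'] at hd
      exact hd.resolve_right hdK)
    (fun d hd d' hd' he Y hY => by
      obtain ⟨w, hw⟩ := Ksome d hd
      exact conn w Y hY _ _ hw (he ▸ hw)) (by omega)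
  refine ⟨K, σ2, fun d => (β (src d)).getD w0, L2, dart, h2.congrSrc _ ?_, inK, fun j => ⟨by simp [βda], by simp [βdb]⟩⟩
  intro d hd d' hd'
  obtain ⟨w, hw⟩ := Ksome d hd
  obtain ⟨w', hw'⟩ := Ksome d' hd'
  simp [hw, hw']

theorem minor {W J : Type} [Finite W] [Finite J] [DecidableEq W] (w0 : W) (C : W → Set T2) (E : J → Set T2) (a b : J → W)
    (hab : ∀ j, a j ≠ b j) (Cc : ∀ w, IsCompact (C w)) (Cp : ∀ w, IsPreconnected (C w))
    (Ec : ∀ j, IsCompact (E j)) (Ep : ∀ j, IsPreconnected (E j))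
    (Cd : ∀ w w', w ≠ w' → Disjoint (C w) (C w')) (Ed : ∀ j j', j ≠ j' → Disjoint (E j) (E j'))
    (EC : ∀ j w, w ≠ a j → w ≠ b j → Disjoint (E j) (C w))
    (Ea : ∀ j, (E j ∩ C (a j)).Nonempty) (Eb : ∀ j, (E j ∩ C (b j)).Nonempty) :
    ∃ (D : Type) (_ : Finite D) (_ : DecidableEq D) (α : D → D) (A : Finset D) (σ : Perm D) (src : D → W)
      (L : Fin 2 → (D → ZMod 2) → ZMod 2) (dart : J → D), Mp α A σ src L ∧
      (∀ z, z ∈ A ↔ ∃ j, z = dart j ∨ z = α (dart j)) ∧ ∀ j, src (dart j) = a j ∧ src (α (dart j)) = b j := by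
  classical
  have := Fintype.ofFinite W
  have := Fintype.ofFinite J
  have q1 : ∀ w w', ∃ N0 : ℕ, w ≠ w' → ∀ N : ℕ, N0 ≤ N → ∀ [NeZero N], ∀ z, ¬ (z ∈ Sq N (C w) ∧ z ∈ Sq N (C w')) := by
    intro w w'
    by_cases h : w = w'
    · exact ⟨0, fun h' => absurd h h'⟩
    · obtain ⟨n, hn⟩ := Sq_sep (Cc w) (Cc w') (Cd w w' h)
      exact ⟨n, fun _ => hn⟩
  have q2 : ∀ w w', ∃ N0 : ℕ, w ≠ w' → ∀ N : ℕ, N0 ≤ N → ∀ [NeZero N], ∀ z, ¬ (z ∈ Sq N (E w) ∧ z ∈ Sq N (E w')) := by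
    intro w w'
    by_cases h : w = w'
    · exact ⟨0, fun h' => absurd h h'⟩
    · obtain ⟨n, hn⟩ := Sq_sep (Ec w) (Ec w') (Ed w w' h)
      exact ⟨n, fun _ => hn⟩
  have q3 : ∀ j w, ∃ N0 : ℕ, w ≠ a j → w ≠ b j → ∀ N : ℕ, N0 ≤ N → ∀ [NeZero N], ∀ z, ¬ (z ∈ Sq N (E j) ∧ z ∈ Sq N (C w)) := by
    intro j w
    by_cases h : w = a j
    · exact ⟨0, fun h' => absurd h h'⟩
    by_cases h' : w = b j
    · exact ⟨0, fun _ h'' => absurd h' h''⟩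
    · obtain ⟨n, hn⟩ := Sq_sep (Ec j) (Cc w) (EC j w h h')
      exact ⟨n, fun _ _ => hn⟩
  choose n1 hn1 using q1
  choose n2 hn2 using q2
  choose n3 hn3 using q3
  let N : ℕ := (∑ w, ∑ w', n1 w w') + (∑ w, ∑ w', n2 w w') + (∑ w, ∑ w', n3 w w') + 1
  have l1 : ∀ w w', n1 w w' ≤ N := by
    intro w w'
    have h1 := Finset.single_le_sum (f := fun w' => n1 w w') (fun _ _ => Nat.zero_le _) (Finset.mem_univ w')
    have h2 := Finset.single_le_sum (f := fun w => ∑ w', n1 w w') (fun _ _ => Nat.zero_le _) (Finset.mem_univ w)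
    omega
  have l2 : ∀ w w', n2 w w' ≤ N := by
    intro w w'
    have h1 := Finset.single_le_sum (f := fun w' => n2 w w') (fun _ _ => Nat.zero_le _) (Finset.mem_univ w')
    have h2 := Finset.single_le_sum (f := fun w => ∑ w', n2 w w') (fun _ _ => Nat.zero_le _) (Finset.mem_univ w)
    omega
  have l3 : ∀ w w', n3 w w' ≤ N := by
    intro w w'
    have h1 := Finset.single_le_sum (f := fun w' => n3 w w') (fun _ _ => Nat.zero_le _) (Finset.mem_univ w')
    have h2 := Finset.single_le_sum (f := fun w => ∑ w', n3 w w') (fun _ _ => Nat.zero_le _) (Finset.mem_univ w)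
    omega
  haveI : NeZero N := ⟨by omega⟩
  obtain ⟨L, hL⟩ := gridMap N
  obtain ⟨K, σ', src', L', dart, r1, r2, r3⟩ := minorComb w0 hL (fun d => Finset.mem_univ d) (fun w => Sq N (C w)) (fun j => Sq N (E j)) a b hab
    (fun w Y hY => Sq_conn N (Cp w) Y hY) (fun w Y hY => Sq_conn N (Ep w) Y hY)
    (fun w w' z h1 h2 => by
      by_contra hc
      exact hn1 w w' hc N (l1 w w') z ⟨h1, h2⟩)
    (fun w w' z h1 h2 => by
      by_contra hc
      exact hn2 w w' hc N (l2 w w') z ⟨h1, h2⟩)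
    (fun w w' z h1 h2 => by
      by_contra hc
      push Not at hc
      exact hn3 w w' hc.1 hc.2 N (l3 w w') z ⟨h1, h2⟩)
    (fun j => by
      obtain ⟨p, hp1, hp2⟩ := Ea j
      obtain ⟨z, hz, hz'⟩ := Sq_of_mem N hp1
      exact ⟨z, hz, p, hz', hp2⟩)
    (fun j => by
      obtain ⟨p, hp1, hp2⟩ := Eb j
      obtain ⟨z, hz, hz'⟩ := Sq_of_mem N hp1
      exact ⟨z, hz, p, hz', hp2⟩)
  exact ⟨GD N, inferInstance, inferInstance, gal N, K, σ', src', L', dart, r1, r2, r3⟩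

end TG

namespace TG
open DS CM Equiv

def pr : ℝ × ℝ → T2 := Prod.map (fun t => (t : C1)) (fun t => (t : C1))

theorem pr_cont : Continuous pr := (AddCircle.continuous_mk' 1).prodMap (AddCircle.continuous_mk' 1)

theorem pr_surj : Function.Surjective pr :=
  QuotientAddGroup.mk_surjective.prodMap QuotientAddGroup.mk_surjective

theorem pr_open : IsOpenMap pr := IsOpenMap.prodMap QuotientAddGroup.isOpenMap_coe QuotientAddGroup.isOpenMap_coe

instance lpcT2 : LocallyPathConnectedSpace T2 :=
  (pr_open.isQuotientMap pr_cont pr_surj).locallyPathConnectedSpace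

theorem cnbhd (x : T2) (U : Set T2) (hU : IsOpen U) (hx : x ∈ U) :
    ∃ C, IsCompact C ∧ IsPreconnected C ∧ C ⊆ U ∧ C ∈ 𝓝 x := by
  obtain ⟨K, hK1, hK2, hK3⟩ := exists_mem_nhds_isClosed_subset (hU.mem_nhds hx)
  refine ⟨closure (connectedComponentIn (interior K) x), isClosed_closure.isCompact,
    isPreconnected_connectedComponentIn.closure, ?_, ?_⟩
  · refine (closure_mono ((connectedComponentIn_subset _ _).trans interior_subset)).trans ?_
    rw [hK2.closure_eq]; exact hK3
  · refine Filter.mem_of_superset ?_ subset_closure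
    exact (isOpen_interior.connectedComponentIn).mem_nhds (mem_connectedComponentIn (mem_interior_iff_mem_nhds.2 hK1))

theorem near0 {η : ℝ → T2} (hη : ContinuousOn η (Icc 0 1)) {C : Set T2} (hC : C ∈ 𝓝 (η 0)) {c : ℝ} (hc : 0 < c) :
    ∃ t ∈ Ioo (0 : ℝ) 1, t < c ∧ η t ∈ C := by
  have h1 : Filter.Tendsto η (𝓝[>] 0) (𝓝 (η 0)) := by
    have := (hη 0 (by simp)).mono (Ioo_subset_Icc_self)
    have h2 : 𝓝[Ioo (0 : ℝ) 1] 0 = 𝓝[>] 0 := nhdsWithin_Ioo_eq_nhdsGT (by norm_num)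
    unfold ContinuousWithinAt at this
    rwa [h2] at this
  have h3 : ∀ᶠ t in 𝓝[>] (0 : ℝ), t ∈ Ioo (0 : ℝ) 1 := Ioo_mem_nhdsGT (by norm_num)
  have h4 : ∀ᶠ t in 𝓝[>] (0 : ℝ), t ∈ Ioo (0 : ℝ) c := Ioo_mem_nhdsGT hc
  obtain ⟨t, e1, e2, e3⟩ := ((h1.eventually hC).and (h3.and h4)).exists
  exact ⟨t, e2, e3.2, e1⟩

theorem near1 {η : ℝ → T2} (hη : ContinuousOn η (Icc 0 1)) {C : Set T2} (hC : C ∈ 𝓝 (η 1)) {c : ℝ} (hc : c < 1) :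
    ∃ t ∈ Ioo (0 : ℝ) 1, c < t ∧ η t ∈ C := by
  obtain ⟨t, h1, h2, h3⟩ := near0 (η := fun t => η (1 - t)) (C := C) (c := 1 - c)
    (hη.comp (by fun_prop) (fun t ht => ⟨by linarith [ht.2], by linarith [ht.1]⟩)) (by simpa using hC) (by linarith)
  exact ⟨1 - t, ⟨by linarith [h1.2], by linarith [h1.1]⟩, by linarith, h3⟩

theorem spider {W J : Type} [Finite W] [Finite J] [DecidableEq W] (q : W → T2) (hq : Function.Injective q)
    (Cx : Set T2) (Cx1 : IsCompact Cx) (Cx2 : IsPreconnected Cx) (Cxq : ∀ w, q w ∉ Cx)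
    (η : J → ℝ → T2) (s : J → Option W) (y : J → W) (ηc : ∀ j, ContinuousOn (η j) (Icc 0 1))
    (sy : ∀ j, s j ≠ some (y j)) (hs : ∀ j w, s j = some w → η j 0 = q w)
    (hsx : ∀ j w, s j = some w → ∀ t ∈ Icc (0 : ℝ) 1, η j t ∉ Cx)
    (hx : ∀ j, s j = none → ∃ t ∈ Ioo (0 : ℝ) 1, η j t ∈ Cx)
    (hy : ∀ j, η j 1 = q (y j))
    (hd : ∀ j j', ∀ t ∈ Ioo (0 : ℝ) 1, ∀ t' ∈ Ioo (0 : ℝ) 1, η j t = η j' t' → j = j')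
    (hw : ∀ j w, s j ≠ some w → y j ≠ w → ∀ t ∈ Icc (0 : ℝ) 1, η j t ≠ q w) :
    ∃ (D : Type) (_ : Finite D) (_ : DecidableEq D) (α : D → D) (A : Finset D) (σ : Perm D) (src : D → Option W)
      (L : Fin 2 → (D → ZMod 2) → ZMod 2) (dart : J → D), Mp α A σ src L ∧
      (∀ z, z ∈ A ↔ ∃ j, z = dart j ∨ z = α (dart j)) ∧ ∀ j, src (dart j) = s j ∧ src (α (dart j)) = some (y j) := by
  classical
  obtain ⟨O, hO1, hO2⟩ : ∃ O : W → Set T2, (∀ w, q w ∈ O w ∧ IsOpen (O w)) ∧ ∀ w w', w ≠ w' → Disjoint (O w) (O w') := by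
    obtain ⟨U, hU1, hU2⟩ := (Set.toFinite (range q)).t2_separation
    refine ⟨fun w => U (q w), fun w => hU1 (q w), fun w w' h => hU2 (mem_range_self w) (mem_range_self w') fun h' => h (hq h')⟩
  have hC : ∀ w, ∃ C, IsCompact C ∧ IsPreconnected C ∧ C ⊆ O w ∩ (Cxᶜ ∩ ⋂ j ∈ {j | s j ≠ some w ∧ y j ≠ w}, (η j '' Icc 0 1)ᶜ) ∧ C ∈ 𝓝 (q w) := by
    intro w
    refine cnbhd _ _ ?_ ?_
    · refine (hO1 w).2.inter (Cx1.isClosed.isOpen_compl.inter ?_)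
      refine (Set.toFinite _).isOpen_biInter fun j _ => ?_
      exact (isCompact_Icc.image_of_continuousOn (ηc j)).isClosed.isOpen_compl
    · refine ⟨(hO1 w).1, Cxq w, ?_⟩
      simp only [mem_iInter]
      rintro j hj ⟨t, ht, he⟩
      exact hw j w hj.1 hj.2 t ht he
  choose C C1 C2 C3 C4 using hC
  have C5 : ∀ w, C w ⊆ O w := fun w => (C3 w).trans inter_subset_left
  have C6 : ∀ w, Disjoint Cx (C w) := fun w => Set.disjoint_left.2 fun p hp hp' => (C3 w hp').2.1 hp
  have C7 : ∀ w j, s j ≠ some w → y j ≠ w → ∀ t ∈ Icc (0 : ℝ) 1, η j t ∉ C w := by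
    intro w j h1 h2 t ht hp
    have := (C3 w hp).2.2
    simp only [mem_iInter] at this
    exact this j ⟨h1, h2⟩ ⟨t, ht, rfl⟩
  let CC : Option W → Set T2 := fun o => o.elim Cx C
  have st : ∀ j, ∃ t ∈ Ioo (0 : ℝ) 1, η j t ∈ CC (s j) := by
    intro j
    cases h : s j with
    | none => exact hx j h
    | some w =>
      obtain ⟨t, h1, -, h3⟩ := near0 (ηc j) (C := C w) (by rw [hs j w h]; exact C4 w) one_pos
      exact ⟨t, h1, h3⟩
  choose t0 ht0 hst using st
  have en : ∀ j, ∃ t ∈ Ioo (0 : ℝ) 1, t0 j < t ∧ η j t ∈ C (y j) := fun j =>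
    near1 (ηc j) (C := C (y j)) (by rw [hy j]; exact C4 _) (ht0 j).2
  choose t1 ht1 ht01 hen using en
  have sub : ∀ j, Icc (t0 j) (t1 j) ⊆ Ioo 0 1 := fun j t ht => ⟨(ht0 j).1.trans_le ht.1, ht.2.trans_lt (ht1 j).2⟩
  have cs : ∀ j, ContinuousOn (η j) (Icc (t0 j) (t1 j)) := fun j => (ηc j).mono ((sub j).trans Ioo_subset_Icc_self)
  refine minor none CC (fun j => η j '' Icc (t0 j) (t1 j)) s (fun j => some (y j)) sy ?_ ?_
    (fun j => isCompact_Icc.image_of_continuousOn (cs j)) (fun j => isPreconnected_Icc.image _ (cs j)) ?_ ?_ ?_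
    (fun j => ⟨η j (t0 j), ⟨t0 j, ⟨le_rfl, (ht01 j).le⟩, rfl⟩, hst j⟩) (fun j => ⟨η j (t1 j), ⟨t1 j, ⟨(ht01 j).le, le_rfl⟩, rfl⟩, hen j⟩)
  · rintro (_ | w)
    exacts [Cx1, C1 w]
  · rintro (_ | w)
    exacts [Cx2, C2 w]
  · rintro (_ | w) (_ | w') h
    · exact absurd rfl h
    · exact C6 w'
    · exact (C6 w).symm
    · exact (hO2 w w' (fun h' => h (by rw [h']))).mono (C5 w) (C5 w')
  · intro j j' h
    refine Set.disjoint_left.2 ?_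
    rintro _ ⟨t, ht, rfl⟩ ⟨t', ht', he⟩
    exact h (hd j j' t (sub j ht) t' (sub j' ht') he.symm)
  · rintro j (_ | w) h1 h2
    · refine Set.disjoint_left.2 ?_
      rintro _ ⟨t, ht, rfl⟩ hp
      cases h : s j with
      | none => exact h1 h.symm
      | some w => exact hsx j w h t (Ioo_subset_Icc_self (sub j ht)) hp
    · refine Set.disjoint_left.2 ?_
      rintro _ ⟨t, ht, rfl⟩ hp
      exact C7 w j (fun h => h1 h.symm) (fun h => h2 (by rw [h])) t (Ioo_subset_Icc_self (sub j ht)) hp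

end TG

namespace TG
open DS CM Equiv

structure TDr {V E : Type} (a b : E → V) (p : V → T2) (γ : E → ℝ → T2) : Prop where
  pinj : Function.Injective p
  ab : ∀ e, a e ≠ b e
  cont : ∀ e, ContinuousOn (γ e) (Icc 0 1)
  inj : ∀ e, InjOn (γ e) (Icc 0 1)
  g0 : ∀ e, γ e 0 = p (a e)
  g1 : ∀ e, γ e 1 = p (b e)
  disj : ∀ e e', ∀ t ∈ Ioo (0 : ℝ) 1, ∀ t' ∈ Ioo (0 : ℝ) 1, γ e t = γ e' t' → e = e'
  pn : ∀ e v, ∀ t ∈ Ioo (0 : ℝ) 1, γ e t ≠ p v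

def KK {V E : Type} (p : V → T2) (γ : E → ℝ → T2) : Set T2 := range p ∪ ⋃ e, γ e '' Ioo 0 1

variable {V E : Type} {a b : E → V} {p : V → T2} {γ : E → ℝ → T2}

theorem Icc_cases {t : ℝ} (ht : t ∈ Icc (0 : ℝ) 1) : t = 0 ∨ t = 1 ∨ t ∈ Ioo (0 : ℝ) 1 := by
  rcases ht.1.eq_or_lt with h | h
  · exact Or.inl h.symm
  rcases ht.2.eq_or_lt with h' | h'
  · exact Or.inr (Or.inl h')
  · exact Or.inr (Or.inr ⟨h, h'⟩)

theorem TDr.memK (h : TDr a b p γ) (e : E) {t : ℝ} (ht : t ∈ Icc (0 : ℝ) 1) : γ e t ∈ KK p γ := by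
  rcases Icc_cases ht with rfl | rfl | ht
  · rw [h.g0]; exact Or.inl (mem_range_self _)
  · rw [h.g1]; exact Or.inl (mem_range_self _)
  · exact Or.inr (mem_iUnion.2 ⟨e, t, ht, rfl⟩)

theorem TDr.closedPart [Finite V] [Finite E] (h : TDr a b p γ) (P : E → Prop) :
    IsClosed (range p ∪ ⋃ e ∈ {e | P e}, γ e '' Icc 0 1) := by
  refine (Set.finite_range p).isClosed.union ?_
  exact (Set.toFinite _).isClosed_biUnion fun e _ => (isCompact_Icc.image_of_continuousOn (h.cont e)).isClosed

theorem TDr.closed [Finite V] [Finite E] (h : TDr a b p γ) : IsClosed (KK p γ) := by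
  have := h.closedPart (fun _ => True)
  convert this using 1
  ext x
  constructor
  · rintro (h1 | h1)
    · exact Or.inl h1
    · right
      obtain ⟨e, t, ht, rfl⟩ := mem_iUnion.1 h1
      simp only [mem_iUnion]
      exact ⟨e, trivial, t, Ioo_subset_Icc_self ht, rfl⟩
  · rintro (h1 | h1)
    · exact Or.inl h1
    · simp only [mem_iUnion] at h1
      obtain ⟨e, -, t, ht, rfl⟩ := h1
      exact h.memK e ht

theorem stay {X : Type} [TopologicalSpace X] {f P : Set X} (fo : IsOpen f) (hP : IsPreconnected P) (hd : ∀ x ∈ P, x ∉ frontier f)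
    {x : X} (hx : x ∈ P) (hxf : x ∈ f) : P ⊆ f := by
  refine hP.subset_left_of_subset_union fo isClosed_closure.isOpen_compl (v := (closure f)ᶜ) ?_ ?_ ⟨x, hx, hxf⟩
  · exact Set.disjoint_left.2 fun y h1 h2 => h2 (subset_closure h1)
  · intro y hy
    by_cases h : y ∈ f
    · exact Or.inl h
    · right
      intro hc
      exact hd y hy ⟨hc, by rwa [fo.interior_eq]⟩

theorem TDr.access [Finite V] [Finite E] (h : TDr a b p γ) {f : Set T2} (fo : IsOpen f) (ff : frontier f ⊆ KK p γ)
    (fK : ∀ x ∈ f, x ∉ KK p γ) {e : E} {t0 : ℝ} (ht0 : t0 ∈ Ioo (0 : ℝ) 1) (h0 : γ e t0 ∈ frontier f) :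
    ∃ τ ∈ Ioo (0 : ℝ) 1, ∃ σ : ℝ → T2, ContinuousOn σ (Icc 0 1) ∧ σ 1 = γ e τ ∧ ∀ t ∈ Ico (0 : ℝ) 1, σ t ∈ f := by
  set K' := range p ∪ ⋃ e' ∈ {e' | e' ≠ e}, γ e' '' Icc 0 1 with hK'
  have hc : IsClosed K' := h.closedPart _
  have hn : γ e t0 ∉ K' := by
    rintro (⟨v, hv⟩ | h1)
    · exact h.pn e v t0 ht0 hv.symm
    · simp only [mem_iUnion] at h1
      obtain ⟨e', he', t, ht, hh⟩ := h1
      rcases Icc_cases ht with rfl | rfl | ht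
      · rw [h.g0] at hh; exact h.pn _ _ _ ht0 hh.symm
      · rw [h.g1] at hh; exact h.pn _ _ _ ht0 hh.symm
      · exact he' (h.disj _ _ _ ht _ ht0 hh)
  obtain ⟨U, ⟨hU1, hU2⟩, hU3⟩ := (path_connected_basis (γ e t0)).mem_iff.1 (hc.isOpen_compl.mem_nhds hn)
  obtain ⟨z, hzU, hzf⟩ := mem_closure_iff_nhds.1 h0.1 U hU1
  have hj := hU2.joinedIn z hzU _ (mem_of_mem_nhds hU1)
  obtain ⟨P, hP⟩ := hj
  let g : ℝ → T2 := P.extend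
  have gc : Continuous g := P.continuous_extend
  have g0 : g 0 = z := P.extend_zero
  have g1 : g 1 = γ e t0 := P.extend_one
  have gU : ∀ t ∈ Icc (0 : ℝ) 1, g t ∈ U := by
    intro t ht
    have : g t = P ⟨t, ht⟩ := P.extend_apply ht
    rw [this]; exact hP _
  have hcp : IsCompact (Icc (0 : ℝ) 1 ∩ g ⁻¹' KK p γ) := isCompact_Icc.inter_right (h.closed.preimage gc)
  obtain ⟨s, hs, hsl⟩ := hcp.exists_isLeast ⟨1, ⟨by simp, by
    show g 1 ∈ KK p γ
    rw [g1]; exact h.memK e (Ioo_subset_Icc_self ht0)⟩⟩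
  have spos : 0 < s := by
    rcases hs.1.1.eq_or_lt with h1 | h1
    · exfalso
      have := hs.2
      rw [← h1, mem_preimage, g0] at this
      exact fK z hzf this
    · exact h1
  have inf : ∀ t ∈ Ico (0 : ℝ) s, g t ∈ f := by
    have := stay fo (isPreconnected_Ico.image g gc.continuousOn) (P := g '' Ico 0 s) (by
      rintro _ ⟨t, ht, rfl⟩ hfr
      have := hsl ⟨⟨ht.1, ht.2.le.trans hs.1.2⟩, ff hfr⟩
      linarith [ht.2]) (x := g 0) ⟨0, ⟨le_rfl, spos⟩, rfl⟩ (by rw [g0]; exact hzf)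
    exact fun t ht => this ⟨t, ht, rfl⟩
  obtain ⟨τ, hτ, hτe⟩ : ∃ τ ∈ Ioo (0 : ℝ) 1, γ e τ = g s := by
    have h1 := hU3 (gU s hs.1)
    have h2 : g s ∈ KK p γ := hs.2
    rcases h2 with h2 | h2
    · exact absurd (Or.inl h2) h1
    · obtain ⟨e', t, ht, he⟩ := mem_iUnion.1 h2
      by_cases hee : e' = e
      · subst hee; exact ⟨t, ht, he⟩
      · refine absurd (Or.inr ?_) h1
        simp only [mem_iUnion]
        exact ⟨e', hee, t, Ioo_subset_Icc_self ht, he⟩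
  refine ⟨τ, hτ, fun t => g (s * t), (gc.comp (by fun_prop)).continuousOn, by simp [hτe], fun t ht => inf _ ⟨?_, ?_⟩⟩
  · exact mul_nonneg spos.le ht.1
  · nlinarith [ht.2]

theorem shrink {σ : ℝ → T2} (hσ : ContinuousOn σ (Icc 0 1)) {O : Set T2} (hO : O ∈ 𝓝 (σ 1)) {f : Set T2} (hf : ∀ t ∈ Ico (0 : ℝ) 1, σ t ∈ f) :
    ∃ σ' : ℝ → T2, ContinuousOn σ' (Icc 0 1) ∧ σ' 1 = σ 1 ∧ (∀ t ∈ Ico (0 : ℝ) 1, σ' t ∈ f) ∧ ∀ t ∈ Icc (0 : ℝ) 1, σ' t ∈ O := by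
  have h1 : ∀ᶠ t in 𝓝[Icc (0 : ℝ) 1] 1, σ t ∈ O := (hσ 1 (by simp)) hO
  rw [eventually_nhdsWithin_iff, Metric.eventually_nhds_iff] at h1
  obtain ⟨ε, he, h2⟩ := h1
  set u : ℝ := max 0 (1 - ε / 2) with hu
  have u0 : 0 ≤ u := le_max_left _ _
  have u1 : u < 1 := max_lt one_pos (by linarith)
  have u2 : 1 - ε / 2 ≤ u := le_max_right _ _
  have r0 : ∀ t ∈ Icc (0 : ℝ) 1, u ≤ u + (1 - u) * t := fun t ht => by nlinarith [ht.1]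
  have r1 : ∀ t ∈ Icc (0 : ℝ) 1, u + (1 - u) * t ≤ 1 := fun t ht => by nlinarith [ht.2]
  refine ⟨fun t => σ (u + (1 - u) * t), hσ.comp (by fun_prop) (fun t ht => ⟨u0.trans (r0 t ht), r1 t ht⟩), by simp, fun t ht => hf _ ⟨?_, ?_⟩, fun t ht => ?_⟩
  · exact u0.trans (r0 t ⟨ht.1, ht.2.le⟩)
  · nlinarith [ht.2]
  · refine h2 ?_ ⟨u0.trans (r0 t ht), r1 t ht⟩
    rw [Real.dist_eq, abs_lt]
    have := r0 t ht
    have := r1 t ht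
    constructor <;> linarith

theorem fin3 (P : Fin 3 → Prop) (h0 : P 0) (h1 : P 1) (h2 : P 2) : ∀ k, P k := by
  intro k
  fin_cases k <;> assumption

theorem toGPl [Finite V] [Finite E] [DecidableEq V] [DecidableEq E] (h : TDr a b p γ) {f : Set T2} (fo : IsOpen f) (fc : IsConnected f)
    (ff : frontier f ⊆ KK p γ) (fK : ∀ x ∈ f, x ∉ KK p γ) :
    ∃ (D : Type) (_ : Finite D) (_ : DecidableEq D) (α : D → D) (A : Finset D) (σ : Perm D) (src : D → Option (V ⊕ E))
      (L : Fin 2 → (D → ZMod 2) → ZMod 2) (dart : E → Fin 3 → D), Mp α A σ src L ∧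
      GPl α A src a b {e | ∃ t ∈ Ioo (0 : ℝ) 1, γ e t ∈ frontier f} dart := by
  classical
  set S : Set E := {e | ∃ t ∈ Ioo (0 : ℝ) 1, γ e t ∈ frontier f} with hS
  have a1 : ∀ e, ∃ τ ∈ Ioo (0 : ℝ) 1, ∃ σ : ℝ → T2, e ∈ S → (ContinuousOn σ (Icc 0 1) ∧ σ 1 = γ e τ ∧ ∀ t ∈ Ico (0 : ℝ) 1, σ t ∈ f) := by
    intro e
    by_cases he : e ∈ S
    · obtain ⟨t, ht, hh⟩ := he
      obtain ⟨τ, hτ, σ, hσ⟩ := h.access fo ff fK ht hh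
      exact ⟨τ, hτ, σ, fun _ => hσ⟩
    · exact ⟨1 / 2, by norm_num, γ e, fun h => absurd h he⟩
  choose τ hτ σ0 hσ0 using a1
  let q : V ⊕ E → T2 := Sum.elim p (fun e => γ e (τ e))
  have hq : Function.Injective q := by
    rintro (v | e) (v' | e') hh
    · rw [h.pinj hh]
    · exact absurd hh.symm (h.pn _ _ _ (hτ e'))
    · exact absurd hh (h.pn _ _ _ (hτ e))
    · rw [h.disj _ _ _ (hτ e) _ (hτ e') hh]
  have qK : ∀ w, q w ∈ KK p γ := by
    rintro (v | e)
    · exact Or.inl (mem_range_self _)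
    · exact h.memK e (Ioo_subset_Icc_self (hτ e))
  obtain ⟨O, hO1, hO2⟩ : ∃ O : V ⊕ E → Set T2, (∀ w, q w ∈ O w ∧ IsOpen (O w)) ∧ ∀ w w', w ≠ w' → Disjoint (O w) (O w') := by
    obtain ⟨U, hU1, hU2⟩ := (Set.toFinite (range q)).t2_separation
    refine ⟨fun w => U (q w), fun w => hU1 (q w), fun w w' h => hU2 (mem_range_self w) (mem_range_self w') fun h' => h (hq h')⟩
  have a2 : ∀ e, ∃ σ : ℝ → T2, e ∈ S → (ContinuousOn σ (Icc 0 1) ∧ σ 1 = γ e (τ e) ∧ (∀ t ∈ Ico (0 : ℝ) 1, σ t ∈ f) ∧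
      ∀ t ∈ Icc (0 : ℝ) 1, σ t ∈ O (Sum.inr e)) := by
    intro e
    by_cases he : e ∈ S
    · obtain ⟨h1, h2, h3⟩ := hσ0 e he
      obtain ⟨σ', g1, g2, g3, g4⟩ := shrink h1 (O := O (Sum.inr e)) (by rw [h2]; exact (hO1 (Sum.inr e)).2.mem_nhds (hO1 (Sum.inr e)).1) h3
      exact ⟨σ', fun _ => ⟨g1, g2.trans h2, g3, g4⟩⟩
    · exact ⟨γ e, fun h => absurd h he⟩
  choose σ hσ using a2
  have fpc : IsPathConnected f := fo.isConnected_iff_isPathConnected.1 fc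
  obtain ⟨z, hz⟩ := fc.nonempty
  have a3 : ∀ e : S, ∃ P : Path z (σ e (1 / 2)), ∀ t, P t ∈ f := by
    intro e
    have := fpc.joinedIn z hz (σ e (1 / 2)) ((hσ e e.2).2.2.1 _ (by norm_num))
    exact ⟨this.somePath, this.somePath_mem⟩
  choose P hP using a3
  let Cx : Set T2 := ⋃ e : S, range (P e)
  have Cxf : ∀ x ∈ Cx, x ∈ f := by
    intro x hx
    obtain ⟨e, t, rfl⟩ := mem_iUnion.1 hx
    exact hP e t
  let η : E → Fin 3 → ℝ → T2 := fun e => ![fun t => γ e (τ e * t), fun t => γ e (1 - (1 - τ e) * t), σ e]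
  let st : E → Fin 3 → Option (V ⊕ E) := fun e => ![some (Sum.inl (a e)), some (Sum.inl (b e)), none]
  have fB : ∀ e k, k ≠ 2 → ∀ t ∈ Icc (0 : ℝ) 1, ∃ r ∈ Icc (0 : ℝ) 1, η e k t = γ e r ∧ (k = 0 → r ≤ τ e) ∧ (k = 1 → τ e ≤ r) ∧
      (0 < t → t < 1 → r ∈ Ioo (0 : ℝ) 1 ∧ r ≠ τ e) := by
    intro e
    have t0 := (hτ e).1
    have t1 := (hτ e).2
    apply fin3
    · intro _ t ht
      refine ⟨τ e * t, ⟨mul_nonneg t0.le ht.1, by nlinarith [ht.1, ht.2]⟩, rfl, fun _ => by nlinarith [ht.1, ht.2], fun h => absurd h (by decide), fun h1 h2 => ⟨⟨by positivity, by nlinarith⟩, by nlinarith⟩⟩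
    · intro _ t ht
      refine ⟨1 - (1 - τ e) * t, ⟨by nlinarith [ht.1, ht.2], by nlinarith [ht.1, ht.2]⟩, rfl, fun h => absurd h (by decide), fun _ => by nlinarith [ht.1, ht.2], fun h1 h2 => ⟨⟨by nlinarith, by nlinarith⟩, by nlinarith⟩⟩
    · intro h; exact absurd rfl h
  let J := {x : E × Fin 3 // x.2 = 2 → x.1 ∈ S}
  obtain ⟨D, i1, i2, α, A, sg, src, L, dart, r1, r2, r3⟩ := spider (J := J) q hq Cx
    (isCompact_iUnion fun e => isCompact_range (P e).continuous)
    (isPreconnected_iUnion ⟨z, mem_iInter.2 fun e => ⟨0, (P e).source⟩⟩ fun e => isPreconnected_range (P e).continuous)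
    (fun w hw => fK _ (Cxf _ hw) (qK w)) (fun j => η j.1.1 j.1.2) (fun j => st j.1.1 j.1.2) (fun j => Sum.inr j.1.1)
    (by
      rintro ⟨⟨e, k⟩, hk⟩
      revert k; apply fin3
      · intro _
        have t0 := (hτ e).1
        have t1 := (hτ e).2
        refine (h.cont e).comp (f := fun t => τ e * t) (by fun_prop) (fun t ht => ⟨mul_nonneg t0.le ht.1, by nlinarith [ht.1, ht.2]⟩)
      · intro _
        have t0 := (hτ e).1
        have t1 := (hτ e).2
        refine (h.cont e).comp (f := fun t => 1 - (1 - τ e) * t) (by fun_prop) (fun t ht => ⟨by nlinarith [ht.1, ht.2], by nlinarith [ht.1, ht.2]⟩)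
      · intro hk
        exact (hσ e (hk rfl)).1)
    (by
      rintro ⟨⟨e, k⟩, hk⟩
      revert k; apply fin3 <;> intro _ <;> simp [st])
    (by
      rintro ⟨⟨e, k⟩, hk⟩ w
      revert k; apply fin3
      · intro _ hw
        simp [st] at hw
        subst hw
        simp [η, q, h.g0]
      · intro _ hw
        simp [st] at hw
        subst hw
        simp [η, q, h.g1]
      · intro _ hw
        simp [st] at hw)
    (by
      rintro ⟨⟨e, k⟩, hk⟩ w hw t ht hc
      by_cases h2 : k = 2
      · subst h2; simp [st] at hw
      · obtain ⟨r, hr, he, -⟩ := fB e k h2 t ht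
        dsimp only at hc
        rw [he] at hc
        exact fK _ (Cxf _ hc) (h.memK e hr))
    (by
      rintro ⟨⟨e, k⟩, hk⟩ hw
      revert k; apply fin3
      · intro _ hw
        simp [st] at hw
      · intro _ hw
        simp [st] at hw
      · intro hk _
        refine ⟨1 / 2, by norm_num, mem_iUnion.2 ⟨⟨e, hk rfl⟩, 1, (P _).target⟩⟩)
    (by
      rintro ⟨⟨e, k⟩, hk⟩
      revert k; apply fin3
      · intro _; simp [η, q]
      · intro _; simp [η, q]
      · intro hk
        exact (hσ e (hk rfl)).2.1)
    (by
      rintro ⟨⟨e, k⟩, hk⟩ ⟨⟨e', k'⟩, hk'⟩ t ht t' ht' he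
      dsimp only at he
      have main : e = e' ∧ k = k' := by
        by_cases h2 : k = 2
        · subst h2
          have m1 := (hσ e (hk rfl)).2.2.1 t ⟨ht.1.le, ht.2⟩
          by_cases h2' : k' = 2
          · subst h2'
            refine ⟨?_, rfl⟩
            have o1 := (hσ e (hk rfl)).2.2.2 t ⟨ht.1.le, ht.2.le⟩
            have o2 := (hσ e' (hk' rfl)).2.2.2 t' ⟨ht'.1.le, ht'.2.le⟩
            by_contra hne
            refine Set.disjoint_left.1 (hO2 (Sum.inr e) (Sum.inr e') (by simpa using hne)) o1 ?_
            have : σ e t = σ e' t' := he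
            rw [this]; exact o2
          · exfalso
            obtain ⟨r, hr, he', -⟩ := fB e' k' h2' t' ⟨ht'.1.le, ht'.2.le⟩
            have : σ e t = γ e' r := he.trans he'
            rw [this] at m1
            exact fK _ m1 (h.memK e' hr)
        · obtain ⟨r, hr, hre, c0, c1, hr'⟩ := fB e k h2 t ⟨ht.1.le, ht.2.le⟩
          obtain ⟨hr', hrn⟩ := hr' ht.1 ht.2
          by_cases h2' : k' = 2
          · exfalso
            subst h2'
            have m1 := (hσ e' (hk' rfl)).2.2.1 t' ⟨ht'.1.le, ht'.2⟩
            have : σ e' t' = γ e r := he.symm.trans hre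
            rw [this] at m1
            exact fK _ m1 (h.memK e hr)
          · obtain ⟨r1, hr1, hre1, c01, c11, hr1'⟩ := fB e' k' h2' t' ⟨ht'.1.le, ht'.2.le⟩
            obtain ⟨hr1', hrn1⟩ := hr1' ht'.1 ht'.2
            have hg : γ e r = γ e' r1 := by rw [← hre, ← hre1, he]
            have hee := h.disj _ _ _ hr' _ hr1' hg
            subst hee
            have hrr := h.inj e hr hr1 hg
            subst hrr
            refine ⟨rfl, ?_⟩
            have : ∀ k k' : Fin 3, k ≠ 2 → k' ≠ 2 → (k = k' ∨ (k = 0 ∧ k' = 1) ∨ (k = 1 ∧ k' = 0)) := by decide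
            rcases this k k' h2 h2' with h3 | h3 | h3
            · exact h3
            · exact absurd (le_antisymm (c0 h3.1) (c11 h3.2)) hrn
            · exact absurd (le_antisymm (c01 h3.2) (c1 h3.1)) hrn
      obtain ⟨rfl, rfl⟩ := main
      rfl)
    (by
      rintro ⟨⟨e, k⟩, hk⟩ w hw1 hw2 t ht he
      dsimp only at he hw1 hw2
      by_cases h2 : k = 2
      · subst h2
        rcases ht.2.eq_or_lt with rfl | hlt
        · have : q (Sum.inr e) = q w := ((hσ e (hk rfl)).2.1).symm.trans he
          exact hw2 (hq this)
        · have m1 := (hσ e (hk rfl)).2.2.1 t ⟨ht.1, hlt⟩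
          have : σ e t = q w := he
          rw [this] at m1
          exact fK _ m1 (qK w)
      · obtain ⟨r, hr, hre, c0, c1, -⟩ := fB e k h2 t ht
        rw [hre] at he
        have k01 : k = 0 ∨ k = 1 := (by decide : ∀ k : Fin 3, k ≠ 2 → k = 0 ∨ k = 1) k h2
        rcases Icc_cases hr with rfl | rfl | hr
        · rw [h.g0] at he
          have := hq (a₁ := Sum.inl (a e)) he
          subst this
          rcases k01 with rfl | rfl
          · exact hw1 rfl
          · exact absurd (c1 rfl) (not_le.2 (hτ e).1)
        · rw [h.g1] at he
          have := hq (a₁ := Sum.inl (b e)) he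
          subst this
          rcases k01 with rfl | rfl
          · exact absurd (c0 rfl) (not_le.2 (hτ e).2)
          · exact hw1 rfl
        · rcases w with v | e'
          · exact h.pn _ _ _ hr he
          · exact hw2 (by rw [h.disj _ _ _ hr _ (hτ e') he]))
  refine ⟨D, i1, i2, α, A, sg, src, L, fun e k => if hk : k = 2 → e ∈ S then dart ⟨(e, k), hk⟩ else dart ⟨(e, 0), fun h => absurd (show (0 : Fin 3) = 2 from h) (by decide)⟩, r1, ?_, ?_, ?_, ?_, ?_⟩
  · intro z
    rw [r2]
    constructor
    · rintro ⟨⟨⟨e, k⟩, hk⟩, hz⟩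
      refine ⟨e, k, hk, ?_⟩
      simp only [dif_pos hk]
      exact hz
    · rintro ⟨e, k, hk, hz⟩
      simp only [dif_pos hk] at hz
      exact ⟨_, hz⟩
  · intro e
    have hk : ((0 : Fin 3) = 2 → e ∈ S) := fun h => absurd h (by decide)
    simp only [dif_pos hk]
    exact (r3 _).1
  · intro e
    have hk : ((1 : Fin 3) = 2 → e ∈ S) := fun h => absurd h (by decide)
    simp only [dif_pos hk]
    exact (r3 _).1
  · intro e he
    have hk : ((2 : Fin 3) = 2 → e ∈ S) := fun _ => he
    rw [dif_pos hk]
    exact (r3 _).1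
  · intro e k hk
    simp only [dif_pos hk]
    exact (r3 _).2

end TG

namespace TG

theorem arcEnd {A : Set T2} {p q : T2} (hpq : p ≠ q) (hc : closure A = A ∪ {p, q})
    {g : ℝ → T2} (gc : ContinuousOn g (Ioo 0 1)) (gA : ∀ t ∈ Ioo (0 : ℝ) 1, g t ∈ A)
    (hK : ∀ K, IsCompact K → K ⊆ A → ∃ δ > 0, ∀ t ∈ Ioo (0 : ℝ) 1, t < δ → g t ∉ K) :
    Filter.Tendsto g (𝓝[>] 0) (𝓝 p) ∨ Filter.Tendsto g (𝓝[>] 0) (𝓝 q) := by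
  have step : ∀ U W : Set T2, IsOpen U → IsOpen W → Disjoint U W → p ∈ U → q ∈ W →
      ∃ δ > 0, δ ≤ 1 ∧ ((∀ t ∈ Ioo 0 δ, g t ∈ U) ∨ ∀ t ∈ Ioo 0 δ, g t ∈ W) := by
    intro U W hU hW hd hp hq
    obtain ⟨δ, hδ, h1⟩ := hK (closure A \ (U ∪ W)) ((isClosed_closure.sdiff (hU.union hW)).isCompact) (by
      rintro x ⟨hx, hx'⟩
      rw [hc] at hx
      rcases hx with hx | rfl | rfl
      · exact hx
      · exact absurd (Or.inl hp) hx'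
      · exact absurd (Or.inr hq) hx')
    refine ⟨min δ 1, by positivity, min_le_right _ _, ?_⟩
    have sub : ∀ t ∈ Ioo 0 (min δ 1), t ∈ Ioo (0 : ℝ) 1 := fun t ht => ⟨ht.1, ht.2.trans_le (min_le_right _ _)⟩
    have hUW : g '' Ioo 0 (min δ 1) ⊆ U ∪ W := by
      rintro _ ⟨t, ht, rfl⟩
      by_contra hn
      exact h1 t (sub t ht) (ht.2.trans_le (min_le_left _ _)) ⟨subset_closure (gA t (sub t ht)), hn⟩
    have hpc : IsPreconnected (g '' Ioo 0 (min δ 1)) := isPreconnected_Ioo.image _ (gc.mono sub)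
    by_cases hne : (g '' Ioo 0 (min δ 1) ∩ U).Nonempty
    · left
      have := hpc.subset_left_of_subset_union hU hW hd hUW hne
      exact fun t ht => this ⟨t, ht, rfl⟩
    · right
      intro t ht
      rcases hUW ⟨t, ht, rfl⟩ with h | h
      · exact absurd ⟨_, ⟨t, ht, rfl⟩, h⟩ hne
      · exact h
  obtain ⟨U, W, hU, hW, hpU, hqW, hd⟩ := t2_separation hpq
  obtain ⟨δ, hδ, hδ1, h1 | h1⟩ := step U W hU hW hd hpU hqW
  · left
    rw [(nhds_basis_opens p).tendsto_right_iff]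
    rintro O ⟨hpO, hO⟩
    obtain ⟨δ', hδ', hδ1', h2 | h2⟩ := step (U ∩ O) W (hU.inter hO) hW (hd.mono_left inter_subset_left) ⟨hpU, hpO⟩ hqW
    · filter_upwards [Ioo_mem_nhdsGT hδ'] with t ht using (h2 t ht).2
    · exfalso
      have m : min δ δ' / 2 ∈ Ioo 0 (min δ δ') := ⟨by positivity, by have : 0 < min δ δ' := by positivity
                                                                     linarith⟩
      exact Set.disjoint_left.1 hd (h1 _ ⟨m.1, m.2.trans_le (min_le_left _ _)⟩) (h2 _ ⟨m.1, m.2.trans_le (min_le_right _ _)⟩)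
  · right
    rw [(nhds_basis_opens q).tendsto_right_iff]
    rintro O ⟨hpO, hO⟩
    obtain ⟨δ', hδ', hδ1', h2 | h2⟩ := step U (W ∩ O) hU (hW.inter hO) (hd.mono_right inter_subset_left) hpU ⟨hqW, hpO⟩
    · exfalso
      have m : min δ δ' / 2 ∈ Ioo 0 (min δ δ') := ⟨by positivity, by have : 0 < min δ δ' := by positivity
                                                                     linarith⟩
      exact Set.disjoint_left.1 hd (h2 _ ⟨m.1, m.2.trans_le (min_le_right _ _)⟩) (h1 _ ⟨m.1, m.2.trans_le (min_le_left _ _)⟩)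
    · filter_upwards [Ioo_mem_nhdsGT hδ'] with t ht using (h2 t ht).2

set_option maxHeartbeats 1000000 in
theorem arcPath {A : Set T2} (hA : Nonempty ((Ioo (0 : ℝ) 1) ≃ₜ A)) {p q : T2} (hpq : p ≠ q) (hp : p ∉ A) (hq : q ∉ A)
    (hc : closure A = A ∪ {p, q}) :
    ∃ γ : ℝ → T2, ContinuousOn γ (Icc 0 1) ∧ InjOn γ (Icc 0 1) ∧ γ 0 = p ∧ γ 1 = q ∧ γ '' Ioo 0 1 = A := by
  obtain ⟨φ⟩ := hA
  let g : ℝ → T2 := fun t => if h : t ∈ Ioo (0 : ℝ) 1 then φ ⟨t, h⟩ else p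
  have gv : ∀ t (ht : t ∈ Ioo (0 : ℝ) 1), g t = φ ⟨t, ht⟩ := fun t ht => dif_pos ht
  have gc : ContinuousOn g (Ioo 0 1) := by
    rw [continuousOn_iff_continuous_restrict]
    have : (Ioo (0 : ℝ) 1).domRestrict g = fun t => (φ t : T2) := by
      funext t
      exact gv t t.2
    rw [this]
    exact continuous_subtype_val.comp φ.continuous
  have gA : ∀ t ∈ Ioo (0 : ℝ) 1, g t ∈ A := fun t ht => by rw [gv t ht]; exact (φ _).2
  have hK : ∀ K, IsCompact K → K ⊆ A → ∃ δ > 0, ∀ t ∈ Ioo (0 : ℝ) 1, g t ∈ K → δ ≤ t ∧ δ ≤ 1 - t := by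
    intro K hK hKA
    let K1 : Set ℝ := (fun x : A => ((φ.symm x : Ioo (0 : ℝ) 1) : ℝ)) '' (Subtype.val ⁻¹' K)
    have hK1 : IsCompact K1 := by
      refine IsCompact.image ?_ (continuous_subtype_val.comp φ.symm.continuous)
      rw [Topology.IsEmbedding.subtypeVal.isCompact_iff, Subtype.image_preimage_coe, inter_eq_right.2 hKA]
      exact hK
    have mem : ∀ t ∈ Ioo (0 : ℝ) 1, g t ∈ K → t ∈ K1 := by
      intro t ht hk
      refine ⟨φ ⟨t, ht⟩, by rw [mem_preimage, ← gv t ht]; exact hk, by simp⟩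
    have sub : ∀ t ∈ K1, t ∈ Ioo (0 : ℝ) 1 := by
      rintro _ ⟨x, -, rfl⟩
      exact (φ.symm x).2
    by_cases hne : K1.Nonempty
    · obtain ⟨l, hl, hl'⟩ := hK1.exists_isLeast hne
      obtain ⟨u, hu, hu'⟩ := hK1.exists_isGreatest hne
      refine ⟨min l (1 - u), lt_min (sub l hl).1 (by linarith [(sub u hu).2]), fun t ht hk => ⟨?_, ?_⟩⟩
      · exact (min_le_left _ _).trans (hl' (mem t ht hk))
      · refine (min_le_right _ _).trans ?_
        have := hu' (mem t ht hk)
        linarith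
    · exact ⟨1, one_pos, fun t ht hk => absurd ⟨t, mem t ht hk⟩ hne⟩
  have e0 := arcEnd hpq hc gc gA (fun K h1 h2 => by
    obtain ⟨δ, h3, h4⟩ := hK K h1 h2
    exact ⟨δ, h3, fun t ht hlt hk => absurd (h4 t ht hk).1 (not_le.2 hlt)⟩)
  have e1 := arcEnd (g := fun t => g (1 - t)) hpq hc (gc.comp (by fun_prop) (fun t ht => ⟨by linarith [ht.2], by linarith [ht.1]⟩))
    (fun t ht => gA _ ⟨by linarith [ht.2], by linarith [ht.1]⟩) (fun K h1 h2 => by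
    obtain ⟨δ, h3, h4⟩ := hK K h1 h2
    refine ⟨δ, h3, fun t ht hlt hk => absurd (h4 (1 - t) ⟨by linarith [ht.2], by linarith [ht.1]⟩ hk).2 (not_le.2 ?_)⟩
    linarith)
  have conv : ∀ r, Filter.Tendsto (fun t => g (1 - t)) (𝓝[>] 0) (𝓝 r) → Filter.Tendsto g (𝓝[<] 1) (𝓝 r) := by
    intro r hr
    have h1 : Filter.Tendsto (fun t : ℝ => 1 - t) (𝓝[<] 1) (𝓝[>] 0) := by
      refine tendsto_nhdsWithin_iff.2 ⟨?_, ?_⟩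
      · have : Filter.Tendsto (fun t : ℝ => 1 - t) (𝓝 1) (𝓝 (1 - 1)) := (by fun_prop : Continuous fun t : ℝ => 1 - t).tendsto 1
        rw [sub_self] at this
        exact this.mono_left nhdsWithin_le_nhds
      · filter_upwards [self_mem_nhdsWithin] with t ht
        have : t < 1 := ht
        show 0 < 1 - t
        linarith
    have := hr.comp h1
    simpa [Function.comp_def] using this
  obtain ⟨r0, hr0, t0⟩ : ∃ r, (r = p ∨ r = q) ∧ Filter.Tendsto g (𝓝[>] 0) (𝓝 r) := by
    rcases e0 with h | h
    exacts [⟨p, Or.inl rfl, h⟩, ⟨q, Or.inr rfl, h⟩]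
  obtain ⟨r1, hr1, t1⟩ : ∃ r, (r = p ∨ r = q) ∧ Filter.Tendsto g (𝓝[<] 1) (𝓝 r) := by
    rcases e1 with h | h
    exacts [⟨p, Or.inl rfl, conv _ h⟩, ⟨q, Or.inr rfl, conv _ h⟩]
  have h01 : (0 : ℝ) < 1 := one_pos
  set γ : ℝ → T2 := extendFrom (Ioo 0 1) g with hγ
  have γc : ContinuousOn γ (Icc 0 1) := continuousOn_Icc_extendFrom_Ioo gc t0 t1
  have γ0 : γ 0 = r0 := eq_lim_at_left_extendFrom_Ioo h01 t0
  have γ1 : γ 1 = r1 := eq_lim_at_right_extendFrom_Ioo h01 t1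
  have γm : ∀ t ∈ Ioo (0 : ℝ) 1, γ t = g t := fun t ht =>
    extendFrom_eq (subset_closure ht) (gc t ht)
  have γI : γ '' Ioo 0 1 = A := by
    ext x
    constructor
    · rintro ⟨t, ht, rfl⟩
      rw [γm t ht]; exact gA t ht
    · intro hx
      refine ⟨φ.symm ⟨x, hx⟩, (φ.symm ⟨x, hx⟩).2, ?_⟩
      rw [γm _ (φ.symm ⟨x, hx⟩).2, gv _ (φ.symm ⟨x, hx⟩).2]
      simp
  have tot : closure A ⊆ γ '' Icc 0 1 := by
    refine closure_minimal ?_ (isCompact_Icc.image_of_continuousOn γc).isClosed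
    rw [← γI]
    exact image_mono Ioo_subset_Icc_self
  have val : ∀ x ∉ A, x ∈ closure A → x = r0 ∨ x = r1 := by
    intro x hx hx'
    obtain ⟨t, ht, rfl⟩ := tot hx'
    rcases Icc_cases ht with rfl | rfl | ht
    · exact Or.inl γ0
    · exact Or.inr γ1
    · exact absurd (γI ▸ ⟨t, ht, rfl⟩ : γ t ∈ A) hx
  have vp := val p hp (by rw [hc]; right; left; rfl)
  have vq := val q hq (by rw [hc]; right; right; rfl)
  have rne : r0 ≠ r1 := by
    rintro rfl
    simp only [or_self] at vp vq
    exact hpq (vp.trans vq.symm)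
  have rA : ∀ r, (r = p ∨ r = q) → r ∉ A := by rintro r (rfl | rfl) <;> assumption
  have γi : InjOn γ (Icc 0 1) := by
    have mA : ∀ t ∈ Ioo (0 : ℝ) 1, γ t ∈ A := fun t ht => γI ▸ ⟨t, ht, rfl⟩
    intro s hs t ht he
    rcases Icc_cases hs with rfl | rfl | hs <;> rcases Icc_cases ht with rfl | rfl | ht
    · rfl
    · exact absurd (γ0.symm.trans (he.trans γ1)) rne
    · rw [γ0] at he; exact absurd (he ▸ mA t ht) (rA _ hr0)
    · exact absurd (γ0.symm.trans (he.symm.trans γ1)) rne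
    · rfl
    · rw [γ1] at he; exact absurd (he ▸ mA t ht) (rA _ hr1)
    · rw [γ0] at he; exact absurd (he ▸ mA s hs) (rA _ hr0)
    · rw [γ1] at he; exact absurd (he ▸ mA s hs) (rA _ hr1)
    · rw [γm s hs, γm t ht, gv s hs, gv t ht] at he
      have := φ.injective (Subtype.ext he)
      exact congrArg Subtype.val this
  by_cases hrp : r0 = p
  · refine ⟨γ, γc, γi, by rw [γ0, hrp], ?_, γI⟩
    rw [γ1]
    rcases vq with h | h
    · exact absurd (hrp.symm.trans h.symm) hpq
    · exact h.symm
  · have h0q : r0 = q := hr0.resolve_left hrp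
    have h1p : r1 = p := by
      rcases vp with h | h
      · exact absurd h.symm hrp
      · exact h.symm
    refine ⟨fun t => γ (1 - t), γc.comp (by fun_prop) (fun t ht => ⟨by linarith [ht.2], by linarith [ht.1]⟩), ?_, ?_, ?_, ?_⟩
    · intro s hs t ht he
      have := γi ⟨by linarith [hs.2], by linarith [hs.1]⟩ ⟨by linarith [ht.2], by linarith [ht.1]⟩ he
      linarith
    · simp [γ1, h1p]
    · simp [γ0, h0q]
    · rw [← γI]
      ext x
      constructor
      · rintro ⟨t, ht, rfl⟩
        exact ⟨1 - t, ⟨by linarith [ht.2], by linarith [ht.1]⟩, rfl⟩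
      · rintro ⟨t, ht, rfl⟩
        exact ⟨1 - t, ⟨by linarith [ht.2], by linarith [ht.1]⟩, by simp⟩

end TG

namespace TG

theorem constInt {X : Type*} [TopologicalSpace X] {S : Set X} {k : X → ℝ} (hS : IsPreconnected S)
    (hk : ContinuousOn k S) (hi : ∀ x ∈ S, ∃ n : ℤ, k x = n) {x y : X} (hx : x ∈ S) (hy : y ∈ S) : k x = k y := by
  have key : ∀ x ∈ S, ∀ y ∈ S, ¬ k x < k y := by
    intro x hx y hy hlt
    obtain ⟨n, hn⟩ := hi x hx
    obtain ⟨m, hm⟩ := hi y hy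
    rw [hn, hm] at hlt
    have h1 : n + 1 ≤ m := by exact_mod_cast hlt
    have h2 : (n : ℝ) + 1 ≤ m := by exact_mod_cast h1
    obtain ⟨z, hz, hz'⟩ := hS.intermediate_value hx hy hk (show (n : ℝ) + 1 / 2 ∈ Icc (k x) (k y) by
      rw [hn, hm]; constructor <;> linarith)
    obtain ⟨l, hl⟩ := hi z hz
    rw [hl] at hz'
    have h3 : (2 * l : ℝ) = 2 * n + 1 := by linarith
    have h4 : 2 * l = 2 * n + 1 := by exact_mod_cast h3
    omega
  exact le_antisymm (not_lt.1 (key y hy x hx)) (not_lt.1 (key x hx y hy))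

theorem planeB (e : C(unitInterval, ℂ)) (ei : Function.Injective e) {A : Set ℂ} (Ao : IsOpen A)
    (Ab : Bornology.IsBounded A) (An : A.Nonempty) (Af : frontier A ⊆ range e) (Ad : ∀ t, e t ∉ A) : False := by
  obtain ⟨a, ha⟩ := An
  have hne : ∀ t, e t - a ≠ 0 := fun t h => Ad t (by rw [sub_eq_zero.1 h]; exact ha)
  have cov := Complex.isCoveringMap_exp
  let f : C(unitInterval, {z : ℂ // z ≠ 0}) := ⟨fun t => ⟨e t - a, hne t⟩, by fun_prop⟩
  obtain ⟨L, hL, -⟩ := cov.exists_path_lifts f (Complex.log (e 0 - a))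
    (Subtype.ext (Complex.exp_log (hne 0)).symm)
  have hL' : ∀ t, Complex.exp (L t) = e t - a := fun t => congrArg Subtype.val (congrFun hL t)
  have ec : IsClosedEmbedding e := e.continuous.isClosedEmbedding ei
  obtain ⟨G, hG⟩ := L.exists_extension' ec
  have hG' : ∀ t, G (e t) = L t := fun t => congrFun hG t
  classical
  let F0 : ℂ → ℂ := fun z => if z ∈ A then Complex.exp (G z) else z - a
  have F0c : Continuous F0 := by
    refine Continuous.if ?_ (by fun_prop) (by fun_prop)
    intro z hz
    obtain ⟨t, rfl⟩ := Af hz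
    rw [hG', hL']
  have F0n : ∀ z, F0 z ≠ 0 := by
    intro z
    by_cases hz : z ∈ A
    · simp only [F0, if_pos hz]; exact Complex.exp_ne_zero _
    · simp only [F0, if_neg hz]
      intro h
      exact hz (by rw [sub_eq_zero.1 h]; exact ha)
  let F : C(ℂ, {z : ℂ // z ≠ 0}) := ⟨fun z => ⟨F0 z, F0n z⟩, by fun_prop⟩
  obtain ⟨H, ⟨-, hH⟩, -⟩ := cov.existsUnique_continuousMap_lifts F 0 (Complex.log (F0 0))
    (Subtype.ext (Complex.exp_log (F0n 0)))
  have hH' : ∀ z, Complex.exp (H z) = F0 z := fun t => congrArg Subtype.val (congrFun hH t)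
  obtain ⟨R, hR, hAR⟩ := Ab.subset_ball_lt 0 a
  let c : ℝ → ℂ := fun t => a + R * Complex.exp (t * Complex.I)
  have cA : ∀ t, c t ∉ A := by
    intro t h
    have := hAR h
    rw [Metric.mem_ball, dist_eq_norm] at this
    simp only [c, add_sub_cancel_left, norm_mul, Complex.norm_exp_ofReal_mul_I, mul_one, Complex.norm_real] at this
    rw [Real.norm_of_nonneg hR.le] at this
    exact lt_irrefl _ this
  have cF : ∀ t, Complex.exp (H (c t) - t * Complex.I) = R := by
    intro t
    rw [Complex.exp_sub, hH']
    simp only [F0, if_neg (cA t), c, add_sub_cancel_left]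
    field_simp [Complex.exp_ne_zero]
  have eq := cov.eq_of_comp_eq (g₁ := fun t : ℝ => H (c t) - t * Complex.I) (g₂ := fun t => H (c 0) - (0 : ℝ) * Complex.I)
    (by fun_prop) (by fun_prop) (by
      funext t
      exact Subtype.ext ((cF t).trans (cF 0).symm)) 0 rfl
  have h2 := congrFun eq (2 * Real.pi)
  have hc : c (2 * Real.pi) = c 0 := by
    simp only [c]
    push_cast
    rw [Complex.exp_two_pi_mul_I]
    simp
  simp only [hc] at h2
  have : ((2 * Real.pi : ℝ) : ℂ) * Complex.I = ((0 : ℝ) : ℂ) * Complex.I := by linear_combination -h2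
  have := mul_right_cancel₀ Complex.I_ne_zero this
  have := Complex.ofReal_injective this
  linarith [Real.pi_pos]

theorem extConn (R : ℝ) (hR : 0 ≤ R) : IsPreconnected {z : ℂ | R < ‖z‖} := by
  have : {z : ℂ | R < ‖z‖} = (fun x : ℝ × ℝ => (x.1 : ℂ) * Complex.exp (x.2 * Complex.I)) '' (Ioi R ×ˢ univ) := by
    ext z
    constructor
    · intro hz
      exact ⟨(‖z‖, Complex.arg z), ⟨hz, trivial⟩, Complex.norm_mul_exp_arg_mul_I z⟩
    · rintro ⟨⟨r, t⟩, ⟨hr, -⟩, rfl⟩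
      have hr : R < r := hr
      simp only [mem_setOf_eq, norm_mul, Complex.norm_exp_ofReal_mul_I, mul_one, Complex.norm_real]
      rw [Real.norm_of_nonneg (hR.trans hr.le)]
      exact hr
  rw [this]
  exact (isPreconnected_Ioi.prod isPreconnected_univ).image _ (by fun_prop)

theorem planeConst (e : C(unitInterval, ℂ)) (ei : Function.Injective e) {k : ℂ → ℝ}
    (kc : ContinuousOn k (range e)ᶜ) (ki : ∀ z ∉ range e, ∃ n : ℤ, k z = n) :
    ∃ c, ∀ z ∉ range e, k z = c := by
  have cl : IsClosed (range e) := (isCompact_range e.continuous).isClosed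
  obtain ⟨R, hR, hb⟩ := (isCompact_range e.continuous).isBounded.subset_closedBall_lt 0 (0 : ℂ)
  have ext : ∀ z : ℂ, R < ‖z‖ → z ∉ range e := by
    intro z hz h
    have := hb h
    rw [mem_closedBall_zero_iff] at this
    linarith
  have hR1 : R < ‖((R + 1 : ℝ) : ℂ)‖ := by
    rw [Complex.norm_real, Real.norm_of_nonneg (by linarith)]; linarith
  refine ⟨k ((R + 1 : ℝ) : ℂ), ?_⟩
  set c := k ((R + 1 : ℝ) : ℂ) with hc
  by_contra! hcon
  obtain ⟨z0, hz0, hz0'⟩ := hcon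
  refine planeB e ei (A := (range e)ᶜ ∩ k ⁻¹' {c}ᶜ) ?_ ?_ ⟨z0, hz0, hz0'⟩ ?_ (fun t h => h.1 ⟨t, rfl⟩)
  · exact kc.isOpen_inter_preimage cl.isOpen_compl isOpen_compl_singleton
  · refine (Metric.isBounded_closedBall (x := (0 : ℂ)) (r := R)).subset ?_
    rintro z ⟨hz, hz'⟩
    by_contra hn
    rw [mem_closedBall_zero_iff, not_le] at hn
    exact hz' (constInt (extConn R hR.le) (kc.mono ext) (fun x hx => ki x (ext x hx)) hn hR1)
  · intro x hx
    by_contra hn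
    have Ao : IsOpen ((range e)ᶜ ∩ k ⁻¹' {c}ᶜ) := kc.isOpen_inter_preimage cl.isOpen_compl isOpen_compl_singleton
    rw [Ao.frontier_eq] at hx
    have hkx : k x = c := by
      by_contra h
      exact hx.2 ⟨hn, h⟩
    have Bo : IsOpen ((range e)ᶜ ∩ k ⁻¹' (Ioo (c - 1/2) (c + 1/2))) := kc.isOpen_inter_preimage cl.isOpen_compl isOpen_Ioo
    obtain ⟨y, hy1, hy2⟩ := mem_closure_iff.1 hx.1 _ Bo ⟨hn, by rw [mem_preimage, hkx]; constructor <;> linarith⟩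
    obtain ⟨n, hn'⟩ := ki y hy1.1
    obtain ⟨m, hm⟩ := ki _ (ext _ hR1)
    have h3 := hy1.2
    rw [mem_preimage, hn', hc, hm] at h3
    have h4 : (n : ℝ) < m + 1 := by linarith [h3.2]
    have h5 : (m : ℝ) < n + 1 := by linarith [h3.1]
    have h4' : n < m + 1 := by exact_mod_cast h4
    have h5' : m < n + 1 := by exact_mod_cast h5
    have : n = m := by omega
    apply hy2.2
    show k y = c
    rw [hn', hc, hm, this]

end TG

namespace TG

def pc (z : ℂ) : T2 := ((z.re : C1), (z.im : C1))

theorem pc_eq : pc = pr ∘ Complex.equivRealProdCLM := rfl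

theorem pc_cont : Continuous pc := pr_cont.comp Complex.equivRealProdCLM.continuous

theorem pc_open : IsOpenMap pc := pr_open.comp Complex.equivRealProdCLM.toHomeomorph.isOpenMap

theorem coe_int {t : ℝ} (h : (t : C1) = 0) : ∃ n : ℤ, t = n := by
  obtain ⟨n, hn⟩ := (AddCircle.coe_eq_zero_iff 1).1 h
  exact ⟨n, by rw [← hn]; simp⟩

theorem coe_near {s t : ℝ} (h : (s : C1) = t) (hst : |s - t| < 1) : s = t := by
  obtain ⟨n, hn⟩ := coe_int (t := s - t) (by rw [AddCircle.coe_sub, h, sub_self])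
  rw [hn] at hst
  have : |n| < 1 := by exact_mod_cast hst
  have : n = 0 := by simpa using this
  rw [this] at hn
  push_cast at hn
  linarith

theorem pc_near {z w : ℂ} (h : pc z = pc w) (hzw : dist z w < 1) : z = w := by
  rw [dist_eq_norm] at hzw
  apply Complex.ext
  · refine coe_near (congrArg Prod.fst h) ?_
    have := Complex.abs_re_le_norm (z - w)
    rw [Complex.sub_re] at this
    linarith
  · refine coe_near (congrArg Prod.snd h) ?_
    have := Complex.abs_im_le_norm (z - w)
    rw [Complex.sub_im] at this
    linarith

theorem pathLift (γ : C(unitInterval, T2)) : ∃ e : C(unitInterval, ℂ), ∀ t, pc (e t) = γ t := by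
  have cov := AddCircle.isCoveringMap_coe (1 : ℝ)
  obtain ⟨x0, hx0⟩ := QuotientAddGroup.mk_surjective (γ 0).1
  obtain ⟨y0, hy0⟩ := QuotientAddGroup.mk_surjective (γ 0).2
  obtain ⟨X, hX, -⟩ := cov.exists_path_lifts (⟨fun t => (γ t).1, by fun_prop⟩ : C(unitInterval, C1)) x0 hx0.symm
  obtain ⟨Y, hY, -⟩ := cov.exists_path_lifts (⟨fun t => (γ t).2, by fun_prop⟩ : C(unitInterval, C1)) y0 hy0.symm
  refine ⟨⟨fun t => ⟨X t, Y t⟩, ?_⟩, fun t => Prod.ext (congrFun hX t) (congrFun hY t)⟩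
  exact Complex.equivRealProdCLM.symm.continuous.comp (X.continuous.prodMk Y.continuous)

theorem arcNonsep0 (γ : C(unitInterval, T2)) (γi : Function.Injective γ) {A : Set T2} (Ao : IsOpen A) (An : A.Nonempty)
    (Af : frontier A ⊆ range γ) (Ad : ∀ t, γ t ∉ A) : ∀ x, x ∈ A ∨ x ∈ range γ := by
  classical
  obtain ⟨e, he⟩ := pathLift γ
  have ei : Function.Injective e := fun s t h => γi (by rw [← he, ← he, h])
  set P := range e with hP
  have Pc : IsCompact P := isCompact_range e.continuous
  have γcl : IsClosed (range γ) := (isCompact_range γ.continuous).isClosed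
  set Q := pc ⁻¹' (range γ) \ P with hQ
  have Qc : IsClosed Q := by
    rw [← isOpen_compl_iff, isOpen_iff_mem_nhds]
    intro x hx
    by_cases hxP : x ∈ P
    · obtain ⟨t, rfl⟩ := hxP
      have Kc : IsCompact (pc '' (P \ Metric.ball (e t) (1/2))) := (Pc.diff Metric.isOpen_ball).image pc_cont
      have hn : e t ∉ pc ⁻¹' (pc '' (P \ Metric.ball (e t) (1/2))) := by
        rintro ⟨_, ⟨⟨s, rfl⟩, hs⟩, hst⟩
        rw [he, he] at hst
        rw [γi hst] at hs
        exact hs (Metric.mem_ball_self (by norm_num))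
      filter_upwards [(Kc.isClosed.preimage pc_cont).isOpen_compl.mem_nhds hn, Metric.ball_mem_nhds (e t) (show (0:ℝ) < 1/2 by norm_num)] with y hy1 hy2
      rintro ⟨⟨s, hs⟩, hyP⟩
      rw [← he] at hs
      by_cases hb : e s ∈ Metric.ball (e t) (1/2)
      · apply hyP
        refine ⟨s, pc_near hs ?_⟩
        rw [Metric.mem_ball] at hb hy2
        have := dist_triangle_right (e s) y (e t)
        linarith
      · exact hy1 ⟨e s, ⟨⟨s, rfl⟩, hb⟩, hs⟩
    · have hx' : x ∉ pc ⁻¹' (range γ) := fun h => hx ⟨h, hxP⟩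
      filter_upwards [(γcl.preimage pc_cont).isOpen_compl.mem_nhds hx'] with y hy hy'
      exact hy hy'.1
  obtain ⟨l, l0, l1, -⟩ := exists_continuous_zero_one_of_isClosed Qc Pc.isClosed disjoint_sdiff_left
  have fr : ∀ z, z ∈ frontier (pc ⁻¹' A) → pc z ∈ range γ := fun z hz => Af (pc_cont.frontier_preimage_subset A hz)
  let G0 : ℂ → C1 := fun z => if pc z ∈ A then ((l z : ℝ) : C1) else 0
  have G0c : Continuous G0 := by
    refine Continuous.if ?_ ((AddCircle.continuous_mk' 1).comp l.continuous) continuous_const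
    intro z hz
    have := fr z hz
    by_cases hzP : z ∈ P
    · rw [l1 hzP]
      exact (AddCircle.coe_eq_zero_iff 1).2 ⟨1, by simp⟩
    · rw [l0 ⟨this, hzP⟩]
      exact (AddCircle.coe_eq_zero_iff 1).2 ⟨0, by simp⟩
  have cov := AddCircle.isCoveringMap_coe (1 : ℝ)
  obtain ⟨x0, hx0⟩ := QuotientAddGroup.mk_surjective (G0 0)
  obtain ⟨G, ⟨-, hG⟩, -⟩ := cov.existsUnique_continuousMap_lifts ⟨G0, G0c⟩ 0 x0 hx0
  have hG' : ∀ z, ((G z : ℝ) : C1) = G0 z := fun z => congrFun hG z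
  let m : ℂ → ℝ := fun z => if pc z ∈ A then l z else 0
  have mG : ∀ z, ((m z : ℝ) : C1) = G0 z := by
    intro z
    by_cases hz : pc z ∈ A
    · simp only [m, G0, if_pos hz]
    · simp only [m, G0, if_neg hz]
      exact (AddCircle.coe_eq_zero_iff 1).2 ⟨0, by simp⟩
  have mc : ContinuousOn m Pᶜ := by
    refine ContinuousOn.if ?_ l.continuous.continuousOn continuousOn_const
    rintro z ⟨hz, hz'⟩
    exact l0 ⟨fr z hz', hz⟩
  obtain ⟨c, hc⟩ := planeConst e ei (k := fun z => G z - m z) (G.continuous.continuousOn.sub mc) (fun z _ => by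
    apply coe_int
    rw [AddCircle.coe_sub, hG', mG, sub_self])
  have PG : ∀ s t, G (e s) = G (e t) := by
    intro s t
    refine constInt (S := univ) (k := fun s => G (e s)) isPreconnected_univ (by fun_prop) (fun t _ => ?_) trivial trivial
    apply coe_int
    rw [hG']
    simp only [G0]
    rw [if_neg (by rw [he]; exact Ad t)]
  set B := (A ∪ range γ)ᶜ with hB
  have Bo : IsOpen B := by
    have : B = (closure A ∪ range γ)ᶜ := by
      rw [hB, closure_eq_self_union_frontier, union_assoc, union_eq_self_of_subset_left Af]
    rw [this]
    exact (isClosed_closure.union γcl).isOpen_compl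
  have hlim : ∀ t, ∀ S : Set T2, γ t ∈ closure S → ∀ ε > 0, ∃ w, pc w ∈ S ∧ |G w - G (e t)| < ε ∧ |l w - 1| < ε := by
    intro t S ht ε hε
    rw [← he] at ht
    have ht' : e t ∈ closure (pc ⁻¹' S) := by
      rw [← pc_open.preimage_closure_eq_closure_preimage pc_cont]
      exact ht
    have hl : l (e t) = 1 := l1 ⟨t, rfl⟩
    have o : IsOpen {w | |G w - G (e t)| < ε ∧ |l w - 1| < ε} := by
      have o1 : IsOpen {w | |G w - G (e t)| < ε} := isOpen_lt (by fun_prop) continuous_const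
      have o2 : IsOpen {w | |l w - 1| < ε} := isOpen_lt (by fun_prop) continuous_const
      exact o1.inter o2
    obtain ⟨w, h1, h2⟩ := mem_closure_iff.1 ht' _ o ⟨by simpa using hε, by rw [hl]; simpa using hε⟩
    exact ⟨w, h2, h1.1, h1.2⟩
  have nP : ∀ w, (pc w ∈ A ∨ pc w ∈ B) → w ∉ P := by
    rintro w h ⟨t, rfl⟩
    rw [he] at h
    rcases h with h | h
    · exact Ad t h
    · exact h (Or.inr ⟨t, rfl⟩)
  have key : (∀ t, γ t ∉ closure A) ∨ ∀ t, γ t ∉ closure B := by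
    by_contra! hcon
    obtain ⟨⟨s, hs⟩, ⟨t, ht⟩⟩ := hcon
    obtain ⟨w, w1, w2, w3⟩ := hlim s A hs (1/8) (by norm_num)
    obtain ⟨u, u1, u2, u3⟩ := hlim t B ht (1/8) (by norm_num)
    have h1 := hc w (nP w (Or.inl w1))
    have h2 := hc u (nP u (Or.inr u1))
    simp only [m, if_pos w1] at h1
    have : pc u ∉ A := fun h => u1 (Or.inl h)
    simp only [m, if_neg this] at h2
    rw [PG s t] at w2
    rw [abs_lt] at w2 w3 u2 u3
    linarith [w2.1, w2.2, w3.1, w3.2, u2.1, u2.2]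
  intro x
  have pcon : PreconnectedSpace T2 := inferInstance
  rcases key with h | h
  · left
    have hcl : IsClosed A := by
      rw [← closure_subset_iff_isClosed, closure_eq_self_union_frontier]
      rintro y (hy | hy)
      · exact hy
      · obtain ⟨t, rfl⟩ := Af hy
        exact absurd (frontier_subset_closure hy) (h t)
    have := IsClopen.eq_univ ⟨hcl, Ao⟩ An
    rw [this]; trivial
  · have hcl : IsClosed B := by
      rw [← closure_subset_iff_isClosed]
      intro y hy hy'
      rcases hy' with hy' | ⟨t, rfl⟩
      · obtain ⟨z, hz, hz'⟩ := mem_closure_iff.1 hy _ Ao hy'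
        exact hz' (Or.inl hz)
      · exact h t hy
    rcases isClopen_iff.1 ⟨hcl, Bo⟩ with h0 | h0
    · have : x ∉ B := by rw [h0]; exact notMem_empty x
      exact not_not.1 this
    · obtain ⟨a, ha⟩ := An
      exact absurd (Or.inl ha) (h0 ▸ trivial : a ∈ B)

theorem arcNonsep {γ : ℝ → T2} (γc : ContinuousOn γ (Icc 0 1)) (γi : InjOn γ (Icc 0 1)) {A : Set T2} (Ao : IsOpen A) (An : A.Nonempty)
    (Af : frontier A ⊆ γ '' Icc 0 1) (Ad : ∀ t ∈ Icc (0 : ℝ) 1, γ t ∉ A) (x : T2) : x ∈ A ∨ x ∈ γ '' Icc 0 1 := by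
  have h := arcNonsep0 ⟨fun t : unitInterval => γ t, γc.comp_continuous continuous_subtype_val (fun t => t.2)⟩
    (fun s t h => Subtype.ext (γi s.2 t.2 h)) Ao An (by
      intro y hy
      obtain ⟨t, ht, rfl⟩ := Af hy
      exact ⟨⟨t, ht⟩, rfl⟩) (fun t => Ad t t.2) x
  rcases h with h | ⟨t, rfl⟩
  · exact Or.inl h
  · exact Or.inr ⟨t, t.2, rfl⟩

end TG

namespace TG

variable {V : Type} {G : SimpleGraph V}

theorem colS (hc : FourCritical G) {S : Set V} (hS : S ≠ univ) :
    ∃ κ : V → Fin 3, ∀ x ∈ S, ∀ y ∈ S, G.Adj x y → κ x ≠ κ y := by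
  classical
  have h1 := hc.2 ((⊤ : G.Subgraph).induce S) (by
    intro h
    apply hS
    have := congrArg SimpleGraph.Subgraph.verts h
    simpa using this)
  have h2 : ((⊤ : G.Subgraph).induce S).coe.Colorable 3 := by
    rw [← SimpleGraph.chromaticNumber_le_iff_colorable]
    exact_mod_cast h1
  obtain ⟨c⟩ := h2
  refine ⟨fun x => if h : x ∈ S then c ⟨x, h⟩ else 0, fun x hx y hy hxy => ?_⟩
  simp only [dif_pos hx, dif_pos hy]
  exact c.valid (by simp [SimpleGraph.Subgraph.coe_adj, hx, hy, hxy])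

theorem not3 (hc : FourCritical G) (κ : V → Fin 3) (h : ∀ x y, G.Adj x y → κ x ≠ κ y) : False := by
  have h1 : G.Colorable 3 := ⟨SimpleGraph.Coloring.mk κ (fun {x y} hxy => h x y hxy)⟩
  have h2 := SimpleGraph.chromaticNumber_le_iff_colorable.2 h1
  rw [hc.1] at h2
  exact absurd h2 (by decide)

theorem conn0 (hc : FourCritical G) (Y : V → ZMod 2) (hY : ∀ x y, G.Adj x y → Y x = Y y) (u v : V) : Y u = Y v := by
  classical
  by_contra huv
  obtain ⟨κ, hκ⟩ := colS hc (S := {x | Y x = Y u}) (fun h => huv (h.symm ▸ trivial : v ∈ {x | Y x = Y u}).symm)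
  obtain ⟨μ, hμ⟩ := colS hc (S := {x | Y x ≠ Y u}) (fun h => (h.symm ▸ trivial : u ∈ {x | Y x ≠ Y u}) rfl)
  refine not3 hc (fun x => if Y x = Y u then κ x else μ x) (fun x y hxy => ?_)
  have e := hY x y hxy
  by_cases hx : Y x = Y u
  · have hy : Y y = Y u := e ▸ hx
    simp only [if_pos hx, if_pos hy]
    exact hκ x hx y hy hxy
  · have hy : Y y ≠ Y u := e ▸ hx
    simp only [if_neg hx, if_neg hy]
    exact hμ x hx y hy hxy

theorem conn1 (hc : FourCritical G) (v : V) (Y : V → ZMod 2) (hY : ∀ x y, G.Adj x y → x ≠ v → y ≠ v → Y x = Y y)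
    (a b : V) (ha : a ≠ v) (hb : b ≠ v) : Y a = Y b := by
  classical
  by_contra hab
  obtain ⟨κ, hκ⟩ := colS hc (S := {x | x = v ∨ Y x = Y a}) (fun h => by
    rcases (h.symm ▸ trivial : b ∈ {x | x = v ∨ Y x = Y a}) with h | h
    exacts [hb h, hab h.symm])
  obtain ⟨μ, hμ⟩ := colS hc (S := {x | x = v ∨ Y x ≠ Y a}) (fun h => by
    rcases (h.symm ▸ trivial : a ∈ {x | x = v ∨ Y x ≠ Y a}) with h | h
    exacts [ha h, h rfl])
  let τ : Equiv.Perm (Fin 3) := Equiv.swap (μ v) (κ v)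
  have hτ : τ (μ v) = κ v := Equiv.swap_apply_left _ _
  refine not3 hc (fun x => if Y x = Y a then κ x else if x = v then κ v else τ (μ x)) (fun x y hxy => ?_)
  have main : ∀ x y, G.Adj x y → Y x = Y a → (if Y x = Y a then κ x else if x = v then κ v else τ (μ x)) ≠
      (if Y y = Y a then κ y else if y = v then κ v else τ (μ y)) := by
    intro x y hxy hx
    by_cases hy : Y y = Y a
    · simp only [if_pos hx, if_pos hy]
      exact hκ x (Or.inr hx) y (Or.inr hy) hxy
    · by_cases hyv : y = v
      · simp only [if_pos hx, if_neg hy, if_pos hyv]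
        rw [hyv] at hxy
        exact hκ x (Or.inr hx) v (Or.inl rfl) hxy
      · simp only [if_pos hx, if_neg hy, if_neg hyv]
        by_cases hxv : x = v
        · rw [hxv, ← hτ]
          intro h
          have := τ.injective h
          rw [hxv] at hxy
          exact hμ v (Or.inl rfl) y (Or.inr hy) hxy this
        · exact absurd ((hY x y hxy hxv hyv).symm.trans hx) hy
  by_cases hx : Y x = Y a
  · exact main x y hxy hx
  · by_cases hy : Y y = Y a
    · exact (main y x hxy.symm hy).symm
    · simp only [if_neg hx, if_neg hy]
      have val : ∀ z, (if z = v then κ v else τ (μ z)) = τ (μ z) := by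
        intro z
        split_ifs with hz
        · rw [hz, hτ]
        · rfl
      rw [val, val]
      intro h
      exact hμ x (Or.inr hx) y (Or.inr hy) hxy (τ.injective h)

theorem deg2 (hc : FourCritical G) {u v : V} (huv : G.Adj u v) : ∃ w, w ≠ v ∧ G.Adj u w := by
  classical
  by_contra! hcon
  obtain ⟨κ, hκ⟩ := colS hc (S := {x | x ≠ u}) (fun h => (h.symm ▸ trivial : u ∈ {x | x ≠ u}) rfl)
  have nb : ∀ w, G.Adj u w → w = v := fun w hw => by
    by_contra h
    exact hcon w h hw
  obtain ⟨c, hcv⟩ : ∃ c : Fin 3, c ≠ κ v := exists_ne _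
  refine not3 hc (fun x => if x = u then c else κ x) (fun x y hxy => ?_)
  by_cases hx : x = u
  · have hy : y ≠ u := fun h => hxy.ne (hx.trans h.symm)
    simp only [if_pos hx, if_neg hy]
    rw [nb y (hx ▸ hxy)]
    exact hcv
  · by_cases hy : y = u
    · simp only [if_neg hx, if_pos hy]
      rw [nb x (hy ▸ hxy.symm)]
      exact hcv.symm
    · simp only [if_neg hx, if_neg hy]
      exact hκ x hx y hy hxy

theorem noTri (ht : TriangleFree G) {a b c : V} (h1 : G.Adj a b) (h2 : G.Adj b c) (h3 : G.Adj c a) : False := by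
  refine ht a (.cons h1 (.cons h2 (.cons h3 .nil))) ?_ rfl
  simp [SimpleGraph.Walk.cons_isCycle_iff, SimpleGraph.Walk.cons_isPath_iff, h1.ne, h2.ne, h3.ne, h1.ne.symm, h2.ne.symm, h3.ne.symm]

theorem exAdj (hc : FourCritical G) (v : V) : ∃ w, G.Adj v w := by
  classical
  by_contra! hcon
  obtain ⟨κ, hκ⟩ := colS hc (S := {x | x ≠ v}) (fun h => (h.symm ▸ trivial : v ∈ {x | x ≠ v}) rfl)
  exact not3 hc κ (fun x y hxy => hκ x (fun h => hcon y (h ▸ hxy)) y (fun h => hcon x (h ▸ hxy.symm)) hxy)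

theorem exV (hc : FourCritical G) : Nonempty V := by
  by_contra h
  rw [not_nonempty_iff] at h
  exact not3 hc (fun _ => 0) (fun x => h.elim x)

theorem walkOf (u : ℕ → V) (m : ℕ) (ha : ∀ i < m, G.Adj (u i) (u (i + 1))) (hi : ∀ i ≤ m, ∀ j ≤ m, u i = u j → i = j) :
    ∃ w : G.Walk (u 0) (u m), w.IsPath ∧ (∀ x, x ∈ w.support ↔ ∃ i ≤ m, u i = x) ∧
      ∀ e, e ∈ w.edges ↔ ∃ i < m, e = s(u i, u (i + 1)) := by
  induction m with
  | zero => exact ⟨.nil, by simp, by simp [eq_comm], by simp⟩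
  | succ m ih =>
    obtain ⟨w, w1, w2, w3⟩ := ih (fun i hi => ha i (by omega)) (fun i hi' j hj => hi i (by omega) j (by omega))
    refine ⟨w.concat (ha m (by omega)), ?_, ?_, ?_⟩
    · refine w1.concat ?_ _
      rw [w2]
      rintro ⟨i, hi', h⟩
      have := hi i (by omega) (m + 1) le_rfl h
      omega
    · intro x
      rw [SimpleGraph.Walk.support_concat, List.mem_append, List.mem_singleton, w2]
      constructor
      · rintro (⟨i, h1, h2⟩ | h)
        · exact ⟨i, by omega, h2⟩
        · exact ⟨m + 1, le_rfl, h.symm⟩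
      · rintro ⟨i, h1, h2⟩
        by_cases h : i = m + 1
        · right; rw [← h2, h]
        · left; exact ⟨i, by omega, h2⟩
    · intro x
      rw [SimpleGraph.Walk.edges_concat, List.concat_eq_append, List.mem_append, List.mem_singleton, w3]
      constructor
      · rintro (⟨i, h1, h2⟩ | h)
        · exact ⟨i, by omega, h2⟩
        · exact ⟨m, by omega, h⟩
      · rintro ⟨i, h1, h2⟩
        by_cases h : i = m
        · right; rw [h2, h]
        · left; exact ⟨i, by omega, h2⟩

end TG

namespace TG
open DS CM Equiv

structure Darts {V D : Type} (G : SimpleGraph V) (α : D → D) (A : Finset D) (s : D → V) : Prop where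
  adj : ∀ d ∈ A, G.Adj (s d) (s (α d))
  ex : ∀ u v, G.Adj u v → ∃ d ∈ A, s d = u ∧ s (α d) = v
  uniq : ∀ d ∈ A, ∀ d' ∈ A, s d = s d' → s (α d) = s (α d') → d = d'

variable {V D : Type} {G : SimpleGraph V} {α : D → D} {A : Finset D} {s : D → V} {σ : Perm D}

theorem noT0 [Finite D] [DecidableEq D] [DecidableEq V] (hc : FourCritical G) (ht : TriangleFree G) (hd : Darts G α A s)
    {L : Empty → (D → ZMod 2) → ZMod 2} (h : Mp α A σ s L) : False := by
  classical
  obtain ⟨v0⟩ := exV hc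
  have hG : Good α A s v0 v0 := by
    refine ⟨fun d h => (hd.adj d h).ne, ?_, ?_⟩
    · intro d h1 e h2 f h3 e1 e2 e3
      have a1 := hd.adj d h1
      have a2 := hd.adj e h2
      have a3 := hd.adj f h3
      rw [← e1] at a2
      rw [← e2, e3] at a3
      exact noTri ht a1 a2 a3
    · intro d h1 e1 e2
      exact (hd.adj d h1).ne (e1.trans e2.symm)
  obtain ⟨κ, hκ, -⟩ := thmA h.toPD hG
  refine not3 hc κ (fun x y hxy => ?_)
  obtain ⟨d, h1, rfl, rfl⟩ := hd.ex x y hxy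
  exact hκ d h1

theorem orbInj [Finite D] [DecidableEq D] [DecidableEq V] (hc : FourCritical G) (ht : TriangleFree G) (hd : Darts G α A s)
    {L : Fin 2 → (D → ZMod 2) → ZMod 2} (h : Mp α A σ s L) {d1 d2 : D} (h1 : d1 ∈ A) (h2 : d2 ∈ A)
    (hs : s d1 = s d2) (orb : ∀ X, IX α A σ X → X d1 = X d2) : d1 = d2 := by
  classical
  by_contra hne
  obtain ⟨σ', src', L', hM, e1, e2, e3, e4⟩ := h.split (v := s d2) h1 h2 hne hs rfl orb
    (fun d hA h1 h2 => (hd.adj d hA).ne (h1.trans h2.symm)) (by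
      intro Y hY d hdA d' hdA' n n'
      refine conn1 hc (s d2) Y ?_ _ _ n n'
      intro x y hxy hx hy
      obtain ⟨z, hz, rfl, rfl⟩ := hd.ex x y hxy
      exact hY z hz hx hy)
  let c : Option V → V := fun o => o.getD (s d2)
  have hcs : ∀ d, c (src' d) = s d := by
    intro d
    by_cases hh : s d = s d2
    · rcases e4 d hh with h | h
      · rw [h, hh]; rfl
      · rw [h, hh]; rfl
    · rw [e3 d hh]; rfl
  have hG : Good α A src' none (some (s d2)) := by
    refine ⟨fun d h e => (hd.adj d h).ne ?_, ?_, ?_⟩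
    · rw [← hcs d, e, hcs]
    · intro d h1 e h2 f h3 e1 e2 e3
      have a1 := hd.adj d h1
      have a2 := hd.adj e h2
      have a3 := hd.adj f h3
      rw [← hcs e, ← e1, hcs] at a2
      rw [← hcs f, ← e2, hcs, ← hcs (α f), e3, hcs] at a3
      exact noTri ht a1 a2 a3
    · intro d h1 e1 e2
      refine (hd.adj d h1).ne ?_
      rw [← hcs d, ← hcs (α d), e1, e2]
      rfl
  obtain ⟨κ, hκ, hn⟩ := thmA hM.toPD hG
  have hk : ∀ d, κ (src' d) = κ (some (s d)) := by
    intro d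
    by_cases hh : s d = s d2
    · rcases e4 d hh with h | h
      · rw [h, hh, hn]
      · rw [h, hh]
    · rw [e3 d hh]
  refine not3 hc (fun v => κ (some v)) (fun x y hxy => ?_)
  obtain ⟨d, h1, rfl, rfl⟩ := hd.ex x y hxy
  have := hκ d h1
  rwa [hk, hk] at this

theorem cyc [Finite D] [DecidableEq D] [DecidableEq V] (hc : FourCritical G) (hd : Darts G α A s)
    {L : Fin 2 → (D → ZMod 2) → ZMod 2} (h : Mp α A σ s L) {d0 : D} (h0 : d0 ∈ A)
    (inj : ∀ z z', (σ * aP α h.inv).SameCycle d0 z → (σ * aP α h.inv).SameCycle d0 z' → s z = s z' → z = z') :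
    ∃ w : G.Walk (s (α d0)) (s d0), w.IsPath ∧ s(s d0, s (α d0)) ∉ w.edges ∧
      (∀ x, x ∈ w.support ↔ ∃ z, (σ * aP α h.inv).SameCycle d0 z ∧ s z = x) ∧
      (∀ e, (e = s(s d0, s (α d0)) ∨ e ∈ w.edges) ↔ ∃ z, (σ * aP α h.inv).SameCycle d0 z ∧ e = s(s z, s (α z))) := by
  classical
  set φ : Perm D := σ * aP α h.inv with hφ
  have hφe : ∀ z, φ z = σ (α z) := fun z => rfl
  have φA : ∀ z ∈ A, φ z ∈ A := fun z hz => h.sA _ (h.cl _ hz)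
  have inA : ∀ z, φ.SameCycle d0 z → z ∈ A := fun z hz => (const_cycle (Y := fun _ => 0) φA (fun _ _ => rfl) h0 z hz).2
  have itc : ∀ i, φ.SameCycle d0 (φ^[i] d0) := fun i => by
    rw [Perm.iterate_eq_pow]
    exact ⟨i, by simp⟩
  set n := Function.minimalPeriod φ d0 with hn
  have npos : 0 < n := Function.minimalPeriod_pos_of_mem_periodicPts (φ.injective.mem_periodicPts d0)
  have per : φ^[n] d0 = d0 := Function.iterate_minimalPeriod
  have itinj : ∀ i < n, ∀ j < n, φ^[i] d0 = φ^[j] d0 → i = j := fun i hi j hj e =>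
    Function.iterate_injOn_Iio_minimalPeriod hi hj e
  have cit : ∀ z, φ.SameCycle d0 z → ∃ i < n, φ^[i] d0 = z := by
    intro z hz
    obtain ⟨i, -, rfl⟩ := hz.exists_pow_eq'
    refine ⟨i % n, Nat.mod_lt _ npos, ?_⟩
    rw [hn, Function.iterate_mod_minimalPeriod_eq, Perm.iterate_eq_pow]
  have snext : ∀ z ∈ A, s (φ z) = s (α z) := fun z hz => h.ss _ (h.cl _ hz)
  have sit : ∀ i, s (φ^[i + 1] d0) = s (α (φ^[i] d0)) := fun i => by
    rw [Function.iterate_succ_apply', snext _ (inA _ (itc i))]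
  obtain ⟨w, w1, w2, w3⟩ := walkOf (G := G) (fun i => s (φ^[i + 1] d0)) (n - 1) (fun i hi => by
      have := hd.adj _ (inA _ (itc (i + 1)))
      rw [← sit] at this
      exact this) (fun i hi j hj e => by
      have e' := inj _ _ (itc _) (itc _) e
      rw [Function.iterate_succ_apply', Function.iterate_succ_apply'] at e'
      exact itinj i (by omega) j (by omega) (φ.injective e'))
  have e0 : s (φ^[0 + 1] d0) = s (α d0) := sit 0
  have e1 : s (φ^[n - 1 + 1] d0) = s d0 := by rw [Nat.sub_add_cancel npos, per]
  have hw2 : ∀ x, x ∈ (w.copy e0 e1).support ↔ ∃ z, φ.SameCycle d0 z ∧ s z = x := by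
    intro x
    rw [SimpleGraph.Walk.support_copy, w2]
    constructor
    · rintro ⟨i, -, h⟩
      exact ⟨_, itc _, h⟩
    · rintro ⟨z, hz, rfl⟩
      obtain ⟨i, hi, rfl⟩ := cit z hz
      by_cases h0 : i = 0
      · exact ⟨n - 1, le_rfl, by rw [e1, h0]; rfl⟩
      · exact ⟨i - 1, by omega, by rw [Nat.sub_add_cancel (by omega)]⟩
  have hw3 : ∀ e, e ∈ (w.copy e0 e1).edges ↔ ∃ i, i ≠ 0 ∧ i < n ∧ e = s(s (φ^[i] d0), s (α (φ^[i] d0))) := by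
    intro e
    rw [SimpleGraph.Walk.edges_copy, w3]
    constructor
    · rintro ⟨i, hi, rfl⟩
      exact ⟨i + 1, by omega, by omega, by rw [sit (i + 1)]⟩
    · rintro ⟨i, h0, hi, rfl⟩
      refine ⟨i - 1, by omega, ?_⟩
      rw [sit (i - 1 + 1), Nat.sub_add_cancel (by omega)]
  refine ⟨w.copy e0 e1, ?_, ?_, hw2, ?_⟩
  · rw [SimpleGraph.Walk.isPath_copy]; exact w1
  · rw [hw3]
    rintro ⟨i, hi0, hin, he⟩
    have hcy := itc i
    have hA := inA _ hcy
    set d' := φ^[i] d0 with hd'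
    have dne : d' ≠ d0 := by
      intro e
      exact hi0 (itinj i hin 0 npos e)
    rw [Sym2.eq_iff] at he
    rcases he with ⟨a1, a2⟩ | ⟨a1, a2⟩
    · exact dne (hd.uniq d0 h0 d' hA a1 a2).symm
    · have hα : d' = α d0 := hd.uniq d' hA (α d0) (h.cl _ h0) a2.symm (by rw [h.inv]; exact a1.symm)
      have hf : φ d0 = d' := inj _ _ (itc 1) hcy (by
        show s (φ d0) = s d'
        rw [snext d0 h0, a2])
      rw [hφe, hα] at hf
      obtain ⟨x, hx, hx'⟩ := deg2 hc (hd.adj d0 h0).symm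
      obtain ⟨z, hz, z1, z2⟩ := hd.ex _ _ hx'
      have := h.link (fun y => if y = α d0 then 1 else 0) (fun y _ => by
        by_cases hy : y = α d0
        · rw [hy, hf]
        · have : σ y ≠ α d0 := fun e => hy (σ.injective (e.trans hf.symm))
          simp only [if_neg hy, if_neg this]) z hz (α d0) (h.cl _ h0) z1
      simp only [if_true] at this
      by_cases hzz : z = α d0
      · rw [hzz, h.inv] at z2
        exact hx z2.symm
      · rw [if_neg hzz] at this
        exact absurd this (by decide)
  · intro e
    rw [hw3]
    constructor
    · rintro (rfl | ⟨i, -, -, rfl⟩)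
      · exact ⟨d0, Perm.SameCycle.refl _ _, rfl⟩
      · exact ⟨_, itc i, rfl⟩
    · rintro ⟨z, hz, rfl⟩
      obtain ⟨i, hi, rfl⟩ := cit z hz
      by_cases hi0 : i = 0
      · left; rw [hi0]; rfl
      · right; exact ⟨i, hi0, hi, rfl⟩

end TG

namespace TG

def ArcS (S : Set T2) (x y : T2) : Prop :=
  ∃ γ : ℝ → T2, Continuous γ ∧ InjOn γ (Icc 0 1) ∧ γ 0 = x ∧ γ 1 = y ∧ γ '' Icc 0 1 = S

theorem ArcS.concat {S S' : Set T2} {x y z : T2} (h : ArcS S x y) (h' : ArcS S' y z) (hd : ∀ p ∈ S, p ∈ S' → p = y) :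
    ArcS (S ∪ S') x z := by
  obtain ⟨γ, c, i, rfl, rfl, rfl⟩ := h
  obtain ⟨δ, c', i', e, rfl, rfl⟩ := h'
  have m1 : ∀ t ∈ Icc (0 : ℝ) 1, t ≤ 1 / 2 → 2 * t ∈ Icc (0 : ℝ) 1 := fun t ht h => ⟨by linarith [ht.1], by linarith⟩
  have m2 : ∀ t ∈ Icc (0 : ℝ) 1, ¬ t ≤ 1 / 2 → 2 * t - 1 ∈ Icc (0 : ℝ) 1 := fun t ht h => ⟨by linarith, by linarith [ht.2]⟩
  have cross : ∀ s ∈ Icc (0 : ℝ) 1, ∀ t ∈ Icc (0 : ℝ) 1, s ≤ 1 / 2 → ¬ t ≤ 1 / 2 → γ (2 * s) ≠ δ (2 * t - 1) := by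
    intro s hs t ht h1 h2 he
    have h3 := hd (δ (2 * t - 1)) ⟨2 * s, m1 s hs h1, he⟩ ⟨2 * t - 1, m2 t ht h2, rfl⟩
    have h4 := i' (m2 t ht h2) ⟨le_rfl, zero_le_one⟩ (h3.trans e.symm)
    exact h2 (by linarith)
  refine ⟨fun t => if t ≤ 1 / 2 then γ (2 * t) else δ (2 * t - 1), ?_, ?_, ?_, ?_, ?_⟩
  · refine Continuous.if_le (by fun_prop) (by fun_prop) continuous_id continuous_const ?_
    intro t ht
    have ht : t = 1 / 2 := ht
    rw [ht]
    norm_num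
    exact e.symm
  · intro s hs t ht he
    dsimp only at he
    split_ifs at he with h1 h2 h2
    · have := i (m1 s hs h1) (m1 t ht h2) he
      linarith
    · exact absurd he (cross s hs t ht h1 h2)
    · exact absurd he.symm (cross t ht s hs h2 h1)
    · have := i' (m2 s hs h1) (m2 t ht h2) he
      linarith
  · norm_num
  · norm_num
  · ext p
    constructor
    · rintro ⟨t, ht, rfl⟩
      dsimp only
      split_ifs with h
      · exact Or.inl ⟨_, m1 t ht h, rfl⟩
      · exact Or.inr ⟨_, m2 t ht h, rfl⟩
    · rintro (⟨t, ht, rfl⟩ | ⟨t, ht, rfl⟩)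
      · refine ⟨t / 2, ⟨by linarith [ht.1], by linarith [ht.2]⟩, ?_⟩
        dsimp only
        rw [if_pos (by linarith [ht.2])]
        congr 1; ring
      · by_cases h0 : t = 0
        · refine ⟨1 / 2, ⟨by norm_num, by norm_num⟩, ?_⟩
          dsimp only
          rw [if_pos le_rfl, h0, e]
          norm_num
        · have : 0 < t := lt_of_le_of_ne ht.1 (Ne.symm h0)
          refine ⟨(t + 1) / 2, ⟨by linarith [ht.1], by linarith [ht.2]⟩, ?_⟩
          dsimp only
          rw [if_neg (by linarith)]
          congr 1; ring

theorem subArc {γ : ℝ → T2} (c : Continuous γ) (i : InjOn γ (Icc 0 1)) {s t : ℝ} (h0 : 0 ≤ s) (hst : s < t) (h1 : t ≤ 1) :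
    ArcS (γ '' Icc s t) (γ s) (γ t) := by
  have hm : ∀ r ∈ Icc (0 : ℝ) 1, s + r * (t - s) ∈ Icc s t := fun r hr =>
    ⟨by nlinarith [hr.1], by nlinarith [hr.2]⟩
  refine ⟨fun r => γ (s + r * (t - s)), by fun_prop, ?_, by simp, by simp, ?_⟩
  · intro r hr r' hr' he
    have := i (Icc_subset_Icc h0 h1 (hm r hr)) (Icc_subset_Icc h0 h1 (hm r' hr')) he
    have h : (r - r') * (t - s) = 0 := by linarith
    rcases mul_eq_zero.1 h with h | h <;> linarith
  · ext p
    constructor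
    · rintro ⟨r, hr, rfl⟩
      exact ⟨_, hm r hr, rfl⟩
    · rintro ⟨r, hr, rfl⟩
      have hp : 0 < t - s := by linarith
      refine ⟨(r - s) / (t - s), ⟨div_nonneg (by linarith [hr.1]) hp.le, (div_le_one hp).2 (by linarith [hr.2])⟩, ?_⟩
      dsimp only
      congr 1
      field_simp
      ring

theorem punct (x : T2) {O : Set T2} (hO : IsOpen O) (hx : x ∈ O) :
    ∃ N, IsOpen N ∧ x ∈ N ∧ N ⊆ O ∧ IsPreconnected (N \ {x}) := by
  obtain ⟨y, rfl⟩ := pr_surj x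
  obtain ⟨z, rfl⟩ := Complex.equivRealProdCLM.surjective y
  have hz : pc z ∈ O := hx
  obtain ⟨r, hr, hr'⟩ := Metric.isOpen_iff.1 (hO.preimage pc_cont) z hz
  set ρ := min r (1 / 2) with hρ
  have ρ0 : 0 < ρ := by positivity
  refine ⟨pc '' Metric.ball z ρ, pc_open _ Metric.isOpen_ball, ⟨z, Metric.mem_ball_self ρ0, rfl⟩, ?_, ?_⟩
  · rintro _ ⟨w, hw, rfl⟩
    exact hr' (Metric.ball_subset_ball (min_le_left _ _) hw)
  · have : pc '' Metric.ball z ρ \ {pr (Complex.equivRealProdCLM z)} =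
        (fun u : ℝ × ℝ => pc (z + u.1 * Complex.exp (u.2 * Complex.I))) '' (Ioo 0 ρ ×ˢ univ) := by
      ext p
      constructor
      · rintro ⟨⟨w, hw, rfl⟩, hne⟩
        have hwz : w ≠ z := by
          rintro rfl
          exact hne rfl
        rw [Metric.mem_ball, dist_eq_norm] at hw
        refine ⟨(‖w - z‖, Complex.arg (w - z)), ⟨⟨norm_pos_iff.2 (sub_ne_zero.2 hwz), hw⟩, trivial⟩, ?_⟩
        dsimp only
        rw [Complex.norm_mul_exp_arg_mul_I]
        congr 1; ring
      · rintro ⟨⟨a, b⟩, ⟨ha, -⟩, rfl⟩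
        have ha : a ∈ Ioo 0 ρ := ha
        have hd : dist (z + a * Complex.exp (b * Complex.I)) z = a := by
          rw [dist_eq_norm, add_sub_cancel_left, norm_mul, Complex.norm_exp_ofReal_mul_I, mul_one, Complex.norm_real,
            Real.norm_of_nonneg ha.1.le]
        refine ⟨⟨_, ?_, rfl⟩, ?_⟩
        · rw [Metric.mem_ball, hd]; exact ha.2
        · intro h
          have h2 : ρ ≤ 1 / 2 := min_le_right _ _
          have := pc_near (z := z + a * Complex.exp (b * Complex.I)) (w := z) h (by rw [hd]; linarith [ha.2])
          rw [this, dist_self] at hd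
          linarith [ha.1]
    rw [this]
    refine (isPreconnected_Ioo.prod isPreconnected_univ).image _ (Continuous.continuousOn ?_)
    exact pc_cont.comp (by fun_prop)

variable {V : Type} {G : SimpleGraph V} (d : Drawing G T2)

theorem mem_wI {u v : V} (w : G.Walk u v) (y : T2) :
    y ∈ walkImage d w ↔ (∃ x ∈ w.support, y = d.vmap x) ∨ ∃ e : G.edgeSet, (e : Sym2 V) ∈ w.edges ∧ y ∈ d.emap e := by
  simp [walkImage]

theorem wI_sub {u v : V} (w : G.Walk u v) : walkImage d w ⊆ d.image := by
  intro y hy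
  rw [mem_wI] at hy
  rcases hy with ⟨x, -, rfl⟩ | ⟨e, -, h⟩
  · exact Or.inl ⟨x, rfl⟩
  · exact Or.inr (mem_iUnion.2 ⟨e, h⟩)

theorem edgeArc {u v : V} (h : G.Adj u v) : ∃ δ : ℝ → T2, Continuous δ ∧ InjOn δ (Icc 0 1) ∧ δ 0 = d.vmap u ∧ δ 1 = d.vmap v ∧
    δ '' Ioo 0 1 = d.emap ⟨s(u, v), h⟩ := by
  obtain ⟨γ, c, i, e0, e1, e2⟩ := arcPath (d.arc ⟨s(u, v), h⟩) (fun e => h.ne (d.vinj e)) (d.vertex_notin _ u) (d.vertex_notin _ v)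
    (d.closure_emap _ u v rfl)
  have pe : ∀ t ∈ Icc (0 : ℝ) 1, γ (projIcc 0 1 zero_le_one t) = γ t := fun t ht => by
    rw [projIcc_of_mem _ ht]
  refine ⟨fun t => γ (projIcc 0 1 zero_le_one t), ?_, ?_, ?_, ?_, ?_⟩
  · exact c.comp_continuous (continuous_subtype_val.comp continuous_projIcc) (fun t => Subtype.prop _)
  · intro s hs t ht he
    dsimp only at he
    rw [pe s hs, pe t ht] at he
    exact i hs ht he
  · rw [← e0]; exact pe 0 ⟨le_rfl, zero_le_one⟩
  · rw [← e1]; exact pe 1 ⟨zero_le_one, le_rfl⟩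
  · rw [← e2]
    exact image_congr fun t ht => pe t (Ioo_subset_Icc_self ht)

theorem wI_v {u v : V} (w : G.Walk u v) {x : V} (hx : x ∉ w.support) : d.vmap x ∉ walkImage d w := by
  rw [mem_wI]
  rintro (⟨y, hy, h⟩ | ⟨e, -, h⟩)
  · rw [d.vinj h] at hx; exact hx hy
  · exact d.vertex_notin _ _ h

theorem wI_e {u v : V} (w : G.Walk u v) {e : G.edgeSet} (he : (e : Sym2 V) ∉ w.edges) {y : T2} (hy : y ∈ d.emap e) :
    y ∉ walkImage d w := by
  rw [mem_wI]
  rintro (⟨x, -, rfl⟩ | ⟨e', h1, h2⟩)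
  · exact d.vertex_notin _ _ hy
  · have hne : e ≠ e' := fun h => he (h ▸ h1)
    have := d.edges_disj e e' hne
    exact (this ▸ ⟨hy, h2⟩ : y ∈ (∅ : Set T2))

theorem wI_cons {u v x : V} (h : G.Adj u v) (w : G.Walk v x) (y : T2) :
    y ∈ walkImage d (.cons h w) ↔ y = d.vmap u ∨ y ∈ d.emap ⟨s(u, v), h⟩ ∨ y ∈ walkImage d w := by
  rw [mem_wI, mem_wI]
  simp only [SimpleGraph.Walk.support_cons, SimpleGraph.Walk.edges_cons, List.mem_cons]
  constructor
  · rintro (⟨z, rfl | hz, rfl⟩ | ⟨⟨e, he⟩, h1 | h1, h2⟩)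
    · exact Or.inl rfl
    · exact Or.inr (Or.inr (Or.inl ⟨z, hz, rfl⟩))
    · right; left
      have h1 : e = s(u, v) := h1
      subst h1
      exact h2
    · exact Or.inr (Or.inr (Or.inr ⟨_, h1, h2⟩))
  · rintro (rfl | h1 | ⟨z, hz, rfl⟩ | ⟨e, h1, h2⟩)
    · exact Or.inl ⟨u, Or.inl rfl, rfl⟩
    · exact Or.inr ⟨_, Or.inl rfl, h1⟩
    · exact Or.inl ⟨z, Or.inr hz, rfl⟩
    · exact Or.inr ⟨e, Or.inr h1, h2⟩

theorem arcWalk {u v : V} (w : G.Walk u v) (hw : w.IsPath) (huv : u ≠ v) : ArcS (walkImage d w) (d.vmap u) (d.vmap v) := by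
  induction w with
  | nil => exact absurd rfl huv
  | @cons u v x h w ih =>
    rw [SimpleGraph.Walk.cons_isPath_iff] at hw
    obtain ⟨δ, c, i, e0, e1, e2⟩ := edgeArc d h
    have eA : ArcS (δ '' Icc 0 1) (d.vmap u) (d.vmap v) := ⟨δ, c, i, e0, e1, rfl⟩
    have hI : ∀ y, y ∈ δ '' Icc 0 1 ↔ y = d.vmap u ∨ y = d.vmap v ∨ y ∈ d.emap ⟨s(u, v), h⟩ := by
      intro y
      rw [← e2]
      constructor
      · rintro ⟨t, ht, rfl⟩
        rcases Icc_cases ht with rfl | rfl | ht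
        · exact Or.inl e0
        · exact Or.inr (Or.inl e1)
        · exact Or.inr (Or.inr ⟨t, ht, rfl⟩)
      · rintro (rfl | rfl | ⟨t, ht, rfl⟩)
        · exact ⟨0, ⟨le_rfl, zero_le_one⟩, e0⟩
        · exact ⟨1, ⟨zero_le_one, le_rfl⟩, e1⟩
        · exact ⟨t, Ioo_subset_Icc_self ht, rfl⟩
    have hv : d.vmap v ∈ walkImage d w := (mem_wI d w _).2 (Or.inl ⟨v, w.start_mem_support, rfl⟩)
    have hun : walkImage d (.cons h w) = δ '' Icc 0 1 ∪ walkImage d w := by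
      ext y
      rw [wI_cons, mem_union, hI]
      constructor
      · rintro (h | h | h)
        · exact Or.inl (Or.inl h)
        · exact Or.inl (Or.inr (Or.inr h))
        · exact Or.inr h
      · rintro ((h | rfl | h) | h)
        · exact Or.inl h
        · exact Or.inr (Or.inr hv)
        · exact Or.inr (Or.inl h)
        · exact Or.inr (Or.inr h)
    by_cases hvx : v = x
    · subst hvx
      have hn : w = .nil := SimpleGraph.Walk.isPath_iff_eq_nil.1 hw.1
      subst hn
      rw [hun, union_eq_self_of_subset_right]
      · exact eA
      · intro y hy
        rw [mem_wI] at hy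
        rw [hI]
        rcases hy with ⟨z, hz, rfl⟩ | ⟨e, h1, -⟩
        · simp at hz
          rw [hz]; exact Or.inr (Or.inl rfl)
        · simp at h1
    · rw [hun]
      refine eA.concat (ih hw.1 hvx) ?_
      intro y hy hy'
      rcases (hI y).1 hy with rfl | rfl | h1
      · exact absurd hy' (wI_v d w hw.2)
      · rfl
      · exact absurd hy' (wI_e d w (fun he => hw.2 (w.fst_mem_support_of_mem_edges he)) h1)

theorem finalCycle {f : Set T2} (fo : IsOpen f) (fn : f.Nonempty) (fK : ∀ x ∈ f, x ∉ d.image) {u v : V} (h : G.Adj u v)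
    (w : G.Walk v u) (hw : w.IsPath) (hwe : s(u, v) ∉ w.edges) (ff : frontier f ⊆ walkImage d (.cons h w)) :
    d.emap ⟨s(u, v), h⟩ ⊆ frontier f := by
  obtain ⟨δ, c, i, e0, e1, e2⟩ := edgeArc d h
  by_contra hcon
  rw [not_subset] at hcon
  obtain ⟨x, hx, hxf⟩ := hcon
  rw [← e2] at hx
  obtain ⟨t0, ht0, rfl⟩ := hx
  have me : ∀ r ∈ Ioo (0 : ℝ) 1, δ r ∈ d.emap ⟨s(u, v), h⟩ := fun r hr => e2 ▸ ⟨r, hr, rfl⟩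
  have op : IsOpen (δ ⁻¹' (frontier f)ᶜ) := isClosed_frontier.isOpen_compl.preimage c
  obtain ⟨ε, hε, hb⟩ := Metric.isOpen_iff.1 op t0 hxf
  obtain ⟨η, hη, hη1, hη2, hη3⟩ : ∃ η > 0, η < ε ∧ η < t0 ∧ η < 1 - t0 := by
    have : 0 < min ε (min t0 (1 - t0)) := lt_min hε (lt_min ht0.1 (by linarith [ht0.2]))
    refine ⟨min ε (min t0 (1 - t0)) / 2, by positivity, ?_, ?_, ?_⟩
    · linarith [min_le_left ε (min t0 (1 - t0))]
    · linarith [min_le_right ε (min t0 (1 - t0)), min_le_left t0 (1 - t0)]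
    · linarith [min_le_right ε (min t0 (1 - t0)), min_le_right t0 (1 - t0)]
  have miss : ∀ r, t0 - η ≤ r → r ≤ t0 + η → δ r ∉ frontier f := by
    intro r h1 h2
    apply hb
    rw [Metric.mem_ball, Real.dist_eq, abs_lt]
    constructor <;> linarith
  have A1 := subArc c i (s := t0 + η) (t := 1) (by linarith [ht0.1]) (by linarith) le_rfl
  have A3 := subArc c i (s := 0) (t := t0 - η) le_rfl (by linarith) (by linarith [ht0.2])
  have A2 := arcWalk d w hw h.ne.symm
  rw [e1] at A1
  rw [e0] at A3
  have nw : ∀ r ∈ Ioo (0 : ℝ) 1, δ r ∉ walkImage d w := fun r hr => wI_e d w hwe (me r hr)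
  have A12 := A1.concat A2 (by
    rintro _ ⟨r, hr, rfl⟩ hy
    by_cases h1 : r = 1
    · rw [h1, e1]
    · exact absurd hy (nw r ⟨by linarith [hr.1, ht0.1], lt_of_le_of_ne hr.2 h1⟩))
  have A := A12.concat A3 (by
    rintro y (⟨r, hr, rfl⟩ | hy) ⟨r', hr', he⟩
    · have := i ⟨hr'.1, by linarith [hr'.2, ht0.2]⟩ ⟨by linarith [hr.1, ht0.1], hr.2⟩ he
      linarith [hr.1, hr'.2]
    · by_cases h0 : r' = 0
      · rw [← he, h0, e0]
      · rw [← he] at hy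
        exact absurd hy (nw r' ⟨lt_of_le_of_ne hr'.1 (Ne.symm h0), by linarith [hr'.2, ht0.2]⟩))
  have im : ∀ r ∈ Icc (0 : ℝ) 1, δ r ∈ d.image := by
    intro r hr
    rcases Icc_cases hr with rfl | rfl | hr
    · rw [e0]; exact Or.inl ⟨_, rfl⟩
    · rw [e1]; exact Or.inl ⟨_, rfl⟩
    · exact Or.inr (mem_iUnion.2 ⟨_, me r hr⟩)
  obtain ⟨γ, γc, γi, -, -, γI⟩ := A
  have res := arcNonsep γc.continuousOn γi fo fn (by
    rw [γI]
    intro y hy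
    rcases (wI_cons d h w y).1 (ff hy) with rfl | h1 | h1
    · exact Or.inr ⟨0, ⟨le_rfl, by linarith⟩, e0⟩
    · rw [← e2] at h1
      obtain ⟨r, hr, rfl⟩ := h1
      by_cases h2 : r < t0 - η
      · exact Or.inr ⟨r, ⟨hr.1.le, h2.le⟩, rfl⟩
      · by_cases h3 : t0 + η < r
        · exact Or.inl (Or.inl ⟨r, ⟨h3.le, hr.2.le⟩, rfl⟩)
        · exact absurd hy (miss r (not_lt.1 h2) (not_lt.1 h3))
    · exact Or.inl (Or.inr h1)) (by
    intro t ht hf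
    refine fK _ hf ?_
    have : γ t ∈ γ '' Icc 0 1 := ⟨t, ht, rfl⟩
    rw [γI] at this
    rcases this with (⟨r, hr, he⟩ | h1) | ⟨r, hr, he⟩
    · rw [← he]; exact im r ⟨by linarith [hr.1, ht0.1], hr.2⟩
    · exact wI_sub d w h1
    · rw [← he]; exact im r ⟨hr.1, by linarith [hr.2, ht0.2]⟩) (δ t0)
  rw [γI] at res
  rcases res with h1 | (⟨r, hr, he⟩ | h1) | ⟨r, hr, he⟩
  · exact fK _ h1 (im t0 (Ioo_subset_Icc_self ht0))
  · have := i ⟨by linarith [hr.1, ht0.1], hr.2⟩ (Ioo_subset_Icc_self ht0) he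
    linarith [hr.1]
  · exact nw t0 ht0 h1
  · have := i ⟨hr.1, by linarith [hr.2, ht0.2]⟩ (Ioo_subset_Icc_self ht0) he
    linarith [hr.2]

theorem frontV [Finite V] (hc : FourCritical G) {f : Set T2} (fo : IsOpen f) (fK : ∀ x ∈ f, x ∉ d.image) (ff : frontier f ⊆ d.image)
    {v : V} (hv : d.vmap v ∈ frontier f) : ∃ e : G.edgeSet, v ∈ (e : Sym2 V) ∧ (d.emap e ∩ frontier f).Nonempty := by
  by_contra! hcon
  let Z : Set T2 := (⋃ x : {x : V // x ≠ v}, {d.vmap x}) ∪ ⋃ e : {e : G.edgeSet // v ∉ (e : Sym2 V)}, closure (d.emap e)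
  have Zc : IsClosed Z := (isClosed_iUnion_of_finite fun _ => isClosed_singleton).union (isClosed_iUnion_of_finite fun _ => isClosed_closure)
  have vZ : d.vmap v ∈ Zᶜ := by
    rintro (h | h)
    · obtain ⟨x, hx⟩ := mem_iUnion.1 h
      exact x.2 (d.vinj hx.symm)
    · obtain ⟨⟨⟨e, he⟩, hve⟩, hx⟩ := mem_iUnion.1 h
      induction e using Sym2.ind with
      | _ a b =>
        rw [d.closure_emap _ a b rfl] at hx
        rcases hx with hx | hx | hx
        · exact d.vertex_notin _ _ hx
        · exact hve (by rw [d.vinj hx]; simp)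
        · exact hve (by rw [d.vinj hx]; simp)
  obtain ⟨N, No, vN, NZ, Np⟩ := punct (d.vmap v) Zc.isOpen_compl vZ
  have vf : d.vmap v ∉ f := fun h => fK _ h (Or.inl ⟨v, rfl⟩)
  obtain ⟨y, hyN, hyf⟩ := mem_closure_iff.1 (frontier_subset_closure hv) N No vN
  have sub := stay fo Np (by
    rintro x ⟨hxN, hxv⟩ hxf
    rcases ff hxf with ⟨z, rfl⟩ | h
    · have : z ≠ v := fun e => hxv (by rw [e]; rfl)
      exact NZ hxN (Or.inl (mem_iUnion.2 ⟨⟨z, this⟩, rfl⟩))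
    · obtain ⟨e, he⟩ := mem_iUnion.1 h
      by_cases hve : v ∈ (e : Sym2 V)
      · have := hcon e hve
        exact (this ▸ ⟨he, hxf⟩ : x ∈ (∅ : Set T2))
      · exact NZ hxN (Or.inr (mem_iUnion.2 ⟨⟨e, hve⟩, subset_closure he⟩))) ⟨hyN, fun e => vf (e ▸ hyf)⟩ hyf
  obtain ⟨z, hz⟩ := exAdj hc v
  have : d.vmap v ∈ closure (d.emap ⟨s(v, z), hz⟩) := by
    rw [d.closure_emap _ v z rfl]
    exact Or.inr (Or.inl rfl)
  obtain ⟨q, hqN, hq⟩ := mem_closure_iff.1 this N No vN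
  refine fK q (sub ⟨hqN, ?_⟩) (Or.inr (mem_iUnion.2 ⟨_, hq⟩))
  intro e
  rw [mem_singleton_iff] at e
  rw [e] at hq
  exact d.vertex_notin _ _ hq

end TG

namespace TG
open DS CM Equiv

variable {V : Type} {G : SimpleGraph V} (d : Drawing G T2)

theorem mkTDr : ∃ (a b : G.edgeSet → V) (γ : G.edgeSet → ℝ → T2), (∀ e : G.edgeSet, (e : Sym2 V) = s(a e, b e)) ∧
    TDr a b d.vmap γ ∧ ∀ e, γ e '' Ioo 0 1 = d.emap e := by
  have h1 : ∀ e : G.edgeSet, ∃ a b, (e : Sym2 V) = s(a, b) ∧ G.Adj a b := by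
    rintro ⟨e, he⟩
    induction e using Sym2.ind with
    | _ x y => exact ⟨x, y, rfl, he⟩
  choose a b hab adj using h1
  have h2 : ∀ e : G.edgeSet, ∃ δ : ℝ → T2, Continuous δ ∧ InjOn δ (Icc 0 1) ∧ δ 0 = d.vmap (a e) ∧ δ 1 = d.vmap (b e) ∧
      δ '' Ioo 0 1 = d.emap e := by
    intro e
    have he : (⟨s(a e, b e), adj e⟩ : G.edgeSet) = e := Subtype.ext (hab e).symm
    have := edgeArc d (adj e)
    rw [he] at this
    exact this
  choose γ c i e0 e1 im using h2
  refine ⟨a, b, γ, hab, ⟨d.vinj, fun e => (adj e).ne, fun e => (c e).continuousOn, i, e0, e1, ?_, ?_⟩, im⟩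
  · intro e e' t ht t' ht' h
    by_contra hne
    have h1 : γ e t ∈ d.emap e := by rw [← im]; exact mem_image_of_mem _ ht
    have h2 : γ e t ∈ d.emap e' := by rw [h, ← im]; exact mem_image_of_mem _ ht'
    have := d.edges_disj e e' hne
    exact (this ▸ (⟨h1, h2⟩ : γ e t ∈ d.emap e ∩ d.emap e') : γ e t ∈ (∅ : Set T2))
  · intro e v t ht h
    have h1 : γ e t ∈ d.emap e := by rw [← im]; exact mem_image_of_mem _ ht
    exact d.vertex_notin e v (h ▸ h1)

theorem faceFacts (hcl : IsClosed d.image) {f : Set T2} (hf : d.IsFace f) : IsOpen f ∧ IsConnected f ∧ (∀ x ∈ f, x ∉ d.image) ∧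
    frontier f ⊆ d.image := by
  obtain ⟨x, hx, rfl⟩ := hf
  have op : ∀ y, IsOpen (connectedComponentIn (d.image)ᶜ y) := fun y => hcl.isOpen_compl.connectedComponentIn
  refine ⟨op x, isConnected_connectedComponentIn_iff.2 hx, fun y hy => connectedComponentIn_subset _ _ hy, ?_⟩
  intro y hy
  by_contra hyn
  rw [(op x).frontier_eq] at hy
  have hm := mem_connectedComponentIn (F := (d.image)ᶜ) hyn
  obtain ⟨z, z1, z2⟩ := mem_closure_iff.1 hy.1 _ (op y) hm
  have := (connectedComponentIn_eq z1).trans (connectedComponentIn_eq z2).symm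
  exact hy.2 (this ▸ hm)

theorem final [Finite V] (ht : TriangleFree G) (hc : FourCritical G) {f : Set T2} (hf : d.IsFace f) :
    ∃ (a : V) (w : G.Walk a a), w.IsCycle ∧ frontier f = walkImage d w := by
  classical
  obtain ⟨v0⟩ := exV hc
  obtain ⟨a, b, γ, hab, tdr, im⟩ := mkTDr d
  have adj : ∀ e, G.Adj (a e) (b e) := fun e => by
    have := e.2
    rw [hab e] at this
    exact this
  have hKK : KK d.vmap γ = d.image := by
    simp only [KK, MDrawing.image, im]
  have hcl : IsClosed d.image := hKK ▸ tdr.closed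
  obtain ⟨fo, fc, fK, ff⟩ := faceFacts d hcl hf
  obtain ⟨D, _, _, α, A, σ, src, L, dart, hM, g⟩ := toGPl tdr fo fc (hKK ▸ ff) (by rw [hKK]; exact fK)
  set S : Set G.edgeSet := {e | ∃ t ∈ Ioo (0 : ℝ) 1, γ e t ∈ frontier f} with hS
  have memS : ∀ e y, y ∈ d.emap e → y ∈ frontier f → e ∈ S := by
    intro e y hy h
    rw [← im] at hy
    obtain ⟨t, ht, rfl⟩ := hy
    exact ⟨t, ht, h⟩
  have edg : ∀ u v (h : G.Adj u v), ∃ e : G.edgeSet, (e : Sym2 V) = s(u, v) := fun u v h => ⟨⟨s(u, v), h⟩, rfl⟩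
  have hconn : ∀ Y : V → ZMod 2, (∀ e, Y (a e) = Y (b e)) → ∀ u v, Y u = Y v := by
    intro Y hY u v
    refine conn0 hc Y (fun x y hxy => ?_) u v
    obtain ⟨e, he⟩ := edg x y hxy
    rw [hab e, Sym2.eq_iff] at he
    have := hY e
    rcases he with ⟨rfl, rfl⟩ | ⟨rfl, rfl⟩
    · exact this
    · exact this.symm
  have hdg : ∀ (e : G.edgeSet) u v, (e : Sym2 V) = s(u, v) → G.Adj u v → ∃ e', e' ≠ e ∧ (a e' = u ∨ b e' = u) := by
    intro e u v he huv
    obtain ⟨w, hw, huw⟩ := deg2 hc huv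
    obtain ⟨e', he'⟩ := edg u w huw
    refine ⟨e', ?_, ?_⟩
    · rintro rfl
      rw [he, Sym2.congr_right] at he'
      exact hw he'.symm
    · rw [hab e', Sym2.eq_iff] at he'
      rcases he' with ⟨h, -⟩ | ⟨-, h⟩
      · exact Or.inl h
      · exact Or.inr h
  have hdeg : ∀ e, (∃ e', e' ≠ e ∧ (a e' = a e ∨ b e' = a e)) ∧ (∃ e', e' ≠ e ∧ (a e' = b e ∨ b e' = b e)) := fun e =>
    ⟨hdg e _ _ (hab e) (adj e), hdg e _ _ ((hab e).trans Sym2.eq_swap) (adj e).symm⟩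
  have key := g.main v0 (fun e => (adj e).ne) hconn hdeg hM
  set s : D → V := fun z => gam b v0 (src z) with hs
  have s0 : ∀ e, s (dart e 0) = a e := fun e => by simp only [hs, g.s0, gam]
  have s1 : ∀ e, s (α (dart e 0)) = b e := fun e => by
    simp only [hs, g.sy e 0 (fun h => absurd h (by decide)), gam]
  have inv := hM.inv
  have mk : ∀ z, z ∈ kp α A dart ↔ ∃ e, z = dart e 0 ∨ z = α (dart e 0) := by
    intro z
    simp only [kp, Finset.mem_filter]
    refine ⟨fun h => h.2, fun h => ⟨?_, h⟩⟩
    obtain ⟨e, he⟩ := h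
    exact (g.mem z).2 ⟨e, 0, fun h => absurd h (by decide), he⟩
  have sed : ∀ e z, z = dart e 0 ∨ z = α (dart e 0) → s(s z, s (α z)) = (e : Sym2 V) := by
    rintro e z (rfl | rfl)
    · rw [s0, s1, hab]
    · rw [inv, s0, s1, hab e]; exact Sym2.eq_swap
  have hd : Darts G α (kp α A dart) s := by
    refine ⟨?_, ?_, ?_⟩
    · intro z hz
      obtain ⟨e, he⟩ := (mk z).1 hz
      have := sed e z he
      rw [← SimpleGraph.mem_edgeSet, this]
      exact e.2
    · intro u v huv
      obtain ⟨e, he⟩ := edg u v huv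
      rw [hab e, Sym2.eq_iff] at he
      rcases he with ⟨h1, h2⟩ | ⟨h1, h2⟩
      · exact ⟨dart e 0, (mk _).2 ⟨e, Or.inl rfl⟩, by rw [s0, h1], by rw [s1, h2]⟩
      · exact ⟨α (dart e 0), (mk _).2 ⟨e, Or.inr rfl⟩, by rw [s1, h2], by rw [inv, s0, h1]⟩
    · intro z hz z' hz' h1 h2
      obtain ⟨e, he⟩ := (mk z).1 hz
      obtain ⟨e', he'⟩ := (mk z').1 hz'
      have hee : e = e' := by
        apply Subtype.ext
        rw [← sed e z he, ← sed e' z' he', h1, h2]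
      subst hee
      rcases he with rfl | rfl <;> rcases he' with rfl | rfl
      · rfl
      · rw [s0, s1] at h1; exact absurd h1 (adj e).ne
      · rw [s0, s1] at h1; exact absurd h1.symm (adj e).ne
      · rfl
  rcases key with ⟨σ', L', h⟩ | ⟨σ', L', h, t, ht1, ht2⟩
  · exact (noT0 hc ht hd h).elim
  have Sne : S.Nonempty := by
    have hfr : (frontier f).Nonempty := by
      rw [nonempty_iff_ne_empty, Ne, frontier_eq_empty_iff]
      rintro (hu | hu)
      · exact fc.nonempty.ne_empty hu
      · exact fK (d.vmap v0) (by rw [hu]; trivial) (Or.inl ⟨v0, rfl⟩)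
    obtain ⟨y, hy⟩ := hfr
    rcases ff hy with ⟨v, rfl⟩ | h1
    · obtain ⟨e, -, z, z1, z2⟩ := frontV d hc fo fK ff hy
      exact ⟨e, memS e z z1 z2⟩
    · obtain ⟨e, he⟩ := mem_iUnion.1 h1
      exact ⟨e, memS e y he hy⟩
  obtain ⟨es, hes⟩ := Sne
  have tA : ∀ e ∈ S, t e ∈ kp α A dart := fun e he => (mk _).2 ⟨e, ht1 e he⟩
  set π : Perm D := σ' * aP α h.inv with hπ
  have πA : ∀ z ∈ kp α A dart, π z ∈ kp α A dart := fun z hz => h.sA _ (h.cl _ hz)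
  have orbA : ∀ z, π.SameCycle (t es) z → z ∈ kp α A dart := fun z hz =>
    (const_cycle (Y := fun _ => 0) πA (fun _ _ => rfl) (tA es hes) z hz).2
  have orbX : ∀ X, IX α (kp α A dart) σ' X → ∀ z, π.SameCycle (t es) z → X z = X (t es) := fun X hX z hz =>
    (const_cycle (Y := X) πA (fun y hy => hX y hy) (tA es hes) z hz).1
  have inj : ∀ z z', π.SameCycle (t es) z → π.SameCycle (t es) z' → s z = s z' → z = z' := fun z z' h1 h2 h3 =>
    orbInj hc ht hd h (orbA z h1) (orbA z' h2) h3 (fun X hX => (orbX X hX z h1).trans (orbX X hX z' h2).symm)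
  have tO : ∀ e ∈ S, π.SameCycle (t es) (t e) := by
    intro e he
    refine orb_same (A := kp α A dart) (fun X hX => ?_)
    obtain ⟨c, hc'⟩ := ht2 X (fun y hy => hX y hy)
    rw [hc' es hes, hc' e he]
  have cycs : ∀ z, π.SameCycle (t es) z → ∃ (hz : G.Adj (s z) (s (α z))) (w : G.Walk (s (α z)) (s z)), w.IsPath ∧ s(s z, s (α z)) ∉ w.edges ∧
      ∀ y, y ∈ walkImage d (.cons hz w) ↔ ∃ z', π.SameCycle (t es) z' ∧
        (y = d.vmap (s z') ∨ ∃ e : G.edgeSet, (e : Sym2 V) = s(s z', s (α z')) ∧ y ∈ d.emap e) := by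
    intro z hz
    obtain ⟨w, w1, w2, w3, w4⟩ := cyc hc hd h (orbA z hz) (fun x x' h1 h2 => inj x x' (hz.trans h1) (hz.trans h2))
    refine ⟨hd.adj z (orbA z hz), w, w1, w2, fun y => ?_⟩
    rw [mem_wI]
    constructor
    · rintro (⟨x, hx, rfl⟩ | ⟨e, he, hy⟩)
      · have hx' : x ∈ w.support := by
          rw [SimpleGraph.Walk.support_cons, List.mem_cons] at hx
          rcases hx with rfl | hx
          · exact w.end_mem_support
          · exact hx
        obtain ⟨z', h1, rfl⟩ := (w3 x).1 hx'
        exact ⟨z', hz.trans h1, Or.inl rfl⟩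
      · rw [SimpleGraph.Walk.edges_cons, List.mem_cons] at he
        obtain ⟨z', h1, h2⟩ := (w4 _).1 he
        exact ⟨z', hz.trans h1, Or.inr ⟨e, h2, hy⟩⟩
    · rintro ⟨z', h1, rfl | ⟨e, he, hy⟩⟩
      · left
        refine ⟨s z', ?_, rfl⟩
        rw [SimpleGraph.Walk.support_cons, List.mem_cons]
        exact Or.inr ((w3 _).2 ⟨z', hz.symm.trans h1, rfl⟩)
      · right
        refine ⟨e, ?_, hy⟩
        rw [SimpleGraph.Walk.edges_cons, List.mem_cons]
        exact (w4 _).2 ⟨z', hz.symm.trans h1, he⟩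
  have sub : ∀ y ∈ frontier f, ∃ z', π.SameCycle (t es) z' ∧
        (y = d.vmap (s z') ∨ ∃ e : G.edgeSet, (e : Sym2 V) = s(s z', s (α z')) ∧ y ∈ d.emap e) := by
    intro y hy
    rcases ff hy with ⟨v, rfl⟩ | h1
    · obtain ⟨e, ve, y, y1, y2⟩ := frontV d hc fo fK ff hy
      have he := memS e y y1 y2
      have h2 := sed e _ (ht1 e he)
      rw [← h2, Sym2.mem_iff] at ve
      rcases ve with rfl | rfl
      · exact ⟨t e, tO e he, Or.inl rfl⟩
      · refine ⟨π (t e), (tO e he).trans (Perm.SameCycle.rfl.apply_right), Or.inl ?_⟩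
        rw [show s (π (t e)) = s (α (t e)) from h.ss _ (h.cl _ (tA e he))]
    · obtain ⟨e, he⟩ := mem_iUnion.1 h1
      have hS' := memS e y he hy
      exact ⟨t e, tO e hS', Or.inr ⟨e, (sed e _ (ht1 e hS')).symm, he⟩⟩
  have esub : ∀ z, π.SameCycle (t es) z → ∀ e : G.edgeSet, (e : Sym2 V) = s(s z, s (α z)) → d.emap e ⊆ frontier f := by
    intro z hz e he
    obtain ⟨hz', w, w1, w2, w3⟩ := cycs z hz
    have := finalCycle d fo fc.nonempty fK hz' w w1 w2 (fun y hy => (w3 y).2 (sub y hy))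
    rw [show e = ⟨s(s z, s (α z)), hz'⟩ from Subtype.ext he]
    exact this
  obtain ⟨hz', w, w1, w2, w3⟩ := cycs (t es) Perm.SameCycle.rfl
  refine ⟨_, .cons hz' w, (SimpleGraph.Walk.cons_isCycle_iff _ _).2 ⟨w1, w2⟩, ?_⟩
  ext y
  rw [w3]
  refine ⟨sub y, ?_⟩
  rintro ⟨z, hz, rfl | ⟨e, he, hy⟩⟩
  · obtain ⟨e, he⟩ := edg _ _ (hd.adj z (orbA z hz))
    have h1 : d.vmap (s z) ∈ closure (d.emap e) := by
      rw [d.closure_emap e _ _ he]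
      exact Or.inr (Or.inl rfl)
    exact closure_minimal (esub z hz e he) isClosed_frontier h1
  · exact esub z hz e he hy

end TG

/-- Let `G` be a triangle-free 4-critical graph drawn in the torus.
Then every face of `G` is bounded by a cycle: its frontier equals the drawing of
some cycle of `G`. -/
theorem faces_bounded_by_cycles {V : Type} [Fintype V] {G : SimpleGraph V}
    (d : Drawing G Torus) (htf : TriangleFree G) (hcrit : FourCritical G) :
    ∀ f : Set Torus, d.IsFace f →
      ∃ (a : V) (w : G.Walk a a), w.IsCycle ∧ frontier f = walkImage d w := by
  intro f hf
  exact TG.final d htf hcrit hf
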